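/- Let p ≥ 5 be a regular prime and let N be a prime with N ≡ 1 (mod p). If r_K ≥ 2, then there exists an odd integer i with 1 ≤ i ≤ p−4 such that M_i is a p-th power in 𝔽_N^×. -/

import Mathlib

open scoped TensorProduct

/-- The `p`-rank of a commutative group `G`, i.e. `dim_{𝔽_p}(G ⊗ 𝔽_p)`. -/
noncomputable def pRank (p : ℕ) (G : Type*) [CommGroup G] : ℕ :=
  Module.finrank (ZMod p) (ZMod p ⊗[ℤ] Additive G)

/-- The `p`-rank of the class group of the number field `K`. -/
noncomputable def classRank (p : ℕ) (K : Type*) [Field K] : ℕ :=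
  pRank p (ClassGroup (NumberField.RingOfIntegers K))

/-- `p` is a regular prime: `p` does not divide the class number of `ℚ(ζ_p)`. -/
def RegularPrime (p : ℕ+) : Prop :=
  ¬ (p : ℕ) ∣ Nat.card (ClassGroup (NumberField.RingOfIntegers (CyclotomicField p ℚ)))

/-- `M_i = ∏_{k=1}^{N-1} ∏_{a=1}^{k-1} k^{a^i}` as an element of `𝔽_N = ZMod N`. -/
def Mnum (N i : ℕ) : ZMod N :=
  ∏ k ∈ Finset.Icc 1 (N - 1), ∏ a ∈ Finset.Icc 1 (k - 1), (k : ZMod N) ^ (a ^ i)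

/-- `S_i = ∏_{k=1}^{p-1} ((Mk)!)^{k^i}` with `M = (N-1)/p`, as an element of `ZMod N`. -/
def Snum (p N i : ℕ) : ZMod N :=
  ∏ k ∈ Finset.Icc 1 (p - 1), (Nat.factorial ((N - 1) / p * k) : ZMod N) ^ (k ^ i)

/-- `A_m = ∏_{k=1}^{N-1} k^{k^m}` as an element of `ZMod N`. -/
def Anum (N m : ℕ) : ZMod N :=
  ∏ k ∈ Finset.Icc 1 (N - 1), (k : ZMod N) ^ (k ^ m)

/-- Merel's number `C = ∏_{k=1}^{(N-1)/2} k^k` as an element of `ZMod N`. -/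
def MerelC (N : ℕ) : ZMod N :=
  ∏ k ∈ Finset.Icc 1 ((N - 1) / 2), (k : ZMod N) ^ k

/-- `x` is a `p`-th power in `𝔽_N`. -/
def IsPthPow (p : ℕ) {N : ℕ} (x : ZMod N) : Prop :=
  ∃ y : ZMod N, y ^ p = x

section

open Module

theorem index_nsmul_of_equiv {A B : Type*} [AddCommGroup A] [AddCommGroup B] (e : A ≃+ B) (p : ℕ) :
    (nsmulAddMonoidHom (α := A) p).range.index = (nsmulAddMonoidHom (α := B) p).range.index ∧
    Nat.card (nsmulAddMonoidHom (α := A) p).ker = Nat.card (nsmulAddMonoidHom (α := B) p).ker := by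
  constructor
  · rw [← AddSubgroup.index_map_equiv _ e]
    congr 1
    ext b
    simp only [AddSubgroup.mem_map, AddMonoidHom.mem_range, nsmulAddMonoidHom_apply]
    constructor
    · rintro ⟨_, ⟨a, rfl⟩, rfl⟩
      exact ⟨e a, by simp⟩
    · rintro ⟨b, rfl⟩
      exact ⟨p • e.symm b, ⟨e.symm b, rfl⟩, by simp⟩
  · apply Nat.card_congr
    refine ⟨fun a => ⟨e a.1, ?_⟩, fun b => ⟨e.symm b.1, ?_⟩, fun a => by simp, fun b => by simp⟩
    · have := a.2
      rw [AddMonoidHom.mem_ker, nsmulAddMonoidHom_apply] at this ⊢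
      rw [← map_nsmul, this, map_zero]
    · have := b.2
      rw [AddMonoidHom.mem_ker, nsmulAddMonoidHom_apply] at this ⊢
      rw [← map_nsmul, this, map_zero]

theorem index_nsmul_prod {A B : Type*} [AddCommGroup A] [AddCommGroup B] (p : ℕ) :
    (nsmulAddMonoidHom (α := A × B) p).range.index =
      (nsmulAddMonoidHom (α := A) p).range.index * (nsmulAddMonoidHom (α := B) p).range.index ∧
    Nat.card (nsmulAddMonoidHom (α := A × B) p).ker =
      Nat.card (nsmulAddMonoidHom (α := A) p).ker * Nat.card (nsmulAddMonoidHom (α := B) p).ker := by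
  constructor
  · rw [← AddSubgroup.index_prod]
    congr 1
    ext ⟨a, b⟩
    simp [AddSubgroup.mem_prod]
  · rw [← Nat.card_prod]
    apply Nat.card_congr
    refine ⟨fun a => ⟨⟨a.1.1, ?_⟩, ⟨a.1.2, ?_⟩⟩, fun b => ⟨(b.1.1, b.2.1), ?_⟩,
      fun a => by simp, fun b => by simp⟩
    · have := a.2
      rw [AddMonoidHom.mem_ker, nsmulAddMonoidHom_apply] at this ⊢
      exact congrArg Prod.fst this
    · have := a.2
      rw [AddMonoidHom.mem_ker, nsmulAddMonoidHom_apply] at this ⊢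
      exact congrArg Prod.snd this
    · have := b.1.2
      have := b.2.2
      rw [AddMonoidHom.mem_ker, nsmulAddMonoidHom_apply] at *
      ext <;> assumption

theorem index_nsmul_pi (n p : ℕ) (hp : p ≠ 0) :
    (nsmulAddMonoidHom (α := Fin n → ℤ) p).range.index = p ^ n ∧
    Nat.card (nsmulAddMonoidHom (α := Fin n → ℤ) p).ker = 1 := by
  constructor
  · let f : (Fin n → ℤ) →+ (Fin n → ZMod p) :=
      { toFun := fun v i => (v i : ZMod p)
        map_zero' := by ext; simp
        map_add' := by intros; ext; simp }
    have hf : Function.Surjective f := by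
      intro w
      choose g hg using fun i => ZMod.intCast_surjective (w i)
      exact ⟨g, by ext i; simp [f, hg]⟩
    have : (nsmulAddMonoidHom (α := Fin n → ℤ) p).range = f.ker := by
      ext v
      simp only [AddMonoidHom.mem_range, nsmulAddMonoidHom_apply, AddMonoidHom.mem_ker]
      constructor
      · rintro ⟨w, rfl⟩
        ext i; simp [f]
      · intro h
        have h2 : ∀ i, ∃ w, v i = p * w := fun i => by
          have := congrFun h i
          exact (ZMod.intCast_zmod_eq_zero_iff_dvd _ _).1 this
        choose w hw using h2
        exact ⟨w, by ext i; simp [hw]⟩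
    have hne : NeZero p := ⟨hp⟩
    rw [this, AddSubgroup.index_ker, AddMonoidHom.range_eq_top.2 hf]
    simp
  · have : (nsmulAddMonoidHom (α := Fin n → ℤ) p).ker = ⊥ := by
      ext v
      simp only [AddMonoidHom.mem_ker, nsmulAddMonoidHom_apply, AddSubgroup.mem_bot]
      constructor
      · intro h
        ext i
        have := congrFun h i
        simpa [hp] using this
      · rintro rfl; simp
    rw [this]; simp

theorem index_nsmul (A : Type*) [AddCommGroup A] [hA : Module.Finite ℤ A] (p : ℕ) (hp : p ≠ 0) :
    (nsmulAddMonoidHom (α := A) p).range.index =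
      p ^ Module.finrank ℤ A * Nat.card (nsmulAddMonoidHom (α := A) p).ker ∧
    0 < Nat.card (nsmulAddMonoidHom (α := A) p).ker := by
  have : AddGroup.FG A := Module.Finite.iff_addGroup_fg.1 hA
  obtain ⟨n, ι, _, q, hq, e, ⟨f⟩⟩ := AddCommGroup.equiv_free_prod_directSum_zmod A
  classical
  have : ∀ i, NeZero (q i ^ e i) := fun i => ⟨pow_ne_zero _ (hq i).ne_zero⟩
  let T := (Π i : ι, ZMod (q i ^ e i))
  let g : A ≃+ (Fin n → ℤ) × T := f.trans
    (AddEquiv.prodCongr (Finsupp.linearEquivFunOnFinite ℤ ℤ (Fin n)).toAddEquiv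
      (DirectSum.addEquivProd _))
  have hr : Module.finrank ℤ A = n := by
    rw [LinearEquiv.finrank_eq g.toIntLinearEquiv]
    have h1 : Module.finrank ℤ T = 0 := by
      rw [Module.finrank_eq_zero_iff]
      intro x
      refine ⟨(Nat.card T : ℤ), by simp, ?_⟩
      rw [natCast_zsmul]
      exact card_nsmul_eq_zero' 
    have := Submodule.finrank_quotient_add_finrank (R := ℤ) (LinearMap.ker (LinearMap.fst ℤ (Fin n → ℤ) T))
    rw [LinearEquiv.finrank_eq (LinearMap.quotKerEquivOfSurjective _ (LinearMap.fst_surjective))] at this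
    rw [← this, LinearMap.ker_fst, LinearMap.finrank_range_of_inj, h1]
    · simp
    · exact LinearMap.inr_injective
  have hT : (nsmulAddMonoidHom (α := T) p).range.index = Nat.card (nsmulAddMonoidHom (α := T) p).ker := by
    have h1 := (nsmulAddMonoidHom (α := T) p).ker.card_mul_index
    rw [AddSubgroup.index_ker] at h1
    have h2 := (nsmulAddMonoidHom (α := T) p).range.card_mul_index
    rw [← h1, mul_comm] at h2
    exact Nat.eq_of_mul_eq_mul_right Nat.card_pos h2
  obtain ⟨e1, e2⟩ := index_nsmul_of_equiv g p
  obtain ⟨e3, e4⟩ := index_nsmul_prod (A := Fin n → ℤ) (B := T) p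
  obtain ⟨e5, e6⟩ := index_nsmul_pi n p hp
  constructor
  · rw [e1, e2, e3, e4, e5, e6, hr, hT, one_mul]
  · rw [e2, e4, e6, one_mul]; exact Nat.card_pos

end

section

open Module

theorem geom_sum_int_poly (p : ℕ) (hp : p.Prime) :
    ∃ g : Polynomial ℤ, (Polynomial.X - 1) ^ (p - 1) =
      (∑ i ∈ Finset.range p, (Polynomial.X : Polynomial ℤ) ^ i) + (p : Polynomial ℤ) * g := by
  have : Fact p.Prime := ⟨hp⟩
  have h : Polynomial.map (Int.castRingHom (ZMod p)) ((Polynomial.X - 1) ^ (p - 1) -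
      (∑ i ∈ Finset.range p, (Polynomial.X : Polynomial ℤ) ^ i)) = 0 := by
    rw [Polynomial.map_sub, Polynomial.map_pow, Polynomial.map_sub, Polynomial.map_sum]
    simp only [Polynomial.map_pow, Polynomial.map_X, Polynomial.map_one]
    have h0 : (Polynomial.X - 1 : Polynomial (ZMod p)) ≠ 0 := by
      have := Polynomial.X_sub_C_ne_zero (1 : ZMod p)
      simpa using this
    apply mul_right_cancel₀ h0
    rw [zero_mul, sub_mul, ← pow_succ, Nat.sub_add_cancel hp.pos, geom_sum_mul,
      sub_pow_char]
    simp
  have h2 : (Polynomial.C (p : ℤ)) ∣ ((Polynomial.X - 1) ^ (p - 1) -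
      (∑ i ∈ Finset.range p, (Polynomial.X : Polynomial ℤ) ^ i)) := by
    rw [Polynomial.C_dvd_iff_dvd_coeff]
    intro i
    have := congrArg (fun q => Polynomial.coeff q i) h
    simp only [Polynomial.coeff_map, Polynomial.coeff_zero, eq_intCast] at this
    exact (ZMod.intCast_zmod_eq_zero_iff_dvd _ _).1 this
  obtain ⟨g, hg⟩ := h2
  refine ⟨g, ?_⟩
  have := sub_eq_iff_eq_add'.1 hg
  rw [this]
  simp

theorem relIndex_nsmul {X : Type*} [AddCommGroup X] [Module.Finite ℤ X] (p : ℕ) (hp : p ≠ 0)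
    (U : AddSubgroup X) :
    (U.map (nsmulAddMonoidHom p)).relIndex U = p ^ Module.finrank ℤ U *
      Nat.card {x : X // x ∈ U ∧ p • x = 0} ∧ 0 < Nat.card {x : X // x ∈ U ∧ p • x = 0} := by
  have hfin : Module.Finite ℤ U := inferInstanceAs (Module.Finite ℤ (AddSubgroup.toIntSubmodule U))
  have := index_nsmul U p hp
  have hc : Nat.card (nsmulAddMonoidHom (α := U) p).ker = Nat.card {x : X // x ∈ U ∧ p • x = 0} := by
    apply Nat.card_congr
    refine ⟨fun a => ⟨a.1.1, a.1.2, ?_⟩, fun b => ⟨⟨b.1, b.2.1⟩, ?_⟩, fun a => by simp, fun b => by simp⟩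
    · have := a.2
      rw [AddMonoidHom.mem_ker, nsmulAddMonoidHom_apply] at this
      exact congrArg Subtype.val this
    · rw [AddMonoidHom.mem_ker, nsmulAddMonoidHom_apply]
      ext; exact b.2.2
  rw [← hc, ← this.1]
  refine ⟨?_, this.2⟩
  rw [AddSubgroup.relIndex]
  congr 1
  ext x
  simp only [AddSubgroup.mem_addSubgroupOf, AddSubgroup.mem_map, AddMonoidHom.mem_range, nsmulAddMonoidHom_apply]
  constructor
  · rintro ⟨y, hy, h⟩
    exact ⟨⟨y, hy⟩, Subtype.ext h⟩
  · rintro ⟨y, rfl⟩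
    exact ⟨y, y.2, rfl⟩

theorem herbrand_bound {X : Type*} [AddCommGroup X] [Module.Finite ℤ X] (p : ℕ) (hp : p.Prime)
    (σ : Module.End ℤ X) (hσ : σ ^ p = 1)
    (hK : ∀ x, (∑ i ∈ Finset.range p, σ ^ i : Module.End ℤ X) x = 0 → ∃ y, σ y - y = x)
    (U : AddSubgroup X) (hUdef : ∀ x, x ∈ U ↔ σ x = x)
    (R0 m' : ℕ) (hU : Module.finrank ℤ U ≤ R0) (hX : R0 + (p - 1) * m' ≤ Module.finrank ℤ X)
    (hT : Nat.card {x : X // x ∈ U ∧ p • x = 0} ∣ p) :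
    (AddMonoidHom.range (LinearMap.toAddMonoidHom (∑ i ∈ Finset.range p, σ ^ i : Module.End ℤ X))).relIndex U * p ^ m' ≤ p ^ R0 ∧
    (AddMonoidHom.range (LinearMap.toAddMonoidHom (∑ i ∈ Finset.range p, σ ^ i : Module.End ℤ X))).relIndex U ≠ 0 := by
  set Nm : Module.End ℤ X := ∑ i ∈ Finset.range p, σ ^ i with hNm
  have hNmx : ∀ x, (LinearMap.toAddMonoidHom Nm) x = Nm x := fun _ => rfl
  set x : Module.End ℤ X := σ - 1 with hx
  have hxa : ∀ y, x y = σ y - y := fun y => rfl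
  have hNx : Nm * x = 0 := by rw [hNm, hx, geom_sum_mul, hσ, sub_self]
  have hxN : x * Nm = 0 := by rw [hNm, hx, mul_geom_sum, hσ, sub_self]
  set K : AddSubgroup X := AddMonoidHom.ker (LinearMap.toAddMonoidHom Nm) with hKd
  have hUk : U = AddMonoidHom.ker (LinearMap.toAddMonoidHom x) := by
    ext y
    rw [hUdef, AddMonoidHom.mem_ker]
    change _ ↔ σ y - y = 0
    rw [sub_eq_zero]
  have hKr : K = AddMonoidHom.range (LinearMap.toAddMonoidHom x) := by
    ext y
    rw [hKd, AddMonoidHom.mem_ker, AddMonoidHom.mem_range]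
    constructor
    · intro h; exact hK y h
    · rintro ⟨z, rfl⟩
      exact congrArg (fun f : Module.End ℤ X => f z) hNx
  have hNU : ∀ u ∈ U, Nm u = p • u := by
    intro u hu
    have : ∀ i, (σ ^ i) u = u := by
      intro i
      induction i with
      | zero => rfl
      | succ i ih => rw [pow_succ, Module.End.mul_apply, (hUdef u).1 hu, ih]
    rw [hNm]
    have h2 : (∑ i ∈ Finset.range p, σ ^ i) u = ∑ i ∈ Finset.range p, (σ ^ i) u :=
      LinearMap.sum_apply _ _ _
    rw [h2, Finset.sum_congr rfl (fun i _ => this i)]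
    simp
  have hNXU : AddMonoidHom.range (LinearMap.toAddMonoidHom Nm) ≤ U := by
    rintro _ ⟨y, rfl⟩
    rw [hUk, AddMonoidHom.mem_ker]
    exact congrArg (fun f : Module.End ℤ X => f y) hxN
  have hpU : U.map (nsmulAddMonoidHom p) = U.map (LinearMap.toAddMonoidHom Nm) := by
    ext y
    constructor
    · rintro ⟨u, hu, rfl⟩; exact ⟨u, hu, hNU u hu⟩
    · rintro ⟨u, hu, rfl⟩; exact ⟨u, hu, (hNU u hu).symm⟩
  have hNU' : U.map (LinearMap.toAddMonoidHom Nm) ≤ AddMonoidHom.range (LinearMap.toAddMonoidHom Nm) := by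
    rintro _ ⟨u, hu, rfl⟩; exact ⟨u, rfl⟩
  -- indices
  have e1 : (U.map (LinearMap.toAddMonoidHom Nm)).relIndex (AddMonoidHom.range (LinearMap.toAddMonoidHom Nm)) *
      (AddMonoidHom.range (LinearMap.toAddMonoidHom Nm)).relIndex U = (U.map (nsmulAddMonoidHom p)).relIndex U := by
    rw [hpU]; exact AddSubgroup.relIndex_mul_relIndex _ _ _ hNU' hNXU
  have e2 : (U.map (LinearMap.toAddMonoidHom Nm)).relIndex (AddMonoidHom.range (LinearMap.toAddMonoidHom Nm)) = (U ⊔ K).index := by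
    rw [AddMonoidHom.range_eq_map, AddSubgroup.relIndex_map_map]
    simp [hKd]
  have e3 : (K.map (LinearMap.toAddMonoidHom x)).relIndex K = (U ⊔ K).index := by
    conv_lhs => rw [hKr]
    rw [AddMonoidHom.range_eq_map (LinearMap.toAddMonoidHom x), AddSubgroup.relIndex_map_map]
    rw [← AddMonoidHom.range_eq_map, ← hKr, ← hUk, sup_comm]
    simp
  set a := Nat.card {x : X // x ∈ U ∧ p • x = 0} with ha
  obtain ⟨e4, ha0⟩ := relIndex_nsmul p hp.ne_zero U
  obtain ⟨e5, hk0⟩ := relIndex_nsmul p hp.ne_zero K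
  set I := (AddMonoidHom.range (LinearMap.toAddMonoidHom Nm)).relIndex U with hI
  set q := (U ⊔ K).index with hq
  rw [e2, e4] at e1
  have hq0 : q ≠ 0 := by
    intro h; rw [h, zero_mul] at e1
    exact (Nat.mul_pos (pow_pos hp.pos _) ha0).ne e1
  have hI0 : I ≠ 0 := by
    intro h; rw [h, mul_zero] at e1
    exact (Nat.mul_pos (pow_pos hp.pos _) ha0).ne e1
  refine ⟨?_, hI0⟩
  -- filtration
  have hKx : K.map (LinearMap.toAddMonoidHom x) ≤ K := by
    rintro _ ⟨y, hy, rfl⟩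
    rw [hKr]; exact ⟨y, rfl⟩
  have hmap : ∀ j, (K.map (x ^ j : Module.End ℤ X).toAddMonoidHom) ≤ K := by
    intro j
    induction j with
    | zero =>
      rintro _ ⟨y, hy, rfl⟩
      exact hy
    | succ j ih =>
      rintro _ ⟨y, hy, rfl⟩
      rw [pow_succ']
      exact hKx ⟨_, ih ⟨y, hy, rfl⟩, rfl⟩
  have hfil : ∀ j, (K.map (x ^ j : Module.End ℤ X).toAddMonoidHom).relIndex K ∣ q ^ j := by
    intro j
    induction j with
    | zero =>
      have : K.map (x ^ 0 : Module.End ℤ X).toAddMonoidHom = K := by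
        ext y
        constructor
        · rintro ⟨z, hz, rfl⟩; exact hz
        · intro h; exact ⟨y, h, rfl⟩
      rw [this]; simp
    | succ j ih =>
      have h1 : K.map (x ^ (j + 1) : Module.End ℤ X).toAddMonoidHom =
          (K.map (LinearMap.toAddMonoidHom x)).map (x ^ j : Module.End ℤ X).toAddMonoidHom := by
        rw [AddSubgroup.map_map]; rw [pow_succ]; rfl
      have h2 := AddSubgroup.relIndex_mul_relIndex _ _ _
        (AddSubgroup.map_mono (f := (x ^ j : Module.End ℤ X).toAddMonoidHom) hKx) (hmap j)
      rw [h1, ← h2, pow_succ, mul_comm]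
      apply mul_dvd_mul ih
      rw [AddSubgroup.relIndex_map_map, ← e3]
      have : (K.map (LinearMap.toAddMonoidHom x) ⊔ AddMonoidHom.ker (x ^ j : Module.End ℤ X).toAddMonoidHom).relIndex
          (K ⊔ AddMonoidHom.ker (x ^ j : Module.End ℤ X).toAddMonoidHom) =
          (K.map (LinearMap.toAddMonoidHom x) ⊔ AddMonoidHom.ker (x ^ j : Module.End ℤ X).toAddMonoidHom).relIndex K := by
        have h3 : K ⊔ AddMonoidHom.ker (x ^ j : Module.End ℤ X).toAddMonoidHom =
          K ⊔ (K.map (LinearMap.toAddMonoidHom x) ⊔ AddMonoidHom.ker (x ^ j : Module.End ℤ X).toAddMonoidHom) := by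
          rw [← sup_assoc, sup_eq_left.2 hKx]
        rw [h3, AddSubgroup.relIndex_sup_right]
      rw [this]
      exact AddSubgroup.relIndex_dvd_of_le_left _ le_sup_left
  obtain ⟨g, hg⟩ := geom_sum_int_poly p hp
  have hg2 : x ^ (p - 1) = Nm + (p : Module.End ℤ X) * Polynomial.aeval σ g := by
    have := congrArg (Polynomial.aeval σ) hg
    simpa [hx, hNm] using this
  have hle : K.map (x ^ (p - 1) : Module.End ℤ X).toAddMonoidHom ≤ K.map (nsmulAddMonoidHom p) := by
    rintro _ ⟨y, hy, rfl⟩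
    have hcomm : Nm * Polynomial.aeval σ g = Polynomial.aeval σ g * Nm := by
      have : Nm = Polynomial.aeval σ (∑ i ∈ Finset.range p, (Polynomial.X : Polynomial ℤ) ^ i) := by
        simp [hNm]
      rw [this, ← map_mul, ← map_mul, mul_comm]
    have hy' : Nm y = 0 := hy
    refine ⟨Polynomial.aeval σ g y, ?_, ?_⟩
    · have := congrArg (fun f : Module.End ℤ X => f y) hcomm
      change Nm _ = 0
      simp only [Module.End.mul_apply, hy', map_zero] at this
      exact this
    · have := congrArg (fun f : Module.End ℤ X => f y) hg2
      change p • _ = (x ^ (p - 1)) y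
      refine Eq.trans ?_ this.symm
      change _ = Nm y + ((p : Module.End ℤ X) * Polynomial.aeval σ g) y
      rw [hy', zero_add, Module.End.mul_apply]
      simp
  have hqk : p ^ Module.finrank ℤ K * a ≤ q ^ (p - 1) := by
    have h1 : p ^ Module.finrank ℤ K * Nat.card {x : X // x ∈ K ∧ p • x = 0} ∣ q ^ (p - 1) := by
      rw [← e5]
      exact (AddSubgroup.relIndex_dvd_of_le_left _ hle).trans (hfil _)
    refine le_trans ?_ (Nat.le_of_dvd (pow_pos (Nat.pos_of_ne_zero hq0) _) h1)
    apply Nat.mul_le_mul_left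
    have : Finite {x : X // x ∈ K ∧ p • x = 0} := Nat.finite_of_card_ne_zero hk0.ne'
    apply Nat.card_le_card_of_injective (fun z : {x : X // x ∈ U ∧ p • x = 0} =>
      (⟨z.1, ?_, z.2.2⟩ : {x : X // x ∈ K ∧ p • x = 0}))
    · intro z w h
      ext; simpa using h
    · change Nm z.1 = 0
      rw [hNU _ z.2.1, z.2.2]
  have hrk : Module.finrank ℤ X ≤ Module.finrank ℤ K + Module.finrank ℤ U := by
    have h1 := Submodule.finrank_quotient_add_finrank (LinearMap.ker Nm)
    rw [Nm.quotKerEquivRange.finrank_eq] at h1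
    have h2 : Module.finrank ℤ (LinearMap.range Nm) ≤ Module.finrank ℤ U := by
      have : (LinearMap.range Nm) ≤ AddSubgroup.toIntSubmodule U := hNXU
      exact Submodule.finrank_mono this
    have h3 : Module.finrank ℤ (LinearMap.ker Nm) = Module.finrank ℤ K := rfl
    omega
  -- arithmetic
  have hap : a ≤ p := Nat.le_of_dvd hp.pos hT
  obtain ⟨t, ht⟩ : ∃ t, I = p ^ t := by
    have : I ∣ p ^ (Module.finrank ℤ U + 1) := by
      rw [pow_succ]
      exact (Dvd.intro_left _ e1).trans (mul_dvd_mul_left _ hT)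
    obtain ⟨t, _, h⟩ := (Nat.dvd_prime_pow hp).1 this
    exact ⟨t, h⟩
  rw [ht, ← pow_add]
  apply Nat.pow_le_pow_right hp.pos
  by_contra hcon
  push Not at hcon
  obtain ⟨b, hb⟩ : ∃ b, p = b + 2 := ⟨p - 2, by have := hp.two_le; omega⟩
  have h1 : (q * I) ^ (p - 1) = (p ^ Module.finrank ℤ U * a) ^ (p - 1) := by rw [e1]
  have h2 : p ^ Module.finrank ℤ K * a * I ^ (p - 1) ≤ (p ^ Module.finrank ℤ U * a) ^ (p - 1) := by
    rw [← h1, mul_pow]; exact Nat.mul_le_mul_right _ hqk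
  rw [ht, mul_pow, ← pow_mul, ← pow_mul] at h2
  have hpb : p - 1 = b + 1 := by omega
  rw [hpb] at h2 hX
  have h3 : p ^ (Module.finrank ℤ K + t * (b + 1)) ≤ p ^ (Module.finrank ℤ U * (b + 1)) * a ^ b := by
    apply Nat.le_of_mul_le_mul_right _ ha0
    calc _ = p ^ finrank ℤ K * a * p ^ (t * (b + 1)) := by ring
      _ ≤ _ := h2
      _ = _ := by ring
  have h4 : p ^ (Module.finrank ℤ K + t * (b + 1)) ≤ p ^ (Module.finrank ℤ U * (b + 1) + b) := by
    rw [pow_add p _ b]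
    exact h3.trans (Nat.mul_le_mul_left _ (Nat.pow_le_pow_left hap _))
  have h5 := (Nat.pow_le_pow_iff_right hp.one_lt).1 h4
  nlinarith [Nat.mul_le_mul_right (b+1) hcon, Nat.mul_le_mul_right (b+1) hU]

end

section

open NumberField IsDedekindDomain

section SUnits
set_option linter.unusedSectionVars false
variable {K : Type*} [Field K] [NumberField K]

/-- additive valuation of a nonzero element at a finite place -/
noncomputable def ord (v : HeightOneSpectrum (𝓞 K)) (x : Kˣ) : ℤ :=
  -WithZero.log (v.valuation K (x : K))

variable (v w : HeightOneSpectrum (𝓞 K)) (x y : Kˣ)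

theorem val_ne_zero : v.valuation K (x : K) ≠ 0 := by simp

theorem val_eq_exp : v.valuation K (x : K) = WithZero.exp (-ord v x) := by
  rw [ord, neg_neg, WithZero.exp_log (val_ne_zero v x)]

theorem ord_mul : ord v (x * y) = ord v x + ord v y := by
  rw [ord, ord, ord, Units.val_mul, map_mul, WithZero.log_mul (val_ne_zero v x) (val_ne_zero v y)]
  ring

theorem ord_one : ord v (1 : Kˣ) = 0 := by simp [ord]

/-- `ord` as a homomorphism -/
noncomputable def ordHom : Additive Kˣ →+ ℤ where
  toFun x := ord v x.toMul
  map_zero' := ord_one v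
  map_add' _ _ := ord_mul v _ _

theorem ord_inv : ord v x⁻¹ = - ord v x := by
  have := ord_mul v x⁻¹ x
  rw [inv_mul_cancel, ord_one] at this; linarith

theorem ord_div : ord v (x / y) = ord v x - ord v y := by
  rw [div_eq_mul_inv, ord_mul, ord_inv]; ring

theorem ord_pow (n : ℕ) : ord v (x ^ n) = n * ord v x := by
  induction n with
  | zero => simp [ord_one]
  | succ n ih => rw [pow_succ, ord_mul, ih]; push_cast; ring

theorem ord_zpow (n : ℤ) : ord v (x ^ n) = n * ord v x := by
  obtain ⟨m, rfl | rfl⟩ := n.eq_nat_or_neg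
  · rw [zpow_natCast, ord_pow]
  · rw [zpow_neg, zpow_natCast, ord_inv, ord_pow]; ring

theorem ord_prod {ι : Type*} (s : Finset ι) (f : ι → Kˣ) :
    ord v (∏ i ∈ s, f i) = ∑ i ∈ s, ord v (f i) := by
  classical
  induction s using Finset.induction_on with
  | empty => simp [ord_one]
  | insert a s ha ih => rw [Finset.prod_insert ha, Finset.sum_insert ha, ord_mul, ih]

theorem ord_nonneg_iff : 0 ≤ ord v x ↔ v.valuation K (x : K) ≤ 1 := by
  rw [val_eq_exp, ← WithZero.exp_zero, WithZero.exp_le_exp]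
  omega

theorem ord_pos_iff : 0 < ord v x ↔ v.valuation K (x : K) < 1 := by
  rw [val_eq_exp, ← WithZero.exp_zero, WithZero.exp_lt_exp]
  omega

theorem ord_eq_zero_iff : ord v x = 0 ↔ v.valuation K (x : K) = 1 := by
  rw [val_eq_exp, ← WithZero.exp_zero, WithZero.exp_inj]
  omega

theorem ord_integral (a : 𝓞 K) (h : (x : K) = algebraMap (𝓞 K) K a) : 0 ≤ ord v x := by
  rw [ord_nonneg_iff, h]; exact v.valuation_le_one a

theorem ord_pos_iff_mem (a : 𝓞 K) (h : (x : K) = algebraMap (𝓞 K) K a) :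
    0 < ord v x ↔ a ∈ v.asIdeal := by
  rw [ord_pos_iff, h, v.valuation_lt_one_iff_mem]

theorem ord_eq_zero_iff_notMem (a : 𝓞 K) (h : (x : K) = algebraMap (𝓞 K) K a) :
    ord v x = 0 ↔ a ∉ v.asIdeal := by
  rw [← ord_pos_iff_mem v x a h]
  have := ord_integral v x a h
  omega

theorem isIntegral_iff_ord : IsIntegral ℤ (x : K) ↔ ∀ v : HeightOneSpectrum (𝓞 K), 0 ≤ ord v x := by
  constructor
  · intro h v
    exact ord_integral v x ⟨x, h⟩ rfl
  · intro h
    obtain ⟨a, ha⟩ := HeightOneSpectrum.mem_integers_of_valuation_le_one K (x : K)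
      (fun v => (ord_nonneg_iff v x).1 (h v))
    rw [← ha]; exact a.2

theorem finite_ord_ne_zero : {v : HeightOneSpectrum (𝓞 K) | ord v x ≠ 0}.Finite := by
  have h1 := HeightOneSpectrum.Support.finite (𝓞 K) (x : K)
  have h2 := HeightOneSpectrum.Support.finite (𝓞 K) ((x⁻¹ : Kˣ) : K)
  refine (h1.union h2).subset ?_
  intro v hv
  rcases lt_or_gt_of_ne hv with h | h
  · left
    by_contra hc
    exact absurd ((ord_nonneg_iff v x).2 (not_lt.1 hc)) (not_le.2 h)
  · right
    by_contra hc
    have := ((ord_nonneg_iff v x⁻¹).2 (not_lt.1 hc))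
    rw [ord_inv] at this
    omega

/-- `s`-units -/
def EE (K : Type*) [Field K] (s : ℕ) : Subgroup Kˣ where
  carrier := {x | ∃ n : ℕ, IsIntegral ℤ ((s : K) ^ n * (x : K)) ∧ IsIntegral ℤ ((s : K) ^ n * ((x⁻¹ : Kˣ) : K))}
  one_mem' := ⟨0, by simpa using isIntegral_one, by simpa using isIntegral_one⟩
  mul_mem' := by
    rintro a b ⟨n, h1, h2⟩ ⟨m, h3, h4⟩
    refine ⟨n + m, ?_, ?_⟩
    · have e : (s : K) ^ (n + m) * ((a * b : Kˣ) : K) = ((s : K) ^ n * a) * ((s : K) ^ m * b) := by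
        push_cast; ring
      rw [e]; exact h1.mul h3
    · have e : (s : K) ^ (n + m) * (((a * b)⁻¹ : Kˣ) : K) =
          ((s : K) ^ n * (a⁻¹ : Kˣ)) * ((s : K) ^ m * (b⁻¹ : Kˣ)) := by
        rw [mul_inv]; push_cast; ring
      rw [e]; exact h2.mul h4
  inv_mem' := by
    rintro a ⟨n, h1, h2⟩
    exact ⟨n, h2, by simpa using h1⟩

variable {x} {s : ℕ}

theorem mem_EE_iff (hs : s ≠ 0) : x ∈ EE K s ↔
    ∀ v : HeightOneSpectrum (𝓞 K), (s : 𝓞 K) ∉ v.asIdeal → ord v x = 0 := by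
  have hsK : (s : K) ≠ 0 := by exact_mod_cast hs
  let su : Kˣ := Units.mk0 (s : K) hsK
  have hsu : (su : K) = algebraMap (𝓞 K) K (s : 𝓞 K) := by simp [su]
  constructor
  · rintro ⟨n, h1, h2⟩ v hv
    have h0 : ord v su = 0 := (ord_eq_zero_iff_notMem v su _ hsu).2 hv
    have h3 := (isIntegral_iff_ord (su ^ n * x)).1 (by simpa [su] using h1) v
    have h4 := (isIntegral_iff_ord (su ^ n * x⁻¹)).1 (by simpa [su] using h2) v
    rw [ord_mul, ord_pow, h0] at h3 h4
    rw [ord_inv] at h4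
    omega
  · intro h
    obtain ⟨n, hn⟩ : ∃ n : ℕ, ∀ v : HeightOneSpectrum (𝓞 K), ord v x ≠ 0 → (ord v x).natAbs ≤ n := by
      refine ⟨∑ v ∈ (finite_ord_ne_zero x).toFinset, (ord v x).natAbs, fun v h0 => ?_⟩
      exact Finset.single_le_sum (f := fun v => (ord v x).natAbs) (fun _ _ => Nat.zero_le _)
              (by simpa using h0)
    have key : ∀ v : HeightOneSpectrum (𝓞 K), |ord v x| ≤ n * ord v su := by
      intro v
      by_cases hv : (s : 𝓞 K) ∈ v.asIdeal
      · have h1 : 1 ≤ ord v su := (ord_pos_iff_mem v su _ hsu).2 hv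
        by_cases h0 : ord v x = 0
        · rw [h0, abs_zero]
          have : (0:ℤ) ≤ n := Int.natCast_nonneg n
          positivity
        · have h2 : (ord v x).natAbs ≤ n := hn v h0
          calc |ord v x| = ((ord v x).natAbs : ℤ) := (Int.natCast_natAbs _).symm
            _ ≤ n * 1 := by rw [mul_one]; exact_mod_cast h2
            _ ≤ n * ord v su := by
              apply mul_le_mul_of_nonneg_left h1 (Int.natCast_nonneg n)
      · rw [h v hv, (ord_eq_zero_iff_notMem v su _ hsu).2 hv]; simp
    refine ⟨n, ?_, ?_⟩
    · have := (isIntegral_iff_ord (su ^ n * x)).2 (fun v => by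
        rw [ord_mul, ord_pow]; have := key v; have := neg_abs_le (ord v x); linarith)
      simpa [su] using this
    · have := (isIntegral_iff_ord (su ^ n * x⁻¹)).2 (fun v => by
        rw [ord_mul, ord_pow, ord_inv]; have := key v; have := le_abs_self (ord v x); linarith)
      simpa [su] using this

/-- the hom from units to `Kˣ` -/
def unitsHom (K : Type*) [Field K] : (𝓞 K)ˣ →* Kˣ := Units.map (algebraMap (𝓞 K) K)

theorem unitsHom_injective : Function.Injective (unitsHom K) :=
  Units.map_injective (FaithfulSMul.algebraMap_injective (𝓞 K) K)

theorem mem_units_iff : x ∈ (unitsHom K).range ↔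
    ∀ v : HeightOneSpectrum (𝓞 K), ord v x = 0 := by
  constructor
  · rintro ⟨u, rfl⟩ v
    rw [ord_eq_zero_iff_notMem v _ (u : 𝓞 K) rfl]
    intro h
    exact v.isPrime.ne_top (Ideal.eq_top_of_isUnit_mem _ h u.isUnit)
  · intro h
    have h1 := (isIntegral_iff_ord x).2 (fun v => (h v).ge)
    have h2 := (isIntegral_iff_ord x⁻¹).2 (fun v => by rw [ord_inv, h v]; simp)
    refine ⟨⟨⟨x, h1⟩, ⟨(x⁻¹ : Kˣ), h2⟩, ?_, ?_⟩, ?_⟩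
    · exact NumberField.RingOfIntegers.ext (by change ((x : K) * ((x⁻¹ : Kˣ) : K)) = 1; simp)
    · exact NumberField.RingOfIntegers.ext (by change (((x⁻¹ : Kˣ) : K) * (x : K)) = 1; simp)
    · ext; rfl

theorem mem_EE_one_iff : x ∈ EE K 1 ↔ x ∈ (unitsHom K).range := by
  rw [mem_units_iff, mem_EE_iff one_ne_zero]
  constructor
  · intro h v
    apply h v
    rw [Nat.cast_one]
    exact fun h => v.isPrime.ne_top ((Ideal.eq_top_iff_one _).2 h)
  · intro h v _; exact h v

theorem units_le_EE (s : ℕ) (hs : s ≠ 0) : (unitsHom K).range ≤ EE K s := by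
  intro x hx
  rw [mem_EE_iff hs]
  intro v _
  exact mem_units_iff.1 hx v

theorem EE_mono {s t : ℕ} (h : s ∣ t) : EE K s ≤ EE K t := by
  rintro x ⟨n, h1, h2⟩
  obtain ⟨r, rfl⟩ := h
  have hr : IsIntegral ℤ ((r : K) ^ n) := by
    have : IsIntegral ℤ (r : K) := by
      have := isIntegral_algebraMap (R := ℤ) (A := K) (x := (r : ℤ))
      simpa using this
    exact this.pow n
  refine ⟨n, ?_, ?_⟩
  · have e : ((s * r : ℕ) : K) ^ n * (x : K) = (r : K) ^ n * ((s : K) ^ n * x) := by push_cast; ring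
    rw [e]; exact hr.mul h1
  · have e : ((s * r : ℕ) : K) ^ n * ((x⁻¹ : Kˣ) : K) = (r : K) ^ n * ((s : K) ^ n * (x⁻¹ : Kˣ)) := by
      push_cast; ring
    rw [e]; exact hr.mul h2

theorem mem_EE_of_pow {n : ℕ} (hn : n ≠ 0) (hs : s ≠ 0) (h : x ^ n ∈ EE K s) : x ∈ EE K s := by
  rw [mem_EE_iff hs] at h ⊢
  intro v hv
  have := h v hv
  rw [ord_pow] at this
  have hn' : (n : ℤ) ≠ 0 := by exact_mod_cast hn
  exact (mul_eq_zero.1 this).resolve_left hn'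

theorem exists_gen (v : HeightOneSpectrum (𝓞 K)) : ∃ γ : Kˣ, ord v γ = classNumber K ∧
    ∀ w, w ≠ v → ord w γ = 0 := by
  have hp : (v.asIdeal ^ classNumber K).IsPrincipal := by
    have hv0 : v.asIdeal ∈ nonZeroDivisors (Ideal (𝓞 K)) := mem_nonZeroDivisors_of_ne_zero v.ne_bot
    have h1 : (ClassGroup.mk0 ⟨v.asIdeal, hv0⟩) ^ classNumber K = 1 := pow_card_eq_one
    rw [← map_pow, ClassGroup.mk0_eq_one_iff] at h1
    exact h1
  obtain ⟨g, hg⟩ := hp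
  have hg0 : g ≠ 0 := by
    rintro rfl
    have h0 : v.asIdeal ^ classNumber K = 0 := by rw [hg]; simp
    exact v.ne_bot (pow_eq_zero_iff (Fintype.card_ne_zero)|>.1 h0)
  have hgK : (algebraMap (𝓞 K) K g) ≠ 0 := by simpa using hg0
  have hg' : Ideal.span {g} = v.asIdeal ^ classNumber K := hg.symm
  refine ⟨Units.mk0 _ hgK, ?_, ?_⟩
  · have h1 : v.intValuation g = WithZero.exp (-(classNumber K : ℤ)) := by
      rw [v.intValuation_eq_exp_neg_multiplicity hg0, hg', multiplicity_pow_self]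
      · exact v.ne_bot
      · exact v.irreducible.not_isUnit
    rw [ord, Units.val_mk0, v.valuation_of_algebraMap, h1, WithZero.log_exp, neg_neg]
  · intro w hw
    rw [ord_eq_zero_iff_notMem w _ g rfl]
    intro h
    have h2 : v.asIdeal ^ classNumber K ≤ w.asIdeal := by
      rw [← hg']; exact (Ideal.span_singleton_le_iff_mem _).2 h
    have h3 := w.isPrime.le_of_pow_le h2
    have := (v.isMaximal.eq_of_le w.isPrime.ne_top h3)
    exact hw (HeightOneSpectrum.ext this.symm)

theorem exists_pow_class {n : ℕ} (hn : n ≠ 0) (hs : s ≠ 0) (f : Kˣ)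
    (h : ∀ v : HeightOneSpectrum (𝓞 K), (s : 𝓞 K) ∉ v.asIdeal → (n : ℤ) ∣ ord v f) :
    ∃ a : Kˣ, ∃ e ∈ EE K s, f ^ classNumber K = a ^ n * e := by
  classical
  choose γ h1 h2 using exists_gen (K := K)
  let S := (finite_ord_ne_zero f).toFinset.filter (fun v => (s : 𝓞 K) ∉ v.asIdeal)
  let a := ∏ v ∈ S, γ v ^ (ord v f / n)
  have ha : ∀ w : HeightOneSpectrum (𝓞 K), (s : 𝓞 K) ∉ w.asIdeal → n * ord w a = classNumber K * ord w f := by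
    intro w hw
    rw [ord_prod]
    by_cases hwS : w ∈ S
    · rw [Finset.sum_eq_single w]
      · rw [ord_zpow, h1]
        obtain ⟨c, hc⟩ := h w hw
        rw [hc, Int.mul_ediv_cancel_left _ (by exact_mod_cast hn)]; ring
      · intro b _ hb
        rw [ord_zpow, h2 b w hb.symm, mul_zero]
      · intro h; exact absurd hwS h
    · rw [Finset.sum_eq_zero]
      · have : ord w f = 0 := by
          by_contra h0
          apply hwS
          simp [S, h0, hw]
        rw [this]; simp
      · intro b hb
        have : w ≠ b := by rintro rfl; exact hwS hb
        rw [ord_zpow, h2 b w this, mul_zero]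
  refine ⟨a, f ^ classNumber K / a ^ n, ?_, by rw [mul_div_cancel]⟩
  rw [mem_EE_iff hs]
  intro w hw
  rw [ord_div, ord_pow, ord_pow, ha w hw, sub_self]

end SUnits

end

section

open NumberField IsDedekindDomain

section Ext
set_option linter.unusedSectionVars false

theorem isIntegral_ringHom_iff {K M : Type*} [Field K] [Field M] (e : K →+* M) (a : K) :
    IsIntegral ℤ (e a) ↔ IsIntegral ℤ a :=
  isIntegral_algHom_iff e.toIntAlgHom e.injective

theorem map_mem_EE_iff {K M : Type*} [Field K] [Field M] (e : K →+* M) (s : ℕ) (x : Kˣ) :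
    Units.map (e : K →* M) x ∈ EE M s ↔ x ∈ EE K s := by
  have h : ∀ (n : ℕ) (y : Kˣ), IsIntegral ℤ ((s : M) ^ n * ((Units.map (e : K →* M) y : Mˣ) : M)) ↔
      IsIntegral ℤ ((s : K) ^ n * (y : K)) := by
    intro n y
    rw [← isIntegral_ringHom_iff e]
    simp
  constructor
  · rintro ⟨n, h1, h2⟩
    rw [← map_inv] at h2
    exact ⟨n, (h n x).1 h1, (h n x⁻¹).1 h2⟩
  · rintro ⟨n, h1, h2⟩
    refine ⟨n, (h n x).2 h1, ?_⟩
    rw [← map_inv]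
    exact (h n x⁻¹).2 h2

variable {K M : Type*} [Field K] [NumberField K] [Field M] [NumberField M] [Algebra K M]

/-- the canonical map on units -/
abbrev um (K M : Type*) [Field K] [Field M] [Algebra K M] : Kˣ →* Mˣ :=
  Units.map (algebraMap K M : K →* M)

theorem ord_liesOver (q : HeightOneSpectrum (𝓞 K)) (Q : HeightOneSpectrum (𝓞 M))
    [Q.asIdeal.LiesOver q.asIdeal] (f : Kˣ) :
    ord Q (um K M f) = q.asIdeal.ramificationIdx' Q.asIdeal * ord q f := by
  have := HeightOneSpectrum.valuation_liesOver M q Q (f : K)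
  rw [val_eq_exp, ← WithZero.exp_nsmul] at this
  have h2 := val_eq_exp Q (um K M f)
  rw [Units.coe_map, MonoidHom.coe_coe, ← this, WithZero.exp_inj] at h2
  simp only [nsmul_eq_mul, mul_neg, neg_inj] at h2
  exact h2.symm

theorem exists_over (q : HeightOneSpectrum (𝓞 K)) : ∃ Q : HeightOneSpectrum (𝓞 M),
    Q.asIdeal.LiesOver q.asIdeal := by
  have := q.isMaximal
  obtain ⟨P, hP, hl⟩ := Ideal.exists_maximal_ideal_liesOver_of_isIntegral (S := 𝓞 M) q.asIdeal
  exact ⟨⟨P, hP.isPrime, Ideal.ne_bot_of_liesOver_of_ne_bot q.ne_bot P⟩, hl⟩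

theorem exists_under (Q : HeightOneSpectrum (𝓞 M)) : ∃ q : HeightOneSpectrum (𝓞 K),
    Q.asIdeal.LiesOver q.asIdeal := by
  refine ⟨⟨Q.asIdeal.under (𝓞 K), inferInstance, ?_⟩, ?_⟩
  · exact Ideal.IsIntegral.comap_ne_bot _ Q.ne_bot
  · exact ⟨rfl⟩

theorem liesOver_mem_iff {q : HeightOneSpectrum (𝓞 K)} {Q : HeightOneSpectrum (𝓞 M)}
    (h : Q.asIdeal.LiesOver q.asIdeal) (a : 𝓞 K) :
    algebraMap (𝓞 K) (𝓞 M) a ∈ Q.asIdeal ↔ a ∈ q.asIdeal := by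
  rw [h.over]; rfl

theorem liesOver_natCast_mem_iff {q : HeightOneSpectrum (𝓞 K)} {Q : HeightOneSpectrum (𝓞 M)}
    (h : Q.asIdeal.LiesOver q.asIdeal) (s : ℕ) :
    (s : 𝓞 M) ∈ Q.asIdeal ↔ (s : 𝓞 K) ∈ q.asIdeal := by
  rw [← liesOver_mem_iff h, map_natCast]

theorem ord_liesOver_pos (q : HeightOneSpectrum (𝓞 K)) (Q : HeightOneSpectrum (𝓞 M))
    [Q.asIdeal.LiesOver q.asIdeal] : 0 < q.asIdeal.ramificationIdx' Q.asIdeal := by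
  have h : q.asIdeal.ramificationIdx' Q.asIdeal ≠ 0 :=
    Ideal.IsDedekindDomain.ramificationIdx'_ne_zero_of_liesOver Q.asIdeal q.ne_bot
  omega

theorem exists_ord_ringHom {K M : Type*} [Field K] [NumberField K] [Field M] [NumberField M]
    (e : K →+* M) (Q : HeightOneSpectrum (𝓞 M)) :
    ∃ (q : HeightOneSpectrum (𝓞 K)) (a : ℕ), 0 < a ∧
      (∀ f : Kˣ, ord Q (Units.map (e : K →* M) f) = a * ord q f) ∧
      (∀ z : 𝓞 K, z ∈ q.asIdeal ↔ RingOfIntegers.mapRingHom e z ∈ Q.asIdeal) := by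
  let _ : Algebra K M := e.toAlgebra
  obtain ⟨q, hq⟩ := exists_under (K := K) Q
  refine ⟨q, _, ord_liesOver_pos q Q, fun f => ord_liesOver q Q f, fun z => ?_⟩
  rw [← liesOver_mem_iff hq z]
  rfl

/-- automorphisms permute places -/
theorem exists_ord_equiv {K M : Type*} [Field K] [NumberField K] [Field M] [NumberField M]
    (e : K ≃+* M) (Q : HeightOneSpectrum (𝓞 M)) :
    ∃ (q : HeightOneSpectrum (𝓞 K)),
      (∀ f : Kˣ, ord Q (Units.map (e : K →* M) f) = ord q f) ∧
      (∀ z : 𝓞 K, z ∈ q.asIdeal ↔ RingOfIntegers.mapRingHom (e : K →+* M) z ∈ Q.asIdeal) := by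
  obtain ⟨q, a, ha, h1, h2⟩ := exists_ord_ringHom (e : K →+* M) Q
  obtain ⟨Q', b, hb, h3, h4⟩ := exists_ord_ringHom (e.symm : M →+* K) q
  have hQ : Q' = Q := by
    ext z
    rw [h4, h2]
    have : RingOfIntegers.mapRingHom (e : K →+* M) (RingOfIntegers.mapRingHom (e.symm : M →+* K) z) = z := by
      exact RingOfIntegers.ext (by change e (e.symm _) = _; simp)
    rw [this]
  subst hQ
  refine ⟨q, fun f => ?_, h2⟩
  obtain ⟨γ, hγ, _⟩ := exists_gen Q'
  have e1 := h1 (Units.map (e.symm : M →* K) γ)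
  have e2 := h3 γ
  have e3 : Units.map ((e : K →+* M) : K →* M) (Units.map (e.symm : M →* K) γ) = γ := by
    ext; simp
  rw [e3, hγ] at e1
  have e4 : ord q (Units.map (e.symm : M →* K) γ) = b * ord Q' γ := e2
  rw [e4, hγ] at e1
  have hpos : (0 : ℤ) < classNumber M := by exact_mod_cast Fintype.card_pos
  have hab : (a * b : ℤ) = 1 := by
    have : (classNumber M : ℤ) * (a * b - 1) = 0 := by linarith
    rcases mul_eq_zero.1 this with h | h
    · omega
    · linarith
  have ha1 : a = 1 := by
    have : a * b = 1 := by exact_mod_cast hab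
    exact Nat.eq_one_of_mul_eq_one_right this
  have := h1 f
  rw [ha1, Nat.cast_one, one_mul] at this
  exact this

theorem natCast_mem_equiv {K M : Type*} [Field K] [NumberField K] [Field M] [NumberField M]
    (e : K ≃+* M) {Q : HeightOneSpectrum (𝓞 M)} {q : HeightOneSpectrum (𝓞 K)}
    (h : ∀ z : 𝓞 K, z ∈ q.asIdeal ↔ RingOfIntegers.mapRingHom (e : K →+* M) z ∈ Q.asIdeal) (s : ℕ) :
    (s : 𝓞 K) ∈ q.asIdeal ↔ (s : 𝓞 M) ∈ Q.asIdeal := by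
  rw [h, map_natCast]

/-- the `p`-Selmer-type group outside `s` -/
def Sel (K : Type*) [Field K] [NumberField K] (p s : ℕ) : Subgroup Kˣ where
  carrier := {x | ∀ v : HeightOneSpectrum (𝓞 K), (s : 𝓞 K) ∉ v.asIdeal → (p : ℤ) ∣ ord v x}
  one_mem' := fun v _ => by rw [ord_one]; exact dvd_zero _
  mul_mem' := fun ha hb v hv => by rw [ord_mul]; exact dvd_add (ha v hv) (hb v hv)
  inv_mem' := fun ha v hv => by rw [ord_inv]; exact (dvd_neg).2 (ha v hv)

theorem Sel_map_equiv {K M : Type*} [Field K] [NumberField K] [Field M] [NumberField M]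
    (e : K ≃+* M) {p s : ℕ} {x : Kˣ} (hx : x ∈ Sel K p s) :
    Units.map (e : K →* M) x ∈ Sel M p s := by
  intro Q hQ
  obtain ⟨q, h1, h2⟩ := exists_ord_equiv e Q
  rw [h1]
  exact hx q (fun h => hQ ((natCast_mem_equiv e h2 s).1 h))

theorem Sel_map {p s : ℕ} {x : Kˣ} (hx : x ∈ Sel K p s) : um K M x ∈ Sel M p s := by
  intro Q hQ
  obtain ⟨q, hq⟩ := exists_under (K := K) Q
  rw [ord_liesOver q Q]
  exact Dvd.dvd.mul_left (hx q (fun h => hQ ((liesOver_natCast_mem_iff hq s).2 h))) _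

theorem pow_mem_Sel {p s : ℕ} (x : Kˣ) : x ^ p ∈ Sel K p s := fun v _ => by
  rw [ord_pow]; exact Dvd.intro _ rfl

theorem EE_le_Sel {p s : ℕ} (hs : s ≠ 0) : EE K s ≤ Sel K p s := fun x hx v hv => by
  rw [(mem_EE_iff hs).1 hx v hv]; exact dvd_zero _

/-- either `p ∤ e` for some prime above, or total ramification -/
theorem ram_dichotomy [IsGalois K M] {p : ℕ} (hp : p.Prime) (hdeg : Module.finrank K M = p)
    (q : HeightOneSpectrum (𝓞 K)) :
    (∃ Q : HeightOneSpectrum (𝓞 M), ∃ _ : Q.asIdeal.LiesOver q.asIdeal,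
      ¬ p ∣ q.asIdeal.ramificationIdx' Q.asIdeal) ∨
    (∃ Q : HeightOneSpectrum (𝓞 M), ∃ _ : Q.asIdeal.LiesOver q.asIdeal,
      q.asIdeal.ramificationIdx' Q.asIdeal = p ∧
      (∀ Q' : HeightOneSpectrum (𝓞 M), Q'.asIdeal.LiesOver q.asIdeal → Q' = Q) ∧
      ∀ b : 𝓞 M, ∃ a : 𝓞 K, b - algebraMap (𝓞 K) (𝓞 M) a ∈ Q.asIdeal) := by
  by_cases hex : ∃ Q : HeightOneSpectrum (𝓞 M), ∃ _ : Q.asIdeal.LiesOver q.asIdeal,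
      ¬ p ∣ q.asIdeal.ramificationIdx' Q.asIdeal
  · exact Or.inl hex
  right
  push Not at hex
  have := q.isMaximal
  have hsum := Ideal.sum_ramification_inertia (𝓞 M) K M q.ne_bot
  rw [hdeg] at hsum
  obtain ⟨Q, hQ⟩ := exists_over (M := M) q
  have hmem : ∀ Q' : HeightOneSpectrum (𝓞 M), Q'.asIdeal.LiesOver q.asIdeal →
      Q'.asIdeal ∈ IsDedekindDomain.primesOverFinset q.asIdeal (𝓞 M) := by
    intro Q' h
    rw [← Finset.mem_coe, IsDedekindDomain.coe_primesOverFinset q.ne_bot]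
    exact ⟨Q'.isPrime, h⟩
  have hterm : ∀ Q' : HeightOneSpectrum (𝓞 M), Q'.asIdeal.LiesOver q.asIdeal →
      p ≤ q.asIdeal.ramificationIdx' Q'.asIdeal * q.asIdeal.inertiaDeg' Q'.asIdeal ∧
      p ≤ q.asIdeal.ramificationIdx' Q'.asIdeal ∧ 0 < q.asIdeal.inertiaDeg' Q'.asIdeal := by
    intro Q' h
    have h1 : p ≤ q.asIdeal.ramificationIdx' Q'.asIdeal := Nat.le_of_dvd (ord_liesOver_pos q Q') (hex Q' h)
    have h2 : 0 < q.asIdeal.inertiaDeg' Q'.asIdeal := Ideal.inertiaDeg'_pos _ _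
    exact ⟨h1.trans (Nat.le_mul_of_pos_right _ h2), h1, h2⟩
  have hle : q.asIdeal.ramificationIdx' Q.asIdeal * q.asIdeal.inertiaDeg' Q.asIdeal ≤ p := by
    rw [← hsum]
    exact Finset.single_le_sum (f := fun P => q.asIdeal.ramificationIdx' P * q.asIdeal.inertiaDeg' P)
      (fun _ _ => Nat.zero_le _) (hmem Q hQ)
  obtain ⟨t1, t2, t3⟩ := hterm Q hQ
  have he : q.asIdeal.ramificationIdx' Q.asIdeal = p := by nlinarith
  have hf : q.asIdeal.inertiaDeg' Q.asIdeal = 1 := by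
    rw [he] at hle
    have := hp.pos
    nlinarith
  refine ⟨Q, hQ, he, ?_, ?_⟩
  · intro Q' hQ'
    by_contra hne
    have hne' : Q'.asIdeal ≠ Q.asIdeal := fun h => hne (HeightOneSpectrum.ext h)
    have h2 : ∑ P ∈ ({Q'.asIdeal, Q.asIdeal} : Finset (Ideal (𝓞 M))), q.asIdeal.ramificationIdx' P *
        q.asIdeal.inertiaDeg' P ≤ p := by
      rw [← hsum]
      apply Finset.sum_le_sum_of_subset
      intro P hP
      simp only [Finset.mem_insert, Finset.mem_singleton] at hP
      rcases hP with rfl | rfl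
      · exact hmem _ hQ'
      · exact hmem _ hQ
    rw [Finset.sum_pair hne'] at h2
    have := (hterm Q' hQ').1
    have := hp.pos
    omega
  · intro b
    rw [Ideal.inertiaDeg'_algebraMap] at hf
    letI := Ideal.Quotient.field q.asIdeal
    have hb := (finrank_eq_one_iff_of_nonzero' (K := 𝓞 K ⧸ q.asIdeal) (1 : 𝓞 M ⧸ Q.asIdeal) one_ne_zero).1 hf
      (Ideal.Quotient.mk _ b)
    obtain ⟨c, hc⟩ := hb
    obtain ⟨a, rfl⟩ := Ideal.Quotient.mk_surjective c
    refine ⟨a, ?_⟩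
    rw [← Ideal.Quotient.eq, ← hc, Algebra.smul_def, mul_one]
    rfl
end Ext

end

section

open NumberField IsDedekindDomain Polynomial

/-- action of a field isomorphism on units -/
abbrev ua {K M : Type*} [Field K] [Field M] (e : K ≃+* M) : Kˣ →* Mˣ := Units.map (e : K →* M)

theorem um_injective (F M : Type*) [Field F] [Field M] [Algebra F M] :
    Function.Injective (um F M) :=
  Units.map_injective (algebraMap F M).injective

/-- Kummer data: a cyclic extension of degree `p` generated by a `p`-th root. -/
structure KD (p : ℕ) (F M : Type) [Field F] [Field M] [Algebra F M] where
  hp : p.Prime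
  hp5 : 5 ≤ p
  ζ : F
  hζ : IsPrimitiveRoot ζ p
  θ : Mˣ
  u : Fˣ
  hu : θ ^ p = um F M u
  hdeg : Module.finrank F M = p
  σ : M ≃ₐ[F] M
  hσ : σ θ = algebraMap F M ζ * θ

namespace KD
variable {p : ℕ} {F M : Type} [Field F] [Field M] [Algebra F M] (D : KD p F M)

/-- sigma on units -/
abbrev s : Mˣ →* Mˣ := ua D.σ.toRingEquiv

/-- the norm on units -/
noncomputable abbrev Nm (_D : KD p F M) : Mˣ →* Fˣ := Units.map (Algebra.norm F)

theorem finDim (D : KD p F M) : FiniteDimensional F M :=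
  Module.finite_of_finrank_pos (by rw [D.hdeg]; exact D.hp.pos)

theorem sigma_pow_theta (i : ℕ) : (D.σ ^ i) D.θ = algebraMap F M (D.ζ ^ i) * D.θ := by
  induction i with
  | zero => simp
  | succ n ih =>
    rw [pow_succ', AlgEquiv.mul_apply, ih, map_mul, AlgEquiv.commutes, D.hσ, pow_succ]
    simp only [map_mul]; ring

theorem sigma_pow_inj {i j : ℕ} (hi : i < p) (hj : j < p) (h : D.σ ^ i = D.σ ^ j) : i = j := by
  have h1 := D.sigma_pow_theta i
  rw [h, D.sigma_pow_theta j] at h1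
  have := mul_right_cancel₀ D.θ.ne_zero h1
  exact D.hζ.pow_inj hi hj ((algebraMap F M).injective this.symm)

theorem card_le (D : KD p F M) : p ≤ Nat.card (M ≃ₐ[F] M) := by
  have := D.finDim
  have hinj : Function.Injective (fun i : Fin p => D.σ ^ (i : ℕ)) := fun i j h =>
    Fin.ext (D.sigma_pow_inj i.2 j.2 h)
  have := Nat.card_le_card_of_injective _ hinj
  simpa using this

theorem card_eq (D : KD p F M) : Nat.card (M ≃ₐ[F] M) = p := by
  have := D.finDim
  refine le_antisymm ?_ D.card_le
  rw [← D.hdeg, Nat.card_eq_fintype_card]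
  exact AlgEquiv.card_le

theorem galois (D : KD p F M) : IsGalois F M := by
  have := D.finDim
  refine IsGalois.of_card_aut_eq_finrank F M ?_
  rw [D.card_eq, D.hdeg]

theorem bij : Function.Bijective (fun i : Fin p => D.σ ^ (i : ℕ)) := by
  have := D.finDim
  rw [Fintype.bijective_iff_injective_and_card]
  refine ⟨fun i j h => Fin.ext (D.sigma_pow_inj i.2 j.2 h), ?_⟩
  rw [Fintype.card_fin, ← Nat.card_eq_fintype_card, D.card_eq]

theorem mem_zpowers (g : M ≃ₐ[F] M) : g ∈ Subgroup.zpowers D.σ := by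
  obtain ⟨i, rfl⟩ := D.bij.2 g
  exact ⟨(i : ℕ), by simp⟩

theorem sigma_pow_p : D.σ ^ p = 1 := by
  have := D.finDim
  have h := pow_card_eq_one' (x := D.σ)
  rwa [D.card_eq] at h

theorem s_iter (i : ℕ) (x : Mˣ) : ((D.s^[i] x : Mˣ) : M) = (D.σ ^ i) (x : M) := by
  induction i with
  | zero => simp
  | succ n ih =>
    rw [Function.iterate_succ_apply', pow_succ', AlgEquiv.mul_apply, ← ih]
    rfl

theorem s_iter_p (x : Mˣ) : D.s^[p] x = x := by
  ext; rw [D.s_iter, D.sigma_pow_p]; rfl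

theorem prod_s (x : Mˣ) : ∏ i ∈ Finset.range p, D.s^[i] x = um F M (D.Nm x) := by
  have := D.finDim
  have := D.galois
  ext
  rw [Units.coe_prod, Units.coe_map, Units.coe_map]
  simp only [MonoidHom.coe_coe]
  rw [Algebra.norm_eq_prod_automorphisms, ← Fin.prod_univ_eq_prod_range
    (fun i => ((D.s^[i] x : Mˣ) : M))]
  refine Fintype.prod_bijective _ D.bij _ _ (fun i => ?_)
  rw [D.s_iter]

theorem hilbert90 (x : Mˣ) (hx : D.Nm x = 1) : ∃ y : Mˣ, x = D.s y / y := by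
  have := D.finDim
  have := D.galois
  have : IsCyclic (M ≃ₐ[F] M) := ⟨D.σ, D.mem_zpowers⟩
  have hx' : Algebra.norm F (x : M) = 1 := by
    have := congrArg (fun z : Fˣ => (z : F)) hx
    simpa using this
  obtain ⟨y, hy⟩ := groupCohomology.exists_div_of_norm_eq_one D.mem_zpowers hx'
  refine ⟨y⁻¹, ?_⟩
  have : x = y / D.s y := by
    ext
    rw [← hy, Units.val_div_eq_div_val]
    rfl
  rw [this, map_inv, inv_div_inv]

theorem s_um (f : Fˣ) : D.s (um F M f) = um F M f := by
  ext; exact D.σ.commutes _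

theorem fixed (x : Mˣ) (hx : D.s x = x) : ∃ f : Fˣ, x = um F M f := by
  have := D.finDim
  have := D.galois
  have h1 : D.σ (x : M) = x := congrArg (fun z : Mˣ => (z : M)) hx
  have h2 : ∀ g : M ≃ₐ[F] M, g x = x := by
    intro g
    obtain ⟨i, rfl⟩ := D.bij.2 g
    have : ∀ n : ℕ, (D.σ ^ n) (x : M) = x := by
      intro n
      induction n with
      | zero => simp
      | succ n ih => rw [pow_succ, AlgEquiv.mul_apply, h1, ih]
    exact this i
  obtain ⟨f, hf⟩ := (IsGalois.mem_range_algebraMap_iff_fixed (F := F) (x : M)).2 h2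
  have hf0 : f ≠ 0 := by
    rintro rfl
    rw [map_zero] at hf
    exact x.ne_zero hf.symm
  exact ⟨Units.mk0 f hf0, by ext; simp [hf]⟩

theorem Nm_um (f : Fˣ) : D.Nm (um F M f) = f ^ p := by
  apply um_injective F M
  rw [← D.prod_s, map_pow]
  have : ∀ i, D.s^[i] (um F M f) = um F M f := fun i => Function.iterate_fixed (D.s_um f) i
  simp [this]

theorem Nm_s (x : Mˣ) : D.Nm (D.s x) = D.Nm x := by
  ext
  simpa using Algebra.norm_eq_of_algEquiv D.σ (x : M)

theorem Nm_s_iter (i : ℕ) (x : Mˣ) : D.Nm (D.s^[i] x) = D.Nm x := by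
  induction i with
  | zero => rfl
  | succ n ih => rw [Function.iterate_succ_apply', D.Nm_s, ih]

theorem zeta_ne : D.ζ ≠ 0 := D.hζ.ne_zero D.hp.ne_zero

/-- zeta as a unit of F -/
noncomputable abbrev zu : Fˣ := Units.mk0 D.ζ D.zeta_ne

theorem s_theta : D.s D.θ = um F M D.zu * D.θ := by
  ext; exact D.hσ

theorem s_iter_theta (i : ℕ) : D.s^[i] D.θ = um F M (D.zu ^ i) * D.θ := by
  ext
  rw [D.s_iter, D.sigma_pow_theta]
  simp

theorem zu_pow : D.zu ^ p = 1 := by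
  ext; simpa using D.hζ.pow_eq_one

theorem Nm_theta : D.Nm D.θ = D.u := by
  apply um_injective F M
  rw [← D.prod_s, ← D.hu]
  have e : ∏ i ∈ Finset.range p, D.zu ^ i = 1 := by
    rw [Finset.prod_pow_eq_pow_sum, Finset.sum_range_id]
    obtain ⟨k, hk⟩ := D.hp.odd_of_ne_two (by have := D.hp5; omega)
    have : p * (p - 1) / 2 = p * k := by
      rw [hk]
      simp only [Nat.add_sub_cancel]
      rw [show (2 * k + 1) * (2 * k) = 2 * ((2 * k + 1) * k) by ring]
      exact Nat.mul_div_cancel_left _ (by norm_num)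
    rw [this, pow_mul, D.zu_pow, one_pow]
  rw [Finset.prod_congr rfl (fun i _ => D.s_iter_theta i), Finset.prod_mul_distrib, ← map_prod, e]
  simp

theorem u_not_pow (b : F) : b ^ p ≠ D.u := by
  intro hb
  have hb0 : b ≠ 0 := by
    rintro rfl
    rw [zero_pow D.hp.ne_zero] at hb
    exact D.u.ne_zero hb.symm
  have hu : (D.θ : M) ^ p = algebraMap F M D.u := by
    have := congrArg (fun z : Mˣ => (z : M)) D.hu
    simpa using this
  have h0 : algebraMap F M b ≠ 0 := by simpa using hb0
  have h1 : ((D.θ : M) / algebraMap F M b) ^ p = 1 := by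
    rw [div_pow, hu, ← hb, map_pow, div_self (pow_ne_zero _ h0)]
  have hz : IsPrimitiveRoot (algebraMap F M D.ζ) p := D.hζ.map_of_injective (algebraMap F M).injective
  have : NeZero p := ⟨D.hp.ne_zero⟩
  obtain ⟨i, _, hi⟩ := hz.eq_pow_of_pow_eq_one h1
  have h2 : (D.θ : M) = algebraMap F M (D.ζ ^ i * b) := by
    rw [map_mul, map_pow, hi, div_mul_cancel₀ _ h0]
  have h3 := D.hσ
  rw [h2, AlgEquiv.commutes, ← h2] at h3
  have h4 : algebraMap F M D.ζ = 1 := by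
    have : (1 - algebraMap F M D.ζ) * (D.θ : M) = 0 := by linear_combination h3
    rcases mul_eq_zero.1 this with h | h
    · linear_combination -h
    · exact absurd h D.θ.ne_zero
  have := hz.ne_one D.hp.one_lt
  exact this h4

theorem irr : Irreducible (X ^ p - C (D.u : F)) :=
  X_pow_sub_C_irreducible_of_prime D.hp D.u_not_pow

theorem theta_pow : (D.θ : M) ^ p = algebraMap F M D.u := by
  have := congrArg (fun z : Mˣ => (z : M)) D.hu
  simpa using this

theorem minpoly_theta : minpoly F (D.θ : M) = X ^ p - C (D.u : F) := by
  symm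
  apply minpoly.eq_of_irreducible_of_monic D.irr
  · simp [D.theta_pow]
  · exact monic_X_pow_sub_C _ D.hp.ne_zero

theorem adjoin_top : Algebra.adjoin F {(D.θ : M)} = ⊤ := by
  have := D.finDim
  have hi : IsIntegral F (D.θ : M) := Algebra.IsIntegral.isIntegral _
  have h1 : Module.finrank F (IntermediateField.adjoin F {(D.θ : M)}) = p := by
    rw [IntermediateField.adjoin.finrank hi, D.minpoly_theta, natDegree_X_pow_sub_C]
  have h2 : IntermediateField.adjoin F {(D.θ : M)} = ⊤ := by
    apply IntermediateField.eq_of_le_of_finrank_eq le_top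
    rw [h1, IntermediateField.finrank_top', D.hdeg]
  rw [← IntermediateField.adjoin_simple_toSubalgebra_of_isAlgebraic hi.isAlgebraic, h2]
  rfl

/-- power basis -/
noncomputable def pb : PowerBasis F M :=
  have := D.finDim
  PowerBasis.ofAdjoinEqTop (Algebra.IsIntegral.isIntegral (D.θ : M)) D.adjoin_top

theorem pb_gen : D.pb.gen = D.θ := by
  have := D.finDim
  exact PowerBasis.ofAdjoinEqTop_gen _ _

theorem pb_dim : D.pb.dim = p := by
  rw [← D.pb.natDegree_minpoly, D.pb_gen, D.minpoly_theta, natDegree_X_pow_sub_C]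

theorem expand (w : M) : ∃ f : ℕ → F, w = ∑ i ∈ Finset.range p, algebraMap F M (f i) * (D.θ : M) ^ i := by
  classical
  refine ⟨fun i => if h : i < D.pb.dim then D.pb.basis.repr w ⟨i, h⟩ else 0, ?_⟩
  conv_lhs => rw [← D.pb.basis.sum_repr w]
  have hr : Finset.range p = Finset.range D.pb.dim := by rw [D.pb_dim]
  rw [hr, ← Fin.sum_univ_eq_sum_range (fun i => algebraMap F M (if h : i < D.pb.dim then
    D.pb.basis.repr w ⟨i, h⟩ else 0) * (D.θ : M) ^ i)]
  refine Finset.sum_congr rfl fun i _ => ?_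
  rw [Algebra.smul_def, D.pb.basis_eq_pow, D.pb_gen]
  simp

theorem exists_lift {R : Type*} [Field R] (g : F →+* R) (t : R) (ht : t ^ p = g D.u) :
    ∃ e : M →+* R, (∀ f, e (algebraMap F M f) = g f) ∧ e D.θ = t := by
  let _ : Algebra F R := g.toAlgebra
  have hy : aeval t (minpoly F D.pb.gen) = 0 := by
    rw [D.pb_gen, D.minpoly_theta]
    simp only [map_sub, map_pow, aeval_X, aeval_C]
    rw [ht]
    exact sub_self _
  refine ⟨(D.pb.lift t hy).toRingHom, fun f => (D.pb.lift t hy).commutes f, ?_⟩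
  have := D.pb.lift_gen t hy
  rw [D.pb_gen] at this
  exact this

theorem hom_ext {R : Type*} [Field R] (e e' : M →+* R)
    (h1 : ∀ f, e (algebraMap F M f) = e' (algebraMap F M f)) (h2 : e D.θ = e' D.θ) : e = e' := by
  ext w
  obtain ⟨f, rfl⟩ := D.expand w
  simp only [map_sum, map_mul, map_pow, h1, h2]

/-- lifting automorphisms -/
theorem exists_aut (g : F ≃+* F) (t : M) (ht : t ^ p = algebraMap F M (g D.u)) :
    ∃ e : M ≃+* M, (∀ f, e (algebraMap F M f) = algebraMap F M (g f)) ∧ e D.θ = t := by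
  obtain ⟨e, h1, h2⟩ := D.exists_lift ((algebraMap F M).comp (g : F →+* F)) t ht
  have := D.finDim
  have hs : Function.Surjective e := by
    let R : Submodule F M :=
      { carrier := Set.range e
        add_mem' := by rintro _ _ ⟨a, rfl⟩ ⟨b, rfl⟩; exact ⟨a + b, map_add e a b⟩
        zero_mem' := ⟨0, map_zero e⟩
        smul_mem' := by
          rintro c _ ⟨a, rfl⟩
          refine ⟨algebraMap F M (g.symm c) * a, ?_⟩
          rw [map_mul, h1, Algebra.smul_def]
          simp }
    have hli : LinearIndependent F (fun i : Fin D.pb.dim => e (D.pb.basis i)) := by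
      rw [Fintype.linearIndependent_iff]
      intro c hc i
      have h0 : e (∑ i, algebraMap F M (g.symm (c i)) * D.pb.basis i) = 0 := by
        rw [map_sum, ← hc]
        refine Finset.sum_congr rfl fun i _ => ?_
        rw [map_mul, h1, Algebra.smul_def]
        simp
      rw [map_eq_zero] at h0
      have := Fintype.linearIndependent_iff.1 D.pb.basis.linearIndependent (fun i => g.symm (c i))
        (by simpa [Algebra.smul_def] using h0) i
      simpa using this
    have hR : R = ⊤ := by
      rw [eq_top_iff, ← hli.span_eq_top_of_card_eq_finrank' (by rw [Fintype.card_fin, D.pb.finrank]),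
        Submodule.span_le]
      rintro _ ⟨i, rfl⟩
      exact ⟨_, rfl⟩
    intro y
    have : y ∈ R := by rw [hR]; trivial
    exact this
  exact ⟨RingEquiv.ofBijective e ⟨e.injective, hs⟩, h1, h2⟩

end KD

end

section

open NumberField IsDedekindDomain

theorem coprime_pow_mem {G : Type*} [CommGroup G] (H : Subgroup G) {a b : ℕ} (h : Nat.Coprime a b)
    {x : G} (ha : x ^ a ∈ H) (hb : x ^ b ∈ H) : x ∈ H := by
  have h1 : (1 : ℤ) = a * Nat.gcdA a b + b * Nat.gcdB a b := by
    rw [← Nat.gcd_eq_gcd_ab, h]; rfl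
  have : x = (x ^ a) ^ (Nat.gcdA a b) * (x ^ b) ^ (Nat.gcdB a b) := by
    rw [← zpow_natCast, ← zpow_natCast, ← zpow_mul, ← zpow_mul, ← zpow_add, ← h1, zpow_one]
  rw [this]
  exact H.mul_mem (H.zpow_mem ha _) (H.zpow_mem hb _)

theorem ua_mem_EE {K M : Type*} [Field K] [Field M] (e : K ≃+* M) {s : ℕ} {x : Kˣ} (h : x ∈ EE K s) :
    ua e x ∈ EE M s := (map_mem_EE_iff (e : K →+* M) s x).2 h

theorem um_mem_EE_iff {K M : Type*} [Field K] [Field M] [Algebra K M] {s : ℕ} {x : Kˣ} :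
    um K M x ∈ EE M s ↔ x ∈ EE K s := map_mem_EE_iff (algebraMap K M) s x

namespace KD
variable {p : ℕ} {F M : Type} [Field F] [Field M] [NumberField F] [NumberField M] [Algebra F M]

/-- some prime above `q` has ramification index prime to `p` -/
def URat (p : ℕ) (F M : Type) [Field F] [Field M] [NumberField F] [NumberField M] [Algebra F M]
    (q : HeightOneSpectrum (𝓞 F)) : Prop :=
  ∃ Q : HeightOneSpectrum (𝓞 M), ∃ _ : Q.asIdeal.LiesOver q.asIdeal,
      ¬ p ∣ q.asIdeal.ramificationIdx' Q.asIdeal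

theorem dvd_ord_of_URat (D : KD p F M) {q : HeightOneSpectrum (𝓞 F)} (h : URat p F M q) (f : Fˣ) (k : ℕ)
    (hf : ∀ Q : HeightOneSpectrum (𝓞 M), Q.asIdeal.LiesOver q.asIdeal → ((p ^ k : ℕ) : ℤ) ∣ ord Q (um F M f)) :
    ((p ^ k : ℕ) : ℤ) ∣ ord q f := by
  obtain ⟨Q, hQ, he⟩ := h
  have h1 := hf Q hQ
  rw [ord_liesOver q Q] at h1
  refine IsCoprime.dvd_of_dvd_mul_left ?_ h1
  rw [Nat.isCoprime_iff_coprime]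
  exact Nat.Coprime.pow_left _ ((Nat.Prime.coprime_iff_not_dvd D.hp).2 he)

/-- unramifiedness criterion -/
theorem urat_of_beta (D : KD p F M) (q : HeightOneSpectrum (𝓞 F)) (β : 𝓞 M)
    (hβ : ∀ Q : HeightOneSpectrum (𝓞 M), Q.asIdeal.LiesOver q.asIdeal →
      RingOfIntegers.mapRingHom (D.σ.toRingEquiv : M →+* M) β - β ∉ Q.asIdeal) : URat p F M q := by
  have := D.galois
  rcases ram_dichotomy (K := F) (M := M) D.hp D.hdeg q with h | ⟨Q, hQ, _, huniq, hres⟩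
  · exact h
  exfalso
  obtain ⟨Q', _, h2⟩ := exists_ord_equiv D.σ.toRingEquiv Q
  have hcomm : ∀ a : 𝓞 F, RingOfIntegers.mapRingHom (D.σ.toRingEquiv : M →+* M)
      (algebraMap (𝓞 F) (𝓞 M) a) = algebraMap (𝓞 F) (𝓞 M) a :=
    fun a => RingOfIntegers.ext (D.σ.commutes (a : F))
  have hQ' : Q'.asIdeal.LiesOver q.asIdeal := by
    constructor
    ext a
    rw [← liesOver_mem_iff hQ, Ideal.mem_comap, h2, hcomm]
  have e := huniq Q' hQ'
  subst e
  obtain ⟨a, ha⟩ := hres β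
  have h3 := (h2 _).1 ha
  rw [map_sub, hcomm] at h3
  apply hβ Q' hQ
  have := Ideal.sub_mem _ h3 ha
  simpa using this

/-- the τ-fixed s-units -/
def XX (M : Type) [Field M] (τ : M ≃+* M) (s : ℕ) : Subgroup Mˣ where
  carrier := {x | x ∈ EE M s ∧ ua τ x = x}
  one_mem' := ⟨one_mem _, map_one _⟩
  mul_mem' := fun ha hb => ⟨mul_mem ha.1 hb.1, by rw [map_mul, ha.2, hb.2]⟩
  inv_mem' := fun ha => ⟨inv_mem ha.1, by rw [map_inv, ha.2]⟩

theorem s_mem_XX (D : KD p F M) {τ : M ≃+* M} (hτσ : ∀ x, τ (D.σ x) = D.σ (τ x)) {s : ℕ} {x : Mˣ}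
    (hx : x ∈ XX M τ s) : D.s x ∈ XX M τ s := by
  refine ⟨ua_mem_EE _ hx.1, ?_⟩
  have h2 : τ (x : M) = x := congrArg (fun z : Mˣ => (z : M)) hx.2
  ext
  change τ (D.σ x) = D.σ x
  rw [hτσ, h2]

theorem gt_main (D : KD p F M) (hh : ¬ p ∣ classNumber F) (τ : M ≃+* M) (c : F ≃+* F)
    (hτσ : ∀ x, τ (D.σ x) = D.σ (τ x)) (hτ2 : ∀ x, τ (τ x) = x)
    (hτc : ∀ f, τ (algebraMap F M f) = algebraMap F M (c f)) {s : ℕ} (hs : s ≠ 0)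
    (hUR : ∀ q : HeightOneSpectrum (𝓞 F), (s : 𝓞 F) ∉ q.asIdeal → URat p F M q)
    (x : Mˣ) (hx : x ∈ XX M τ s) (hN : D.Nm x = 1) : ∃ y ∈ XX M τ s, D.s y / y = x := by
  let H : Subgroup Mˣ :=
    { carrier := {z | ∃ y ∈ XX M τ s, D.s y / y = z}
      one_mem' := ⟨1, one_mem _, by simp⟩
      mul_mem' := by
        rintro _ _ ⟨a, ha, rfl⟩ ⟨b, hb, rfl⟩
        exact ⟨a * b, mul_mem ha hb, by rw [map_mul, mul_div_mul_comm]⟩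
      inv_mem' := by
        rintro _ ⟨a, ha, rfl⟩
        exact ⟨a⁻¹, inv_mem ha, by rw [map_inv, inv_div_inv, inv_div]⟩ }
  change x ∈ H
  have hiter : ∀ i, D.s^[i] x ∈ XX M τ s := by
    intro i
    induction i with
    | zero => exact hx
    | succ n ih => rw [Function.iterate_succ_apply']; exact D.s_mem_XX hτσ ih
  have hdiv : ∀ i, D.s^[i] x / x ∈ H := by
    intro i
    induction i with
    | zero => simp [H.one_mem]
    | succ n ih =>
      have : D.s^[n+1] x / x = (D.s (D.s^[n] x) / D.s^[n] x) * (D.s^[n] x / x) := by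
        rw [Function.iterate_succ_apply', div_mul_div_cancel]
      rw [this]
      exact H.mul_mem ⟨_, hiter n, rfl⟩ ih
  have hp1 : x ^ p ∈ H := by
    have : ∏ i ∈ Finset.range p, D.s^[i] x / x = (x ^ p)⁻¹ := by
      rw [Finset.prod_div_distrib, D.prod_s, hN, map_one]
      simp
    rw [← H.inv_mem_iff, ← this]
    exact H.prod_mem fun i _ => hdiv i
  have hp2 : x ^ (4 * classNumber F) ∈ H := by
    obtain ⟨w, hw⟩ := D.hilbert90 x hN
    have hcomm : ∀ z : Mˣ, ua τ (D.s z) = D.s (ua τ z) := fun z => by ext; exact hτσ _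
    have hcommi : ∀ (i : ℕ) (z : Mˣ), ua τ (D.s^[i] z) = D.s^[i] (ua τ z) := fun i => by
      induction i with
      | zero => intro z; rfl
      | succ n ih => intro z; rw [Function.iterate_succ_apply, ih, hcomm]; rfl
    have hx2 : x = D.s (ua τ w) / ua τ w := by
      conv_lhs => rw [← hx.2, hw]
      rw [map_div, hcomm]
    set w' := w * ua τ w with hw'
    have hτw' : ua τ w' = w' := by
      rw [hw', map_mul, mul_comm]
      congr 1
      ext; exact hτ2 _
    have hxsq : D.s w' / w' = x ^ 2 := by
      rw [hw', map_mul, mul_div_mul_comm, ← hw, ← hx2, sq]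
    have hit : ∀ i, D.s^[i] w' / w' ∈ EE M s := by
      intro i
      induction i with
      | zero => simp [one_mem]
      | succ n ih =>
        have : D.s^[n+1] w' / w' = (D.s^[n] (D.s w' / w')) * (D.s^[n] w' / w') := by
          rw [iterate_map_div, Function.iterate_succ_apply, div_mul_div_cancel]
        rw [this, hxsq, iterate_map_pow]
        exact mul_mem (pow_mem (hiter n).1 _) ih
    set ε := ∏ i ∈ Finset.range p, D.s^[i] w' / w' with hε
    have hεm : ε ∈ EE M s := Subgroup.prod_mem _ fun i _ => hit i
    have hNw : um F M (D.Nm w') = w' ^ p * ε := by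
      rw [hε, Finset.prod_div_distrib, D.prod_s]
      simp
    have hfd : ∀ v : HeightOneSpectrum (𝓞 F), (s : 𝓞 F) ∉ v.asIdeal → (p : ℤ) ∣ ord v (D.Nm w') := by
      intro v hv
      have := D.dvd_ord_of_URat (hUR v hv) (D.Nm w') 1 ?_
      · simpa using this
      intro Q hQ
      rw [hNw, ord_mul, ord_pow, (mem_EE_iff hs).1 hεm Q (fun h => hv ((liesOver_natCast_mem_iff hQ s).1 h))]
      simp
    obtain ⟨a, e, he, hae⟩ := exists_pow_class D.hp.ne_zero hs (D.Nm w') hfd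
    set h := classNumber F
    set b := w' ^ h / um F M a with hb
    have hbp : b ^ p * ε ^ h = um F M e := by
      have : um F M (D.Nm w') ^ h = um F M a ^ p * um F M e := by
        rw [← map_pow, hae, map_mul, map_pow]
      rw [hNw] at this
      rw [hb, div_pow, ← pow_mul, mul_comm h p, pow_mul, div_mul_eq_mul_div, ← mul_pow, this]
      simp
    have hbm : b ∈ EE M s := by
      apply mem_EE_of_pow D.hp.ne_zero hs
      have : b ^ p = um F M e / ε ^ h := by rw [← hbp]; simp
      rw [this]
      exact div_mem (um_mem_EE_iff.2 he) (pow_mem hεm _)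
    have hw2 : w' ^ (2 * h) = um F M (a * ua c a) * (b * ua τ b) := by
      have h1 : w' ^ h = um F M a * b := by rw [hb]; simp
      have h2 : w' ^ h = um F M (ua c a) * ua τ b := by
        have := congrArg (ua τ) h1
        rw [map_pow, hτw', map_mul] at this
        rw [this]
        congr 1
        ext; exact hτc _
      rw [two_mul, pow_add]
      nth_rewrite 1 [h1]
      rw [h2, map_mul]
      exact mul_mul_mul_comm _ _ _ _
    refine ⟨b * ua τ b, ⟨mul_mem hbm (ua_mem_EE _ hbm), ?_⟩, ?_⟩
    · rw [map_mul, mul_comm]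
      congr 1
      ext; exact hτ2 _
    · have e1 : b * ua τ b = w' ^ (2 * h) / um F M (a * ua c a) := by
        rw [hw2]; simp
      rw [e1, map_div, D.s_um, map_pow, div_div_div_cancel_right, ← div_pow, hxsq, ← pow_mul]
      congr 1; ring
  refine coprime_pow_mem H ?_ hp1 hp2
  rw [Nat.Prime.coprime_iff_not_dvd D.hp]
  intro hd
  rcases (Nat.Prime.dvd_mul D.hp).1 hd with h | h
  · have := Nat.le_of_dvd (by norm_num) h
    have := D.hp5
    omega
  · exact hh h

end KD

end

section

open NumberField IsDedekindDomain

theorem finrank_ge_of {A B : Type*} [AddCommGroup A] [AddCommGroup B] [Module.Finite ℤ A]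
    (ψ : B →+ A) (hψ : ∀ b, ψ b = 0 → ∃ n : ℤ, n ≠ 0 ∧ n • b = 0) {T : Type*} [Fintype T]
    (v : T → A →+ ℤ) (a : T → A) (hva : ∀ t, v t (a t) ≠ 0) (hva' : ∀ t t', t ≠ t' → v t (a t') = 0)
    (hvψ : ∀ t b, v t (ψ b) = 0) : Module.finrank ℤ B + Fintype.card T ≤ Module.finrank ℤ A := by
  classical
  obtain ⟨f, hf⟩ := exists_linearIndependent_of_le_finrank (R := ℤ) (M := B) le_rfl
  have hli : LinearIndependent ℤ (Sum.elim (fun i => ψ (f i)) a) := by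
    rw [Fintype.linearIndependent_iff]
    intro g hg
    rw [Fintype.sum_sum_type] at hg
    simp only [Sum.elim_inl, Sum.elim_inr] at hg
    have h1 : ∀ t, g (Sum.inr t) = 0 := by
      intro t
      have := congrArg (v t) hg
      simp only [map_add, map_sum, map_zsmul, hvψ, smul_zero, Finset.sum_const_zero, zero_add,
        map_zero] at this
      rw [Finset.sum_eq_single t (fun t' _ h => by rw [hva' t t' h.symm, smul_zero]) (by simp)] at this
      exact (mul_eq_zero.1 this).resolve_right (hva t)
    simp only [h1, zero_smul, Finset.sum_const_zero, add_zero] at hg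
    have h2 : ψ (∑ i, g (Sum.inl i) • f i) = 0 := by rw [map_sum]; simpa using hg
    obtain ⟨n, hn, hn'⟩ := hψ _ h2
    rw [Finset.smul_sum] at hn'
    simp only [smul_smul] at hn'
    have h3 := Fintype.linearIndependent_iff.1 hf _ hn'
    rintro (i | t)
    · exact (mul_eq_zero.1 (h3 i)).resolve_left hn
    · exact h1 t
  have := hli.fintype_card_le_finrank
  simpa using this

theorem finite_of_homs {A B C : Type*} [AddCommGroup A] [AddCommGroup B] [AddCommGroup C]
    [Module.Finite ℤ B] (g : A →+ C) (hg : Function.Injective g) (ub : B →+ C)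
    {I : Type*} [Fintype I] (v : I → A →+ ℤ)
    (h : ∀ a, (∀ i, v i a = 0) → ∃ b, ub b = g a) :
    Module.Finite ℤ A ∧ Module.finrank ℤ A ≤ Module.finrank ℤ B + Fintype.card I := by
  let V : A →ₗ[ℤ] (I → ℤ) := LinearMap.pi (fun i => (v i).toIntLinearMap)
  let j : V.ker →ₗ[ℤ] ub.toIntLinearMap.range :=
    (g.toIntLinearMap.comp V.ker.subtype).codRestrict _ (by
      rintro ⟨a, ha⟩
      obtain ⟨b, hb⟩ := h a (fun i => congrFun (LinearMap.mem_ker.1 ha) i)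
      exact ⟨b, hb⟩)
  have hj : Function.Injective j := by
    intro x y hxy
    have := congrArg Subtype.val hxy
    exact Subtype.ext (hg this)
  have hker : Module.Finite ℤ V.ker := Module.Finite.of_injective j hj
  have hfin : Module.Finite ℤ A := by
    have h1 : Module.Finite ℤ (A ⧸ V.ker) := Module.Finite.equiv (V.quotKerEquivRange).symm
    exact Module.Finite.of_submodule_quotient V.ker
  refine ⟨hfin, ?_⟩
  have h1 : Module.finrank ℤ V.ker ≤ Module.finrank ℤ B :=
    (LinearMap.finrank_le_finrank_of_injective hj).trans (LinearMap.finrank_range_le _)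
  have h2 : Module.finrank ℤ V.range ≤ Fintype.card I := by
    have := Submodule.finrank_le V.range
    simpa using this
  have h3 := Submodule.finrank_quotient_add_finrank V.ker
  rw [(V.quotKerEquivRange).finrank_eq] at h3
  omega

section
variable {K : Type*} [Field K] [NumberField K]

theorem finite_places_mem {s : ℕ} (hs : s ≠ 0) :
    {v : HeightOneSpectrum (𝓞 K) | (s : 𝓞 K) ∈ v.asIdeal}.Finite := by
  have h0 : (s : K) ≠ 0 := by exact_mod_cast hs
  refine (finite_ord_ne_zero (Units.mk0 (s : K) h0)).subset ?_
  intro v hv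
  have := (ord_pos_iff_mem v (Units.mk0 (s : K) h0) (s : 𝓞 K) (by simp)).2 hv
  simp only [Set.mem_setOf_eq]
  omega

theorem EE_finite {s : ℕ} (hs : s ≠ 0) (X : Subgroup Kˣ) (hX : X ≤ EE K s) :
    Module.Finite ℤ (Additive X) := by
  have := (finite_places_mem (K := K) hs).fintype
  refine (finite_of_homs (A := Additive X) (B := Additive (𝓞 K)ˣ) (C := Additive Kˣ)
    (MonoidHom.toAdditive X.subtype) (fun a b h => Subtype.ext h) (MonoidHom.toAdditive (unitsHom K))
    (I := {v : HeightOneSpectrum (𝓞 K) | (s : 𝓞 K) ∈ v.asIdeal})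
    (fun v => (ordHom v.1).comp (MonoidHom.toAdditive X.subtype)) ?_).1
  intro a ha
  have : (a.toMul : Kˣ) ∈ (unitsHom K).range := by
    rw [mem_units_iff]
    intro v
    by_cases hv : (s : 𝓞 K) ∈ v.asIdeal
    · exact ha ⟨v, hv⟩
    · exact (mem_EE_iff hs).1 (hX a.toMul.2) v hv
  obtain ⟨b, hb⟩ := this
  exact ⟨Additive.ofMul b, hb⟩
end

namespace KD
variable {p : ℕ} {F M : Type} [Field F] [Field M] [NumberField F] [NumberField M] [Algebra F M]

/-- the norm group -/
noncomputable def NX (D : KD p F M) (τ : M ≃+* M) (s : ℕ) : Subgroup Fˣ := (XX M τ s).map D.Nm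

set_option maxHeartbeats 1000000 in
theorem gt_bound (D : KD p F M) (hh : ¬ p ∣ classNumber F) (τ : M ≃+* M) (c : F ≃+* F)
    (hτσ : ∀ x, τ (D.σ x) = D.σ (τ x)) (hτ2 : ∀ x, τ (τ x) = x)
    (hτc : ∀ f, τ (algebraMap F M f) = algebraMap F M (c f))
    {m : ℕ} (hm : m ≠ 0) (hτm : ∀ x ∈ (unitsHom M).range, ua τ x ^ m = x ^ m)
    {s : ℕ} (hs : s ≠ 0)
    (hUR : ∀ q : HeightOneSpectrum (𝓞 F), (s : 𝓞 F) ∉ q.asIdeal → URat p F M q)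
    {I : Type} [Fintype I] (v : I → Additive Fˣ →+ ℤ)
    (hv : ∀ f ∈ XX F c s, (∀ i, v i (Additive.ofMul f) = 0) → f ∈ (unitsHom F).range)
    {T : Type} [Fintype T] (Q : T → HeightOneSpectrum (𝓞 M)) (hQs : ∀ t, (s : 𝓞 M) ∈ (Q t).asIdeal)
    (hQ : ∀ t t', t ≠ t' → Q t ≠ Q t' ∧
      ∃ z : 𝓞 M, z ∈ (Q t').asIdeal ∧ RingOfIntegers.mapRingHom (τ : M →+* M) z ∉ (Q t).asIdeal)
    (m' : ℕ) (hX : (Units.rank F + Fintype.card I) + (p - 1) * m' ≤ Units.rank M + Fintype.card T) :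
    (D.NX τ s).relIndex (XX F c s) * p ^ m' ≤ p ^ (Units.rank F + Fintype.card I) ∧
      (D.NX τ s).relIndex (XX F c s) ≠ 0 := by
  classical
  set X := XX M τ s with hXdef
  have hfin : Module.Finite ℤ (Additive X) := EE_finite hs X (fun x hx => hx.1)
  let sX : X →* X := (D.s.comp X.subtype).codRestrict X (fun x => D.s_mem_XX hτσ x.2)
  let S : Module.End ℤ (Additive X) := (MonoidHom.toAdditive sX).toIntLinearMap
  have hSi : ∀ (i : ℕ) (x : Additive X), (((S ^ i) x).toMul : Mˣ) = D.s^[i] (x.toMul : Mˣ) := by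
    intro i
    induction i with
    | zero => intro x; rfl
    | succ n ih =>
      intro x
      rw [pow_succ', Module.End.mul_apply, Function.iterate_succ_apply', ← ih]
      rfl
  have hSsum : ∀ x : Additive X, (((∑ i ∈ Finset.range p, S ^ i : Module.End ℤ (Additive X)) x).toMul : Mˣ)
      = um F M (D.Nm x.toMul) := by
    intro x
    rw [← D.prod_s, LinearMap.sum_apply, toMul_sum, Subgroup.val_finset_prod]
    exact Finset.prod_congr rfl fun i _ => hSi i x
  let U : AddSubgroup (Additive X) :=
    { carrier := {x | S x = x}
      zero_mem' := map_zero S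
      add_mem' := fun {a b} ha hb => by
        change S (a + b) = a + b
        rw [map_add, ha, hb]
      neg_mem' := fun {a} ha => by
        change S (-a) = -a
        rw [map_neg, ha] }
  -- elements of U come from F
  have hUF : ∀ x ∈ U, ∃ f ∈ XX F c s, um F M f = (x.toMul : Mˣ) := by
    intro x hx
    have h1 : D.s (x.toMul : Mˣ) = x.toMul := congrArg (fun z : Additive X => (z.toMul : Mˣ)) hx
    obtain ⟨f, hf⟩ := D.fixed _ h1
    have h2 := x.toMul.2
    rw [hf] at h2
    refine ⟨f, ⟨um_mem_EE_iff.1 h2.1, ?_⟩, hf.symm⟩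
    apply um_injective F M
    refine Eq.trans ?_ h2.2
    ext; exact (hτc _).symm
  have hFU : ∀ f ∈ XX F c s, um F M f ∈ X := by
    intro f hf
    refine ⟨um_mem_EE_iff.2 hf.1, ?_⟩
    nth_rewrite 2 [← hf.2]
    ext; exact hτc _
  have key := herbrand_bound p D.hp S ?_ ?_ U (fun x => Iff.rfl) (Units.rank F + Fintype.card I) m' ?_ ?_ ?_
  · -- translate
    let j : XX F c s →* X := ((um F M).comp (XX F c s).subtype).codRestrict X (fun f => hFU f f.2)
    let J : Additive (XX F c s) →+ Additive X := MonoidHom.toAdditive j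
    have hJ : Function.Injective J := by
      intro a b hab
      have := congrArg (fun z : Additive X => (z.toMul : Mˣ)) hab
      exact Subtype.ext (um_injective F M this)
    let N' : Subgroup (XX F c s) := (D.NX τ s).subgroupOf (XX F c s)
    have e2 : AddSubgroup.map J ⊤ = U := by
      ext x
      constructor
      · rintro ⟨a, _, rfl⟩
        change S (J a) = J a
        exact Subtype.ext (D.s_um _)
      · intro hx
        obtain ⟨f, hf, hfx⟩ := hUF x hx
        exact ⟨Additive.ofMul ⟨f, hf⟩, trivial, Subtype.ext hfx⟩
    have e1 : AddSubgroup.map J (Subgroup.toAddSubgroup N') =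
        AddMonoidHom.range (LinearMap.toAddMonoidHom (∑ i ∈ Finset.range p, S ^ i)) := by
      ext x
      constructor
      · rintro ⟨a, ha, rfl⟩
        obtain ⟨y, hy, hyx⟩ : ((a.toMul : XX F c s) : Fˣ) ∈ D.NX τ s := ha
        refine ⟨Additive.ofMul ⟨y, hy⟩, ?_⟩
        refine Subtype.ext ((hSsum _).trans ?_)
        change um F M (D.Nm y) = um F M _
        rw [hyx]; rfl
      · rintro ⟨y, rfl⟩
        have hmem : D.Nm (y.toMul : Mˣ) ∈ XX F c s := by
          have h2 := (((∑ i ∈ Finset.range p, S ^ i : Module.End ℤ (Additive X)) y).toMul).2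
          rw [hSsum] at h2
          refine ⟨um_mem_EE_iff.1 h2.1, ?_⟩
          apply um_injective F M
          refine Eq.trans ?_ h2.2
          ext; exact (hτc _).symm
        refine ⟨Additive.ofMul ⟨_, hmem⟩, ?_, ?_⟩
        · exact ⟨_, y.toMul.2, rfl⟩
        · exact Subtype.ext (hSsum y).symm
    have e3 : (D.NX τ s).relIndex (XX F c s) =
        (AddMonoidHom.range (LinearMap.toAddMonoidHom (∑ i ∈ Finset.range p, S ^ i))).relIndex U := by
      rw [← e1, ← e2, AddSubgroup.relIndex_map_map_of_injective _ _ hJ, AddSubgroup.relIndex_top_right]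
      rfl
    rw [e3]
    exact key
  · refine LinearMap.ext fun x => Subtype.ext ?_
    exact (hSi p x).trans (D.s_iter_p _)
  · intro x hx
    have h1 : D.Nm (x.toMul : Mˣ) = 1 := by
      apply um_injective F M
      rw [← hSsum x, hx, map_one]; rfl
    obtain ⟨y, hy, hyx⟩ := D.gt_main hh τ c hτσ hτ2 hτc hs hUR _ x.toMul.2 h1
    exact ⟨Additive.ofMul ⟨y, hy⟩, Subtype.ext hyx⟩
  · -- upper bound for U
    choose! φ hφ1 hφ2 using hUF
    let g : U →+ Additive Fˣ :=
      { toFun := fun x => Additive.ofMul (φ x)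
        map_zero' := by
          apply um_injective F M
          exact (hφ2 _ U.zero_mem).trans (map_one _).symm
        map_add' := by
          intro x y
          apply um_injective F M
          refine (hφ2 _ (U.add_mem x.2 y.2)).trans ?_
          refine Eq.trans ?_ (map_mul (um F M) (φ x) (φ y)).symm
          rw [hφ2 _ x.2, hφ2 _ y.2]
          rfl }
    have hg : Function.Injective g := by
      intro x y hxy
      have h1 : φ x = φ y := hxy
      apply Subtype.ext
      apply Additive.toMul.injective
      apply Subtype.ext
      rw [← hφ2 _ x.2, ← hφ2 _ y.2, h1]
    have := (finite_of_homs (B := Additive (𝓞 F)ˣ) g hg (MonoidHom.toAdditive (unitsHom F))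
      (fun i => (v i).comp g) ?_).2
    · rw [NumberField.Units.finrank_eq] at this
      exact this
    · intro x hx
      obtain ⟨b, hb⟩ := hv _ (hφ1 _ x.2) hx
      exact ⟨Additive.ofMul b, hb⟩
  · -- lower bound for X
    refine hX.trans ?_
    rw [← NumberField.Units.finrank_eq M]
    choose γ hγ1 hγ2 using exists_gen (K := M)
    have hunit : ∀ b : (𝓞 M)ˣ, unitsHom M b ^ m ∈ X := fun b =>
      ⟨pow_mem (units_le_EE s hs ⟨b, rfl⟩) _, by rw [map_pow]; exact hτm _ ⟨b, rfl⟩⟩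
    let ψ0 : (𝓞 M)ˣ →* X := ((powMonoidHom m).comp (unitsHom M)).codRestrict X hunit
    choose Q' hQ'1 hQ'2 using fun t => exists_ord_equiv τ (Q t)
    have hcl : (0 : ℤ) < classNumber M := by exact_mod_cast Fintype.card_pos
    have hγE : ∀ t, γ (Q t) ∈ EE M s := by
      intro t
      rw [mem_EE_iff hs]
      intro w hw
      apply hγ2
      rintro rfl
      exact hw (hQs t)
    have hfix : ∀ t, ua τ (γ (Q t) * ua τ (γ (Q t))) = γ (Q t) * ua τ (γ (Q t)) := by
      intro t
      rw [map_mul, mul_comm]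
      congr 1
      ext; exact hτ2 _
    refine finrank_ge_of (T := T) (MonoidHom.toAdditive ψ0) ?_
      (fun t => (ordHom (Q t)).comp (MonoidHom.toAdditive X.subtype))
      (fun t => Additive.ofMul ⟨γ (Q t) * ua τ (γ (Q t)), ⟨mul_mem (hγE t) (ua_mem_EE _ (hγE t)), hfix t⟩⟩)
      ?_ ?_ ?_
    · intro b hb
      refine ⟨m, by exact_mod_cast hm, ?_⟩
      have h1 : unitsHom M (b.toMul) ^ m = 1 := congrArg (fun z : Additive X => (z.toMul : Mˣ)) hb
      rw [← map_pow] at h1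
      have h2 := unitsHom_injective (h1.trans (map_one _).symm)
      rw [natCast_zsmul]
      exact h2
    · intro t
      change ord (Q t) (γ (Q t) * ua τ (γ (Q t))) ≠ 0
      rw [ord_mul, hγ1, hQ'1]
      by_cases h : Q' t = Q t
      · rw [h, hγ1]; omega
      · rw [hγ2 _ _ h]; omega
    · intro t t' htt
      change ord (Q t) (γ (Q t') * ua τ (γ (Q t'))) = 0
      rw [ord_mul, hγ2 _ _ (hQ t t' htt).1, hQ'1, hγ2, add_zero]
      intro h
      obtain ⟨z, hz1, hz2⟩ := (hQ t t' htt).2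
      rw [← h, hQ'2] at hz1
      exact hz2 hz1
    · intro t b
      change ord (Q t) (unitsHom M b.toMul ^ m) = 0
      rw [ord_pow, mem_units_iff.1 ⟨b.toMul, rfl⟩ (Q t), mul_zero]
  · -- torsion
    have hz : IsPrimitiveRoot (algebraMap F M D.ζ) p := D.hζ.map_of_injective (algebraMap F M).injective
    have : NeZero p := ⟨D.hp.ne_zero⟩
    let H : Subgroup Mˣ :=
      { carrier := {x | (∃ h : x ∈ X, Additive.ofMul (⟨x, h⟩ : X) ∈ U) ∧ x ^ p = 1}
        one_mem' := ⟨⟨X.one_mem, U.zero_mem⟩, one_pow _⟩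
        mul_mem' := by
          rintro a b ⟨⟨ha, ha'⟩, ha2⟩ ⟨⟨hb, hb'⟩, hb2⟩
          exact ⟨⟨X.mul_mem ha hb, U.add_mem ha' hb'⟩, by rw [mul_pow, ha2, hb2, one_mul]⟩
        inv_mem' := by
          rintro a ⟨⟨ha, ha'⟩, ha2⟩
          exact ⟨⟨X.inv_mem ha, U.neg_mem ha'⟩, by rw [inv_pow, ha2, inv_one]⟩ }
    have hH : H ≤ rootsOfUnity p M := fun x hx => hx.2
    have hd := Subgroup.card_dvd_of_le hH
    rw [hz.card_rootsOfUnity] at hd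
    have : Nat.card {x : Additive X // x ∈ U ∧ p • x = 0} = Nat.card H := by
      refine Nat.card_congr ⟨fun x => ⟨(x.1.toMul : Mˣ), ⟨x.1.toMul.2, x.2.1⟩, ?_⟩,
        fun y => ⟨Additive.ofMul ⟨y.1, y.2.1.choose⟩, y.2.1.choose_spec, Subtype.ext y.2.2⟩, ?_, ?_⟩
      · exact congrArg (fun z : Additive X => (z.toMul : Mˣ)) x.2.2
      · intro x; rfl
      · intro y; rfl
    rw [this]
    exact hd
end KD

end

section

open Finset

/-- base arithmetic data -/
structure Bs (p N : ℕ) [Fact p.Prime] [Fact N.Prime] where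
  hp5 : 5 ≤ p
  hmod : N % p = 1
  z : ZMod N
  hz : IsPrimitiveRoot z p

namespace Bs
variable {p N : ℕ} [hpF : Fact p.Prime] [hNF : Fact N.Prime] (B : Bs p N)

/-- (N-1)/p -/
def m0 (_B : Bs p N) : ℕ := (N - 1) / p

theorem hN : N = B.m0 * p + 1 := by
  have h1 := B.hmod
  have h2 := Nat.div_add_mod N p
  have : (N - 1) / p = N / p := by
    rw [← h2, h1, Nat.add_sub_cancel, Nat.mul_div_cancel_left _ hpF.out.pos, Nat.mul_add_div hpF.out.pos]
    rw [Nat.div_eq_of_lt (hpF.out.one_lt), add_zero]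
  unfold m0
  rw [this, mul_comm]
  omega

theorem m0_pos : 0 < B.m0 := by
  have h1 := B.hN
  have := hNF.out.two_le
  rcases Nat.eq_zero_or_pos B.m0 with h | h
  · rw [h] at h1; omega
  · exact h

theorem hsub : N - 1 = B.m0 * p := by have := B.hN; omega

theorem p_lt (B : Bs p N) : p < N := by
  have := B.hN
  have := B.m0_pos
  nlinarith

theorem pow_m0_p {x : ZMod N} (hx : x ≠ 0) : (x ^ B.m0) ^ p = 1 := by
  rw [← pow_mul, ← B.hsub]
  exact ZMod.pow_card_sub_one_eq_one hx

theorem exists_ind {x : ZMod N} (hx : x ≠ 0) : ∃ k : ZMod p, B.z ^ k.val = x ^ B.m0 := by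
  obtain ⟨i, hi, h⟩ := B.hz.eq_pow_of_pow_eq_one (B.pow_m0_p hx)
  exact ⟨i, by rw [ZMod.val_cast_of_lt hi, h]⟩

open Classical in
/-- discrete logarithm of the p-th power residue symbol -/
noncomputable def ind (x : ZMod N) : ZMod p :=
  if h : ∃ k : ZMod p, B.z ^ k.val = x ^ B.m0 then h.choose else 0

theorem ind_spec {x : ZMod N} (hx : x ≠ 0) : B.z ^ (B.ind x).val = x ^ B.m0 := by
  unfold ind
  rw [dif_pos (B.exists_ind hx)]
  exact (B.exists_ind hx).choose_spec

theorem z_pow_mod (k : ℕ) : B.z ^ ((k : ZMod p)).val = B.z ^ k := by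
  rw [ZMod.val_natCast, pow_mod_natAbs_aux]
where
  pow_mod_natAbs_aux {k : ℕ} : B.z ^ (k % p) = B.z ^ k := by
    conv_rhs => rw [← Nat.mod_add_div k p, pow_add, pow_mul, B.hz.pow_eq_one, one_pow, mul_one]

theorem z_ne : B.z ≠ 0 := B.hz.ne_zero hpF.out.ne_zero

theorem z_inj {a b : ZMod p} (h : B.z ^ a.val = B.z ^ b.val) : a = b :=
  ZMod.val_injective p (B.hz.pow_inj (ZMod.val_lt a) (ZMod.val_lt b) h)

theorem z_add (a b : ZMod p) : B.z ^ (a + b).val = B.z ^ a.val * B.z ^ b.val := by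
  rw [← pow_add, ← B.z_pow_mod (a.val + b.val)]
  simp

theorem ind_eq {x : ZMod N} (hx : x ≠ 0) {k : ZMod p} (h : B.z ^ k.val = x ^ B.m0) : B.ind x = k :=
  B.z_inj ((B.ind_spec hx).trans h.symm)

theorem ind_mul {x y : ZMod N} (hx : x ≠ 0) (hy : y ≠ 0) : B.ind (x * y) = B.ind x + B.ind y := by
  apply B.ind_eq (mul_ne_zero hx hy)
  rw [B.z_add, B.ind_spec hx, B.ind_spec hy, mul_pow]

theorem ind_one : B.ind 1 = 0 := by
  apply B.ind_eq one_ne_zero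
  simp

theorem ind_inv {x : ZMod N} (hx : x ≠ 0) : B.ind x⁻¹ = - B.ind x := by
  have := B.ind_mul hx (inv_ne_zero hx)
  rw [mul_inv_cancel₀ hx, B.ind_one] at this
  linear_combination -this

theorem ind_pow {x : ZMod N} (hx : x ≠ 0) (n : ℕ) : B.ind (x ^ n) = n * B.ind x := by
  induction n with
  | zero => simp [B.ind_one]
  | succ n ih => rw [pow_succ, B.ind_mul (pow_ne_zero _ hx) hx, ih]; push_cast; ring

theorem ind_prod {ι : Type*} (s : Finset ι) (f : ι → ZMod N) (h : ∀ i ∈ s, f i ≠ 0) :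
    B.ind (∏ i ∈ s, f i) = ∑ i ∈ s, B.ind (f i) := by
  classical
  induction s using Finset.induction_on with
  | empty => simp [B.ind_one]
  | insert a s ha ih =>
    rw [Finset.prod_insert ha, Finset.sum_insert ha, B.ind_mul (h a (by simp))
      (Finset.prod_ne_zero_iff.2 fun i hi => h i (by simp [hi])), ih (fun i hi => h i (by simp [hi]))]

theorem two_ne (B : Bs p N) : (2 : ZMod p) ≠ 0 := by
  have h2 := B.hp5
  have : ((2 : ℕ) : ZMod p) ≠ 0 := by
    rw [Ne, ZMod.natCast_eq_zero_iff]
    intro h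
    have := Nat.le_of_dvd (by norm_num) h
    omega
  exact_mod_cast this

theorem ind_neg_one : B.ind (-1) = 0 := by
  have h := B.ind_mul (x := -1) (y := -1) (by simp) (by simp)
  rw [neg_mul_neg, one_mul, B.ind_one, ← two_mul] at h
  exact (mul_eq_zero.1 h.symm).resolve_left B.two_ne

theorem ind_neg {x : ZMod N} (hx : x ≠ 0) : B.ind (-x) = B.ind x := by
  rw [← neg_one_mul, B.ind_mul (by simp) hx, B.ind_neg_one, zero_add]

theorem isPth_of_ind {x : ZMod N} (hx : x ≠ 0) (h : B.ind x = 0) : ∃ y : ZMod N, y ^ p = x := by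
  have h1 := B.ind_spec hx
  rw [h, ZMod.val_zero, pow_zero] at h1
  obtain ⟨g, hg⟩ := IsCyclic.exists_generator (α := (ZMod N)ˣ)
  obtain ⟨k, hk⟩ := hg (Units.mk0 x hx)
  have hord : orderOf g = N - 1 := by
    rw [orderOf_eq_card_of_forall_mem_zpowers hg, Nat.card_eq_fintype_card, ZMod.card_units]
  have h2 : g ^ (k * B.m0) = 1 := by
    rw [zpow_mul, show g ^ k = Units.mk0 x hx from hk]
    ext
    simp [h1.symm]
  have h3 := orderOf_dvd_iff_zpow_eq_one.2 h2
  rw [hord, B.hsub] at h3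
  push_cast at h3
  rw [mul_comm k] at h3
  have h4 := (mul_dvd_mul_iff_left (by exact_mod_cast B.m0_pos.ne')).1 h3
  obtain ⟨l, rfl⟩ := h4
  refine ⟨((g ^ l : (ZMod N)ˣ) : ZMod N), ?_⟩
  have : ((g ^ l) ^ p : (ZMod N)ˣ) = Units.mk0 x hx := by
    rw [← show g ^ ((p:ℤ) * l) = Units.mk0 x hx from hk, ← zpow_natCast, ← zpow_mul, mul_comm l]
  have := congrArg (fun u : (ZMod N)ˣ => (u : ZMod N)) this
  simpa using this

theorem natCast_ne {j : ℕ} (h1 : 1 ≤ j) (h2 : j < N) : (j : ZMod N) ≠ 0 := by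
  rw [Ne, ZMod.natCast_eq_zero_iff]
  intro h
  have := Nat.le_of_dvd h1 h
  omega

/-- Γ -/
noncomputable def Gam (c : ℕ) : ZMod p := ∑ j ∈ Icc 1 (B.m0 * c), B.ind j

theorem ind_factorial {n : ℕ} (hn : n < N) : B.ind (n.factorial : ZMod N) = ∑ j ∈ Icc 1 n, B.ind j := by
  rw [← Finset.prod_Ico_id_eq_factorial, show Ico 1 (n + 1) = Icc 1 n by ext; simp]
  push_cast
  exact B.ind_prod _ _ fun i hi => by
    rw [Finset.mem_Icc] at hi
    exact natCast_ne hi.1 (by omega)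

theorem Gam_compl {c : ℕ} (hc : c ≤ p) : B.Gam (p - c) = - B.Gam c := by
  have hle : B.m0 * c ≤ N - 1 := by rw [B.hsub]; exact Nat.mul_le_mul_left _ hc
  have htot : ∑ j ∈ Icc 1 (N - 1), B.ind j = 0 := by
    rw [← B.ind_factorial (by have := hNF.out.pos; omega), ZMod.wilsons_lemma, B.ind_neg_one]
  have h1 : B.m0 * (p - c) = N - 1 - B.m0 * c := by rw [B.hsub, Nat.mul_sub]
  have h2 : B.Gam (p - c) = ∑ j ∈ Icc (B.m0 * c + 1) (N - 1), B.ind j := by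
    unfold Gam
    rw [h1]
    have hN2 := hNF.out.two_le
    refine Finset.sum_bij (fun j _ => N - j) ?_ ?_ ?_ ?_
    · intro j hj; rw [mem_Icc] at *; omega
    · intro a ha b hb h; rw [mem_Icc] at *; omega
    · intro b hb; rw [mem_Icc] at *; exact ⟨N - b, by rw [mem_Icc]; omega, by omega⟩
    · intro j hj
      rw [mem_Icc] at hj
      rw [Nat.cast_sub (by omega), ZMod.natCast_self, zero_sub, B.ind_neg (natCast_ne hj.1 (by omega))]
  have h3 : ∑ j ∈ Icc 1 (B.m0 * c), B.ind j + ∑ j ∈ Icc (B.m0 * c + 1) (N - 1), B.ind j = 0 := by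
    rw [← htot, ← Finset.sum_union]
    · apply Finset.sum_congr _ (fun _ _ => rfl)
      ext j; simp only [mem_union, mem_Icc]; omega
    · rw [Finset.disjoint_left]; intro j; simp only [mem_Icc]; omega
  rw [h2]
  unfold Gam
  linear_combination h3

end Bs

end

section

open Finset

theorem sum_pow_zmod {p : ℕ} [hp : Fact p.Prime] {i : ℕ} (h1 : 1 ≤ i) (h2 : i < p - 1) :
    ∑ a ∈ range p, (a : ZMod p) ^ i = 0 := by
  have h := FiniteField.sum_pow_lt_card_sub_one (ZMod p) i (by rw [ZMod.card]; exact h2)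
  rw [← h]
  refine Finset.sum_bij (fun a _ => (a : ZMod p)) (fun _ _ => mem_univ _) ?_ ?_ (fun _ _ => rfl)
  · intro a ha b hb hab
    rw [mem_range] at ha hb
    rw [← ZMod.val_cast_of_lt ha, ← ZMod.val_cast_of_lt hb, hab]
  · intro b _
    exact ⟨b.val, mem_range.2 (ZMod.val_lt b), by simp⟩

namespace Bs
variable {p N : ℕ} [hpF : Fact p.Prime] [hNF : Fact N.Prime] (B : Bs p N)

theorem S_mul {i : ℕ} (h1 : 1 ≤ i) (h2 : i < p - 1) (q : ℕ) :
    ∑ a ∈ range (p * q), (a : ZMod p) ^ i = 0 := by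
  induction q with
  | zero => simp
  | succ q ih =>
    rw [mul_add, mul_one, Finset.sum_range_add, ih, zero_add, ← sum_pow_zmod h1 h2]
    refine Finset.sum_congr rfl fun a _ => ?_
    push_cast; simp

theorem S_compl {i : ℕ} (ho : Odd i) (h2 : i < p - 1) (q : ℕ) : ∀ t : ℕ, t ≤ p * q →
    ∑ a ∈ range (p * q - t), (a : ZMod p) ^ i = ∑ c ∈ Icc 1 t, (c : ZMod p) ^ i := by
  intro t
  induction t with
  | zero => intro _; simpa using S_mul ho.pos h2 q
  | succ t ih =>
    intro ht
    have h := ih (by omega)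
    rw [show p * q - t = (p * q - (t + 1)) + 1 by omega, Finset.sum_range_succ] at h
    rw [Nat.cast_sub ht, Nat.cast_mul, CharP.cast_eq_zero, zero_mul, zero_sub, ho.neg_pow] at h
    rw [Finset.sum_Icc_succ_top (by omega)]
    linear_combination h

/-- S -/
noncomputable def SS (p i k : ℕ) : ZMod p := ∑ a ∈ range k, (a : ZMod p) ^ i

theorem T_eq {i : ℕ} (ho : Odd i) (h2 : i < p - 1) {j : ℕ} (hj : j ∈ Icc 1 (N - 1)) :
    ∑ c ∈ (range p).filter (fun c => j ≤ B.m0 * c), (c : ZMod p) ^ i = - SS p i (p * j % N) := by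
  rw [mem_Icc] at hj
  have hN2 := hNF.out.two_le
  have hpN := B.p_lt
  have hN := B.hN
  set t := p * j / N with ht
  set r := p * j % N with hr
  have hdm : N * t + r = p * j := Nat.div_add_mod _ _
  have hrlt : r < N := Nat.mod_lt _ (by omega)
  have htp : t < p := by
    rw [ht, Nat.div_lt_iff_lt_mul (by omega)]
    exact Nat.mul_lt_mul_of_pos_left (by omega) hpF.out.pos
  have hrpos : r ≠ 0 := by
    intro h0
    have hd : N ∣ p * j := Nat.dvd_of_mod_eq_zero h0
    rcases (Nat.Prime.dvd_mul hNF.out).1 hd with h | h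
    · exact absurd (Nat.le_of_dvd hpF.out.pos h) (by omega)
    · exact absurd (Nat.le_of_dvd (by omega) h) (by omega)
  obtain ⟨q, hq⟩ : ∃ q, t + r = p * q := by
    have : p ∣ t + r := by
      have h3 : p ∣ (B.m0 * p) * t + (t + r) := ⟨j, by
        have e : N * t = (B.m0 * p + 1) * t := by rw [← hN]
        rw [← hdm, e]; ring⟩
      exact (Nat.dvd_add_right ⟨B.m0 * t, by ring⟩).1 h3
    exact this
  have hfil : (range p).filter (fun c => j ≤ B.m0 * c) = Ico (t + 1) p := by
    ext c
    rw [mem_filter, mem_range, mem_Ico]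
    have key : ∀ c, c < p → (j ≤ B.m0 * c ↔ t + 1 ≤ c) := by
      intro c hc
      have e1 : (j ≤ B.m0 * c) ↔ N * t + r + c ≤ N * c := by
        rw [hdm]
        constructor
        · intro h
          have : p * j ≤ p * (B.m0 * c) := Nat.mul_le_mul_left _ h
          have e : N * c = p * (B.m0 * c) + c := by
            have e : N * c = (B.m0 * p + 1) * c := by rw [← hN]
            rw [e]; ring
          omega
        · intro h
          have e : N * c = p * (B.m0 * c) + c := by
            have e : N * c = (B.m0 * p + 1) * c := by rw [← hN]
            rw [e]; ring
          exact Nat.le_of_mul_le_mul_left (by omega : p * j ≤ p * (B.m0 * c)) hpF.out.pos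
      rw [e1]
      constructor
      · intro h
        by_contra hlt
        have : N * c ≤ N * t := Nat.mul_le_mul_left _ (by omega)
        omega
      · intro h
        -- N * (t+1) + N * (c - t - 1)
        obtain ⟨d, rfl⟩ := Nat.exists_eq_add_of_le h
        have h5 : t + 1 + r ≤ N := by
          by_contra hcon
          have h6 : N + 1 ≤ t + 1 + r := by omega
          have h7 : B.m0 * p + 1 ≤ p * q := by rw [← hN]; omega
          have h8 : p * q < B.m0 * p + 1 + p := by rw [← hN, ← hq]; omega
          have h9 : B.m0 < q := by
            by_contra h; have : p * q ≤ p * B.m0 := Nat.mul_le_mul_left _ (by omega)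
            rw [mul_comm] at h7; omega
          have h10 : p * (B.m0 + 1) ≤ p * q := Nat.mul_le_mul_left _ h9
          have h11 : t + r = B.m0 * p + p := by
            rw [hq]
            have : q = B.m0 + 1 := by
              by_contra hne
              have : p * (B.m0 + 2) ≤ p * q := Nat.mul_le_mul_left _ (by omega)
              have h5' := hpF.out.two_le
              nlinarith
            rw [this]; ring
          omega
        have h6 : d ≤ N * d := Nat.le_mul_of_pos_left _ (by omega)
        nlinarith
    constructor
    · rintro ⟨h1, h2⟩; exact ⟨(key c h1).1 h2, h1⟩
    · rintro ⟨h1, h2⟩; exact ⟨h2, (key c h2).2 h1⟩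
  rw [hfil]
  have h3 := S_compl ho h2 q t (by omega)
  rw [show p * q - t = r by omega] at h3
  unfold SS
  rw [h3]
  have h4 := sum_pow_zmod (p := p) ho.pos h2
  have h5 : range p = insert 0 (Icc 1 t ∪ Ico (t + 1) p) := by
    ext a; simp only [mem_range, mem_insert, mem_union, mem_Icc, mem_Ico]; omega
  rw [h5, Finset.sum_insert (by simp), Finset.sum_union] at h4
  · simp only [Nat.cast_zero] at h4
    rw [zero_pow ho.pos.ne'] at h4
    linear_combination h4
  · rw [Finset.disjoint_left]; intro a; simp only [mem_Icc, mem_Ico]; omega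

theorem sum_perm (f : ℕ → ZMod p) (hpN : p < N) :
    ∑ j ∈ Icc 1 (N - 1), f (p * j % N) = ∑ r ∈ Icc 1 (N - 1), f r := by
  have hN2 := hNF.out.two_le
  have hmaps : ∀ j ∈ Icc 1 (N - 1), p * j % N ∈ Icc 1 (N - 1) := by
    intro j hj
    rw [mem_Icc] at *
    have : p * j % N < N := Nat.mod_lt _ (by omega)
    refine ⟨?_, by omega⟩
    by_contra h0
    have hd : N ∣ p * j := Nat.dvd_of_mod_eq_zero (by omega)
    rcases (Nat.Prime.dvd_mul hNF.out).1 hd with h | h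
    · exact absurd (Nat.le_of_dvd hpF.out.pos h) (by omega)
    · exact absurd (Nat.le_of_dvd (by omega) h) (by omega)
  have hinj : Set.InjOn (fun j => p * j % N) (Icc 1 (N - 1) : Finset ℕ) := by
    intro a ha b hb hab
    rw [mem_coe, mem_Icc] at ha hb
    have h1 : p * a ≡ p * b [MOD N] := hab
    have h2 := Nat.ModEq.cancel_left_of_coprime
      ((Nat.coprime_primes hNF.out hpF.out).2 (by omega)) h1
    rw [Nat.ModEq, Nat.mod_eq_of_lt (by omega), Nat.mod_eq_of_lt (by omega)] at h2
    exact h2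
  exact Finset.sum_nbij (fun j => p * j % N) hmaps hinj
    (Finset.surjOn_of_injOn_of_card_le _ hmaps hinj le_rfl) (fun _ _ => rfl)

theorem swap_sum (f : ℕ → ZMod p) (i : ℕ) :
    ∑ c ∈ range p, (c : ZMod p) ^ i * ∑ j ∈ Icc 1 (B.m0 * c), f j
    = ∑ j ∈ Icc 1 (N - 1), (∑ c ∈ (range p).filter (fun c => j ≤ B.m0 * c), (c : ZMod p) ^ i) * f j := by
  have : ∀ c ∈ range p, (c : ZMod p) ^ i * ∑ j ∈ Icc 1 (B.m0 * c), f j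
      = ∑ j ∈ Icc 1 (N - 1), if j ≤ B.m0 * c then (c : ZMod p) ^ i * f j else 0 := by
    intro c hc
    rw [← Finset.sum_filter, Finset.mul_sum]
    refine Finset.sum_congr ?_ fun _ _ => rfl
    ext j
    rw [mem_range] at hc
    have : B.m0 * c ≤ N - 1 := by rw [B.hsub]; exact Nat.mul_le_mul_left _ hc.le
    simp only [mem_Icc, mem_filter]
    omega
  rw [Finset.sum_congr rfl this, Finset.sum_comm]
  refine Finset.sum_congr rfl fun j _ => ?_
  rw [Finset.sum_mul, Finset.sum_filter]

theorem sum_Gam {i : ℕ} (ho : Odd i) (h2 : i + 1 < p - 1) :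
    ∑ c ∈ range p, (c : ZMod p) ^ i * B.Gam c = - ∑ r ∈ Icc 1 (N - 1), SS p i r * B.ind r := by
  have hpN := B.p_lt
  unfold Gam
  rw [B.swap_sum]
  have hz : ∑ j ∈ Icc 1 (N - 1), SS p i (p * j % N) = 0 := by
    have h := B.swap_sum (fun _ => 1) i
    have h3 : ∑ c ∈ range p, (c : ZMod p) ^ i * ∑ j ∈ Icc 1 (B.m0 * c), (1 : ZMod p) = 0 := by
      have : ∀ c ∈ range p, (c : ZMod p) ^ i * ∑ j ∈ Icc 1 (B.m0 * c), (1 : ZMod p) =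
          B.m0 * (c : ZMod p) ^ (i + 1) := by
        intro c _
        simp
        ring
      rw [Finset.sum_congr rfl this, ← Finset.mul_sum, sum_pow_zmod (by omega) h2, mul_zero]
    rw [h3] at h
    have h4 : ∑ j ∈ Icc 1 (N - 1), - SS p i (p * j % N) = 0 := by
      rw [h]
      refine Finset.sum_congr rfl fun j hj => ?_
      rw [B.T_eq ho (by omega) hj, mul_one]
    rw [Finset.sum_neg_distrib] at h4
    simpa using h4
  rw [← sum_perm (fun r => SS p i r * B.ind r) hpN, ← Finset.sum_neg_distrib]
  have hpne : (p : ZMod N) ≠ 0 := natCast_ne hpF.out.one_le hpN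
  have h5 : ∀ j ∈ Icc 1 (N - 1), (∑ c ∈ (range p).filter (fun c => j ≤ B.m0 * c), (c : ZMod p) ^ i) * B.ind j
      = -(SS p i (p * j % N) * B.ind ((p * j % N : ℕ) : ZMod N)) + SS p i (p * j % N) * B.ind (p : ZMod N) := by
    intro j hj
    rw [B.T_eq ho (by omega) hj]
    rw [mem_Icc] at hj
    have : ((p * j % N : ℕ) : ZMod N) = p * j := by simp
    rw [this, B.ind_mul hpne (natCast_ne hj.1 (by omega))]
    ring
  rw [Finset.sum_congr rfl h5, Finset.sum_add_distrib, ← Finset.sum_mul, hz, zero_mul, add_zero]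

theorem ind_M {i : ℕ} (ho : Odd i) :
    B.ind (∏ k ∈ Finset.Icc 1 (N - 1), ∏ a ∈ Finset.Icc 1 (k - 1), (k : ZMod N) ^ (a ^ i))
      = ∑ r ∈ Icc 1 (N - 1), SS p i r * B.ind r := by
  have hN2 := hNF.out.two_le
  have hne : ∀ k ∈ Icc 1 (N - 1), (k : ZMod N) ≠ 0 := by
    intro k hk; rw [mem_Icc] at hk; exact natCast_ne hk.1 (by omega)
  rw [B.ind_prod]
  · refine Finset.sum_congr rfl fun k hk => ?_
    rw [B.ind_prod _ _ (fun a _ => pow_ne_zero _ (hne k hk))]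
    simp_rw [B.ind_pow (hne k hk)]
    rw [← Finset.sum_mul]
    congr 1
    unfold SS
    rw [mem_Icc] at hk
    rw [show range k = insert 0 (Icc 1 (k - 1)) by ext; simp only [mem_range, mem_insert, mem_Icc]; omega,
      Finset.sum_insert (by simp)]
    simp [ho.pos.ne']
  · intro k hk
    exact Finset.prod_ne_zero_iff.2 fun a _ => pow_ne_zero _ (hne k hk)

theorem M_ne (i : ℕ) :
    (∏ k ∈ Finset.Icc 1 (N - 1), ∏ a ∈ Finset.Icc 1 (k - 1), (k : ZMod N) ^ (a ^ i)) ≠ 0 := by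
  have hN2 := hNF.out.two_le
  refine Finset.prod_ne_zero_iff.2 fun k hk => Finset.prod_ne_zero_iff.2 fun a _ => pow_ne_zero _ ?_
  rw [mem_Icc] at hk; exact natCast_ne hk.1 (by omega)

/-- conclusion of M1 -/
theorem Gam_hat_ne {i : ℕ} (ho : Odd i) (h2 : i ≤ p - 4)
    (hM : ¬ ∃ y : ZMod N, y ^ p = ∏ k ∈ Finset.Icc 1 (N - 1), ∏ a ∈ Finset.Icc 1 (k - 1), (k : ZMod N) ^ (a ^ i)) :
    ∑ c ∈ range p, (c : ZMod p) ^ i * B.Gam c ≠ 0 := by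
  intro h
  have := B.hp5
  rw [B.sum_Gam ho (by omega), ← B.ind_M ho, neg_eq_zero] at h
  exact hM (B.isPth_of_ind (M_ne i) h)

end Bs

end

section

open Finset NumberField

section padic
variable {p N : ℕ} [hpF : Fact p.Prime] [hNF : Fact N.Prime]

theorem padic_form (y : ℚ_[N]ˣ) : ∃ u : ℤ_[N]ˣ, (y : ℚ_[N]) = (N : ℚ_[N]) ^ ((y : ℚ_[N]).valuation) * ((u : ℤ_[N]) : ℚ_[N]) := by
  have hN0 : (N : ℚ_[N]) ≠ 0 := Nat.cast_ne_zero.2 hNF.out.ne_zero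
  have hnorm : ‖(y : ℚ_[N]) * (N : ℚ_[N]) ^ (-(y : ℚ_[N]).valuation)‖ = 1 := by
    rw [norm_mul, Padic.norm_p_zpow, Padic.norm_eq_zpow_neg_valuation y.ne_zero, neg_neg, ← zpow_add₀, neg_add_cancel,
      zpow_zero]
    exact_mod_cast hNF.out.ne_zero
  refine ⟨PadicInt.mkUnits hnorm, ?_⟩
  rw [PadicInt.mkUnits_eq, mul_comm (y : ℚ_[N]), ← mul_assoc, ← zpow_add₀ hN0, add_neg_cancel, zpow_zero, one_mul]

theorem padic_form_val (k : ℤ) (u : ℤ_[N]ˣ) : ((N : ℚ_[N]) ^ k * ((u : ℤ_[N]) : ℚ_[N])).valuation = k := by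
  have hN0 : (N : ℚ_[N]) ≠ 0 := Nat.cast_ne_zero.2 hNF.out.ne_zero
  have hu : ((u : ℤ_[N]) : ℚ_[N]) ≠ 0 := by
    rw [PadicInt.coe_ne_zero]; exact u.ne_zero
  rw [Padic.valuation_mul (zpow_ne_zero _ hN0) hu, Padic.valuation_zpow, Padic.valuation_p, mul_one,
    PadicInt.valuation_coe]
  have := PadicInt.norm_units u
  rw [PadicInt.norm_eq_zpow_neg_valuation u.ne_zero] at this
  have h1 : (1:ℝ) < N := by exact_mod_cast hNF.out.one_lt
  have := (zpow_eq_one_iff_right₀ (by linarith) h1.ne').1 this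
  omega

theorem toZMod_unit_ne (u : ℤ_[N]ˣ) : PadicInt.toZMod (u : ℤ_[N]) ≠ 0 :=
  (u.isUnit.map PadicInt.toZMod).ne_zero

/-- local valuation hom -/
noncomputable def lv (N : ℕ) [hNF : Fact N.Prime] : Additive ℚ_[N]ˣ →+ ℤ where
  toFun y := ((y.toMul : ℚ_[N]ˣ) : ℚ_[N]).valuation
  map_zero' := by simp
  map_add' a b := by
    simp only [toMul_add, Units.val_mul]
    exact Padic.valuation_mul (Units.ne_zero _) (Units.ne_zero _)

theorem ls_wd {k l : ℤ} {u w : ℤ_[N]ˣ}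
    (h : (N : ℚ_[N]) ^ k * ((u : ℤ_[N]) : ℚ_[N]) = (N : ℚ_[N]) ^ l * ((w : ℤ_[N]) : ℚ_[N])) : u = w := by
  have hN0 : (N : ℚ_[N]) ≠ 0 := Nat.cast_ne_zero.2 hNF.out.ne_zero
  have h1 := congrArg Padic.valuation h
  rw [padic_form_val, padic_form_val] at h1
  subst h1
  have := mul_left_cancel₀ (zpow_ne_zero _ hN0) h
  exact Units.ext (Subtype.ext this)

namespace Bs
variable (B : Bs p N)

/-- residue symbol of an N-adic number-/
noncomputable def lsf (y : ℚ_[N]ˣ) : ZMod p := B.ind (PadicInt.toZMod ((padic_form y).choose : ℤ_[N]))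

theorem lsf_eq (y : ℚ_[N]ˣ) (k : ℤ) (u : ℤ_[N]ˣ) (h : (y : ℚ_[N]) = (N : ℚ_[N]) ^ k * ((u : ℤ_[N]) : ℚ_[N])) :
    B.lsf y = B.ind (PadicInt.toZMod (u : ℤ_[N])) := by
  have := (padic_form y).choose_spec.symm.trans h
  unfold lsf
  rw [ls_wd this]

/-- residue symbol hom -/
noncomputable def ls : Additive ℚ_[N]ˣ →+ ZMod p where
  toFun y := B.lsf y.toMul
  map_zero' := by
    rw [B.lsf_eq _ 0 1 (by simp)]
    simp [B.ind_one]
  map_add' a b := by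
    obtain ⟨u, hu⟩ := padic_form a.toMul
    obtain ⟨w, hw⟩ := padic_form b.toMul
    rw [B.lsf_eq _ _ _ hu, B.lsf_eq _ _ _ hw, ← B.ind_mul (toZMod_unit_ne u) (toZMod_unit_ne w)]
    rw [B.lsf_eq (Additive.toMul (a + b)) (((a.toMul : ℚ_[N]ˣ) : ℚ_[N]).valuation + ((b.toMul : ℚ_[N]ˣ) : ℚ_[N]).valuation) (u * w)]
    · simp
    · rw [toMul_add, Units.val_mul]
      nth_rw 1 [hu, hw]
      rw [zpow_add₀ (Nat.cast_ne_zero.2 hNF.out.ne_zero)]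
      push_cast
      ring

theorem lv_form (y : ℚ_[N]ˣ) (k : ℤ) (u : ℤ_[N]ˣ) (h : (y : ℚ_[N]) = (N : ℚ_[N]) ^ k * ((u : ℤ_[N]) : ℚ_[N])) :
    lv N (Additive.ofMul y) = k := by
  change (y : ℚ_[N]).valuation = k
  rw [h, padic_form_val]

theorem ls_form (y : ℚ_[N]ˣ) (k : ℤ) (u : ℤ_[N]ˣ) (h : (y : ℚ_[N]) = (N : ℚ_[N]) ^ k * ((u : ℤ_[N]) : ℚ_[N])) :
    B.ls (Additive.ofMul y) = B.ind (PadicInt.toZMod (u : ℤ_[N])) := B.lsf_eq y k u h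

theorem ls_one_add (y : ℚ_[N]ˣ) (h : ‖(y : ℚ_[N]) - 1‖ < 1) :
    lv N (Additive.ofMul y) = 0 ∧ B.ls (Additive.ofMul y) = 0 := by
  have h1 : ‖(y : ℚ_[N])‖ = 1 := by
    have : (y : ℚ_[N]) = 1 + (y - 1) := by ring
    rw [this, Padic.add_eq_max_of_ne, norm_one, max_eq_left h.le]
    rw [norm_one]; exact h.ne'
  have e : (y : ℚ_[N]) = (N : ℚ_[N]) ^ (0:ℤ) * ((PadicInt.mkUnits h1 : ℤ_[N]) : ℚ_[N]) := by
    rw [PadicInt.mkUnits_eq]; simp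
  refine ⟨lv_form _ _ _ e, ?_⟩
  rw [B.ls_form _ _ _ e]
  have h2 : PadicInt.toZMod ((PadicInt.mkUnits h1 : ℤ_[N]) - 1) = 0 := by
    have : ((PadicInt.mkUnits h1 : ℤ_[N]) - 1) ∈ RingHom.ker (PadicInt.toZMod (p := N)) := by
      rw [PadicInt.ker_toZMod, IsLocalRing.mem_maximalIdeal, PadicInt.mem_nonunits]
      rw [PadicInt.norm_def]
      push_cast
      rw [PadicInt.mkUnits_eq]
      exact h
    exact this
  rw [map_sub, map_one, sub_eq_zero] at h2
  rw [h2, B.ind_one]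

end Bs
end padic

/-- Cyclotomic data -/
structure Cy (p N : ℕ) [Fact p.Prime] [Fact N.Prime] (F : Type) [Field F] [NumberField F] extends Bs p N where
  hcyc : IsCyclotomicExtension {p} ℚ F
  ζ : F
  hζ : IsPrimitiveRoot ζ p
  Z : ℤ_[N]
  hZ : Z ^ p = 1
  hZz : PadicInt.toZMod Z = z

namespace Cy
variable {p N : ℕ} [hpF : Fact p.Prime] [hNF : Fact N.Prime] {F : Type} [Field F] [NumberField F] (C : Cy p N F)

theorem hZ1 : IsPrimitiveRoot (C.Z : ℚ_[N]) p := by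
  have h0 : ((C.Z : ℚ_[N])) ^ p = 1 := by exact_mod_cast congrArg (fun x : ℤ_[N] => (x : ℚ_[N])) C.hZ
  have h1 : (C.Z : ℚ_[N]) ≠ 1 := by
    intro h
    have h2 : C.Z = 1 := Subtype.ext h
    have h3 := C.hZz
    rw [h2, map_one] at h3
    exact C.hz.ne_one hpF.out.one_lt h3.symm
  rw [IsPrimitiveRoot.iff_orderOf]
  exact orderOf_eq_prime h0 h1

theorem irr_cyc : Irreducible (Polynomial.cyclotomic p ℚ) :=
  Polynomial.cyclotomic.irreducible_rat hpF.out.pos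

/-- the automorphism σ_a -/
noncomputable def sg (a : (ZMod p)ˣ) : F ≃ₐ[ℚ] F :=
  have := C.hcyc
  (IsCyclotomicExtension.Rat.galEquivZMod p F).symm a

theorem sg_of_pow (a : (ZMod p)ˣ) {x : F} (hx : x ^ p = 1) : C.sg a x = x ^ (a : ZMod p).val := by
  have := C.hcyc
  have h := IsCyclotomicExtension.Rat.galEquivZMod_apply_of_pow_eq p F (C.sg a) hx
  rw [h]
  unfold sg
  rw [MulEquiv.apply_symm_apply]

theorem sg_zeta (a : (ZMod p)ˣ) : C.sg a C.ζ = C.ζ ^ (a : ZMod p).val := C.sg_of_pow a C.hζ.pow_eq_one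

theorem sg_mul (a b : (ZMod p)ˣ) (x : F) : C.sg (a * b) x = C.sg a (C.sg b x) := by
  have h : C.sg (a * b) = C.sg a * C.sg b := by unfold sg; exact map_mul _ _ _
  rw [h]; rfl

theorem sg_one (x : F) : C.sg 1 x = x := by
  have h : C.sg 1 = 1 := by unfold sg; exact map_one _
  rw [h]; rfl

theorem emb_ext {R : Type*} [CommRing R] [Algebra ℚ R] (f g : F →ₐ[ℚ] R) (h : f C.ζ = g C.ζ) : f = g := by
  have := C.hcyc
  apply (C.hζ.powerBasis ℚ).algHom_ext
  rw [IsPrimitiveRoot.powerBasis_gen]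
  exact h

theorem emb_ext' {R : Type*} [Field R] [CharZero R] (f g : F →+* R) (h : f C.ζ = g C.ζ) : f = g := by
  have := C.emb_ext (f.toRatAlgHom) (g.toRatAlgHom) h
  ext x
  exact DFunLike.congr_fun this x

/-- embedding -/
noncomputable def io (d : (ZMod p)ˣ) : F →ₐ[ℚ] ℚ_[N] :=
  have := C.hcyc
  (C.hζ.embeddingsEquivPrimitiveRoots ℚ_[N] (irr_cyc (p := p))).symm
    ⟨(C.Z : ℚ_[N]) ^ (d : ZMod p).val, by
      rw [mem_primitiveRoots hpF.out.pos]
      exact C.hZ1.pow_of_coprime _ (ZMod.val_coe_unit_coprime d)⟩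

theorem io_zeta (d : (ZMod p)ˣ) : C.io d C.ζ = (C.Z : ℚ_[N]) ^ (d : ZMod p).val := by
  have := C.hcyc
  have h := IsPrimitiveRoot.embeddingsEquivPrimitiveRoots_apply_coe C.hζ ℚ_[N] (irr_cyc (p := p)) (C.io d)
  rw [← h]
  unfold io
  simp

theorem io_sg (d a : (ZMod p)ˣ) (x : F) : C.io d (C.sg a x) = C.io (d * a) x := by
  have : (C.io d).comp (C.sg a).toAlgHom = C.io (d * a) := by
    apply C.emb_ext
    change C.io d (C.sg a C.ζ) = _
    rw [C.sg_zeta, map_pow, C.io_zeta, C.io_zeta, ← pow_mul, Units.val_mul, ZMod.val_mul]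
    conv_lhs => rw [← Nat.mod_add_div ((d : ZMod p).val * (a : ZMod p).val) p, pow_add, pow_mul, C.hZ1.pow_eq_one,
      one_pow, mul_one]
  exact DFunLike.congr_fun this x

theorem io_norm_le (d : (ZMod p)ˣ) (x : 𝓞 F) : ‖C.io d (x : F)‖ ≤ 1 := by
  have h1 : IsIntegral ℤ (C.io d (x : F)) := (RingOfIntegers.isIntegral_coe x).map (C.io d)
  have h2 : IsIntegral ℤ_[N] (C.io d (x : F)) := h1.tower_top
  obtain ⟨w, hw⟩ := IsIntegrallyClosed.isIntegral_iff.1 h2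
  rw [← hw]
  exact w.2

/-- integral version -/
noncomputable def iO (d : (ZMod p)ˣ) : 𝓞 F →+* ℤ_[N] where
  toFun x := ⟨C.io d (x : F), C.io_norm_le d x⟩
  map_one' := Subtype.ext (by simp)
  map_zero' := Subtype.ext (by simp)
  map_mul' a b := Subtype.ext (by simp; rfl)
  map_add' a b := Subtype.ext (by simp; rfl)

theorem iO_coe (d : (ZMod p)ˣ) (x : 𝓞 F) : ((C.iO d x : ℤ_[N]) : ℚ_[N]) = C.io d (x : F) := rfl

/-- reduction -/
noncomputable def ph (d : (ZMod p)ˣ) : 𝓞 F →+* ZMod N := (PadicInt.toZMod).comp (C.iO d)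

/-- integral zeta -/
noncomputable def zO : 𝓞 F := C.hζ.toInteger

theorem zO_coe : (C.zO : F) = C.ζ := rfl

theorem ph_zeta (d : (ZMod p)ˣ) : C.ph d C.zO = C.z ^ (d : ZMod p).val := by
  have : C.iO d C.zO = C.Z ^ (d : ZMod p).val := by
    apply Subtype.ext
    rw [iO_coe, zO_coe, io_zeta]; simp
  change PadicInt.toZMod (C.iO d C.zO) = _
  rw [this, map_pow, C.hZz]

/-- valuations -/
noncomputable def vH (d : (ZMod p)ˣ) : Additive Fˣ →+ ℤ :=
  (lv N).comp (MonoidHom.toAdditive (Units.map ((C.io d : F →ₐ[ℚ] ℚ_[N]) : F →* ℚ_[N])))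

/-- symbols -/
noncomputable def sH (d : (ZMod p)ˣ) : Additive Fˣ →+ ZMod p :=
  (C.ls).comp (MonoidHom.toAdditive (Units.map ((C.io d : F →ₐ[ℚ] ℚ_[N]) : F →* ℚ_[N])))

/-- valuation function -/
noncomputable def v (d : (ZMod p)ˣ) (y : Fˣ) : ℤ := C.vH d (Additive.ofMul y)
/-- symbol function -/
noncomputable def s (d : (ZMod p)ˣ) (y : Fˣ) : ZMod p := C.sH d (Additive.ofMul y)

theorem v_mul (d) (x y : Fˣ) : C.v d (x * y) = C.v d x + C.v d y := map_add (C.vH d) _ _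
theorem s_mul (d) (x y : Fˣ) : C.s d (x * y) = C.s d x + C.s d y := map_add (C.sH d) _ _
theorem v_one (d) : C.v d 1 = 0 := map_zero (C.vH d)
theorem s_one (d) : C.s d 1 = 0 := map_zero (C.sH d)
theorem v_inv (d) (x : Fˣ) : C.v d x⁻¹ = - C.v d x := map_neg (C.vH d) _
theorem s_inv (d) (x : Fˣ) : C.s d x⁻¹ = - C.s d x := map_neg (C.sH d) _
theorem v_div (d) (x y : Fˣ) : C.v d (x / y) = C.v d x - C.v d y := map_sub (C.vH d) _ _
theorem s_div (d) (x y : Fˣ) : C.s d (x / y) = C.s d x - C.s d y := map_sub (C.sH d) _ _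
theorem v_pow (d) (x : Fˣ) (n : ℕ) : C.v d (x ^ n) = n * C.v d x := by
  have := map_nsmul (C.vH d) n (Additive.ofMul x)
  rw [nsmul_eq_mul] at this; exact this
theorem s_pow (d) (x : Fˣ) (n : ℕ) : C.s d (x ^ n) = n * C.s d x := by
  have := map_nsmul (C.sH d) n (Additive.ofMul x)
  rw [nsmul_eq_mul] at this; exact this
theorem v_zpow (d) (x : Fˣ) (n : ℤ) : C.v d (x ^ n) = n * C.v d x := by
  have := map_zsmul (C.vH d) n (Additive.ofMul x)
  rw [zsmul_eq_mul] at this; exact this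
theorem s_zpow (d) (x : Fˣ) (n : ℤ) : C.s d (x ^ n) = n * C.s d x := by
  have := map_zsmul (C.sH d) n (Additive.ofMul x)
  rw [zsmul_eq_mul] at this; exact this
theorem v_prod (d) {ι : Type*} (t : Finset ι) (f : ι → Fˣ) : C.v d (∏ i ∈ t, f i) = ∑ i ∈ t, C.v d (f i) := by
  classical
  induction t using Finset.induction_on with
  | empty => simp [v_one]
  | insert a t ha ih => rw [prod_insert ha, sum_insert ha, v_mul, ih]
theorem s_prod (d) {ι : Type*} (t : Finset ι) (f : ι → Fˣ) : C.s d (∏ i ∈ t, f i) = ∑ i ∈ t, C.s d (f i) := by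
  classical
  induction t using Finset.induction_on with
  | empty => simp [s_one]
  | insert a t ha ih => rw [prod_insert ha, sum_insert ha, s_mul, ih]

theorem v_form (d) (y : Fˣ) (k : ℤ) (u : ℤ_[N]ˣ) (h : C.io d (y : F) = (N : ℚ_[N]) ^ k * ((u : ℤ_[N]) : ℚ_[N])) :
    C.v d y = k := Bs.lv_form _ k u h
theorem s_form (d) (y : Fˣ) (k : ℤ) (u : ℤ_[N]ˣ) (h : C.io d (y : F) = (N : ℚ_[N]) ^ k * ((u : ℤ_[N]) : ℚ_[N])) :
    C.s d y = C.ind (PadicInt.toZMod (u : ℤ_[N])) := C.ls_form _ k u h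
theorem io_form (d) (y : Fˣ) : ∃ u : ℤ_[N]ˣ, C.io d (y : F) = (N : ℚ_[N]) ^ (C.v d y) * ((u : ℤ_[N]) : ℚ_[N]) :=
  padic_form (Units.map ((C.io d : F →ₐ[ℚ] ℚ_[N]) : F →* ℚ_[N]) y)

/-- action on units -/
noncomputable def sgu (a : (ZMod p)ˣ) : Fˣ →* Fˣ := ua (C.sg a).toRingEquiv

theorem sgu_coe (a) (y : Fˣ) : (C.sgu a y : F) = C.sg a (y : F) := rfl

theorem v_sg (d a) (y : Fˣ) : C.v d (C.sgu a y) = C.v (d * a) y := by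
  obtain ⟨u, hu⟩ := C.io_form (d * a) y
  apply C.v_form d _ _ u
  rw [sgu_coe, io_sg, hu]

theorem s_sg (d a) (y : Fˣ) : C.s d (C.sgu a y) = C.s (d * a) y := by
  obtain ⟨u, hu⟩ := C.io_form (d * a) y
  rw [C.s_form (d * a) _ _ u hu]
  apply C.s_form d _ (C.v (d * a) y) u
  rw [sgu_coe, io_sg, hu]

theorem vs_of_ph (d) (y : Fˣ) (x : 𝓞 F) (hx : (x : F) = y) (h : C.ph d x ≠ 0) :
    C.v d y = 0 ∧ C.s d y = C.ind (C.ph d x) := by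
  have hu : IsUnit (C.iO d x) := by
    by_contra hc
    apply h
    have : C.iO d x ∈ RingHom.ker (PadicInt.toZMod (p := N)) := by
      rw [PadicInt.ker_toZMod, IsLocalRing.mem_maximalIdeal]; exact hc
    exact this
  obtain ⟨u, hu⟩ := hu
  have e : C.io d (y : F) = (N : ℚ_[N]) ^ (0:ℤ) * ((u : ℤ_[N]) : ℚ_[N]) := by
    rw [hu, iO_coe, hx]; simp
  exact ⟨C.v_form d y _ _ e, by rw [C.s_form d y _ _ e, hu]; rfl⟩

theorem v_nonneg (d) (y : Fˣ) (x : 𝓞 F) (hx : (x : F) = y) : 0 ≤ C.v d y := by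
  have h := C.io_norm_le d x
  obtain ⟨u, hu⟩ := C.io_form d y
  rw [hx, hu, norm_mul, Padic.norm_p_zpow, ← PadicInt.norm_def, PadicInt.norm_units, mul_one] at h
  have h1 : (1:ℝ) < N := by exact_mod_cast hNF.out.one_lt
  have := (zpow_le_one_iff_right₀ h1).1 h
  omega

theorem v_pos_of_ph (d) (y : Fˣ) (x : 𝓞 F) (hx : (x : F) = y) (h : C.ph d x = 0) : 0 < C.v d y := by
  have h1 := C.v_nonneg d y x hx
  rcases h1.lt_or_eq with h2 | h2
  · exact h2
  · exfalso
    obtain ⟨u, hu⟩ := C.io_form d y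
    rw [← h2, zpow_zero, one_mul, ← hx, ← iO_coe] at hu
    have : C.iO d x = u := Subtype.ext hu
    have h3 : C.ph d x = PadicInt.toZMod (u : ℤ_[N]) := by rw [← this]; rfl
    exact toZMod_unit_ne u (h3 ▸ h)

theorem N_ne : (N : F) ≠ 0 := Nat.cast_ne_zero.2 hNF.out.ne_zero

theorem vs_N (d) (y : Fˣ) (hy : (y : F) = N) : C.v d y = 1 ∧ C.s d y = 0 := by
  have e : C.io d (y : F) = (N : ℚ_[N]) ^ (1:ℤ) * (((1 : ℤ_[N]ˣ) : ℤ_[N]) : ℚ_[N]) := by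
    rw [hy]; simp
  exact ⟨C.v_form d y _ _ e, by rw [C.s_form d y _ _ e]; simp [C.ind_one]⟩

theorem vs_one_add (d) (y : Fˣ) (h : ‖C.io d (y : F) - 1‖ < 1) : C.v d y = 0 ∧ C.s d y = 0 :=
  C.ls_one_add _ h

end Cy

end

section

open Finset NumberField

namespace Cy
variable {p N : ℕ} [hpF : Fact p.Prime] [hNF : Fact N.Prime] {F : Type} [Field F] [NumberField F] (C : Cy p N F)
open IsDedekindDomain

theorem ph_eq_zero_iff (d) (x : 𝓞 F) : C.ph d x = 0 ↔ ‖C.io d (x : F)‖ < 1 := by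
  have : C.ph d x = 0 ↔ C.iO d x ∈ RingHom.ker (PadicInt.toZMod (p := N)) := Iff.rfl
  rw [this, PadicInt.ker_toZMod, IsLocalRing.mem_maximalIdeal, PadicInt.mem_nonunits, PadicInt.norm_def]
  rfl

theorem sg_surj (σ : F ≃ₐ[ℚ] F) : ∃ a, σ = C.sg a := by
  have := C.hcyc
  exact ⟨IsCyclotomicExtension.Rat.galEquivZMod p F σ, by unfold sg; simp only [MulEquiv.symm_apply_apply]⟩

theorem isGal (C : Cy p N F) : IsGalois ℚ F := by
  have := C.hcyc
  exact IsCyclotomicExtension.isGalois {p} ℚ F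

theorem int_mem (v : HeightOneSpectrum (𝓞 F)) (hv : ((N : ℕ) : 𝓞 F) ∈ v.asIdeal) (k : ℤ) (hk : (k : 𝓞 F) ∈ v.asIdeal) :
    (N : ℤ) ∣ k := by
  by_contra h
  have hc : IsCoprime (N : ℤ) k := by
    rw [Prime.coprime_iff_not_dvd (Nat.prime_iff_prime_int.1 hNF.out)]
    exact h
  obtain ⟨a, b, hab⟩ := hc
  apply v.isPrime.ne_top
  rw [Ideal.eq_top_iff_one]
  have : (1 : 𝓞 F) = a * (N : ℕ) + b * k := by exact_mod_cast (congrArg (fun x : ℤ => (x : 𝓞 F)) hab).symm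
  rw [this]
  exact v.asIdeal.add_mem (v.asIdeal.mul_mem_left _ hv) (v.asIdeal.mul_mem_left _ hk)

theorem exists_ph_zero (v : HeightOneSpectrum (𝓞 F)) (hv : ((N : ℕ) : 𝓞 F) ∈ v.asIdeal) (x : 𝓞 F) (hx : x ∈ v.asIdeal) :
    ∃ d, C.ph d x = 0 := by
  have := C.isGal
  by_contra! hcon
  set k := Algebra.norm ℤ x with hkdef
  have hk : (k : 𝓞 F) ∈ v.asIdeal := by
    apply Ideal.mem_of_dvd _ _ hx
    have h := RingOfIntegers.dvd_norm ℚ x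
    have e : (algebraMap (𝓞 ℚ) (𝓞 F)) (RingOfIntegers.norm ℚ x) = (k : 𝓞 F) := by
      apply RingOfIntegers.ext
      rw [RingOfIntegers.coe_algebraMap_norm]
      have := Algebra.coe_norm_int x
      have h2 : ((k : 𝓞 F) : F) = algebraMap ℚ F ((k : ℚ)) := by simp
      rw [h2, hkdef, this]
    rw [← e]; exact h
  have hd := int_mem v hv k hk
  have h1 : ‖((k : ℤ) : ℚ_[N])‖ < 1 := (Padic.norm_intCast_lt_one_iff).2 hd
  have h2 : C.io 1 ((algebraMap ℚ F) (Algebra.norm ℚ (x : F))) = ((k : ℤ) : ℚ_[N]) := by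
    rw [← Algebra.coe_norm_int x]; simp [hkdef]
  rw [Algebra.norm_eq_prod_automorphisms, map_prod] at h2
  rw [← h2, norm_prod] at h1
  refine absurd h1 (not_lt.2 (le_of_eq ?_))
  symm
  apply Finset.prod_eq_one
  intro σ _
  obtain ⟨a, rfl⟩ := C.sg_surj σ
  rw [io_sg]
  have h3 := hcon (1 * a)
  rw [Ne, ph_eq_zero_iff, not_lt] at h3
  exact le_antisymm (C.io_norm_le _ _) h3

theorem exists_d (v : HeightOneSpectrum (𝓞 F)) (hv : ((N : ℕ) : 𝓞 F) ∈ v.asIdeal) :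
    ∃ d, ∀ x, x ∈ v.asIdeal ↔ C.ph d x = 0 := by
  have h : (v.asIdeal : Set (𝓞 F)) ⊆ ⋃ d ∈ ((Finset.univ : Finset (ZMod p)ˣ) : Set (ZMod p)ˣ), (RingHom.ker (C.ph d) : Ideal (𝓞 F)) := by
    intro x hx
    obtain ⟨d, hd⟩ := C.exists_ph_zero v hv x hx
    simp only [Set.mem_iUnion]
    exact ⟨d, by simp, hd⟩
  rw [Ideal.subset_union_prime (f := fun d => RingHom.ker (C.ph d)) 1 1 (fun _ _ _ _ => RingHom.ker_isPrime _)] at h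
  obtain ⟨d, _, hd⟩ := h
  refine ⟨d, fun x => ?_⟩
  have := v.isMaximal.eq_of_le (RingHom.ker_isPrime (C.ph d)).ne_top hd
  rw [this]; rfl

/-- the prime 𝔫_d -/
noncomputable def nn (d : (ZMod p)ˣ) : HeightOneSpectrum (𝓞 F) where
  asIdeal := RingHom.ker (C.ph d)
  isPrime := RingHom.ker_isPrime _
  ne_bot := by
    intro h
    have : ((N : ℕ) : 𝓞 F) ∈ RingHom.ker (C.ph d) := by
      rw [RingHom.mem_ker]; simp
    rw [h, Ideal.mem_bot] at this
    exact hNF.out.ne_zero (by exact_mod_cast this)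

theorem mem_nn (d) (x : 𝓞 F) : x ∈ (C.nn d).asIdeal ↔ C.ph d x = 0 := Iff.rfl

theorem N_mem_nn (d) : ((N : ℕ) : 𝓞 F) ∈ (C.nn d).asIdeal := by rw [mem_nn]; simp

theorem eq_nn (v : HeightOneSpectrum (𝓞 F)) (hv : ((N : ℕ) : 𝓞 F) ∈ v.asIdeal) : ∃ d, v = C.nn d := by
  obtain ⟨d, hd⟩ := C.exists_d v hv
  exact ⟨d, HeightOneSpectrum.ext (Ideal.ext hd)⟩

theorem ph_inj {d d'} (h : ∀ x, C.ph d x = 0 → C.ph d' x = 0) : d = d' := by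
  -- ζ - n with n = z^d
  have h1 : C.ph d (C.zO - ((C.z ^ (d : ZMod p).val).val : ℕ)) = 0 := by
    rw [map_sub, ph_zeta, map_natCast, ZMod.natCast_val, ZMod.cast_id', id, sub_self]
  have h2 := h _ h1
  rw [map_sub, ph_zeta, map_natCast, ZMod.natCast_val, ZMod.cast_id', id, sub_eq_zero] at h2
  exact (Units.ext (C.z_inj h2)).symm

theorem nn_inj {d d'} (h : C.nn d = C.nn d') : d = d' := by
  apply C.ph_inj
  intro x hx
  rw [← mem_nn, h] at hx
  exact hx

/-- a local fraction representation -/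
theorem exists_frac (v : HeightOneSpectrum (𝓞 F)) (y : Fˣ) (hy : ord v y = 0) :
    ∃ a b : 𝓞 F, a ∉ v.asIdeal ∧ b ∉ v.asIdeal ∧ (y : F) * b = a := by
  classical
  have hfin := finite_ord_ne_zero y
  have hb : ∀ w : HeightOneSpectrum (𝓞 F), w ≠ v → ∃ b : 𝓞 F, b ∈ w.asIdeal ∧ b ∉ v.asIdeal := by
    intro w hw
    by_contra! hcon
    apply hw
    apply HeightOneSpectrum.ext
    exact w.isMaximal.eq_of_le v.isPrime.ne_top hcon
  choose! f hf1 hf2 using hb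
  set b : 𝓞 F := ∏ w ∈ hfin.toFinset, (f w) ^ ((ord w y).natAbs) with hbdef
  have hne : ∀ w ∈ hfin.toFinset, w ≠ v := by
    rintro w hw rfl
    rw [Set.Finite.mem_toFinset] at hw
    exact hw hy
  have hbv : b ∉ v.asIdeal := by
    intro h
    obtain ⟨w, hw, h2⟩ := (Ideal.IsPrime.prod_mem_iff (hp := v.isPrime)).1 h
    exact hf2 w (hne w hw) (v.isPrime.mem_of_pow_mem _ h2)
  have hb0 : b ≠ 0 := fun h => hbv (h ▸ v.asIdeal.zero_mem)
  have hbF : (b : F) ≠ 0 := by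
    rw [Ne, RingOfIntegers.coe_eq_zero_iff]; exact hb0
  set bu : Fˣ := Units.mk0 (b : F) hbF with hbu
  have hintg : IsIntegral ℤ ((y * bu : Fˣ) : F) := by
    rw [isIntegral_iff_ord]
    intro w
    rw [ord_mul]
    have hbn : 0 ≤ ord w bu := ord_integral w bu b rfl
    by_cases hw : ord w y = 0
    · omega
    · have hwm : w ∈ hfin.toFinset := by rw [Set.Finite.mem_toFinset]; exact hw
      have hfw0 : (f w : F) ≠ 0 := by
        rw [Ne, RingOfIntegers.coe_eq_zero_iff]; intro h0
        exact hf2 w (hne w hwm) (h0 ▸ v.asIdeal.zero_mem)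
      obtain ⟨c, hc⟩ := Finset.dvd_prod_of_mem (fun w => (f w) ^ ((ord w y).natAbs)) hwm
      have hc' : b = (f w) ^ ((ord w y).natAbs) * c := hc
      have hcF : (c : F) ≠ 0 := by
        rw [Ne, RingOfIntegers.coe_eq_zero_iff]; rintro rfl
        exact hb0 (by rw [hc', mul_zero])
      have : bu = (Units.mk0 (f w : F) hfw0) ^ ((ord w y).natAbs) * Units.mk0 (c : F) hcF := by
        ext
        simp only [hbu, Units.val_mk0, Units.val_mul, Units.val_pow_eq_pow_val, hc']
        push_cast; rfl
      rw [this, ord_mul, ord_pow]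
      have h1 : 0 ≤ ord w (Units.mk0 (c : F) hcF) := ord_integral w _ c rfl
      have h2 : 0 < ord w (Units.mk0 (f w : F) hfw0) := (ord_pos_iff_mem w _ (f w) rfl).2 (hf1 w (hne w hwm))
      have h3 : (((ord w y).natAbs : ℕ) : ℤ) = |ord w y| := by simp
      rw [h3]
      have := neg_abs_le (ord w y)
      nlinarith [abs_nonneg (ord w y)]
  refine ⟨⟨_, hintg⟩, b, ?_, hbv, rfl⟩
  rw [← ord_eq_zero_iff_notMem v (y * bu) ⟨_, hintg⟩ rfl, ord_mul, hy,
    (ord_eq_zero_iff_notMem v bu b rfl).2 hbv, add_zero]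

theorem v_zero_of_ord (d) (y : Fˣ) (hy : ord (C.nn d) y = 0) : C.v d y = 0 := by
  obtain ⟨a, b, ha, hb, h⟩ := exists_frac (C.nn d) y hy
  have hb0 : (b : F) ≠ 0 := by
    rw [Ne, RingOfIntegers.coe_eq_zero_iff]; rintro rfl; exact hb (Ideal.zero_mem _)
  have ha0 : (a : F) ≠ 0 := by
    rw [Ne, RingOfIntegers.coe_eq_zero_iff]; rintro rfl; exact ha (Ideal.zero_mem _)
  have e : y * Units.mk0 (b : F) hb0 = Units.mk0 (a : F) ha0 := by ext; exact h
  have h1 := C.vs_of_ph d (Units.mk0 (a : F) ha0) a rfl ha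
  have h2 := C.vs_of_ph d (Units.mk0 (b : F) hb0) b rfl hb
  rw [← e, v_mul, h2.1, add_zero] at h1
  exact h1.1

theorem ord_eq (d) (y n : Fˣ) (hn : (n : F) = N) : ord (C.nn d) y = C.v d y * ord (C.nn d) n := by
  have h : ord (C.nn d) (y ^ ord (C.nn d) n / n ^ ord (C.nn d) y) = 0 := by
    rw [ord_div, ord_zpow, ord_zpow]; ring
  have h2 := C.v_zero_of_ord d _ h
  rw [v_div, v_zpow, v_zpow, (C.vs_N d n hn).1] at h2
  linarith

theorem ord_N_pos (d) (n : Fˣ) (hn : (n : F) = N) : 0 < ord (C.nn d) n := by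
  refine (ord_pos_iff_mem _ n ((N : ℕ) : 𝓞 F) ?_).2 (C.N_mem_nn d)
  rw [hn]; simp

end Cy

end

section

open Finset NumberField

theorem prod_sub_one_lt {R : Type*} [NormedField R] [IsUltrametricDist R] {ι : Type*} (t : Finset ι) (f : ι → R)
    (h : ∀ i ∈ t, ‖f i - 1‖ < 1) : ‖∏ i ∈ t, f i - 1‖ < 1 := by
  classical
  induction t using Finset.induction_on with
  | empty => simp
  | insert a t ha ih =>
    rw [prod_insert ha]
    have h1 := h a (by simp)
    have h2 := ih (fun i hi => h i (by simp [hi]))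
    have e : f a * ∏ i ∈ t, f i - 1 = (f a - 1) * (∏ i ∈ t, f i - 1) + ((f a - 1) + (∏ i ∈ t, f i - 1)) := by ring
    rw [e]
    refine lt_of_le_of_lt (IsUltrametricDist.norm_add_le_max _ _) (max_lt ?_ ?_)
    · rw [norm_mul]
      exact mul_lt_one_of_nonneg_of_lt_one_left (norm_nonneg _) h1 h2.le
    · exact lt_of_le_of_lt (IsUltrametricDist.norm_add_le_max _ _) (max_lt h1 h2)

theorem norm_sum_lt' {R : Type*} [NormedField R] [IsUltrametricDist R] {ι : Type*} (t : Finset ι) (f : ι → R) {c : ℝ}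
    (hc : 0 < c) (h : ∀ i ∈ t, ‖f i‖ < c) : ‖∑ i ∈ t, f i‖ < c := by
  classical
  induction t using Finset.induction_on with
  | empty => simpa
  | insert a t ha ih =>
    rw [sum_insert ha]
    exact lt_of_le_of_lt (IsUltrametricDist.norm_add_le_max _ _)
      (max_lt (h a (by simp)) (ih fun i hi => h i (by simp [hi])))

namespace Cy
variable {p N : ℕ} [hpF : Fact p.Prime] [hNF : Fact N.Prime] {F : Type} [Field F] [NumberField F] (C : Cy p N F)
variable {M : Type} [Field M] [NumberField M] [Algebra F M] (D : KD p F M)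

/-- ψ extends ι_d -/
def Ext (d : (ZMod p)ˣ) (ψ : M →+* PadicAlgCl N) : Prop :=
  ∀ f : F, ψ (algebraMap F M f) = algebraMap ℚ_[N] (PadicAlgCl N) (C.io d f)

theorem exists_Ext (D : KD p F M) (d : (ZMod p)ˣ) : ∃ ψ : M →+* PadicAlgCl N, C.Ext d ψ := by
  obtain ⟨t, ht⟩ := IsAlgClosed.exists_pow_nat_eq (k := PadicAlgCl N) (algebraMap ℚ_[N] (PadicAlgCl N) (C.io d D.u)) hpF.out.pos
  obtain ⟨e, he, _⟩ := D.exists_lift ((algebraMap ℚ_[N] (PadicAlgCl N)).comp (C.io d : F →+* ℚ_[N])) t ht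
  exact ⟨e, he⟩

theorem norm_io (d) (y : Fˣ) : ‖C.io d (y : F)‖ = (N : ℝ) ^ (-C.v d y) := by
  obtain ⟨u, hu⟩ := C.io_form d y
  rw [hu, norm_mul, Padic.norm_p_zpow, ← PadicInt.norm_def, PadicInt.norm_units, mul_one]

theorem norm_alg (x : ℚ_[N]) : ‖algebraMap ℚ_[N] (PadicAlgCl N) x‖ = ‖x‖ := norm_algebraMap' _ x

theorem norm_term {d : (ZMod p)ˣ} {ψ : M →+* PadicAlgCl N} (h : C.Ext d ψ) (f : Fˣ) (i : ℕ) :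
    ‖ψ ((um F M f * D.θ ^ i : Mˣ) : M)‖ ^ p = (N : ℝ) ^ (-(p * C.v d f + i * C.v d D.u)) := by
  rw [← norm_pow, ← map_pow, ← Units.val_pow_eq_pow_val, mul_pow, ← pow_mul, mul_comm i p, pow_mul, D.hu,
    ← map_pow, ← map_pow, ← map_mul]
  have : ((um F M (f ^ p * D.u ^ i) : Mˣ) : M) = algebraMap F M ((f ^ p * D.u ^ i : Fˣ) : F) := rfl
  rw [this, h, norm_alg, norm_io, v_mul, v_pow, v_pow]

theorem norm_term_inj {d : (ZMod p)ˣ} {ψ : M →+* PadicAlgCl N} (h : C.Ext d ψ) (hv : ¬ (p : ℤ) ∣ C.v d D.u)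
    (f g : Fˣ) {i j : ℕ} (hi : i < p) (hj : j < p)
    (he : ‖ψ ((um F M f * D.θ ^ i : Mˣ) : M)‖ = ‖ψ ((um F M g * D.θ ^ j : Mˣ) : M)‖) : i = j := by
  have h1 := C.norm_term D h f i
  rw [he, C.norm_term D h g j] at h1
  have hN1 : (1:ℝ) < N := by exact_mod_cast hNF.out.one_lt
  have h2 := zpow_right_injective₀ (by linarith) hN1.ne' h1
  have h3 : (p : ℤ) ∣ ((i : ℤ) - j) * C.v d D.u := ⟨C.v d g - C.v d f, by linarith⟩
  have h4 := ((Nat.prime_iff_prime_int.1 hpF.out).dvd_or_dvd h3).resolve_right hv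
  have := Int.eq_zero_of_abs_lt_dvd h4 (by rw [abs_lt]; omega)
  omega

theorem norm_term_indep {d : (ZMod p)ˣ} {ψ ψ' : M →+* PadicAlgCl N} (h : C.Ext d ψ) (h' : C.Ext d ψ') (f : F) (i : ℕ) :
    ‖ψ (algebraMap F M f * (D.θ : M) ^ i)‖ = ‖ψ' (algebraMap F M f * (D.θ : M) ^ i)‖ := by
  by_cases hf : f = 0
  · simp [hf]
  · have e : algebraMap F M f * (D.θ : M) ^ i = ((um F M (Units.mk0 f hf) * D.θ ^ i : Mˣ) : M) := by
      simp [um]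
    rw [e]
    have := (C.norm_term D h (Units.mk0 f hf) i).trans (C.norm_term D h' (Units.mk0 f hf) i).symm
    exact (pow_left_inj₀ (norm_nonneg _) (norm_nonneg _) hpF.out.ne_zero).1 this

/-- dominating term -/
theorem dominate (d : (ZMod p)ˣ) (hv : ¬ (p : ℤ) ∣ C.v d D.u) (w : Mˣ) :
    ∃ (f : Fˣ) (m : ℕ), ∀ ψ : M →+* PadicAlgCl N, C.Ext d ψ →
      ‖ψ ((w / (um F M f * D.θ ^ m) : Mˣ) : M) - 1‖ < 1 := by
  classical
  obtain ⟨ψ0, h0⟩ := C.exists_Ext D d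
  obtain ⟨f, hf⟩ := D.expand (w : M)
  set T := (range p).filter (fun i => f i ≠ 0) with hT
  have hsum : (w : M) = ∑ i ∈ T, algebraMap F M (f i) * (D.θ : M) ^ i := by
    rw [hf, hT, Finset.sum_filter]
    refine Finset.sum_congr rfl fun i _ => ?_
    split_ifs with h
    · rfl
    · push Not at h; simp [h]
  have hTne : T.Nonempty := by
    rw [Finset.nonempty_iff_ne_empty]
    intro h
    rw [h, sum_empty] at hsum
    exact w.ne_zero hsum
  obtain ⟨m, hm, hmax⟩ := Finset.exists_max_image T (fun i => ‖ψ0 (algebraMap F M (f i) * (D.θ : M) ^ i)‖) hTne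
  rw [hT, mem_filter, mem_range] at hm
  refine ⟨Units.mk0 (f m) hm.2, m, fun ψ h => ?_⟩
  set w0 : Mˣ := um F M (Units.mk0 (f m) hm.2) * D.θ ^ m with hw0
  have hw0' : (w0 : M) = algebraMap F M (f m) * (D.θ : M) ^ m := by simp [hw0, um]
  have hpos : 0 < ‖ψ (w0 : M)‖ := norm_pos_iff.2 (by
    rw [Ne, map_eq_zero]; exact w0.ne_zero)
  have e : ψ ((w / w0 : Mˣ) : M) - 1 = (∑ i ∈ T.erase m, ψ (algebraMap F M (f i) * (D.θ : M) ^ i)) / ψ (w0 : M) := by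
    have hmT : m ∈ T := by rw [hT, mem_filter, mem_range]; exact hm
    rw [Units.val_div_eq_div_val, map_div₀, hsum, ← Finset.add_sum_erase _ _ hmT, map_add, ← hw0', map_sum]
    have : ψ (w0 : M) ≠ 0 := by rw [Ne, map_eq_zero]; exact w0.ne_zero
    field_simp
    ring
  rw [e, norm_div, div_lt_one hpos]
  refine norm_sum_lt' _ _ hpos ?_
  intro i hi
  rw [mem_erase, hT, mem_filter, mem_range] at hi
  have hle := hmax i (by rw [hT, mem_filter, mem_range]; exact hi.2)
  rw [C.norm_term_indep D h0 h, C.norm_term_indep D h0 h, ← hw0'] at hle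
  refine lt_of_le_of_ne hle fun heq => hi.1 ?_
  have e2 : algebraMap F M (f i) * (D.θ : M) ^ i = ((um F M (Units.mk0 (f i) hi.2.2) * D.θ ^ i : Mˣ) : M) := by
    simp [um]
  rw [e2] at heq
  exact C.norm_term_inj D h hv _ _ hi.2.1 hm.1 heq

theorem symbol_norm (d : (ZMod p)ˣ) (hv : ¬ (p : ℤ) ∣ C.v d D.u) (w : Mˣ) :
    ((C.v d (D.Nm w) : ℤ) : ZMod p) * C.s d D.u = ((C.v d D.u : ℤ) : ZMod p) * C.s d (D.Nm w) := by
  obtain ⟨f, m, h⟩ := C.dominate D d hv w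
  obtain ⟨ψ, hψ⟩ := C.exists_Ext D d
  set w0 : Mˣ := um F M f * D.θ ^ m with hw0
  have key : C.v d (D.Nm (w / w0)) = 0 ∧ C.s d (D.Nm (w / w0)) = 0 := by
    apply C.vs_one_add
    rw [← norm_alg, map_sub, map_one, ← hψ]
    have e : algebraMap F M (D.Nm (w / w0) : F) = ((um F M (D.Nm (w / w0)) : Mˣ) : M) := rfl
    rw [e, ← D.prod_s, Units.coe_prod, map_prod]
    apply prod_sub_one_lt
    intro i _
    have hψ' : C.Ext d (ψ.comp ((D.σ ^ i : M ≃ₐ[F] M) : M →+* M)) := by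
      intro g
      change ψ ((D.σ ^ i) (algebraMap F M g)) = _
      rw [AlgEquiv.commutes, hψ]
    have := h _ hψ'
    rw [D.s_iter]
    exact this
  have e : D.Nm w = D.Nm (w / w0) * (f ^ p * D.u ^ m) := by
    have : D.Nm w0 = f ^ p * D.u ^ m := by rw [hw0, map_mul, map_pow, D.Nm_um, D.Nm_theta]
    rw [← this, ← map_mul, div_mul_cancel]
  rw [e, v_mul, s_mul, key.1, key.2, v_mul, s_mul, v_pow, s_pow, v_pow, s_pow]
  push_cast
  simp only [CharP.cast_eq_zero]
  ring

end Cy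

end

section

open Finset NumberField

section coes
variable {F : Type} [Field F]
theorem cO_mul (x y : 𝓞 F) : ((x * y : 𝓞 F) : F) = (x : F) * (y : F) := rfl
theorem cO_add (x y : 𝓞 F) : ((x + y : 𝓞 F) : F) = (x : F) + (y : F) := rfl
theorem cO_sub (x y : 𝓞 F) : ((x - y : 𝓞 F) : F) = (x : F) - (y : F) := rfl
theorem cO_one : ((1 : 𝓞 F) : F) = 1 := rfl
theorem cO_pow (x : 𝓞 F) (n : ℕ) : ((x ^ n : 𝓞 F) : F) = (x : F) ^ n := map_pow (algebraMap (𝓞 F) F) x n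
theorem cO_sum {ι : Type*} (t : Finset ι) (f : ι → 𝓞 F) : ((∑ i ∈ t, f i : 𝓞 F) : F) = ∑ i ∈ t, (f i : F) :=
  map_sum (algebraMap (𝓞 F) F) f t
theorem cO_prod {ι : Type*} (t : Finset ι) (f : ι → 𝓞 F) : ((∏ i ∈ t, f i : 𝓞 F) : F) = ∏ i ∈ t, (f i : F) :=
  map_prod (algebraMap (𝓞 F) F) f t
theorem cO_nat (n : ℕ) : ((n : 𝓞 F) : F) = n := map_natCast (algebraMap (𝓞 F) F) n
end coes

namespace Bs
variable {p N : ℕ} [hpF : Fact p.Prime] [hNF : Fact N.Prime] (B : Bs p N)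

theorem ind_surj (c : ZMod p) : ∃ x : ZMod N, x ≠ 0 ∧ B.ind x = c := by
  obtain ⟨g, hg⟩ := IsCyclic.exists_generator (α := (ZMod N)ˣ)
  have ho : orderOf g = N - 1 := by
    rw [orderOf_eq_card_of_forall_mem_zpowers hg, Nat.card_eq_fintype_card, ZMod.card_units]
  have h1 : B.ind (g : ZMod N) ≠ 0 := by
    intro h
    have h2 := B.ind_spec (x := (g : ZMod N)) g.ne_zero
    rw [h, ZMod.val_zero, pow_zero] at h2
    have h3 : g ^ B.m0 = 1 := by
      apply Units.ext; push_cast; exact h2.symm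
    have h4 := orderOf_dvd_of_pow_eq_one h3
    rw [ho, B.hsub] at h4
    have := Nat.le_of_dvd B.m0_pos h4
    have h5 := B.m0_pos
    have := B.hp5
    nlinarith
  refine ⟨(g : ZMod N) ^ (c * (B.ind (g : ZMod N))⁻¹).val, pow_ne_zero _ g.ne_zero, ?_⟩
  rw [B.ind_pow g.ne_zero, ZMod.natCast_zmod_val, inv_mul_cancel_right₀ h1]

/-- Γ as a function on `ZMod p` -/
noncomputable def G (c : ZMod p) : ZMod p := B.Gam c.val

theorem G_neg (c : ZMod p) : B.G (-c) = - B.G c := by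
  unfold G
  by_cases h : c = 0
  · subst h
    simp [Gam]
  · rw [ZMod.neg_val, if_neg h, B.Gam_compl c.val_lt.le]

/-- power sum -/
theorem sum_pow_eq {j : ℕ} (hj : 0 < j) (hj2 : j < 2 * (N - 1)) :
    ∑ x : ZMod N, x ^ j = if j = N - 1 then -1 else 0 := by
  have h1 : ∑ x : ZMod N, x ^ j = ∑ x : (ZMod N)ˣ, (x ^ j : ZMod N) := by
    rw [← Finset.add_sum_erase _ _ (mem_univ (0 : ZMod N)), zero_pow hj.ne', zero_add]
    symm
    apply Finset.sum_bij (fun (x : (ZMod N)ˣ) _ => (x : ZMod N))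
    · intro a _; simp
    · intro a _ b _ h; exact Units.ext h
    · intro b hb
      exact ⟨Units.mk0 b (by simpa using hb), mem_univ _, rfl⟩
    · intro a _; rfl
  rw [h1, FiniteField.sum_pow_units, ZMod.card]
  congr 1
  apply propext
  constructor
  · rintro ⟨k, hk⟩
    have : k < 2 := by
      by_contra h
      push Not at h
      nlinarith
    interval_cases k <;> omega
  · rintro rfl; exact dvd_rfl

theorem sum_beta {a b : ℕ} (ha : 0 < a) (ha2 : a < N - 1) (hb2 : b < N - 1) :
    ∑ x : ZMod N, x ^ a * (1 - x) ^ b = if N - 1 ≤ a + b then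
      - ((-1) ^ (N - 1 - a) * (b.choose (N - 1 - a) : ZMod N)) else 0 := by
  have h1 : ∀ x : ZMod N, x ^ a * (1 - x) ^ b = ∑ k ∈ range (b + 1), (-1) ^ k * (b.choose k : ZMod N) * x ^ (a + k) := by
    intro x
    rw [show (1 - x) = (-x) + 1 by ring, add_pow, mul_sum]
    apply sum_congr rfl
    intro k _
    rw [one_pow, neg_pow, pow_add]; ring
  simp_rw [h1]
  rw [sum_comm]
  simp_rw [← mul_sum]
  have h2 : ∀ k ∈ range (b + 1), (-1) ^ k * (b.choose k : ZMod N) * ∑ x : ZMod N, x ^ (a + k) =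
      if k = N - 1 - a then - ((-1) ^ k * (b.choose k : ZMod N)) else 0 := by
    intro k hk
    rw [mem_range] at hk
    rw [sum_pow_eq (by omega) (by omega)]
    by_cases h : k = N - 1 - a
    · rw [if_pos h, if_pos (by omega)]; ring
    · rw [if_neg h, if_neg (by omega), mul_zero]
  rw [sum_congr rfl h2, sum_ite_eq']
  congr 1
  rw [mem_range]; apply propext; omega

theorem ind_choose {a b : ℕ} (hb : b ≤ a) (ha : a < N) :
    (a.choose b : ZMod N) ≠ 0 ∧ B.ind (a.choose b : ZMod N) =
      ∑ j ∈ Icc 1 a, B.ind j - ∑ j ∈ Icc 1 b, B.ind j - ∑ j ∈ Icc 1 (a - b), B.ind j := by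
  have h := Nat.choose_mul_factorial_mul_factorial hb
  have hf : ∀ n < N, (n.factorial : ZMod N) ≠ 0 := by
    intro n hn h0
    rw [ZMod.natCast_eq_zero_iff, hNF.out.dvd_factorial] at h0
    omega
  have h' : (a.choose b : ZMod N) * (b.factorial : ZMod N) * ((a-b).factorial : ZMod N) = (a.factorial : ZMod N) := by
    rw [← h]; push_cast; rfl
  have h0 : (a.choose b : ZMod N) ≠ 0 := by
    intro h0
    rw [h0, zero_mul, zero_mul] at h'
    exact hf a ha h'.symm
  refine ⟨h0, ?_⟩
  have hb' := hf b (by omega)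
  have hab := hf (a-b) (by omega)
  rw [← B.ind_factorial ha, ← B.ind_factorial (show b < N by omega), ← B.ind_factorial (show a - b < N by omega), ← h',
    B.ind_mul (mul_ne_zero h0 hb') hab, B.ind_mul h0 hb']
  ring

end Bs

namespace Cy
variable {p N : ℕ} [hpF : Fact p.Prime] [hNF : Fact N.Prime] {F : Type} [Field F] [NumberField F] (C : Cy p N F)

/-- ζ^c -/
noncomputable def zp (c : ZMod p) : 𝓞 F := C.zO ^ c.val

theorem zO_pow : C.zO ^ p = 1 := by
  apply RingOfIntegers.ext
  rw [cO_pow]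
  change C.ζ ^ p = _
  rw [C.hζ.pow_eq_one, cO_one]

theorem zO_pow_mod (k : ℕ) : C.zO ^ (k % p) = C.zO ^ k := by
  conv_rhs => rw [← Nat.mod_add_div k p, pow_add, pow_mul, C.zO_pow, one_pow, mul_one]

theorem zp_nat (k : ℕ) : C.zp (k : ZMod p) = C.zO ^ k := by
  unfold zp; rw [ZMod.val_natCast, zO_pow_mod]

theorem zp_add (a b : ZMod p) : C.zp (a + b) = C.zp a * C.zp b := by
  unfold zp; rw [ZMod.val_add, zO_pow_mod, pow_add]

theorem zp_mul (a b : ZMod p) : C.zp (a * b) = C.zp a ^ b.val := by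
  unfold zp; rw [ZMod.val_mul, zO_pow_mod, pow_mul]

theorem zp_zero : C.zp 0 = 1 := by unfold zp; simp

theorem zp_one : C.zp 1 = C.zO := by
  have := C.zp_nat 1; simpa using this

theorem zp_inj {a b : ZMod p} (h : C.zp a = C.zp b) : a = b := by
  have h2 := congrArg (fun x : 𝓞 F => (x : F)) h
  simp only [zp, cO_pow] at h2
  exact ZMod.val_injective p (C.hζ.pow_inj a.val_lt b.val_lt h2)

theorem z_mul (a b : ZMod p) : C.z ^ (a * b).val = (C.z ^ a.val) ^ b.val := by
  rw [ZMod.val_mul, ← pow_mul]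
  have := C.z_pow_mod (a.val * b.val)
  rwa [ZMod.val_natCast] at this

theorem ph_zp (d : (ZMod p)ˣ) (c : ZMod p) : C.ph d (C.zp c) = C.z ^ ((d : ZMod p) * c).val := by
  rw [zp, map_pow, ph_zeta, z_mul]

/-- action on integers -/
noncomputable def sgO (a : (ZMod p)ˣ) : 𝓞 F →+* 𝓞 F := RingOfIntegers.mapRingHom (C.sg a).toRingEquiv

theorem sgO_coe (a : (ZMod p)ˣ) (x : 𝓞 F) : ((C.sgO a x : 𝓞 F) : F) = C.sg a (x : F) := rfl

theorem sgO_zp (a : (ZMod p)ˣ) (c : ZMod p) : C.sgO a (C.zp c) = C.zp (a * c) := by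
  rw [zp_mul, zp, map_pow]
  congr 1
  apply RingOfIntegers.ext
  rw [sgO_coe, zO_coe, sg_zeta, zp, cO_pow]
  rfl

/-- Jacobi sums -/
noncomputable def J (m n : ZMod p) : 𝓞 F :=
  ∑ x ∈ (univ : Finset (ZMod N)) \ {0, 1}, C.zp (m * C.ind x + n * C.ind (1 - x))

theorem sgO_J (a : (ZMod p)ˣ) (m n : ZMod p) : C.sgO a (C.J m n) = C.J (a * m) (a * n) := by
  unfold J
  rw [map_sum]
  apply sum_congr rfl
  intro x _
  rw [sgO_zp]
  congr 1
  ring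

theorem ph_J (d : (ZMod p)ˣ) (m n : ZMod p) (hm : m ≠ 0) (hn : n ≠ 0) : C.ph d (C.J m n) =
    ∑ x : ZMod N, x ^ (C.m0 * (d * m : ZMod p).val) * (1 - x) ^ (C.m0 * (d * n : ZMod p).val) := by
  have hA : 0 < (d * m : ZMod p).val := by
    rw [Nat.pos_iff_ne_zero, Ne, ZMod.val_eq_zero]; exact mul_ne_zero d.ne_zero hm
  have hB : 0 < (d * n : ZMod p).val := by
    rw [Nat.pos_iff_ne_zero, Ne, ZMod.val_eq_zero]; exact mul_ne_zero d.ne_zero hn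
  have h0 := C.m0_pos
  unfold J
  rw [map_sum]
  rw [← Finset.sum_sdiff (Finset.subset_univ ({0, 1} : Finset (ZMod N)))]
  rw [Finset.sum_pair zero_ne_one, zero_pow (by positivity), zero_mul, sub_self, zero_pow (by positivity), mul_zero,
    add_zero, add_zero]
  apply sum_congr rfl
  intro x hx
  simp only [mem_sdiff, mem_univ, mem_insert, mem_singleton, true_and, not_or] at hx
  have hx1 : 1 - x ≠ 0 := sub_ne_zero.2 (Ne.symm hx.2)
  rw [ph_zp, show (d : ZMod p) * (m * C.ind x + n * C.ind (1 - x)) = C.ind x * (d * m) + C.ind (1-x) * (d * n) by ring,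
    C.z_add, z_mul, z_mul, C.ind_spec hx.1, C.ind_spec hx1, pow_mul, pow_mul]

theorem ph_J_lt (d : (ZMod p)ˣ) (m n : ZMod p) (hm : m ≠ 0) (hn : n ≠ 0)
    (h : (d * m : ZMod p).val + (d * n : ZMod p).val < p) : C.ph d (C.J m n) = 0 := by
  have hA : 0 < (d * m : ZMod p).val := by
    rw [Nat.pos_iff_ne_zero, Ne, ZMod.val_eq_zero]; exact mul_ne_zero d.ne_zero hm
  have h0 := C.m0_pos
  have h1 := C.hsub
  have hA' := (d * m : ZMod p).val_lt
  have hB' := (d * n : ZMod p).val_lt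
  have e : ∀ t, t < p → C.m0 * t < N - 1 := fun t ht => by rw [h1]; exact Nat.mul_lt_mul_of_pos_left ht h0
  rw [C.ph_J d m n hm hn, Bs.sum_beta (by positivity) (e _ hA') (e _ hB'), if_neg]
  rw [← mul_add]
  exact not_le.2 (e _ h)

theorem ph_J_gt (d : (ZMod p)ˣ) (m n : ZMod p) (hm : m ≠ 0) (hn : n ≠ 0)
    (h : p < (d * m : ZMod p).val + (d * n : ZMod p).val) : C.ph d (C.J m n) ≠ 0 ∧
      C.ind (C.ph d (C.J m n)) = C.G (d * m) + C.G (d * n) - C.G (d * (m + n)) := by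
  have hA : 0 < (d * m : ZMod p).val := by
    rw [Nat.pos_iff_ne_zero, Ne, ZMod.val_eq_zero]; exact mul_ne_zero d.ne_zero hm
  have h0 := C.m0_pos
  have h1 := C.hsub
  have hA' := (d * m : ZMod p).val_lt
  have hB' := (d * n : ZMod p).val_lt
  have e : ∀ t, t < p → C.m0 * t < N - 1 := fun t ht => by rw [h1]; exact Nat.mul_lt_mul_of_pos_left ht h0
  rw [C.ph_J d m n hm hn, Bs.sum_beta (by positivity) (e _ hA') (e _ hB'), if_pos]
  swap
  · rw [← mul_add, h1]; exact Nat.mul_le_mul_left _ h.le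
  have e2 : N - 1 - C.m0 * (d * m : ZMod p).val = C.m0 * (p - (d * m : ZMod p).val) := by
    rw [h1, Nat.mul_sub]
  rw [e2]
  have hle : C.m0 * (p - (d * m : ZMod p).val) ≤ C.m0 * (d * n : ZMod p).val := Nat.mul_le_mul_left _ (by omega)
  obtain ⟨h2, h3⟩ := C.ind_choose (a := C.m0 * (d * n : ZMod p).val) hle (by have := e _ hB'; omega)
  have hs : ((-1 : ZMod N)) ^ (C.m0 * (p - (d * m : ZMod p).val)) ≠ 0 := pow_ne_zero _ (by simp)
  refine ⟨neg_ne_zero.2 (mul_ne_zero hs h2), ?_⟩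
  rw [C.ind_neg (mul_ne_zero hs h2), C.ind_mul hs h2, C.ind_pow (by simp), C.ind_neg_one, mul_zero, zero_add, h3,
    ← Nat.mul_sub]
  have e3 : (d * n : ZMod p).val - (p - (d * m : ZMod p).val) = (d * (m + n) : ZMod p).val := by
    rw [mul_add, ZMod.val_add_of_le (by omega)]; omega
  rw [e3]
  have e4 : C.Gam (p - (d * m : ZMod p).val) = - C.Gam (d * m : ZMod p).val := C.Gam_compl hA'.le
  unfold Bs.G
  unfold Bs.Gam at *
  rw [e4]
  ring

/-- the characters -/
noncomputable def chi (m : ZMod p) : MulChar (ZMod N) F := MulChar.mk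
  { toFun := fun x => if x = 0 then 0 else (C.zp (m * C.ind x) : F)
    map_one' := by rw [if_neg one_ne_zero, C.ind_one, mul_zero, zp_zero]; rfl
    map_mul' := by
      intro x y
      by_cases hx : x = 0
      · simp [hx]
      by_cases hy : y = 0
      · simp [hy]
      rw [if_neg hx, if_neg hy, if_neg (mul_ne_zero hx hy), C.ind_mul hx hy, mul_add, zp_add, cO_mul] }
  (by intro a ha
      have : a = 0 := by simpa using ha
      simp [this])

theorem chi_apply (m : ZMod p) {x : ZMod N} (hx : x ≠ 0) : C.chi m x = (C.zp (m * C.ind x) : F) := if_neg hx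

theorem chi_mul (m n : ZMod p) : C.chi m * C.chi n = C.chi (m + n) := by
  ext x
  rw [MulChar.mul_apply, chi_apply _ _ x.ne_zero, chi_apply _ _ x.ne_zero, chi_apply _ _ x.ne_zero, add_mul, zp_add, cO_mul]

theorem chi_zero : C.chi 0 = 1 := by
  ext x
  rw [chi_apply _ _ x.ne_zero, zero_mul, zp_zero]; simp

theorem chi_inv (m : ZMod p) : (C.chi m)⁻¹ = C.chi (-m) := by
  rw [inv_eq_iff_mul_eq_one, chi_mul, add_neg_cancel, chi_zero]

theorem chi_ne (m : ZMod p) (hm : m ≠ 0) : C.chi m ≠ 1 := by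
  intro h
  obtain ⟨x, hx, h1⟩ := C.ind_surj 1
  have h2 := congrArg (fun f : MulChar (ZMod N) F => f x) h
  simp only [C.chi_apply m hx, h1, mul_one] at h2
  rw [MulChar.one_apply (isUnit_iff_ne_zero.2 hx)] at h2
  have : C.zp m = C.zp 0 := by
    apply RingOfIntegers.ext; rw [h2, zp_zero]; rfl
  exact hm (C.zp_inj this)

theorem J_eq (m n : ZMod p) : (C.J m n : F) = jacobiSum (C.chi m) (C.chi n) := by
  rw [jacobiSum_eq_sum_sdiff, J, cO_sum]
  apply sum_congr rfl
  intro x hx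
  simp only [mem_sdiff, mem_univ, mem_insert, mem_singleton, true_and, not_or] at hx
  have hx1 : 1 - x ≠ 0 := sub_ne_zero.2 (Ne.symm hx.2)
  rw [chi_apply _ _ hx.1, chi_apply _ _ hx1, zp_add, cO_mul]

theorem J_mul (m n : ZMod p) (hm : m ≠ 0) (hn : n ≠ 0) (hmn : m + n ≠ 0) : (C.J m n : F) * (C.J (-m) (-n) : F) = N := by
  rw [J_eq, J_eq, ← chi_inv, ← chi_inv, jacobiSum_mul_jacobiSum_inv _ (C.chi_ne m hm) (C.chi_ne n hn)
    (by rw [chi_mul]; exact C.chi_ne _ hmn), ZMod.card]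
  rw [ringChar.eq (ZMod N) N, ringChar.eq_zero]
  exact hNF.out.ne_zero.symm

theorem J_ne (m n : ZMod p) (hm : m ≠ 0) (hn : n ≠ 0) (hmn : m + n ≠ 0) : (C.J m n : F) ≠ 0 := by
  intro h
  have := C.J_mul m n hm hn hmn
  rw [h, zero_mul] at this
  exact N_ne this.symm

/-- Jacobi sum as a unit of the field -/
noncomputable def Ju (m n : ZMod p) (hm : m ≠ 0) (hn : n ≠ 0) (hmn : m + n ≠ 0) : Fˣ := Units.mk0 _ (C.J_ne m n hm hn hmn)

theorem Ju_coe (m n : ZMod p) (hm hn hmn) : (C.Ju m n hm hn hmn : F) = C.J m n := rfl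

theorem vs_J_gt (d : (ZMod p)ˣ) (m n : ZMod p) (hm hn hmn)
    (h : p < (d * m : ZMod p).val + (d * n : ZMod p).val) : C.v d (C.Ju m n hm hn hmn) = 0 ∧
     C.s d (C.Ju m n hm hn hmn) = C.G (d * m) + C.G (d * n) - C.G (d * (m + n)) := by
  obtain ⟨h1, h2⟩ := C.ph_J_gt d m n hm hn h
  obtain ⟨h3, h4⟩ := C.vs_of_ph d (C.Ju m n hm hn hmn) (C.J m n) rfl h1
  exact ⟨h3, h4.trans h2⟩

theorem s_J (d : (ZMod p)ˣ) (m n : ZMod p) (hm hn hmn) : 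
     C.s d (C.Ju m n hm hn hmn) = C.G (d * m) + C.G (d * n) - C.G (d * (m + n)) := by
  have hmn' : (d * m + d * n : ZMod p) ≠ 0 := by
    rw [← mul_add]; exact mul_ne_zero d.ne_zero hmn
  have hA : (d * m : ZMod p) ≠ 0 := mul_ne_zero d.ne_zero hm
  have hB : (d * n : ZMod p) ≠ 0 := mul_ne_zero d.ne_zero hn
  rcases lt_trichotomy ((d * m : ZMod p).val + (d * n : ZMod p).val) p with h | h | h
  · have hm' : -m ≠ 0 := neg_ne_zero.2 hm
    have hn' : -n ≠ 0 := neg_ne_zero.2 hn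
    have hmn2 : -m + -n ≠ 0 := by rw [← neg_add]; exact neg_ne_zero.2 hmn
    have h1 : p < (d * (-m) : ZMod p).val + (d * (-n) : ZMod p).val := by
      rw [mul_neg, mul_neg, ZMod.neg_val, ZMod.neg_val, if_neg hA, if_neg hB]
      have := (d * m : ZMod p).val_lt
      have := (d * n : ZMod p).val_lt
      omega
    obtain ⟨h2, h3⟩ := C.vs_J_gt d (-m) (-n) hm' hn' hmn2 h1
    obtain ⟨-, h5⟩ := C.vs_N d (C.Ju m n hm hn hmn * C.Ju (-m) (-n) hm' hn' hmn2) (C.J_mul m n hm hn hmn)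
    rw [s_mul, h3] at h5
    rw [← neg_add] at h5
    rw [mul_neg, mul_neg, mul_neg, C.G_neg, C.G_neg, C.G_neg] at h5
    linear_combination h5
  · exfalso
    apply hmn'
    have : ((((d * m : ZMod p).val + (d * n : ZMod p).val : ℕ)) : ZMod p) = 0 := by rw [h]; simp
    rwa [Nat.cast_add, ZMod.natCast_zmod_val, ZMod.natCast_zmod_val] at this
  · exact (C.vs_J_gt d m n hm hn hmn h).2

theorem Ju_mem (m n : ZMod p) (hm hn hmn) : C.Ju m n hm hn hmn ∈ EE F N := by
  rw [mem_EE_iff hNF.out.ne_zero]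
  intro w hw
  rw [ord_eq_zero_iff_notMem w _ (C.J m n) rfl]
  intro h
  apply hw
  have h1 : C.J m n * C.J (-m) (-n) = ((N : ℕ) : 𝓞 F) := by
    apply RingOfIntegers.ext
    rw [cO_mul, C.J_mul m n hm hn hmn, cO_nat]
  rw [← h1]
  exact Ideal.mul_mem_right _ _ h

/-- Fourier transform -/
noncomputable def _root_.hat {p : ℕ} [Fact p.Prime] (k : ℕ) (f : (ZMod p)ˣ → ZMod p) : ZMod p := ∑ d : (ZMod p)ˣ, ((d⁻¹ : (ZMod p)ˣ) : ZMod p) ^ k * f d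

theorem _root_.hat_shift {p : ℕ} [Fact p.Prime] (k : ℕ) (f : (ZMod p)ˣ → ZMod p) (a : (ZMod p)ˣ) : hat k (fun d => f (d * a)) = (a : ZMod p) ^ k * hat k f := by
  unfold hat
  rw [mul_sum, ← Equiv.sum_comp (Equiv.mulRight a⁻¹)]
  apply sum_congr rfl
  intro d _
  simp only [Equiv.coe_mulRight, inv_mul_cancel_right, mul_inv_rev, inv_inv]
  push_cast
  rw [mul_pow]; ring

theorem _root_.hat_add {p : ℕ} [Fact p.Prime] (k : ℕ) (f g : (ZMod p)ˣ → ZMod p) : hat k (fun d => f d + g d) = hat k f + hat k g := by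
  unfold hat; rw [← sum_add_distrib]; exact sum_congr rfl fun _ _ => by ring

theorem _root_.hat_sub {p : ℕ} [Fact p.Prime] (k : ℕ) (f g : (ZMod p)ˣ → ZMod p) : hat k (fun d => f d - g d) = hat k f - hat k g := by
  unfold hat; rw [← sum_sub_distrib]; exact sum_congr rfl fun _ _ => by ring

theorem _root_.hat_mul {p : ℕ} [Fact p.Prime] (k : ℕ) (c : ZMod p) (f : (ZMod p)ˣ → ZMod p) : hat k (fun d => c * f d) = c * hat k f := by
  unfold hat; rw [mul_sum]; exact sum_congr rfl fun _ _ => by ring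

theorem hat_s_J (k : ℕ) (m n : (ZMod p)ˣ) (hmn : (m : ZMod p) + n ≠ 0) :
    hat k (fun d => C.s d (C.Ju m n m.ne_zero n.ne_zero hmn)) =
      ((m : ZMod p) ^ k + (n : ZMod p) ^ k - ((m : ZMod p) + n) ^ k) * hat k (fun d => C.G d) := by
  simp_rw [s_J]
  rw [hat_sub k (fun d => C.G ((d : ZMod p) * m) + C.G ((d : ZMod p) * n)), hat_add]
  have h := hat_shift k (fun d : (ZMod p)ˣ => C.G d)
  have h1 := h m
  have h2 := h n
  have h3 := h (Units.mk0 _ hmn)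
  simp only [Units.val_mul, Units.val_mk0] at h1 h2 h3
  rw [h1, h2, h3]; ring

theorem hat_G_ne {k : ℕ} (hk : Odd k) (h3 : 3 ≤ k) (hk2 : k ≤ p - 2)
    (hM : ¬ ∃ y : ZMod N, y ^ p = ∏ l ∈ Finset.Icc 1 (N - 1), ∏ a ∈ Finset.Icc 1 (l - 1), (l : ZMod N) ^ (a ^ (p - 1 - k))) :
    hat k (fun d => C.G d) ≠ 0 := by
  have hp5 := C.hp5
  have hpo : Odd p := hpF.out.odd_of_ne_two (by omega)
  have h := C.Gam_hat_ne (i := p - 1 - k) (by grind) (by omega) hM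
  intro h0
  apply h
  rw [← h0]
  unfold hat
  rw [← Fin.sum_univ_eq_sum_range (fun c => (c : ZMod p) ^ (p - 1 - k) * C.Gam c)]
  have e : ∑ i : Fin p, ((i : ℕ) : ZMod p) ^ (p - 1 - k) * C.Gam i = ∑ c : ZMod p, c ^ (p-1-k) * C.G c := by
    symm
    apply Finset.sum_bij (fun (c : ZMod p) _ => (⟨c.val, c.val_lt⟩ : Fin p))
    · simp
    · intro a _ b _ h; simpa [ZMod.val_injective p |>.eq_iff] using h
    · intro b _; exact ⟨(b : ℕ), mem_univ _, by ext; simp [ZMod.val_cast_of_lt b.2]⟩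
    · intro a _; simp [Bs.G]
  rw [e, ← Finset.add_sum_erase _ _ (mem_univ (0 : ZMod p)), zero_pow (by omega), zero_mul, zero_add]
  symm
  apply Finset.sum_bij (fun (x : (ZMod p)ˣ) _ => (x : ZMod p))
  · intro a _; simp
  · intro a _ b _ h; exact Units.ext h
  · intro b hb
    exact ⟨Units.mk0 b (by simpa using hb), mem_univ _, rfl⟩
  · intro a _
    congr 1
    have : (a : ZMod p) ^ (p - 1) = 1 := ZMod.pow_card_sub_one_eq_one a.ne_zero
    rw [Units.val_inv_eq_inv_val, inv_pow, pow_sub₀ _ a.ne_zero (by omega), this, one_mul]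

theorem exists_b {k : ℕ} (hk : Odd k) (h3 : 3 ≤ k) (hk2 : k ≤ p - 2) :
    ∃ b : (ZMod p)ˣ, (1 : ZMod p) + b ≠ 0 ∧ (1 : ZMod p) ^ k + (b : ZMod p) ^ k - (1 + b) ^ k ≠ 0 := by
  classical
  by_contra hcon
  push Not at hcon
  let P : Polynomial (ZMod p) := 1 + Polynomial.X ^ k - (Polynomial.X + 1) ^ k
  have hP : ∀ b : ZMod p, P.eval b = 0 := by
    intro b
    simp only [P, Polynomial.eval_sub, Polynomial.eval_add, Polynomial.eval_one, Polynomial.eval_pow, Polynomial.eval_X]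
    by_cases hb : b = 0
    · simp [hb, (show k ≠ 0 by omega)]
    by_cases hb1 : b + 1 = 0
    · rw [hb1, eq_neg_of_add_eq_zero_left hb1, hk.neg_one_pow, zero_pow (by omega)]; ring
    · have := hcon (Units.mk0 b hb) (by simpa [add_comm] using hb1)
      simpa [add_comm] using this
  have hdeg : P.natDegree < p := by
    have : P.natDegree ≤ k := by
      simp only [P]; compute_degree
    omega
  have hP0 : P = 0 := by
    apply Polynomial.eq_zero_of_natDegree_lt_card_of_eval_eq_zero' P Finset.univ (fun b _ => hP b)
    rw [card_univ, ZMod.card]; exact hdeg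
  have hc : P.coeff 1 = - (k : ZMod p) := by
    simp only [P, Polynomial.coeff_sub, Polynomial.coeff_add, Polynomial.coeff_X_add_one_pow, Polynomial.coeff_X_pow, Polynomial.coeff_one]
    rw [if_neg (by norm_num), if_neg (by omega)]; simp
  rw [hP0, Polynomial.coeff_zero] at hc
  have : (k : ZMod p) = 0 := neg_eq_zero.1 hc.symm
  rw [ZMod.natCast_eq_zero_iff] at this
  have := Nat.le_of_dvd (by omega) this
  omega

end Cy

end

section

open Finset NumberField

namespace Bs
variable {p N : ℕ} [hpF : Fact p.Prime] [hNF : Fact N.Prime] (B : Bs p N)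

noncomputable def fib (c : ZMod p) : Finset (ZMod N) := by
  classical exact univ.filter (fun x => x ≠ 0 ∧ B.ind x = c)

theorem mem_fib (c : ZMod p) (x : ZMod N) : x ∈ B.fib c ↔ x ≠ 0 ∧ B.ind x = c := by
  classical unfold fib; simp

theorem sum_fib {R : Type*} [AddCommMonoid R] (f : ZMod N → R) : ∑ x ∈ univ.erase (0 : ZMod N), f x = ∑ c : ZMod p, ∑ x ∈ B.fib c, f x := by
  classical
  rw [← Finset.sum_fiberwise (univ.erase (0 : ZMod N)) (fun x => B.ind x) f]
  apply sum_congr rfl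
  intro c _
  apply sum_congr _ (fun _ _ => rfl)
  ext x; simp [mem_fib]

theorem card_fib (c : ZMod p) : (B.fib c).card = B.m0 := by
  have h0 : ∀ c, (B.fib c).card = (B.fib 0).card := by
    intro c
    obtain ⟨x, hx, hxc⟩ := B.ind_surj c
    symm
    apply Finset.card_bij (fun y _ => x * y)
    · intro y hy
      rw [mem_fib] at hy ⊢
      exact ⟨mul_ne_zero hx hy.1, by rw [B.ind_mul hx hy.1, hy.2, hxc, add_zero]⟩
    · intro y _ y' _ h; exact mul_left_cancel₀ hx h
    · intro y hy
      rw [mem_fib] at hy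
      refine ⟨x⁻¹ * y, ?_, by field_simp⟩
      rw [mem_fib]
      refine ⟨mul_ne_zero (inv_ne_zero hx) hy.1, ?_⟩
      rw [B.ind_mul (inv_ne_zero hx) hy.1, B.ind_inv hx, hy.2, hxc, neg_add_cancel]
  have h1 := B.sum_fib (fun _ => (1 : ℕ))
  simp only [sum_const, smul_eq_mul, mul_one] at h1
  rw [sum_congr rfl (fun c _ => h0 c), sum_const, card_erase_of_mem (mem_univ _), card_univ, card_univ, ZMod.card, ZMod.card,
    B.hsub, smul_eq_mul] at h1
  rw [h0 c]
  apply Nat.eq_of_mul_eq_mul_left hpF.out.pos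
  rw [← h1, mul_comm]

/-- the product formula over a fibre -/
theorem prod_fib (c : ZMod p) : ∏ x ∈ B.fib c, (1 - x) = 1 - B.z ^ c.val := by
  classical
  let P : Polynomial (ZMod N) := Polynomial.X ^ B.m0 - Polynomial.C (B.z ^ c.val)
  have hm : P.Monic := Polynomial.monic_X_pow_sub_C _ B.m0_pos.ne'
  have hd : P.natDegree = B.m0 := Polynomial.natDegree_X_pow_sub_C
  have h1 : ∏ x ∈ B.fib c, (Polynomial.X - Polynomial.C x) = P := by
    symm
    apply Polynomial.eq_of_monic_of_dvd_of_natDegree_le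
    · exact Polynomial.monic_prod_of_monic _ (fun x => Polynomial.X - Polynomial.C x) fun x _ => Polynomial.monic_X_sub_C x
    · exact hm
    · apply Finset.prod_dvd_of_coprime
      · intro x _ y _ hxy
        exact Polynomial.isCoprime_X_sub_C_of_isUnit_sub (by rw [isUnit_iff_ne_zero]; exact sub_ne_zero.2 hxy)
      · intro x hx
        rw [mem_fib] at hx
        rw [Polynomial.dvd_iff_isRoot, Polynomial.IsRoot.def]
        simp only [P, Polynomial.eval_sub, Polynomial.eval_pow, Polynomial.eval_X, Polynomial.eval_C]
        rw [← B.ind_spec hx.1, hx.2, sub_self]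
    · rw [hd, Polynomial.natDegree_prod_of_monic _ (fun x => Polynomial.X - Polynomial.C x) fun x _ => Polynomial.monic_X_sub_C x]
      simp [B.card_fib]
  have h2 := congrArg (Polynomial.eval 1) h1
  rw [Polynomial.eval_prod] at h2
  simpa [P] using h2

/-- `L c = ind (1 - z^c)` -/
noncomputable def Lf (c : ZMod p) : ZMod p := B.ind (1 - B.z ^ c.val)

theorem z_pow_ne_one {c : ZMod p} (hc : c ≠ 0) : (1 : ZMod N) - B.z ^ c.val ≠ 0 := by
  intro h
  apply hc
  apply B.z_inj
  rw [ZMod.val_zero, pow_zero]; exact (sub_eq_zero.1 h).symm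

theorem sum_fib_ind {c : ZMod p} (hc : c ≠ 0) : ∑ x ∈ B.fib c, B.ind (1 - x) = B.Lf c := by
  rw [Lf, ← B.prod_fib c, B.ind_prod]
  intro x hx h
  apply B.z_pow_ne_one hc
  rw [← B.prod_fib c]
  exact Finset.prod_eq_zero hx h

section ident
variable {R : Type*} [CommRing R] [Algebra (ZMod p) R] (e : ZMod p → R)

open Classical in
noncomputable def Ef (m : ZMod p) (x : ZMod N) : R := if x = 0 then 0 else e (m * B.ind x)

local notation "al" => algebraMap (ZMod p) R

theorem Ef_zero (m : ZMod p) : B.Ef e m 0 = 0 := by simp [Ef]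

theorem Ef_mul (ha : ∀ a b, e (a + b) = e a * e b) (m : ZMod p) (x y : ZMod N) : B.Ef e m (x * y) = B.Ef e m x * B.Ef e m y := by
  unfold Ef
  by_cases hx : x = 0
  · simp [hx]
  by_cases hy : y = 0
  · simp [hy]
  rw [if_neg hx, if_neg hy, if_neg (mul_ne_zero hx hy), B.ind_mul hx hy, mul_add, ha]

theorem Ef_add (ha : ∀ a b, e (a + b) = e a * e b) (m n : ZMod p) (x : ZMod N) : B.Ef e (m + n) x = B.Ef e m x * B.Ef e n x := by
  unfold Ef
  by_cases hx : x = 0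
  · simp [hx]
  rw [if_neg hx, if_neg hx, if_neg hx, add_mul, ha]

noncomputable def Jf (m n : ZMod p) : R := ∑ x : ZMod N, B.Ef e m x * B.Ef e n (1 - x)
noncomputable def Qf (m : ZMod p) : R := ∑ x : ZMod N, al (B.ind (1 - x)) * B.Ef e m x
noncomputable def Tf (m n : ZMod p) : R := ∑ x : ZMod N, al (B.ind (1 - x)) * (B.Ef e m x * B.Ef e n (1 - x))

theorem ind_zero : B.ind 0 = 0 := by
  unfold ind
  rw [dif_neg]
  rintro ⟨k, hk⟩
  rw [zero_pow B.m0_pos.ne'] at hk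
  exact pow_ne_zero _ B.z_ne hk

theorem JQ1 (ha : ∀ a b, e (a + b) = e a * e b) (m n : ZMod p) :
    B.Jf e m n * B.Qf e (m + n) = ∑ X : ZMod N, ∑ Y : ZMod N, al (B.ind (1 - X - Y)) * (B.Ef e m X * B.Ef e n Y) := by
  unfold Jf Qf
  have h1 : ∀ y : ZMod N, (∑ x : ZMod N, B.Ef e m x * B.Ef e n (1 - x)) * (al (B.ind (1 - y)) * B.Ef e (m + n) y) =
      ∑ X : ZMod N, al (B.ind (1 - y)) * (B.Ef e m X * B.Ef e n (y - X)) := by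
    intro y
    by_cases hy : y = 0
    · subst hy
      simp [Ef_zero, B.ind_one]
    · rw [← Equiv.sum_comp (Equiv.mulRight₀ y hy) (fun X => al (B.ind (1 - y)) * (B.Ef e m X * B.Ef e n (y - X))), sum_mul]
      apply sum_congr rfl
      intro x _
      rw [Equiv.mulRight₀_apply, show y - x * y = (1 - x) * y by ring, Ef_mul B e ha, Ef_mul B e ha, Ef_add B e ha]
      ring
  rw [mul_sum, sum_congr rfl fun y _ => h1 y, sum_comm]
  apply sum_congr rfl
  intro X _
  rw [← Equiv.sum_comp (Equiv.addRight X)]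
  apply sum_congr rfl
  intro Y _
  simp only [Equiv.coe_addRight, add_sub_cancel_right]
  rw [show 1 - (Y + X) = 1 - X - Y by ring]

theorem JQ2 (h0 : e 0 = 1) (ha : ∀ a b, e (a + b) = e a * e b) (m n : ZMod p) :
    B.Jf e m n * B.Qf e n = ∑ X : ZMod N, ∑ Y : ZMod N, al (B.ind (1 - X - Y)) * (B.Ef e m X * B.Ef e n Y)
      - ∑ Y : ZMod N, al (B.ind Y) * B.Ef e n Y - B.Qf e m * ∑ Y : ZMod N, B.Ef e n Y + B.Tf e m n := by
  classical
  have key : ∀ x : ZMod N, (B.Ef e m x * B.Ef e n (1 - x)) * B.Qf e n =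
      ∑ Y : ZMod N, al (B.ind (1 - x - Y)) * (B.Ef e m x * B.Ef e n Y)
      - (if x = 1 then ∑ Y : ZMod N, al (B.ind Y) * B.Ef e n Y else 0) -
       (al (B.ind (1 - x)) * B.Ef e m x) * ∑ Y : ZMod N, B.Ef e n Y + al (B.ind (1 - x)) * (B.Ef e m x * B.Ef e n (1 - x)) := by
    intro x
    by_cases hx : x = 1
    · subst hx
      have h1 : B.Ef e m 1 = 1 := by rw [Ef, if_neg one_ne_zero, B.ind_one, mul_zero, h0]
      rw [if_pos rfl, sub_self, Ef_zero, B.ind_zero, map_zero, h1]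
      have : ∀ Y : ZMod N, al (B.ind (0 - Y)) * (1 * B.Ef e n Y) = al (B.ind Y) * B.Ef e n Y := by
        intro Y
        by_cases hY : Y = 0
        · simp [hY]
        · rw [zero_sub, B.ind_neg hY, one_mul]
      rw [sum_congr rfl fun Y _ => this Y]
      ring
    · have hx1 : 1 - x ≠ 0 := sub_ne_zero.2 (Ne.symm hx)
      rw [if_neg hx, sub_zero]
      have h2 : ∀ y : ZMod N, (B.Ef e m x * B.Ef e n (1 - x)) * (al (B.ind (1 - y)) * B.Ef e n y) =
         al (B.ind (1 - x - (1 - x) * y)) * (B.Ef e m x * B.Ef e n ((1 - x) * y))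
         - (al (B.ind (1 - x)) * B.Ef e m x) * B.Ef e n ((1 - x) * y)
         + if y = 1 then al (B.ind (1 - x)) * (B.Ef e m x * B.Ef e n (1 - x)) else 0 := by
        intro y
        by_cases hy : y = 1
        · subst hy
          rw [if_pos rfl, mul_one, sub_self, sub_self, B.ind_zero, map_zero]; ring
        · have hy1 : 1 - y ≠ 0 := sub_ne_zero.2 (Ne.symm hy)
          rw [if_neg hy, show 1 - x - (1 - x) * y = (1 - x) * (1 - y) by ring, B.ind_mul hx1 hy1, map_add, Ef_mul B e ha]
          ring
      unfold Qf
      rw [mul_sum, sum_congr rfl fun y _ => h2 y, sum_add_distrib, sum_sub_distrib, sum_ite_eq', if_pos (mem_univ _), ← mul_sum]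
      rw [← Equiv.sum_comp (Equiv.mulLeft₀ (1 - x) hx1) (fun Y => al (B.ind (1 - x - Y)) * (B.Ef e m x * B.Ef e n Y)),
        ← Equiv.sum_comp (Equiv.mulLeft₀ (1 - x) hx1) (fun Y => B.Ef e n Y)]
      rfl
  conv_lhs => unfold Jf
  rw [sum_mul, sum_congr rfl fun x _ => key x, sum_add_distrib, sum_sub_distrib, sum_sub_distrib, sum_ite_eq', if_pos (mem_univ _),
    ← sum_mul]
  rfl

theorem sum_Ef (g : ZMod p → R) (n : ZMod p) : ∑ Y : ZMod N, g (B.ind Y) * B.Ef e n Y = B.m0 • ∑ c : ZMod p, g c * e (n * c) := by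
  rw [← Finset.add_sum_erase _ _ (mem_univ (0 : ZMod N)), Ef_zero, mul_zero, zero_add, B.sum_fib, smul_sum]
  apply sum_congr rfl
  intro c _
  have : ∀ x ∈ B.fib c, g (B.ind x) * B.Ef e n x = g c * e (n * c) := by
    intro x hx
    rw [mem_fib] at hx
    rw [Ef, if_neg hx.1, hx.2]
  rw [sum_congr rfl this, sum_const, B.card_fib]

theorem Tf_eq (h0 : e 0 = 1) (ha : ∀ a b, e (a + b) = e a * e b) (hs : ∑ c, e c = 0) (hs2 : ∑ c, al c * e c = 0)
    (m n : ZMod p) (hn : n ≠ 0) : B.Tf e m n = B.Jf e m n * (B.Qf e n - B.Qf e (m + n)) := by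
  have h1 : ∑ Y : ZMod N, B.Ef e n Y = 0 := by
    have := B.sum_Ef e (fun _ => 1) n
    simp only [one_mul] at this
    have h := Equiv.sum_comp (Equiv.mulLeft₀ n hn) (fun c => e c)
    simp only [Equiv.mulLeft₀_apply] at h
    rw [this, h, hs, smul_zero]
  have h2 : ∑ Y : ZMod N, al (B.ind Y) * B.Ef e n Y = 0 := by
    rw [B.sum_Ef e (fun c => al c) n]
    have : ∑ c : ZMod p, al c * e (n * c) = al n⁻¹ * ∑ c, al c * e c := by
      rw [← Equiv.sum_comp (Equiv.mulLeft₀ n hn) (fun c => al c * e c), mul_sum]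
      apply sum_congr rfl
      intro c _
      rw [Equiv.mulLeft₀_apply, ← mul_assoc, ← map_mul, inv_mul_cancel_left₀ hn]
    rw [this, hs2, mul_zero, smul_zero]
  rw [mul_sub, B.JQ2 e h0 ha, B.JQ1 e ha, h1, h2]; ring

theorem Jf_comm (m n : ZMod p) : B.Jf e m n = B.Jf e n m := by
  unfold Jf
  rw [← Equiv.sum_comp (Equiv.subLeft 1)]
  apply sum_congr rfl
  intro x _
  simp [mul_comm]

theorem T'_eq (m n : ZMod p) : ∑ x : ZMod N, al (B.ind x) * (B.Ef e m x * B.Ef e n (1 - x)) = B.Tf e n m := by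
  unfold Tf
  rw [← Equiv.sum_comp (Equiv.subLeft 1)]
  apply sum_congr rfl
  intro x _
  simp [mul_comm]

/-- the Θ-sum vanishes -/
theorem Q_sum (k : ℕ) (hk : Odd k) (h3 : 3 ≤ k) (hk2 : k ≤ p - 2) (hL : ∑ c : (ZMod p)ˣ, (c : ZMod p) ^ (k - 1) * B.Lf c = 0) :
    ∑ a : (ZMod p)ˣ, al ((a⁻¹ : (ZMod p)ˣ) : ZMod p) ^ (k - 1) * B.Qf e a = 0 := by
  have hp5 := B.hp5
  have hQ : ∀ a : ZMod p, B.Qf e a = al (∑ x ∈ B.fib 0, B.ind (1 - x)) * e 0 + ∑ c : (ZMod p)ˣ, al (B.Lf c) * e (a * c) := by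
    intro a
    unfold Qf
    have h1 : ∀ c : ZMod p, ∑ x ∈ B.fib c, al (B.ind (1 - x)) * B.Ef e a x = al (∑ x ∈ B.fib c, B.ind (1 - x)) * e (a * c) := by
      intro c
      rw [map_sum, sum_mul]
      apply sum_congr rfl
      intro x hx
      rw [mem_fib] at hx
      rw [Ef, if_neg hx.1, hx.2]
    rw [← Finset.add_sum_erase _ _ (mem_univ (0 : ZMod N)), Ef_zero, mul_zero, zero_add, B.sum_fib, sum_congr rfl fun c _ => h1 c,
      ← Finset.add_sum_erase _ _ (mem_univ (0 : ZMod p)), mul_zero]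
    congr 1
    symm
    apply Finset.sum_bij (fun (x : (ZMod p)ˣ) _ => (x : ZMod p))
    · intro a _; simp
    · intro a _ b _ h; exact Units.ext h
    · intro b hb
      exact ⟨Units.mk0 b (by simpa using hb), mem_univ _, rfl⟩
    · intro c _
      rw [B.sum_fib_ind c.ne_zero]
  simp_rw [hQ, mul_add, sum_add_distrib]
  rw [← sum_mul]
  have h2 : ∑ a : (ZMod p)ˣ, al ((a⁻¹ : (ZMod p)ˣ) : ZMod p) ^ (k - 1) = 0 := by
    rw [show ∑ a : (ZMod p)ˣ, al ((a⁻¹ : (ZMod p)ˣ) : ZMod p) ^ (k - 1) = _ from Equiv.sum_comp (Equiv.inv (ZMod p)ˣ) (fun a : (ZMod p)ˣ => al (a : ZMod p) ^ (k - 1))]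
    have := FiniteField.sum_pow_units (ZMod p) (k - 1)
    rw [if_neg] at this
    · rw [← map_zero al, ← this, map_sum]
      simp
    · rw [ZMod.card]; intro h
      have := Nat.le_of_dvd (by omega) h
      omega
  rw [h2, zero_mul, zero_add]
  simp_rw [mul_sum]
  rw [sum_comm]
  have h4 : ∀ c : (ZMod p)ˣ, ∑ a : (ZMod p)ˣ, al ((a⁻¹ : (ZMod p)ˣ) : ZMod p) ^ (k - 1) * (al (B.Lf c) * e (a * c)) =
     al ((c : ZMod p) ^ (k - 1) * B.Lf c) * ∑ a : (ZMod p)ˣ, al ((a⁻¹ : (ZMod p)ˣ) : ZMod p) ^ (k - 1) * e a := by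
    intro c
    rw [← Equiv.sum_comp (Equiv.mulRight c) (fun a : (ZMod p)ˣ => al ((a⁻¹ : (ZMod p)ˣ) : ZMod p) ^ (k - 1) * e a), mul_sum]
    apply sum_congr rfl
    intro a _
    simp only [Equiv.coe_mulRight, mul_inv_rev, Units.val_mul, map_mul, map_pow, mul_pow]
    have : al (c : ZMod p) ^ (k-1) * al ((c⁻¹ : (ZMod p)ˣ) : ZMod p) ^ (k - 1) = 1 := by
      rw [← mul_pow, ← map_mul, Units.mul_inv, map_one, one_pow]
    linear_combination (- al (B.Lf c) * al ((a⁻¹ : (ZMod p)ˣ) : ZMod p) ^ (k - 1) * e (a * c)) * this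
  rw [sum_congr rfl fun c _ => h4 c, ← sum_mul, ← map_sum, hL, map_zero, zero_mul]

end ident
end Bs

end

section

open Finset NumberField Polynomial

section polyprim
variable {p : ℕ} [hpF : Fact p.Prime]

theorem X_sub_one_pow_p : ((X : (ZMod p)[X]) - 1) ^ p = X ^ p - 1 := by
  have := sub_pow_char (p := p) (X : (ZMod p)[X]) 1
  rw [this, one_pow]

theorem geom_poly : ∑ i ∈ range p, (X : (ZMod p)[X]) ^ i = (X - 1) ^ (p - 1) := by
  have h1 := geom_sum_mul (X : (ZMod p)[X]) p
  rw [← X_sub_one_pow_p] at h1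
  have hne : (X : (ZMod p)[X]) - 1 ≠ 0 := by
    have := X_sub_C_ne_zero (1 : ZMod p); rwa [C_1] at this
  apply mul_right_cancel₀ hne
  rw [h1, ← pow_succ, Nat.sub_add_cancel hpF.out.one_le]

/-- if `(X-1)^(p-2)` divides the derivative then constant mod `(X-1)^(p-1)` -/
theorem const_of_deriv (Y : (ZMod p)[X]) (hp : 2 ≤ p) (h : (X - 1) ^ (p - 2) ∣ derivative Y) :
    ∃ c : ZMod p, (X - 1) ^ (p - 1) ∣ Y - C c := by
  have hX : (X : (ZMod p)[X]) - 1 = X - C 1 := by rw [C_1]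
  let Z := Y.comp (X + 1)
  have h1 : X ^ (p - 2) ∣ derivative Z := by
    obtain ⟨W, hW⟩ := h
    refine ⟨W.comp (X + 1), ?_⟩
    simp only [Z, derivative_comp, hW]
    simp
  have h2 : ∀ i, 1 ≤ i → i < p - 1 → Z.coeff i = 0 := by
    intro i hi hi2
    rw [X_pow_dvd_iff] at h1
    have h3 := h1 (i - 1) (by omega)
    rw [coeff_derivative, Nat.sub_add_cancel hi] at h3
    rcases mul_eq_zero.1 h3 with h4 | h4
    · exact h4
    · exfalso
      have h5 : ((i : ℕ) : ZMod p) = 0 := by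
        rw [← h4, Nat.cast_sub hi]; push_cast; ring
      rw [ZMod.natCast_eq_zero_iff] at h5
      have := Nat.le_of_dvd hi h5
      omega
  have h3 : X ^ (p - 1) ∣ Z - C (Z.coeff 0) := by
    rw [X_pow_dvd_iff]
    intro d hd
    rw [coeff_sub, coeff_C]
    split_ifs with h
    · rw [h, sub_self]
    · rw [h2 d (by omega) hd, sub_zero]
  refine ⟨Z.coeff 0, ?_⟩
  obtain ⟨W, hW⟩ := h3
  refine ⟨W.comp (X - 1), ?_⟩
  have h4 := congrArg (fun f => Polynomial.comp f (X - 1)) hW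
  simp only [sub_comp, mul_comp, X_pow_comp, C_comp] at h4
  rw [← h4]
  simp only [Z, comp_assoc]
  simp

end polyprim

namespace Bs
variable {p N : ℕ} [hpF : Fact p.Prime] [hNF : Fact N.Prime] (B : Bs p N)

noncomputable abbrev II (p : ℕ) : Ideal (ZMod p)[X] := Ideal.span {(X - 1) ^ (p - 2)}
noncomputable abbrev RR (p : ℕ) : Type := (ZMod p)[X] ⧸ II p
noncomputable abbrev mkR (p : ℕ) : (ZMod p)[X] →+* RR p := Ideal.Quotient.mk (II p)

noncomputable def eR (c : ZMod p) : RR p := mkR p (X ^ c.val)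

theorem mkR_zero_iff (f : (ZMod p)[X]) : mkR p f = 0 ↔ (X - 1) ^ (p - 2) ∣ f := by
  rw [Ideal.Quotient.eq_zero_iff_mem, Ideal.mem_span_singleton]

theorem mkR_C (c : ZMod p) : mkR p (C c) = algebraMap (ZMod p) (RR p) c := rfl

theorem eR_zero : eR (0 : ZMod p) = 1 := by simp [eR]

theorem eR_add (a b : ZMod p) : eR (a + b) = eR a * eR b := by
  unfold eR
  have h1 : (mkR p X) ^ p = 1 := by
    rw [← sub_eq_zero, ← map_pow, ← map_one (mkR p), ← map_sub, mkR_zero_iff, ← X_sub_one_pow_p]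
    exact pow_dvd_pow _ (Nat.sub_le _ _)
  rw [map_pow, map_pow, map_pow, ZMod.val_add, ← pow_add]
  conv_rhs => rw [← Nat.mod_add_div (a.val + b.val) p, pow_add, pow_mul, h1, one_pow, mul_one]

theorem sum_zmod_range {R : Type*} [AddCommMonoid R] (f : ℕ → R) : ∑ c : ZMod p, f c.val = ∑ i ∈ range p, f i := by
  rw [← Fin.sum_univ_eq_sum_range]
  apply Finset.sum_bij (fun (c : ZMod p) _ => (⟨c.val, c.val_lt⟩ : Fin p))
  · simp
  · intro a _ b _ h; simpa [ZMod.val_injective p |>.eq_iff] using h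
  · intro b _; exact ⟨(b : ℕ), mem_univ _, by ext; simp [ZMod.val_cast_of_lt b.2]⟩
  · intro a _; rfl

theorem eR_sum : ∑ c : ZMod p, eR c = 0 := by
  unfold eR
  rw [← map_sum, sum_zmod_range (fun i => (X : (ZMod p)[X]) ^ i), geom_poly, mkR_zero_iff]
  exact pow_dvd_pow _ (by omega)

theorem Xder (c : ZMod p) : X * derivative ((X : (ZMod p)[X]) ^ c.val) = C c * X ^ c.val := by
  rw [derivative_X_pow, ZMod.natCast_zmod_val]
  by_cases h : c.val = 0
  · have : c = 0 := (ZMod.val_eq_zero c).1 h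
    simp [this]
  · rw [mul_left_comm, ← pow_succ', Nat.sub_add_cancel (Nat.pos_of_ne_zero h)]

theorem eR_sum2 : ∑ c : ZMod p, algebraMap (ZMod p) (RR p) c * eR c = 0 := by
  have h1 : ∀ c : ZMod p, algebraMap (ZMod p) (RR p) c * eR c = mkR p (X * derivative (X ^ c.val)) := by
    intro c
    rw [Xder, map_mul, mkR_C]; rfl
  rw [sum_congr rfl fun c _ => h1 c, ← map_sum, ← mul_sum, ← derivative_sum, sum_zmod_range (fun i => (X : (ZMod p)[X]) ^ i), geom_poly, mkR_zero_iff]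
  rw [show (X : (ZMod p)[X]) - 1 = X - C 1 by rw [C_1], derivative_X_sub_C_pow]
  apply Dvd.dvd.mul_left
  apply Dvd.dvd.mul_left
  exact pow_dvd_pow _ (by omega)

noncomputable def PJ (m n : ZMod p) : (ZMod p)[X] :=
  ∑ x ∈ (univ : Finset (ZMod N)) \ {0, 1}, X ^ (m * B.ind x + n * B.ind (1 - x)).val

theorem sum_Sset {R : Type*} [AddCommMonoid R] (f g : ZMod N → R) (h0 : g 0 = 0) (h1 : g 1 = 0) (h : ∀ x, x ≠ 0 → 1 - x ≠ 0 → f x = g x) :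
    ∑ x ∈ (univ : Finset (ZMod N)) \ {0, 1}, f x = ∑ x, g x := by
  rw [← Finset.sum_sdiff (Finset.subset_univ ({0, 1} : Finset (ZMod N))), Finset.sum_pair zero_ne_one, h0, h1, add_zero, add_zero]
  apply sum_congr rfl
  intro x hx
  simp only [mem_sdiff, mem_univ, mem_insert, mem_singleton, true_and, not_or] at hx
  exact h x hx.1 (sub_ne_zero.2 (Ne.symm hx.2))

theorem mk_PJ (m n : ZMod p) : mkR p (B.PJ m n) = B.Jf eR m n := by
  rw [PJ, map_sum, Jf]
  apply sum_Sset
  · simp [Ef_zero]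
  · simp [Ef_zero]
  · intro x hx hx1
    rw [Ef, if_neg hx, Ef, if_neg hx1, ← eR_add]; rfl

/-- the gradient -/
noncomputable def gr (m n : ZMod p) : RR p := 
  algebraMap (ZMod p) (RR p) m * B.Qf eR m + algebraMap (ZMod p) (RR p) n * B.Qf eR n - algebraMap (ZMod p) (RR p) (m + n) * B.Qf eR (m + n)

theorem d_PJ (m n : ZMod p) (hm : m ≠ 0) (hn : n ≠ 0) : mkR p (X * derivative (B.PJ m n)) = mkR p (B.PJ m n) * B.gr m n := by
  have h1 : mkR p (X * derivative (B.PJ m n)) = algebraMap (ZMod p) (RR p) m * B.Tf eR n m + algebraMap (ZMod p) (RR p) n * B.Tf eR m n := by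
    rw [← B.T'_eq eR m n, Tf, PJ, derivative_sum, mul_sum, map_sum, mul_sum, mul_sum, ← sum_add_distrib]
    apply sum_Sset
    · simp [Ef_zero]
    · simp [Ef_zero]
    · intro x hx hx1
      rw [Xder, map_mul, mkR_C, Ef, if_neg hx, Ef, if_neg hx1, ← eR_add, map_add, map_mul, map_mul]
      simp only [eR]
      ring
  rw [h1, mk_PJ, B.Tf_eq eR eR_zero eR_add eR_sum eR_sum2 m n hn, B.Tf_eq eR eR_zero eR_add eR_sum eR_sum2 n m hm, B.Jf_comm eR n m,
    add_comm n m, gr, map_add]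
  ring

theorem d_mul {f g : (ZMod p)[X]} {a b : RR p} (h1 : mkR p (X * derivative f) = mkR p f * a) (h2 : mkR p (X * derivative g) = mkR p g * b) :
    mkR p (X * derivative (f * g)) = mkR p (f * g) * (a + b) := by
  rw [derivative_mul, show X * (derivative f * g + f * derivative g) = (X * derivative f) * g + f * (X * derivative g) by ring,
    map_add, map_mul _ _ g, map_mul _ f, h1, h2, map_mul]
  ring

theorem d_pow {f : (ZMod p)[X]} {a : RR p} (h1 : mkR p (X * derivative f) = mkR p f * a) (n : ℕ) :
    mkR p (X * derivative (f ^ n)) = mkR p (f ^ n) * (n * a) := by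
  induction n with
  | zero => simp
  | succ n ih =>
    rw [pow_succ, d_mul ih h1]
    push_cast; ring

theorem d_prod {ι : Type*} (t : Finset ι) (f : ι → (ZMod p)[X]) (a : ι → RR p) (h1 : ∀ i, mkR p (X * derivative (f i)) = mkR p (f i) * a i) :
    mkR p (X * derivative (∏ i ∈ t, f i)) = mkR p (∏ i ∈ t, f i) * (∑ i ∈ t, a i) := by
  classical
  induction t using Finset.induction_on with
  | empty => simp
  | insert i t hi ih =>
    rw [prod_insert hi, sum_insert hi]
    exact d_mul (h1 i) ih

/-- exponents -/
noncomputable def ex (k : ℕ) (a : (ZMod p)ˣ) : ℕ := (((a⁻¹ : (ZMod p)ˣ) : ZMod p) ^ k).val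

theorem ex_cast (k : ℕ) (a : (ZMod p)ˣ) : (ex k a : ZMod p) = ((a⁻¹ : (ZMod p)ˣ) : ZMod p) ^ k := by
  unfold ex; rw [ZMod.natCast_zmod_val]

theorem Q_shift (k : ℕ) (hk : 1 ≤ k) (m : (ZMod p)ˣ) :
    ∑ a : (ZMod p)ˣ, algebraMap (ZMod p) (RR p) (((a⁻¹ : (ZMod p)ˣ) : ZMod p) ^ k) * (algebraMap (ZMod p) (RR p) (a * m) * B.Qf eR (a * m)) =
    algebraMap (ZMod p) (RR p) ((m : ZMod p) ^ k) *
    ∑ a : (ZMod p)ˣ, algebraMap (ZMod p) (RR p) ((a⁻¹ : (ZMod p)ˣ) : ZMod p) ^ (k - 1) * B.Qf eR a := by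
  rw [← Equiv.sum_comp (Equiv.mulRight m) (fun a : (ZMod p)ˣ => algebraMap (ZMod p) (RR p) ((a⁻¹ : (ZMod p)ˣ) : ZMod p) ^ (k - 1) * B.Qf eR a),
    mul_sum]
  apply sum_congr rfl
  intro a _
  rw [Equiv.coe_mulRight, ← mul_assoc, ← mul_assoc, ← map_mul, ← map_pow, ← map_mul]
  congr 2
  obtain ⟨j, rfl⟩ : ∃ j, k = j + 1 := ⟨k - 1, by omega⟩
  rw [Nat.add_sub_cancel, mul_inv_rev, Units.val_mul, mul_pow]
  have e1 : ((a⁻¹ : (ZMod p)ˣ) : ZMod p) * a = 1 := Units.inv_mul a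
  have e2 : ((m⁻¹ : (ZMod p)ˣ) : ZMod p) ^ j * (m : ZMod p) ^ j = 1 := by rw [← mul_pow, Units.inv_mul, one_pow]
  rw [pow_succ, pow_succ]
  linear_combination (((a⁻¹ : (ZMod p)ˣ) : ZMod p) ^ j * m) * e1 - (((a⁻¹ : (ZMod p)ˣ) : ZMod p) ^ j * m) * e2

theorem poly_primary (k : ℕ) (hk : Odd k) (h3 : 3 ≤ k) (hk2 : k ≤ p - 2) (hL : ∑ c : (ZMod p)ˣ, (c : ZMod p) ^ (k - 1) * B.Lf c = 0)
    (b : (ZMod p)ˣ) (hb : (1 : ZMod p) + b ≠ 0) :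
    ∃ c : ZMod p, (X - 1) ^ (p - 1) ∣ ∏ a : (ZMod p)ˣ, (B.PJ (a * 1) (a * b)) ^ (ex k a) - C c := by
  have hp5 := B.hp5
  apply const_of_deriv _ (by omega)
  have h1 : mkR p (X * derivative (∏ a : (ZMod p)ˣ, (B.PJ (a * 1) (a * b)) ^ (ex k a))) = 0 := by
    rw [d_prod _ _ (fun a : (ZMod p)ˣ => ((ex k a : ℕ) : RR p) * B.gr (a * 1) (a * b))
      (fun a => d_pow (B.d_PJ _ _ (by simp) (by simp)) _)]
    convert mul_zero _
    have h4 : ∀ a : (ZMod p)ˣ, ((ex k a : ℕ) : RR p) = algebraMap (ZMod p) (RR p) (((a⁻¹ : (ZMod p)ˣ) : ZMod p) ^ k) := by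
      intro a; rw [← ex_cast, map_natCast]
    have h5 := B.Q_shift k (by omega) 1
    have h6 := B.Q_shift k (by omega) b
    have h7 := B.Q_shift k (by omega) (Units.mk0 _ hb)
    rw [B.Q_sum eR k hk h3 hk2 hL, mul_zero] at h5 h6 h7
    simp only [Units.val_one, Units.val_mk0] at h5 h6 h7
    have h8 : ∀ a : (ZMod p)ˣ, (a : ZMod p) * 1 + a * b = a * (1 + b) := fun a => by ring
    have h9 : ∀ a : (ZMod p)ˣ, ((ex k a : ℕ) : RR p) * B.gr (a * 1) (a * b) = 
      algebraMap (ZMod p) (RR p) (((a⁻¹ : (ZMod p)ˣ) : ZMod p) ^ k) * (algebraMap (ZMod p) (RR p) (a * 1) * B.Qf eR (a * 1)) + 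
      algebraMap (ZMod p) (RR p) (((a⁻¹ : (ZMod p)ˣ) : ZMod p) ^ k) * (algebraMap (ZMod p) (RR p) (a * b) * B.Qf eR (a * b)) - 
      algebraMap (ZMod p) (RR p) (((a⁻¹ : (ZMod p)ˣ) : ZMod p) ^ k) * (algebraMap (ZMod p) (RR p) (a * (1 + b)) * B.Qf eR (a * (1 + b))) := by
      intro a
      rw [gr, h4, h8]; ring
    rw [sum_congr rfl fun a _ => h9 a, sum_sub_distrib, sum_add_distrib, h5, h6, h7]
    ring
  rw [mkR_zero_iff] at h1
  refine IsCoprime.dvd_of_dvd_mul_left ?_ h1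
  apply IsCoprime.pow_left
  exact ⟨-1, 1, by ring⟩

end Bs

end

section

open Finset NumberField Polynomial

namespace Cy
variable {p N : ℕ} [hpF : Fact p.Prime] [hNF : Fact N.Prime] {F : Type} [Field F] [NumberField F] (C : Cy p N F)
open IsDedekindDomain

/-- π = ζ - 1 -/
noncomputable def pO : 𝓞 F := C.zO - 1

theorem pO_prime : Prime C.pO := by
  have := C.hcyc
  exact C.hζ.zeta_sub_one_prime'

theorem pO_assoc : Associated (C.pO ^ (p - 1)) (p : 𝓞 F) := by
  have := C.hcyc
  exact IsCyclotomicExtension.Rat.associated_zeta_sub_one_pow_prime p C.hζ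

noncomputable def lam : HeightOneSpectrum (𝓞 F) where
  asIdeal := Ideal.span {C.pO}
  isPrime := (Ideal.span_singleton_prime C.pO_prime.ne_zero).2 C.pO_prime
  ne_bot := by
    rw [Ne, Ideal.span_singleton_eq_bot]; exact C.pO_prime.ne_zero

theorem mem_lam (x : 𝓞 F) : x ∈ C.lam.asIdeal ↔ C.pO ∣ x := Ideal.mem_span_singleton

theorem pO_dvd_p : C.pO ∣ (p : 𝓞 F) := by
  have := C.hp5
  exact (dvd_pow_self _ (by omega)).trans C.pO_assoc.dvd

theorem p_mem_lam : ((p : ℕ) : 𝓞 F) ∈ C.lam.asIdeal := (C.mem_lam _).2 C.pO_dvd_p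

theorem eq_lam (v : HeightOneSpectrum (𝓞 F)) (hv : ((p : ℕ) : 𝓞 F) ∈ v.asIdeal) : v = C.lam := by
  have h1 : C.pO ∈ v.asIdeal := v.isPrime.mem_of_pow_mem (p - 1) (by
    obtain ⟨u, hu⟩ := C.pO_assoc.symm
    rw [← hu]; exact Ideal.mul_mem_right _ _ hv)
  have h2 : C.lam.asIdeal ≤ v.asIdeal := by
    change Ideal.span {C.pO} ≤ _
    rw [Ideal.span_singleton_le_iff_mem]; exact h1
  have h3 := C.lam.isMaximal.eq_of_le v.isPrime.ne_top h2
  exact (HeightOneSpectrum.ext h3).symm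

theorem pO_dvd_int (n : ℤ) (h : C.pO ∣ (n : 𝓞 F)) : (p : ℤ) ∣ n := by
  by_contra hn
  have hc : IsCoprime (p : ℤ) n := (Prime.coprime_iff_not_dvd (Nat.prime_iff_prime_int.1 hpF.out)).2 hn
  obtain ⟨a, b, hab⟩ := hc
  apply C.pO_prime.not_unit
  rw [isUnit_iff_dvd_one]
  have h2 : ((a : 𝓞 F) * p + b * n) = 1 := by exact_mod_cast congrArg (Int.cast : ℤ → 𝓞 F) hab
  rw [← h2]
  exact dvd_add (C.pO_dvd_p.mul_left _) (h.mul_left _)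

theorem exists_int (x : 𝓞 F) : ∃ n : ℤ, C.pO ∣ x - n := by
  have := C.hcyc
  obtain ⟨f, hf⟩ := (IsPrimitiveRoot.integralPowerBasis C.hζ).exists_eq_aeval' x
  rw [IsPrimitiveRoot.integralPowerBasis_gen] at hf
  refine ⟨f.eval 1, ?_⟩
  have h1 := Polynomial.sub_dvd_eval_sub (C.zO) 1 (f.map (Int.castRingHom (𝓞 F)))
  rw [Polynomial.eval_map, Polynomial.eval_map] at h1
  have h2 : eval₂ (Int.castRingHom (𝓞 F)) C.zO f = x := by
    rw [hf]; rfl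
  have h3 : eval₂ (Int.castRingHom (𝓞 F)) 1 f = ((f.eval 1 : ℤ) : 𝓞 F) := by
    have := Polynomial.eval₂_at_apply (p := f) (Int.castRingHom (𝓞 F)) 1
    simpa using this
  rw [h2, h3] at h1
  exact h1

theorem pO_dvd_sgO (a : (ZMod p)ˣ) : C.pO ∣ C.sgO a C.pO := by
  have : C.sgO a C.pO = C.zO ^ ((a : ZMod p)).val - 1 := by
    rw [pO, map_sub, map_one, ← zp_one, sgO_zp, mul_one]; rw [zp, zp_one]
  rw [this]
  exact sub_one_dvd_pow_sub_one _ _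
where
  sub_one_dvd_pow_sub_one (x : 𝓞 F) (n : ℕ) : x - 1 ∣ x ^ n - 1 := by
    simpa using sub_dvd_pow_sub_pow x 1 n

theorem sgO_sub (a : (ZMod p)ˣ) (x : 𝓞 F) : C.pO ∣ C.sgO a x - x := by
  obtain ⟨n, w, hw⟩ := C.exists_int x
  have h : x = n + C.pO * w := by linear_combination hw
  rw [h, map_add, map_mul, map_intCast]
  have : (n : 𝓞 F) + C.sgO a C.pO * C.sgO a w - (n + C.pO * w) = C.sgO a C.pO * C.sgO a w - C.pO * w := by ring
  rw [this]
  exact dvd_sub ((C.pO_dvd_sgO a).mul_right _) (dvd_mul_right _ _)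

/-- the group-ring element applied to the Jacobi sum -/
noncomputable def yO (k : ℕ) (b : (ZMod p)ˣ) : 𝓞 F := ∏ a : (ZMod p)ˣ, (C.sgO a (C.J 1 b)) ^ (Bs.ex k a)

theorem primary (k : ℕ) (hk : Odd k) (h3 : 3 ≤ k) (hk2 : k ≤ p - 2) (hL : ∑ c : (ZMod p)ˣ, (c : ZMod p) ^ (k - 1) * C.Lf c = 0)
    (b : (ZMod p)ˣ) (hb : (1 : ZMod p) + b ≠ 0) : ∃ c : ℤ, (p : 𝓞 F) ∣ C.yO k b - c := by
  obtain ⟨c, W, hW⟩ := C.poly_primary k hk h3 hk2 hL b hb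
  have hchar : CharP (𝓞 F ⧸ (Ideal.span {(p : 𝓞 F)})) p := by
    apply CharP.quotient
    intro hu
    exact C.pO_prime.not_unit (isUnit_of_dvd_unit C.pO_dvd_p hu)
  let I : Ideal (𝓞 F) := Ideal.span {(p : 𝓞 F)}
  let g : ZMod p →+* (𝓞 F ⧸ I) := ZMod.castHom dvd_rfl _
  let q : 𝓞 F →+* 𝓞 F ⧸ I := Ideal.Quotient.mk I
  let f : (ZMod p)[X] →+* (𝓞 F ⧸ I) := Polynomial.eval₂RingHom g (q C.zO)
  have hfX : f X = q C.zO := by simp [f]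
  have hfJ : ∀ m n, f (C.PJ m n) = q (C.J m n) := by
    intro m n
    rw [Bs.PJ, J, map_sum, map_sum]
    apply sum_congr rfl
    intro x _
    rw [map_pow, hfX, zp, map_pow]
  refine ⟨(c.val : ℤ), ?_⟩
  rw [← Ideal.mem_span_singleton, ← Ideal.Quotient.eq_zero_iff_mem]
  change q _ = 0
  have h4 := congrArg f hW
  rw [map_sub, map_prod, map_mul, map_pow, map_sub, map_one, hfX] at h4
  have h5 : (q C.zO - 1) ^ (p - 1) = 0 := by
    rw [← map_one q, ← map_sub, ← map_pow]
    change Ideal.Quotient.mk I (C.pO ^ (p - 1)) = 0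
    rw [Ideal.Quotient.eq_zero_iff_mem, Ideal.mem_span_singleton]
    exact C.pO_assoc.symm.dvd
  have h6 : f (Polynomial.C c) = q (((c.val : ℕ) : ℤ) : 𝓞 F) := by
    simp only [f, coe_eval₂RingHom, eval₂_C]
    rw [Int.cast_natCast, map_natCast, ← ZMod.natCast_zmod_val c, map_natCast]
    simp
  rw [h5, zero_mul, h6] at h4
  rw [map_sub, ← h4, yO, map_prod]
  congr 1
  apply prod_congr rfl
  intro a _
  rw [map_pow, map_pow, hfJ, sgO_J]

end Cy

end

section

open Finset NumberField

/-- quotient of a unit by its complex conjugate is a root of unity -/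
theorem cm_pow {K : Type} [Field K] [NumberField K] (τ : K ≃+* K)
    (h : ∀ (φ : K →+* ℂ) (x : K), φ (τ x) = (starRingEnd ℂ) (φ x)) (x : Kˣ) (hx : x ∈ (unitsHom K).range) :
    (ua τ x) ^ (Units.torsionOrder K) = x ^ (Units.torsionOrder K) := by
  obtain ⟨e, rfl⟩ := hx
  let e' : (𝓞 K)ˣ := Units.map ((RingOfIntegers.mapRingHom τ : 𝓞 K →+* 𝓞 K) : 𝓞 K →* 𝓞 K) e
  have he' : unitsHom K e' = ua τ (unitsHom K e) := by ext; rfl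
  have ht : e' * e⁻¹ ∈ Units.torsion K := by
    change IsOfFinOrder _
    have h2 : IsIntegral ℤ (((e' * e⁻¹ : (𝓞 K)ˣ) : 𝓞 K) : K) := RingOfIntegers.isIntegral_coe _
    obtain ⟨n, hn, h3⟩ := Embeddings.pow_eq_one_of_norm_eq_one K ℂ h2 (by
      intro φ
      have h4 : ((((e' * e⁻¹ : (𝓞 K)ˣ) : 𝓞 K) : K)) * ((e : 𝓞 K) : K) = τ ((e : 𝓞 K) : K) := by
        have : ((e' * e⁻¹ : (𝓞 K)ˣ) : 𝓞 K) * (e : 𝓞 K) = (e' : 𝓞 K) := by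
          rw [← Units.val_mul]; simp
        rw [← cO_mul, this]; rfl
      have h5 := congrArg (fun z => ‖φ z‖) h4
      simp only [map_mul, norm_mul, h, RCLike.norm_conj] at h5
      have h6 : ‖φ ((e : 𝓞 K) : K)‖ ≠ 0 := by
        rw [norm_ne_zero_iff, Ne, map_eq_zero]
        exact fun hc => e.ne_zero ((RingOfIntegers.coe_eq_zero_iff).1 hc)
      exact mul_right_cancel₀ h6 (by rw [h5, one_mul]))
    rw [isOfFinOrder_iff_pow_eq_one]
    refine ⟨n, hn, ?_⟩
    apply Units.ext
    apply RingOfIntegers.ext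
    rw [Units.val_pow_eq_pow_val, cO_pow, h3]; rfl
  have h7 : (e' * e⁻¹) ^ (Units.torsionOrder K) = 1 := by
    have := pow_card_eq_one' (x := (⟨_, ht⟩ : Units.torsion K))
    exact congrArg Subtype.val this
  rw [← he', ← map_pow (unitsHom K), ← map_pow (unitsHom K)]
  congr 1
  rw [mul_pow, inv_pow, mul_inv_eq_one] at h7
  exact h7

namespace Cy
variable {p N : ℕ} [hpF : Fact p.Prime] [hNF : Fact N.Prime] {F : Type} [Field F] [NumberField F] (C : Cy p N F)
open IsDedekindDomain

theorem conj_sg (φ : F →+* ℂ) (x : F) : φ (C.sg (-1) x) = (starRingEnd ℂ) (φ x) := by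
  have h : φ.comp ((C.sg (-1)).toRingEquiv : F →+* F) = (starRingEnd ℂ).comp φ := by
    apply C.emb_ext'
    change φ (C.sg (-1) C.ζ) = (starRingEnd ℂ) (φ C.ζ)
    have h1 : φ C.ζ ^ p = 1 := by rw [← map_pow, C.hζ.pow_eq_one, map_one]
    have h2 : ‖φ C.ζ‖ = 1 := Complex.norm_eq_one_of_pow_eq_one h1 hpF.out.ne_zero
    have h3 : φ C.ζ * φ (C.sg (-1) C.ζ) = 1 := by
      rw [← map_mul, sg_zeta, ← pow_succ']
      have : ((((-1 : (ZMod p)ˣ)) : ZMod p)).val + 1 = p := by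
        have h5 := hpF.out.two_le
        rw [Units.val_neg, Units.val_one, ZMod.neg_val, if_neg one_ne_zero, ZMod.val_one]; omega
      rw [this, C.hζ.pow_eq_one, map_one]
    have h4 : φ C.ζ * (starRingEnd ℂ) (φ C.ζ) = 1 := by
      rw [Complex.mul_conj, Complex.normSq_eq_norm_sq, h2]; simp
    have h5 : φ C.ζ ≠ 0 := by intro h; rw [h, zero_mul] at h3; exact zero_ne_one h3
    exact mul_left_cancel₀ h5 (h3.trans h4.symm)
  exact DFunLike.congr_fun h x

noncomputable def zu : Fˣ := Units.mk0 C.ζ (C.hζ.ne_zero hpF.out.ne_zero)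

theorem vs_zeta (d) : C.v d C.zu = 0 ∧ C.s d C.zu = d * C.ind C.z := by
  have h := C.vs_of_ph d C.zu C.zO rfl (by rw [ph_zeta]; exact pow_ne_zero _ (C.hz.ne_zero hpF.out.ne_zero))
  refine ⟨h.1, ?_⟩
  rw [h.2, ph_zeta, C.ind_pow]; simp
  exact (C.hz.ne_zero hpF.out.ne_zero)

theorem vs_neg_one (d) : C.v d (-1) = 0 ∧ C.s d (-1) = 0 := by
  have e : C.ph d (-1) = -1 := by rw [map_neg, map_one]
  have h := C.vs_of_ph d (-1 : Fˣ) (-1 : 𝓞 F) (by rw [Units.val_neg, Units.val_one]; exact map_neg (algebraMap (𝓞 F) F) 1) (by rw [e]; exact neg_ne_zero.2 one_ne_zero)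
  exact ⟨h.1, by rw [h.2, e]; exact C.ind_neg_one⟩

theorem sgu_sgu (a b) (x : Fˣ) : C.sgu a (C.sgu b x) = C.sgu (a * b) x := by
  ext; rw [sgu_coe, sgu_coe, sgu_coe, sg_mul]
theorem sgu_one (x : Fˣ) : C.sgu 1 x = x := by
  ext; rw [sgu_coe, sg_one]
theorem sgu_comm (a b) (x : Fˣ) : C.sgu a (C.sgu b x) = C.sgu b (C.sgu a x) := by
  rw [sgu_sgu, sgu_sgu, mul_comm]

theorem sgu_mem (a) (m : ℕ) (x : Fˣ) (hx : x ∈ EE F m) : C.sgu a x ∈ EE F m := ua_mem_EE _ hx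

theorem s_pow_p (d) (a : Fˣ) : C.s d (a ^ p) = 0 := by rw [s_pow]; simp

theorem v_unit (d) (y : Fˣ) (h : y ∈ (unitsHom F).range) : C.v d y = 0 := by
  obtain ⟨e, rfl⟩ := h
  apply (C.vs_of_ph d _ (e : 𝓞 F) rfl _).1
  exact (e.isUnit.map (C.ph d)).ne_zero

theorem lemO (hh : ¬ p ∣ classNumber F) (y : Fˣ) (hy : y ∈ EE F N) (hc : C.sgu (-1) y = y⁻¹) (hv : ∀ d, (C.v d y : ZMod p) = 0) :
    ∃ r : ZMod p, ∀ d : (ZMod p)ˣ, C.s d y = d * r := by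
  have h1 : ∀ w : HeightOneSpectrum (𝓞 F), ((1:ℕ) : 𝓞 F) ∉ w.asIdeal → (p : ℤ) ∣ ord w y := by
    intro w _
    by_cases hw : (N : 𝓞 F) ∈ w.asIdeal
    · obtain ⟨d, rfl⟩ := C.eq_nn w hw
      rw [C.ord_eq d y (Units.mk0 _ N_ne) rfl]
      exact ((ZMod.intCast_zmod_eq_zero_iff_dvd _ _).1 (hv d)).mul_right _
    · rw [(mem_EE_iff hNF.out.ne_zero).1 hy w hw]; exact dvd_zero _
  obtain ⟨a, e, he, h2⟩ := exists_pow_class hpF.out.ne_zero one_ne_zero y h1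
  rw [mem_EE_one_iff] at he
  have h3 := cm_pow (C.sg (-1)).toRingEquiv (C.conj_sg) e he
  change C.sgu (-1) e ^ _ = _ at h3
  have h4 : IsOfFinOrder ((e / C.sgu (-1) e : Fˣ) : F) := by
    rw [isOfFinOrder_iff_pow_eq_one]
    refine ⟨_, Units.torsionOrder_pos F, ?_⟩
    rw [← Units.val_pow_eq_pow_val, div_pow, h3, div_self']; rfl
  have := C.hcyc
  obtain ⟨r, hr⟩ := C.hζ.exists_neg_pow_of_isOfFinOrder (hpF.out.odd_of_ne_two (by have := C.hp5; omega)) h4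
  have hr' : e / C.sgu (-1) e = (-1 * C.zu) ^ r := by
    ext; rw [hr]; simp [zu]
  have h5 : (y ^ classNumber F) ^ 2 = (a / C.sgu (-1) a) ^ p * (-1 * C.zu) ^ r := by
    rw [← hr']
    have : (y ^ classNumber F) ^ 2 = y ^ classNumber F / C.sgu (-1) (y ^ classNumber F) := by
      rw [map_pow, hc, sq, inv_pow, div_inv_eq_mul]
    rw [this, h2, map_mul, map_pow, div_pow, mul_div_mul_comm]
  have h2h : ((2 * classNumber F : ℕ) : ZMod p) ≠ 0 := by
    rw [Ne, ZMod.natCast_eq_zero_iff]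
    intro h
    rcases hpF.out.dvd_mul.1 h with h | h
    · have := Nat.le_of_dvd (by norm_num) h; have := C.hp5; omega
    · exact hh h
  refine ⟨((2 * classNumber F : ℕ) : ZMod p)⁻¹ * (r * C.ind C.z), fun d => ?_⟩
  have h6 := congrArg (C.s d) h5
  rw [s_mul, s_pow_p, s_pow, s_pow, s_pow, s_mul, (C.vs_neg_one d).2, (C.vs_zeta d).2] at h6
  have h7 : ((2 * classNumber F : ℕ) : ZMod p) * C.s d y = d * (r * C.ind C.z) := by
    push_cast
    push_cast at h6
    linear_combination h6
  field_simp
  linear_combination h7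

/-- the isotypic operator -/
noncomputable def TT (k : ℕ) (y : Fˣ) : Fˣ := ∏ a : (ZMod p)ˣ, (C.sgu a y) ^ (Bs.ex k a)

theorem hat_conv (k : ℕ) (f : (ZMod p)ˣ → ZMod p) (d : (ZMod p)ˣ) :
    ∑ a : (ZMod p)ˣ, ((a⁻¹ : (ZMod p)ˣ) : ZMod p) ^ k * f (d * a) = d ^ k * hat k f := by
  have := hat_shift k f d
  rw [← this, hat]
  apply sum_congr rfl
  intro a _
  rw [mul_comm d a]

theorem s_TT (k) (y : Fˣ) (d) : C.s d (C.TT k y) = d ^ k * hat k (fun d => C.s d y) := by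
  rw [TT, s_prod, ← hat_conv]
  apply sum_congr rfl
  intro a _
  rw [s_pow, Bs.ex_cast, s_sg]

theorem v_TT (k) (y : Fˣ) (d) : (C.v d (C.TT k y) : ZMod p) = d ^ k * hat k (fun d => (C.v d y : ZMod p)) := by
  rw [TT, v_prod, ← hat_conv, Int.cast_sum]
  apply sum_congr rfl
  intro a _
  rw [v_pow, Int.cast_mul, Int.cast_natCast, Bs.ex_cast, v_sg]

theorem TT_mem (k) (m : ℕ) (y : Fˣ) (hy : y ∈ EE F m) : C.TT k y ∈ EE F m :=
  Subgroup.prod_mem _ fun a _ => Subgroup.pow_mem _ (C.sgu_mem a m y hy) _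

theorem sgu_TT (k) (y : Fˣ) (b) : C.sgu b (C.TT k y) = C.TT k (C.sgu b y) := by
  rw [TT, TT, map_prod]
  apply prod_congr rfl
  intro a _
  rw [map_pow, sgu_comm]

/-- congruent to one modulo λ^p -/
def PR (x : Fˣ) : Prop := ∃ A B : 𝓞 F, ¬ C.pO ∣ B ∧ C.pO ^ p ∣ A - B ∧ (x : F) * B = A

theorem PR_one : C.PR 1 := ⟨1, 1, fun h => C.pO_prime.not_unit (isUnit_of_dvd_one h), by simp, by rw [Units.val_one, one_mul]⟩

theorem PR_mul {x y : Fˣ} (hx : C.PR x) (hy : C.PR y) : C.PR (x * y) := by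
  obtain ⟨A, B, h1, h2, h3⟩ := hx
  obtain ⟨A', B', h1', h2', h3'⟩ := hy
  refine ⟨A * A', B * B', ?_, ?_, ?_⟩
  · intro h; rcases C.pO_prime.dvd_or_dvd h with h | h
    · exact h1 h
    · exact h1' h
  · have : A * A' - B * B' = (A - B) * A' + B * (A' - B') := by ring
    rw [this]; exact dvd_add (h2.mul_right _) (h2'.mul_left _)
  · rw [cO_mul, cO_mul, ← h3, ← h3', Units.val_mul]; ring

theorem PR_pow {x : Fˣ} (hx : C.PR x) (n : ℕ) : C.PR (x ^ n) := by
  induction n with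
  | zero => rw [pow_zero]; exact C.PR_one
  | succ n ih => rw [pow_succ]; exact C.PR_mul ih hx

theorem PR_prod {ι : Type*} (t : Finset ι) (f : ι → Fˣ) (h : ∀ i ∈ t, C.PR (f i)) : C.PR (∏ i ∈ t, f i) := by
  classical
  induction t using Finset.induction_on with
  | empty => simp [PR_one]
  | insert a s ha ih =>
    rw [prod_insert ha]
    exact C.PR_mul (h _ (mem_insert_self _ _)) (ih fun i hi => h _ (mem_insert_of_mem hi))

theorem pO_not_dvd_J (b : (ZMod p)ˣ) (hb : (1 : ZMod p) + b ≠ 0) (a : (ZMod p)ˣ) : ¬ C.pO ∣ C.sgO a (C.J 1 b) := by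
  rw [sgO_J]
  intro h
  have h1 := C.J_mul (a * 1) (a * b) (by simp) (by simp) (by rw [← mul_add]; exact mul_ne_zero a.ne_zero hb)
  have h2 : C.J (a * 1) (a * b) * C.J (-(a * 1)) (-(a * b)) = (N : 𝓞 F) := by
    apply RingOfIntegers.ext; rw [cO_mul, h1]; exact (cO_nat N).symm
  have h3 : C.pO ∣ ((N : ℤ) : 𝓞 F) := by
    rw [Int.cast_natCast, ← h2]; exact h.mul_right _
  have h4 := Int.natCast_dvd_natCast.1 (C.pO_dvd_int _ h3)
  have h5 := Nat.mod_eq_zero_of_dvd h4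
  rw [C.hmod] at h5; omega

theorem exists_u (hh : ¬ p ∣ classNumber F) (k : ℕ) (hk : Odd k) (h3 : 3 ≤ k) (hk2 : k ≤ p - 2)
    (hL : ∑ c : (ZMod p)ˣ, (c : ZMod p) ^ (k - 1) * C.Lf c = 0)
    (hG : hat k (fun d => C.G d) ≠ 0) :
    ∃ u : Fˣ, u ∈ EE F N ∧ C.PR u ∧ C.sgu (-1) u = u⁻¹ ∧ ∃ a : ZMod p, a ≠ 0 ∧
      ∀ d : (ZMod p)ˣ, (C.v d u : ZMod p) = d ^ k ∧ C.s d u = a * d ^ k := by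
  obtain ⟨b, hb, hb2⟩ := exists_b hk h3 hk2
  have hp5 := C.hp5
  have hb' : ((1 : (ZMod p)ˣ) : ZMod p) + b ≠ 0 := by simpa using hb
  have hsJ := C.hat_s_J k 1 b hb'
  obtain ⟨g, hg⟩ := IsCyclic.exists_generator (α := (ZMod p)ˣ)
  have hgo : orderOf g = p - 1 := by
    rw [orderOf_eq_card_of_forall_mem_zpowers hg, Nat.card_eq_fintype_card, ZMod.card_units]
  have hgj : ∀ j, (g : ZMod p) ^ j = 1 → (p - 1) ∣ j := by
    intro j hj
    rw [← hgo]; apply orderOf_dvd_of_pow_eq_one; ext; simpa using hj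
  set j1 : Fˣ := C.Ju ((1 : (ZMod p)ˣ) : ZMod p) b (Units.ne_zero _) (Units.ne_zero _) hb' with hj1
  set Y := C.TT k j1 with hY
  have hYm : Y ∈ EE F N := C.TT_mem k N _ (C.Ju_mem _ _ _ _ _)
  have hYc : (Y : F) = (C.yO k b : F) := by
    rw [hY, TT, yO, cO_prod, Units.coe_prod]
    apply prod_congr rfl
    intro a _
    rw [cO_pow, Units.val_pow_eq_pow_val, sgu_coe, hj1, Ju_coe, sgO_coe, Units.val_one]
  set u0 := Y / C.sgu (-1) Y with hu0
  set u1 := C.sgu g u0 / u0 with hu1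
  have hu1m : u1 ∈ EE F N := by
    have h0 : u0 ∈ EE F N := Subgroup.div_mem _ hYm (C.sgu_mem _ _ _ hYm)
    exact Subgroup.div_mem _ (C.sgu_mem _ _ _ h0) h0
  have hneg : ∀ x : Fˣ, C.sgu (-1) (C.sgu (-1) x) = x := by
    intro x; rw [sgu_sgu]; simp [sgu_one]
  have hc0 : C.sgu (-1) u0 = u0⁻¹ := by
    rw [hu0, map_div, hneg, inv_div]
  have hc1 : C.sgu (-1) u1 = u1⁻¹ := by
    rw [hu1, map_div, sgu_comm, hc0, map_inv, div_inv_eq_mul, inv_div, mul_comm, div_eq_mul_inv]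
  have hneg1 : ((-1 : (ZMod p)ˣ) : ZMod p) ^ k = -1 := by simp [hk.neg_one_pow]
  have hs1 : ∀ d, C.s d u1 = (2 * (g ^ k - 1) * hat k (fun d => C.s d j1)) * d ^ k := by
    intro d
    rw [hu1, s_div, s_sg, hu0, s_div, s_div, s_sg, s_sg, hY, s_TT, s_TT, s_TT, s_TT]
    simp only [Units.val_mul, mul_pow, hneg1]; ring
  have hv1 : ∀ d, (C.v d u1 : ZMod p) = (2 * (g ^ k - 1) * hat k (fun d => (C.v d j1 : ZMod p))) * d ^ k := by
    intro d
    rw [hu1, v_div, v_sg, hu0, v_div, v_div, v_sg, v_sg, hY]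
    push_cast
    rw [v_TT, v_TT, v_TT, v_TT]
    simp only [Units.val_mul, mul_pow, hneg1]; ring
  have h20 : (2 : ZMod p) ≠ 0 := by
    intro h
    have : ((2 : ℕ) : ZMod p) = 0 := by exact_mod_cast h
    rw [ZMod.natCast_eq_zero_iff] at this
    have := Nat.le_of_dvd (by norm_num) this; omega
  have hgk : (g : ZMod p) ^ k - 1 ≠ 0 := by
    intro h
    have := Nat.le_of_dvd (by omega) (hgj k (sub_eq_zero.1 h)); omega
  have hsne : 2 * ((g : ZMod p) ^ k - 1) * hat k (fun d => C.s d j1) ≠ 0 := by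
    refine mul_ne_zero (mul_ne_zero h20 hgk) ?_
    rw [hsJ]
    exact mul_ne_zero (by simpa using hb2) hG
  set V := 2 * ((g : ZMod p) ^ k - 1) * hat k (fun d => (C.v d j1 : ZMod p)) with hV
  set S := 2 * ((g : ZMod p) ^ k - 1) * hat k (fun d => C.s d j1) with hS
  have hVne : V ≠ 0 := by
    intro h
    obtain ⟨r, hr⟩ := C.lemO hh u1 hu1m hc1 (fun d => by rw [hv1, h, zero_mul])
    have e1 := (hs1 1).symm.trans (hr 1)
    have e2 := (hs1 g).symm.trans (hr g)
    simp at e1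
    rw [← e1] at e2
    have e3 : (g : ZMod p) ^ (k - 1) = 1 := by
      have : (g : ZMod p) ^ k = g ^ (k - 1) * g := by rw [← pow_succ]; congr 1; omega
      rw [this] at e2
      have hg0 := g.ne_zero
      have : S * (g : ZMod p) * (g ^ (k - 1) - 1) = 0 := by linear_combination e2
      rcases mul_eq_zero.1 this with h | h
      · exact absurd h (mul_ne_zero hsne hg0)
      · exact sub_eq_zero.1 h
    have := Nat.le_of_dvd (by omega) (hgj _ e3); omega
  have hPR : C.PR u1 := by
    obtain ⟨c, w, hw⟩ := C.primary k hk h3 hk2 hL b hb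
    set y := C.yO k b with hy
    have hyw : y = c + p * w := by linear_combination hw
    have hny : ¬ C.pO ∣ y := by
      intro h
      rw [hy, yO] at h
      obtain ⟨a, _, ha⟩ := (C.pO_prime.dvd_finsetProd_iff _).1 h
      exact C.pO_not_dvd_J b hb a (C.pO_prime.dvd_of_dvd_pow ha)
    have hnb : ∀ a, ¬ C.pO ∣ C.sgO a y := by
      intro a h
      have := dvd_sub h (C.sgO_sub a y)
      rw [sub_sub_cancel] at this
      exact hny this
    refine ⟨C.sgO g y * C.sgO (-1) y, C.sgO g (C.sgO (-1) y) * y, ?_, ?_, ?_⟩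
    · intro h
      rcases C.pO_prime.dvd_or_dvd h with h | h
      · have := dvd_sub h (C.sgO_sub g (C.sgO (-1) y))
        rw [sub_sub_cancel] at this
        exact hnb _ this
      · exact hny h
    · have e1 : C.pO ^ p ∣ (p : 𝓞 F) * C.pO := by
        obtain ⟨t, ht⟩ := C.pO_assoc.dvd
        rw [ht]
        refine ⟨t, ?_⟩
        have : C.pO ^ p = C.pO ^ (p - 1) * C.pO := by rw [← pow_succ]; congr 1; omega
        rw [this]; ring
      have e2 : C.pO ^ p ∣ (p : 𝓞 F) * p := e1.trans (mul_dvd_mul_left _ C.pO_dvd_p)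
      have hA : C.sgO g y * C.sgO (-1) y - C.sgO g (C.sgO (-1) y) * y =
          (p * (C.sgO g w - w)) * c - (p * (C.sgO g (C.sgO (-1) w) - C.sgO (-1) w)) * c
           + p * p * (C.sgO g w * C.sgO (-1) w - C.sgO g (C.sgO (-1) w) * w) := by
        rw [hyw]; simp only [map_add, map_mul, map_intCast, map_natCast]; ring
      rw [hA]
      refine dvd_add (dvd_sub ?_ ?_) (e2.mul_right _)
      · exact (e1.trans (mul_dvd_mul_left _ (C.sgO_sub g w))).mul_right _
      · exact (e1.trans (mul_dvd_mul_left _ (C.sgO_sub g _))).mul_right _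
    · have e : u1 * (C.sgu g (C.sgu (-1) Y) * Y) = C.sgu g Y * C.sgu (-1) Y := by
        rw [hu1, hu0, map_div, div_div_eq_mul_div, div_mul_eq_mul_div, div_eq_iff_eq_mul, ← mul_assoc, mul_right_comm (C.sgu g Y / _), div_mul_cancel]
      have e' := congrArg (fun x : Fˣ => (x : F)) e
      simp only [Units.val_mul, sgu_coe, hYc] at e'
      rw [cO_mul, cO_mul, sgO_coe, sgO_coe, sgO_coe]
      exact e'
  have hval : ((V⁻¹).val : ZMod p) = V⁻¹ := ZMod.natCast_zmod_val _
  refine ⟨u1 ^ (V⁻¹).val, Subgroup.pow_mem _ hu1m _, C.PR_pow hPR _, by rw [map_pow, hc1, inv_pow], V⁻¹ * S,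
    mul_ne_zero (inv_ne_zero hVne) hsne, fun d => ⟨?_, ?_⟩⟩
  · rw [v_pow]; push_cast
    rw [hval, hv1, ← mul_assoc, inv_mul_cancel₀ hVne, one_mul]
  · rw [s_pow, hval, hs1]; ring

end Cy

end

section

open NumberField IsDedekindDomain Polynomial

theorem rank_cplx {K : Type} [Field K] [NumberField K] {p : ℕ} (hp : 2 < p) {ζ : K} (hζ : IsPrimitiveRoot ζ p) :
    2 * (Units.rank K + 1) = Module.finrank ℚ K := by
  have h1 := NumberField.InfinitePlace.IsPrimitiveRoot.nrRealPlaces_eq_zero_of_two_lt hp hζ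
  have h2 := InfinitePlace.card_add_two_mul_card_eq_rank K
  have h3 := InfinitePlace.card_eq_nrRealPlaces_add_nrComplexPlaces K
  have h4 : 0 < Fintype.card (InfinitePlace K) := Fintype.card_pos
  rw [Units.rank]
  omega

/-- p-th roots in the N-adic integers -/
theorem padic_root {p N : ℕ} [Fact p.Prime] [Fact N.Prime] (hpN : p < N) (w : ℤ_[N]) (a : ZMod N) (ha : a ≠ 0)
    (h : a ^ p = PadicInt.toZMod w) : ∃ t : ℤ_[N], t ^ p = w ∧ PadicInt.toZMod t = a := by
  have hp := (Fact.out : p.Prime)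
  have hn0 : ∀ x : ℤ_[N], PadicInt.toZMod x = 0 ↔ ‖x‖ < 1 := by
    intro x
    rw [← RingHom.mem_ker, PadicInt.ker_toZMod, IsLocalRing.mem_maximalIdeal, PadicInt.mem_nonunits]
  obtain ⟨b, hb⟩ : ∃ b : ℤ_[N], PadicInt.toZMod b = a := ⟨(a.val : ℤ_[N]), by rw [map_natCast]; exact ZMod.natCast_zmod_val a⟩
  have hder : ‖(derivative (X ^ p - C w)).aeval b‖ = 1 := by
    have e : (derivative (X ^ p - C w)).aeval b = (p : ℤ_[N]) * b ^ (p - 1) := by simp [derivative_X_pow]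
    rw [e]
    refine le_antisymm (PadicInt.norm_le_one _) (not_lt.1 ?_)
    rw [← hn0, map_mul, map_pow, map_natCast, hb]
    refine mul_ne_zero ?_ (pow_ne_zero _ ha)
    rw [Ne, ZMod.natCast_eq_zero_iff]
    intro hc
    have := Nat.le_of_dvd hp.pos hc; omega
  obtain ⟨t, h1, h2, -⟩ := hensels_lemma (F := X ^ p - C w) (a := b) (by
    rw [hder, one_pow, ← hn0]
    simp [hb, h])
  refine ⟨t, ?_, ?_⟩
  · simpa [sub_eq_zero] using h1
  · rw [hder, ← hn0, map_sub, hb, sub_eq_zero] at h2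
    exact h2

theorem exists_Cy {p N : ℕ} [hp : Fact p.Prime] [hN : Fact N.Prime] (hp5 : 5 ≤ p) (hmod : N % p = 1) (F : Type) [Field F] [NumberField F]
    [hc : IsCyclotomicExtension {p} ℚ F] : Nonempty (Cy p N F) := by
  have hd : p ∣ N - 1 := (Nat.modEq_iff_dvd' hN.out.one_le).1 (by
    rw [Nat.ModEq, hmod, Nat.mod_eq_of_lt (by omega)])
  have hpN : p < N := by
    have := Nat.le_of_dvd (by have := hN.out.two_le; omega) hd
    have := hN.out.two_le; omega
  obtain ⟨g, hg⟩ := IsCyclic.exists_generator (α := (ZMod N)ˣ)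
  have hgo : orderOf g = N - 1 := by
    rw [orderOf_eq_card_of_forall_mem_zpowers hg, Nat.card_eq_fintype_card, ZMod.card_units]
  obtain ⟨q, hq⟩ := hd
  have hz : IsPrimitiveRoot (g ^ q) p := (hgo ▸ IsPrimitiveRoot.orderOf g).pow (by have := hN.out.two_le; omega) (by rw [hq, mul_comm])
  have hz' : IsPrimitiveRoot ((g ^ q : (ZMod N)ˣ) : ZMod N) p := IsPrimitiveRoot.coe_units_iff.2 hz
  obtain ⟨Z, h1, h2⟩ := padic_root hpN (1 : ℤ_[N]) ((g ^ q : (ZMod N)ˣ) : ZMod N) (Units.ne_zero _) (by rw [hz'.pow_eq_one, map_one])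
  let B : Bs p N := ⟨hp5, hmod, _, hz'⟩
  exact ⟨⟨B, hc, IsCyclotomicExtension.zeta p ℚ F, IsCyclotomicExtension.zeta_spec p ℚ F, Z, h1, h2⟩⟩

theorem exists_KD {p : ℕ} (hp : p.Prime) (hp5 : 5 ≤ p) {F : Type} [Field F] [NumberField F] {ζ : F} (hζ : IsPrimitiveRoot ζ p)
    (u : Fˣ) (hu : ∀ b : F, b ^ p ≠ u) :
    ∃ (M : Type) (_ : Field M) (_ : NumberField M) (_ : Algebra F M) (D : KD p F M), D.u = u ∧ D.ζ = ζ := by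
  have hirr : Irreducible (X ^ p - C (u : F)) := X_pow_sub_C_irreducible_of_prime hp hu
  have : Fact (Irreducible (X ^ p - C (u : F))) := ⟨hirr⟩
  let M := AdjoinRoot (X ^ p - C (u : F))
  have hmon : (X ^ p - C (u : F)).Monic := monic_X_pow_sub_C _ hp.ne_zero
  let pb : PowerBasis F M := AdjoinRoot.powerBasis hirr.ne_zero
  have hfd : FiniteDimensional F M := pb.finite
  have hdeg : Module.finrank F M = p := by
    rw [pb.finrank, AdjoinRoot.powerBasis_dim, natDegree_X_pow_sub_C]
  have hc0 : CharZero M := charZero_of_injective_algebraMap (algebraMap F M).injective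
  have hnf : NumberField M := @NumberField.mk _ _ hc0 (FiniteDimensional.trans ℚ F M)
  have hr : (AdjoinRoot.root (X ^ p - C (u : F))) ^ p = algebraMap F M u := by
    have := AdjoinRoot.eval₂_root (X ^ p - C (u : F))
    rw [eval₂_sub, eval₂_X_pow, eval₂_C, sub_eq_zero] at this
    exact this
  have hr0 : AdjoinRoot.root (X ^ p - C (u : F)) ≠ 0 := by
    intro h
    rw [h, zero_pow hp.ne_zero] at hr
    exact u.ne_zero ((algebraMap F M).injective (by rw [← hr, map_zero]))
  let θ : Mˣ := Units.mk0 _ hr0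
  have hζM : (algebraMap F M ζ) ^ p = 1 := by rw [← map_pow, hζ.pow_eq_one, map_one]
  have hev : (X ^ p - C (u : F)).eval₂ (Algebra.ofId F M).toRingHom (algebraMap F M ζ * (θ : M)) = 0 := by
    have : (algebraMap F M ζ * (θ : M)) ^ p = algebraMap F M u := by rw [mul_pow, hζM, one_mul]; exact hr
    rw [eval₂_sub, eval₂_X_pow, eval₂_C, this, sub_eq_zero]; rfl
  let f : M →ₐ[F] M := AdjoinRoot.liftAlgHom _ (Algebra.ofId F M) (algebraMap F M ζ * θ) hev
  have hfb : Function.Bijective f := Algebra.IsAlgebraic.algHom_bijective f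
  refine ⟨M, inferInstance, hnf, inferInstance, ⟨hp, hp5, ζ, hζ, θ, u, ?_, hdeg, AlgEquiv.ofBijective f hfb, ?_⟩, rfl, rfl⟩
  · ext; exact hr
  · change f (AdjoinRoot.root (X ^ p - C (u : F))) = _
    exact AdjoinRoot.lift_root hev

namespace Cy
variable {p N : ℕ} [hpF : Fact p.Prime] [hNF : Fact N.Prime] {F : Type} [Field F] [NumberField F] (C : Cy p N F)
  {M : Type} [Field M] [NumberField M] [Algebra F M]

theorem rankF (C : Cy p N F) : 2 * (Units.rank F + 1) = p - 1 := by
  have := C.hcyc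
  rw [rank_cplx (by have := C.hp5; omega) C.hζ, IsCyclotomicExtension.finrank F (irr_cyc (p := p)), Nat.totient_prime hpF.out]

theorem rankM (C : Cy p N F) (D : KD p F M) : 2 * (Units.rank M + 1) = (p - 1) * p := by
  have := C.hcyc
  have := D.finDim
  have h : IsPrimitiveRoot (algebraMap F M C.ζ) p := C.hζ.map_of_injective (algebraMap F M).injective
  rw [rank_cplx (by have := C.hp5; omega) h, ← Module.finrank_mul_finrank ℚ F M, D.hdeg,
    IsCyclotomicExtension.finrank F (irr_cyc (p := p)), Nat.totient_prime hpF.out]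

theorem zO_sub (D : KD p F M) (hζ : D.ζ = C.ζ) (x : F) :
    D.σ (algebraMap F M x * D.θ) - algebraMap F M x * D.θ = algebraMap F M (C.pO : F) * (algebraMap F M x * D.θ) := by
  rw [map_mul, D.σ.commutes, D.hσ, hζ]
  have : (C.pO : F) = C.ζ - 1 := rfl
  rw [this, map_sub, map_one]; ring

theorem isInt_of_pow (D : KD p F M) (x : M) (a : 𝓞 F) (h : x ^ p = algebraMap F M (a : F)) : IsIntegral ℤ x := by
  apply IsIntegral.of_pow D.hp.pos
  rw [h]
  exact (RingOfIntegers.isIntegral_coe a).map (algebraMap F M).toIntAlgHom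

theorem urat_a (D : KD p F M) (hζ : D.ζ = C.ζ) (q : HeightOneSpectrum (𝓞 F)) (hq : (p : 𝓞 F) ∉ q.asIdeal) (hu : ord q D.u = 0) :
    KD.URat p F M q := by
  obtain ⟨a, b, ha, hb, hab⟩ := exists_frac q D.u hu
  have hpow : (algebraMap F M (b : F) * (D.θ : M)) ^ p = algebraMap F M ((b ^ (p - 1) * a : 𝓞 F) : F) := by
    have hθ : (D.θ : M) ^ p = algebraMap F M D.u := by
      have := congrArg (fun x : Mˣ => (x : M)) D.hu; simpa using this
    rw [mul_pow, hθ, ← map_pow, ← map_mul, cO_mul, cO_pow, ← hab]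
    congr 1
    have : (b : F) ^ p = b ^ (p - 1) * b := by rw [← pow_succ]; congr 1; have := C.hp5; omega
    rw [this]; ring
  let β : 𝓞 M := ⟨algebraMap F M (b : F) * D.θ, isInt_of_pow D _ _ hpow⟩
  refine D.urat_of_beta q β ?_
  intro Q hQ
  have e : RingOfIntegers.mapRingHom (D.σ.toRingEquiv : M →+* M) β - β = algebraMap (𝓞 F) (𝓞 M) C.pO * β := by
    apply RingOfIntegers.ext
    exact C.zO_sub D hζ b
  have hβp : β ^ p = algebraMap (𝓞 F) (𝓞 M) (b ^ (p - 1) * a) := by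
    apply RingOfIntegers.ext
    rw [cO_pow]; exact hpow
  rw [e]
  intro h
  rcases Q.isPrime.mem_or_mem h with h | h
  · have h1 := (liesOver_mem_iff hQ _).1 h
    apply hq
    obtain ⟨t, ht⟩ := C.pO_dvd_p
    rw [ht]; exact Ideal.mul_mem_right _ _ h1
  · have h1 : β ^ p ∈ Q.asIdeal := Ideal.pow_mem_of_mem _ h _ hpF.out.pos
    rw [hβp, liesOver_mem_iff hQ] at h1
    rcases q.isPrime.mem_or_mem h1 with h | h
    · exact hb (q.isPrime.mem_of_pow_mem _ h)
    · exact ha h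

theorem urat_b (D : KD p F M) (hζ : D.ζ = C.ζ) (hu : C.PR D.u) : KD.URat p F M C.lam := by
  obtain ⟨A, B, hB, hAB, hx⟩ := hu
  have hp5 := C.hp5
  have hθ : (D.θ : M) ^ p = algebraMap F M D.u := by
    have := congrArg (fun x : Mˣ => (x : M)) D.hu; simpa using this
  have hpow : (algebraMap F M (B : F) * (D.θ : M)) ^ p = algebraMap F M ((B ^ (p - 1) * A : 𝓞 F) : F) := by
    rw [mul_pow, hθ, ← map_pow, ← map_mul, cO_mul, cO_pow, ← hx]
    congr 1
    have : (B : F) ^ p = B ^ (p - 1) * B := by rw [← pow_succ]; congr 1; omega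
    rw [this]; ring
  let b0 : 𝓞 M := ⟨algebraMap F M (B : F) * D.θ, isInt_of_pow D _ _ hpow⟩
  have hb0p : b0 ^ p = algebraMap (𝓞 F) (𝓞 M) (B ^ (p - 1) * A) := by
    apply RingOfIntegers.ext
    rw [cO_pow]; exact hpow
  set π := algebraMap F M (C.pO : F) with hπ
  have hπ0 : π ≠ 0 := by
    rw [hπ, Ne, map_eq_zero, RingOfIntegers.coe_eq_zero_iff]; exact C.pO_prime.ne_zero
  set Bm := algebraMap F M (B : F) with hBm
  let β : M := (Bm * D.θ - Bm) / π
  have hβ : π * β + Bm = Bm * D.θ := by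
    simp only [β]; rw [mul_div_cancel₀ _ hπ0]; ring
  have hc : ∀ k, k < p → ∃ c : 𝓞 F, C.pO ^ p * c = if k = 0 then B ^ p - B ^ (p - 1) * A else
      C.pO ^ k * B ^ (p - k) * (p.choose k : 𝓞 F) := by
    intro k hk
    split_ifs with h
    · obtain ⟨t, ht⟩ := hAB
      refine ⟨- (B ^ (p - 1) * t), ?_⟩
      have : B ^ p = B ^ (p - 1) * B := by rw [← pow_succ]; congr 1; omega
      rw [this]; linear_combination (B ^ (p - 1)) * ht
    · obtain ⟨t, ht⟩ := C.pO_assoc.dvd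
      obtain ⟨r, hr⟩ := hpF.out.dvd_choose_self h hk
      rw [hr, Nat.cast_mul, ht]
      have : C.pO ^ p = C.pO ^ (p - 1) * C.pO := by rw [← pow_succ]; congr 1; omega
      have h2 : C.pO ^ k = C.pO * C.pO ^ (k - 1) := by rw [← pow_succ']; congr 1; omega
      rw [this, h2]
      exact ⟨C.pO ^ (k - 1) * B ^ (p - k) * t * r, by ring⟩
  choose! c hc using hc
  have hintg : IsIntegral ℤ β := by
    have : IsIntegral (𝓞 F) β := by
      refine ⟨X ^ p + ∑ k ∈ Finset.range p, Polynomial.C (c k) * X ^ k, ?_, ?_⟩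
      · apply monic_X_pow_add
        refine (degree_sum_le _ _).trans_lt ?_
        rw [Finset.sup_lt_iff (by exact WithBot.bot_lt_coe p)]
        intro k hk
        exact (degree_C_mul_X_pow_le _ _).trans_lt (by exact_mod_cast Finset.mem_range.1 hk)
      · rw [eval₂_add, eval₂_X_pow, eval₂_finsetSum]
        have e1 := add_pow (π * β) Bm p
        rw [hβ, hpow, Finset.sum_range_succ, ← Finset.sum_range_add_sum_Ico _ (show 1 ≤ p by omega)] at e1
        have e2 : π ^ p * (β ^ p + ∑ k ∈ Finset.range p, eval₂ (algebraMap (𝓞 F) M) β (Polynomial.C (c k) * X ^ k)) = 0 := by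
          have e3 : ∀ k, k < p → π ^ p * eval₂ (algebraMap (𝓞 F) M) β (Polynomial.C (c k) * X ^ k) =
             algebraMap (𝓞 F) M (if k = 0 then B ^ p - B ^ (p - 1) * A else C.pO ^ k * B ^ (p - k) * (p.choose k : 𝓞 F)) * β ^ k := by
            intro k hk
            rw [← hc k hk, eval₂_mul, eval₂_C, eval₂_X_pow, map_mul, map_pow, ← mul_assoc]; rfl
          rw [mul_add, Finset.mul_sum, Finset.sum_congr rfl (fun k hk => e3 k (Finset.mem_range.1 hk)),
            ← Finset.sum_range_add_sum_Ico _ (show 1 ≤ p by omega)]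
          have e4 : ∑ k ∈ Finset.Ico 1 p, algebraMap (𝓞 F) M (if k = 0 then B ^ p - B ^ (p - 1) * A else C.pO ^ k * B ^ (p - k) * (p.choose k : 𝓞 F)) * β ^ k
            = ∑ k ∈ Finset.Ico 1 p, (π * β) ^ k * Bm ^ (p - k) * (p.choose k : M) := by
            apply Finset.sum_congr rfl
            intro k hk
            rw [if_neg (by have := Finset.mem_Ico.1 hk; omega)]
            simp only [map_mul, map_pow, map_natCast]
            rw [mul_pow]
            change π ^ k * Bm ^ (p - k) * _ * β ^ k = _
            ring
          rw [e4]
          simp only [Finset.sum_range_one, if_true, map_sub, pow_zero, mul_one, one_mul, Nat.choose_zero_right, Nat.cast_one,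
            Nat.choose_self, Nat.sub_self, Nat.sub_zero, map_pow] at e1 ⊢
          have e5 : algebraMap (𝓞 F) M (B ^ (p - 1) * A) = algebraMap F M ((B ^ (p - 1) * A : 𝓞 F) : F) := rfl
          have e6 : algebraMap (𝓞 F) M B = Bm := rfl
          rw [e5, e1, e6, mul_pow]
          ring
        exact (mul_eq_zero.1 e2).resolve_left (pow_ne_zero _ hπ0)
    exact isIntegral_trans (R := ℤ) (A := 𝓞 F) β this
  refine D.urat_of_beta C.lam ⟨β, hintg⟩ ?_
  intro Q hQ
  have e : RingOfIntegers.mapRingHom (D.σ.toRingEquiv : M →+* M) ⟨β, hintg⟩ - ⟨β, hintg⟩ = b0 := by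
    apply RingOfIntegers.ext
    change D.σ β - β = Bm * D.θ
    have h1 := C.zO_sub D hζ B
    have h2 : π * (D.σ β - β) = π * (Bm * D.θ) := by
      rw [← h1]
      have h3 : D.σ (π * β + Bm) = D.σ (Bm * D.θ) := by rw [hβ]
      have h4 : D.σ π = π := D.σ.commutes _
      have h5 : D.σ Bm = Bm := D.σ.commutes _
      rw [map_add, map_mul, h4, h5] at h3
      rw [← h3, ← hβ]; ring
    exact mul_left_cancel₀ hπ0 h2
  rw [e]
  intro h
  have h1 : b0 ^ p ∈ Q.asIdeal := Ideal.pow_mem_of_mem _ h _ hpF.out.pos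
  rw [hb0p, liesOver_mem_iff hQ] at h1
  rcases C.lam.isPrime.mem_or_mem h1 with h | h
  · exact hB ((C.mem_lam _).1 (C.lam.isPrime.mem_of_pow_mem _ h))
  · apply hB
    have h2 := (C.mem_lam _).1 h
    have h3 : C.pO ∣ A - B := (dvd_pow_self _ hpF.out.ne_zero).trans hAB
    have := dvd_sub h2 h3
    rwa [sub_sub_cancel] at this

theorem urat_all (D : KD p F M) (hζ : D.ζ = C.ζ) (hu : C.PR D.u) (hm : D.u ∈ EE F N) (q : HeightOneSpectrum (𝓞 F)) (hq : (N : 𝓞 F) ∉ q.asIdeal) :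
    KD.URat p F M q := by
  by_cases h : (p : 𝓞 F) ∈ q.asIdeal
  · rw [C.eq_lam q h]; exact C.urat_b D hζ hu
  · exact C.urat_a D hζ q h ((mem_EE_iff hNF.out.ne_zero).1 hm q hq)

end Cy

end

section

open Finset NumberField

theorem vander {p : ℕ} [hpF : Fact p.Prime] (g : (ZMod p)ˣ) (hg : orderOf g = p - 1) (B : Finset ℕ) (hB : ∀ j ∈ B, j < p - 1) (c : ℕ → ZMod p)
    (h : ∀ i < B.card, ∑ j ∈ B, c j * ((g ^ i : (ZMod p)ˣ) : ZMod p) ^ j = 0) : ∀ j ∈ B, c j = 0 := by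
  let e := B.orderIsoOfFin rfl
  let f : Fin B.card → ZMod p := fun i => ((g ^ ((e i : ℕ)) : (ZMod p)ˣ) : ZMod p)
  have hf : Function.Injective f := by
    intro i i' hii
    have h1 := Units.ext hii
    have h2 := pow_injOn_Iio_orderOf (x := g) (by rw [hg]; exact hB _ (e i).2) (by rw [hg]; exact hB _ (e i').2) h1
    exact e.injective (Subtype.ext h2)
  have hv := Matrix.eq_zero_of_forall_pow_sum_mul_pow_eq_zero (f := f) (v := fun i => c (e i)) hf (by
    intro i
    rw [← h i i.2, ← Finset.sum_coe_sort B, ← Equiv.sum_comp e.toEquiv (fun j : B => c j * ((g ^ (i : ℕ) : (ZMod p)ˣ) : ZMod p) ^ (j : ℕ))]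
    apply sum_congr rfl
    intro j _
    simp only [f]
    push_cast
    rw [← pow_mul, ← pow_mul, mul_comm (i : ℕ)]; rfl)
  intro j hj
  have := congrFun hv (e.symm ⟨j, hj⟩)
  simpa using this

theorem exists_gpow {p : ℕ} [hpF : Fact p.Prime] : ∃ g : (ZMod p)ˣ, orderOf g = p - 1 := by
  obtain ⟨g, hg⟩ := IsCyclic.exists_generator (α := (ZMod p)ˣ)
  exact ⟨g, by rw [orderOf_eq_card_of_forall_mem_zpowers hg, Nat.card_eq_fintype_card, ZMod.card_units]⟩

/-- Fourier inversion -/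
theorem hat_inv {p : ℕ} [hpF : Fact p.Prime] (f : (ZMod p)ˣ → ZMod p) (d : (ZMod p)ˣ) :
    f d = - ∑ j ∈ range (p - 1), hat j f * (d : ZMod p) ^ j := by
  have hkey : ∀ x : (ZMod p)ˣ, ∑ j ∈ range (p - 1), (x : ZMod p) ^ j = if x = 1 then -1 else 0 := by
    intro x
    split_ifs with h
    · rw [h]; simp [Nat.cast_sub hpF.out.one_le]
    · have h1 : (x : ZMod p) ≠ 1 := fun hc => h (Units.ext hc)
      rw [geom_sum_eq h1, ZMod.pow_card_sub_one_eq_one x.ne_zero]; simp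
  have : ∑ j ∈ range (p - 1), hat j f * (d : ZMod p) ^ j = ∑ e : (ZMod p)ˣ, f e * ∑ j ∈ range (p - 1), ((e⁻¹ * d : (ZMod p)ˣ) : ZMod p) ^ j := by
    simp_rw [hat, sum_mul, mul_sum]
    rw [sum_comm]
    apply sum_congr rfl; intro e _
    apply sum_congr rfl; intro j _
    rw [Units.val_mul, mul_pow]; ring
  rw [this]
  simp_rw [hkey]
  have h2 : ∀ e : (ZMod p)ˣ, (e⁻¹ * d = 1) = (e = d) := by
    intro e; rw [inv_mul_eq_one]
  simp_rw [h2]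
  simp

theorem hat_even_odd {p : ℕ} [hpF : Fact p.Prime] (hp2 : p ≠ 2) (f : (ZMod p)ˣ → ZMod p) (hf : ∀ d, f (-d) = f d) (j : ℕ) (hj : Odd j) : hat j f = 0 := by
  have h := hat_shift j f (-1)
  have : (fun d => f (d * -1)) = f := by ext d; rw [mul_neg_one, hf]
  rw [this, Units.val_neg, Units.val_one, hj.neg_one_pow] at h
  have h2 : (2 : ZMod p) ≠ 0 := by
    intro h0
    have : ((2:ℕ) : ZMod p) = 0 := by exact_mod_cast h0
    rw [ZMod.natCast_eq_zero_iff] at this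
    exact hp2 ((Nat.prime_dvd_prime_iff_eq hpF.out Nat.prime_two).1 this)
  have h3 : 2 * hat j f = 0 := by linear_combination h
  exact (mul_eq_zero.1 h3).resolve_left h2

namespace Cy
variable {p N : ℕ} [hpF : Fact p.Prime] [hNF : Fact N.Prime] {F : Type} [Field F] [NumberField F] (C : Cy p N F)

theorem cyc_unit (g : (ZMod p)ˣ) : ∃ y ∈ (unitsHom F).range, ∀ d : (ZMod p)ˣ, C.s d y = C.Lf ((d * g : (ZMod p)ˣ) : ZMod p) - C.Lf d := by
  have hcop : (g : ZMod p).val.Coprime p := ZMod.val_coe_unit_coprime g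
  have hp5 := C.hp5
  obtain ⟨e, he⟩ := (C.hζ.toInteger_isPrimitiveRoot).associated_sub_one_pow_sub_one_of_coprime hcop
  refine ⟨unitsHom F e, ⟨e, rfl⟩, ?_⟩
  intro d
  have hne : C.ph d (e : 𝓞 F) ≠ 0 := (e.isUnit.map (C.ph d)).ne_zero
  rw [(C.vs_of_ph d _ (e : 𝓞 F) rfl hne).2]
  have h1 := congrArg (C.ph d) he
  have h2 : C.ph d (C.hζ.toInteger) = C.z ^ (d : ZMod p).val := C.ph_zeta d
  rw [map_mul, map_sub, map_sub, map_pow, h2, map_one, ← pow_mul, ← C.z_pow_mod (_ * _)] at h1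
  have h3 : (((d : ZMod p).val * (g : ZMod p).val : ℕ) : ZMod p) = ((d * g : (ZMod p)ˣ) : ZMod p) := by simp
  rw [h3] at h1
  have n1 := C.z_pow_ne_one d.ne_zero
  have n2 := C.z_pow_ne_one (d * g).ne_zero
  have h4 := congrArg C.ind h1
  rw [← neg_sub 1, ← neg_sub 1 (C.z ^ ((d * g : (ZMod p)ˣ) : ZMod p).val), C.ind_mul (neg_ne_zero.2 n1) hne, C.ind_neg n1, C.ind_neg n2] at h4
  rw [Bs.Lf, Bs.Lf, ← h4]; ring

theorem hat_cyc (j : ℕ) (hj : 0 < j) (hj2 : j < p - 1) (hL : hat j (fun d => C.Lf d) ≠ 0) :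
    ∃ y ∈ (unitsHom F).range, hat j (fun d => C.s d y) ≠ 0 := by
  obtain ⟨g, hg⟩ := exists_gpow (p := p)
  obtain ⟨y, hy, h⟩ := C.cyc_unit g
  refine ⟨y, hy, ?_⟩
  have e : hat j (fun d => C.s d y) = ((g : ZMod p) ^ j - 1) * hat j (fun d => C.Lf d) := by
    simp_rw [h]
    rw [hat_sub, hat_shift j (fun d : (ZMod p)ˣ => C.Lf d) g]; ring
  rw [e]
  refine mul_ne_zero (fun h0 => ?_) hL
  rw [sub_eq_zero] at h0
  have h1 : g ^ j = 1 := Units.ext (by push_cast; exact h0)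
  have := Nat.le_of_dvd hj (orderOf_dvd_of_pow_eq_one h1)
  omega

theorem hat_Lf (k j : ℕ) (hj : k + j = p) (hk : 1 ≤ k) : ∑ c : (ZMod p)ˣ, (c : ZMod p) ^ (k - 1) * C.Lf c = hat j (fun d => C.Lf d) := by
  unfold hat
  apply sum_congr rfl
  intro c _
  congr 1
  have h1 : (c : ZMod p) ^ (k - 1) * (c : ZMod p) ^ j = 1 := by
    rw [← pow_add, show k - 1 + j = p - 1 by omega]; exact ZMod.pow_card_sub_one_eq_one c.ne_zero
  rw [← mul_left_inj' (pow_ne_zero j c.ne_zero), h1, ← mul_pow, Units.inv_mul, one_pow]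
end Cy

end

section

open NumberField IsDedekindDomain

/-- reduction map attached to an N-adic embedding -/
theorem padic_red {N : ℕ} [hNF : Fact N.Prime] {M : Type} [Field M] [NumberField M] (e : M →+* ℚ_[N]) :
    ∃ f : 𝓞 M →+* ZMod N, ∀ (x : 𝓞 M) (w : ℤ_[N]), e (x : M) = (w : ℚ_[N]) → f x = PadicInt.toZMod w := by
  have hle : ∀ x : 𝓞 M, ‖e (x : M)‖ ≤ 1 := by
    intro x
    have h1 : IsIntegral ℤ (e (x : M)) := (RingOfIntegers.isIntegral_coe x).map e.toIntAlgHom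
    have h2 : IsIntegral ℤ_[N] (e (x : M)) := h1.tower_top
    obtain ⟨w, hw⟩ := IsIntegrallyClosed.isIntegral_iff.1 h2
    rw [← hw]
    exact w.2
  let E : 𝓞 M →+* ℤ_[N] :=
    { toFun := fun x => ⟨e (x : M), hle x⟩
      map_one' := Subtype.ext (by simp)
      map_zero' := Subtype.ext (by simp)
      map_mul' := fun a b => Subtype.ext (by simp; rfl)
      map_add' := fun a b => Subtype.ext (by simp; rfl) }
  refine ⟨PadicInt.toZMod.comp E, ?_⟩
  intro x w h
  rw [RingHom.comp_apply]
  congr 1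
  exact Subtype.ext h

namespace Cy
variable {p N : ℕ} [hpF : Fact p.Prime] [hNF : Fact N.Prime] {F : Type} [Field F] [NumberField F] (C : Cy p N F)
  {M : Type} [Field M] [NumberField M] [Algebra F M]

/-- totally split primes -/
theorem split_primes (D : KD p F M) (d : (ZMod p)ˣ) (hv : (p : ℤ) ∣ C.v d D.u) (hs : C.s d D.u = 0) :
    ∃ Q : Fin p → HeightOneSpectrum (𝓞 M), Function.Injective Q ∧
      ∀ i, (Q i).asIdeal.LiesOver (C.nn d).asIdeal := by
  obtain ⟨m, hm⟩ := hv
  obtain ⟨w, hw⟩ := C.io_form d D.u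
  have hind : C.ind (PadicInt.toZMod (w : ℤ_[N])) = 0 := by rw [← C.s_form d D.u _ w hw, hs]
  obtain ⟨a, ha⟩ := C.isPth_of_ind (toZMod_unit_ne w) hind
  have ha0 : a ≠ 0 := by
    rintro rfl
    rw [zero_pow hpF.out.ne_zero] at ha
    exact toZMod_unit_ne w ha.symm
  obtain ⟨t, ht, hta⟩ := padic_root C.p_lt (w : ℤ_[N]) a ha0 ha
  have hN0 : (N : ℚ_[N]) ≠ 0 := Nat.cast_ne_zero.2 hNF.out.ne_zero
  have hlift : ∀ i : Fin p, ∃ e : M →+* ℚ_[N], (∀ f, e (algebraMap F M f) = C.io d f) ∧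
      e D.θ = (C.Z : ℚ_[N]) ^ (i : ℕ) * ((N : ℚ_[N]) ^ m * (t : ℚ_[N])) := by
    intro i
    apply D.exists_lift ((C.io d : F →ₐ[ℚ] ℚ_[N]) : F →+* ℚ_[N])
    have hZ : (C.Z : ℚ_[N]) ^ p = 1 := by exact_mod_cast congrArg (fun x : ℤ_[N] => (x : ℚ_[N])) C.hZ
    have ht' : (t : ℚ_[N]) ^ p = (w : ℤ_[N]) := by exact_mod_cast congrArg (fun x : ℤ_[N] => (x : ℚ_[N])) ht
    rw [mul_pow, mul_pow, ← pow_mul, mul_comm (i : ℕ), pow_mul, hZ, one_pow, one_mul, ht', ← zpow_natCast, ← zpow_mul, mul_comm m, ← hm]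
    exact hw.symm
  choose e he1 he2 using hlift
  choose f hf using fun i => padic_red (e i)
  have hfF : ∀ i (x : 𝓞 F), f i (algebraMap (𝓞 F) (𝓞 M) x) = C.ph d x := by
    intro i x
    rw [hf i _ (C.iO d x)]
    · rfl
    · exact he1 i x
  let Q : Fin p → HeightOneSpectrum (𝓞 M) := fun i =>
    { asIdeal := RingHom.ker (f i)
      isPrime := RingHom.ker_isPrime _
      ne_bot := by
        intro h
        have : ((N : ℕ) : 𝓞 M) ∈ RingHom.ker (f i) := by
          rw [RingHom.mem_ker]; simp
        rw [h, Ideal.mem_bot] at this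
        exact hNF.out.ne_zero (by exact_mod_cast this) }
  refine ⟨Q, ?_, ?_⟩
  · -- the separating element
    let n : Fˣ := Units.mk0 (N : F) N_ne
    let y : Fˣ := D.u * (n ^ (p * m))⁻¹
    have hvy : C.v d y = 0 := by
      rw [v_mul, v_inv, v_zpow, (C.vs_N d n rfl).1, hm]; ring
    have hoy : ord (C.nn d) y = 0 := by rw [C.ord_eq d y n rfl, hvy, zero_mul]
    obtain ⟨A, b, hA, hb, hAb⟩ := exists_frac (C.nn d) y hoy
    let x : M := algebraMap F M (b : F) * (D.θ * (algebraMap F M (N : F)) ^ (-m))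
    have hx : x ^ p = algebraMap F M ((b ^ (p - 1) * A : 𝓞 F) : F) := by
      have hyc : (y : F) = D.u * ((N : F) ^ (p * m))⁻¹ := by simp [y, n]
      simp only [x]
      rw [mul_pow, mul_pow, D.theta_pow, ← zpow_natCast (_ ^ (-m)), ← zpow_mul, ← map_zpow₀, ← map_pow, ← map_mul, ← map_mul, cO_mul, cO_pow, ← hAb, hyc]
      congr 1
      have h1 : (b : F) ^ p = b ^ (p - 1) * b := by rw [← pow_succ]; congr 1; have := hpF.out.pos; omega
      rw [h1, show -m * (p : ℤ) = - (p * m) by ring, zpow_neg]; ring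
    let X : 𝓞 M := ⟨x, isInt_of_pow D _ _ hx⟩
    have hfX : ∀ i, f i X = C.ph d b * (C.z ^ (i : ℕ) * a) := by
      intro i
      rw [hf i X (C.iO d b * (C.Z ^ (i : ℕ) * t))]
      · rw [map_mul, map_mul, map_pow, C.hZz, hta]; rfl
      · change e i (algebraMap F M (b : F) * (D.θ * (algebraMap F M (N : F)) ^ (-m))) = _
        rw [map_mul, map_mul, map_zpow₀, he1, he1, he2]
        have : ((C.iO d b : ℤ_[N]) : ℚ_[N]) = C.io d (b : F) := rfl
        push_cast
        rw [this, map_natCast]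
        have h2 : (N : ℚ_[N]) ^ m * (N : ℚ_[N]) ^ (-m) = 1 := by rw [← zpow_add₀ hN0]; simp
        linear_combination (C.io d (b : F)) * (C.Z : ℚ_[N]) ^ (i : ℕ) * (t : ℚ_[N]) * h2
    intro i j hij
    have hker : RingHom.ker (f i) = RingHom.ker (f j) := congrArg HeightOneSpectrum.asIdeal hij
    have h1 : X - ((f i X).val : ℕ) ∈ RingHom.ker (f i) := by
      rw [RingHom.mem_ker, map_sub, map_natCast, ZMod.natCast_zmod_val, sub_self]
    rw [hker, RingHom.mem_ker, map_sub, map_natCast, ZMod.natCast_zmod_val, hfX, hfX, sub_eq_zero] at h1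
    have h2 := mul_right_cancel₀ ha0 (mul_left_cancel₀ (show C.ph d b ≠ 0 from hb) h1)
    have h3 := C.hz.pow_inj j.2 i.2 h2
    exact (Fin.ext h3).symm
  · intro i
    refine ⟨?_⟩
    ext x
    change _ ↔ f i (algebraMap (𝓞 F) (𝓞 M) x) = 0
    rw [hfF]; rfl

end Cy

end

section

open NumberField IsDedekindDomain

namespace Cy
variable {p N : ℕ} [hpF : Fact p.Prime] [hNF : Fact N.Prime] {F : Type} [Field F] [NumberField F] (C : Cy p N F)
  {M : Type} [Field M] [NumberField M] [Algebra F M]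

theorem ph_sgO (d a : (ZMod p)ˣ) (x : 𝓞 F) : C.ph d (C.sgO a x) = C.ph (d * a) x := by
  have : C.iO d (C.sgO a x) = C.iO (d * a) x := by
    apply Subtype.ext
    rw [iO_coe, iO_coe, sgO_coe, io_sg]
  exact congrArg PadicInt.toZMod this

theorem sg_neg_zeta : C.sg (-1) C.ζ = C.ζ⁻¹ := by
  have h0 : C.ζ ≠ 0 := C.hζ.ne_zero hpF.out.ne_zero
  have h1 : C.ζ ^ (p - 1) * C.ζ = 1 := by
    rw [← pow_succ, Nat.sub_add_cancel hpF.out.one_le, C.hζ.pow_eq_one]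
  have hp := hpF.out.two_le
  have h2 : (((-1 : (ZMod p)ˣ) : ZMod p)).val = p - 1 := by
    rw [Units.val_neg, Units.val_one]
    obtain ⟨n, hn⟩ : ∃ n, p = n + 1 := ⟨p - 1, by omega⟩
    subst hn
    rw [ZMod.val_neg_one]; rfl
  rw [sg_zeta, h2]
  exact eq_inv_of_mul_eq_one_left h1

theorem exists_tau (D : KD p F M) (hζ : D.ζ = C.ζ) (hc : C.sgu (-1) D.u = D.u⁻¹) :
    ∃ τ : M ≃+* M, (∀ x, τ (D.σ x) = D.σ (τ x)) ∧ (∀ x, τ (τ x) = x) ∧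
      (∀ f, τ (algebraMap F M f) = algebraMap F M (C.sg (-1) f)) ∧
      (∀ (φ : M →+* ℂ) (x : M), φ (τ x) = (starRingEnd ℂ) (φ x)) := by
  have hcu : C.sg (-1) (D.u : F) = (D.u : F)⁻¹ := by
    rw [← sgu_coe, hc, Units.val_inv_eq_inv_val]
  have hcc : ∀ f, C.sg (-1) (C.sg (-1) f) = f := by
    intro f; rw [← sg_mul, neg_mul_neg, one_mul, sg_one]
  obtain ⟨τ, h1, h2⟩ := D.exists_aut (C.sg (-1)).toRingEquiv ((D.θ : M)⁻¹) (by
    rw [inv_pow, D.theta_pow, ← map_inv₀]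
    congr 1
    exact hcu.symm)
  have h1 : ∀ f, τ (algebraMap F M f) = algebraMap F M (C.sg (-1) f) := h1
  refine ⟨τ, ?_, ?_, h1, ?_⟩
  · have := D.hom_ext ((τ : M →+* M).comp (D.σ.toRingEquiv : M →+* M)) ((D.σ.toRingEquiv : M →+* M).comp (τ : M →+* M))
      (by
        intro f
        change τ (D.σ (algebraMap F M f)) = D.σ (τ (algebraMap F M f))
        rw [D.σ.commutes, h1, D.σ.commutes])
      (by
        change τ (D.σ D.θ) = D.σ (τ D.θ)
        rw [h2, D.hσ, map_mul, h1, h2, hζ, sg_neg_zeta, map_inv₀, map_inv₀, D.hσ, hζ, mul_inv])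
    intro x
    exact DFunLike.congr_fun this x
  · have := D.hom_ext ((τ : M →+* M).comp (τ : M →+* M)) (RingHom.id M)
      (by
        intro f
        change τ (τ (algebraMap F M f)) = algebraMap F M f
        rw [h1, h1, hcc])
      (by
        change τ (τ D.θ) = D.θ
        rw [h2, map_inv₀, h2, inv_inv])
    intro x
    exact DFunLike.congr_fun this x
  · intro φ
    have := D.hom_ext (φ.comp (τ : M →+* M)) ((starRingEnd ℂ).comp φ)
      (by
        intro f
        change φ (τ (algebraMap F M f)) = (starRingEnd ℂ) (φ (algebraMap F M f))
        rw [h1]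
        exact C.conj_sg (φ.comp (algebraMap F M)) f)
      (by
        change φ (τ D.θ) = (starRingEnd ℂ) (φ D.θ)
        rw [h2, map_inv₀]
        have e1 := C.conj_sg (φ.comp (algebraMap F M)) D.u
        rw [hcu] at e1
        have e2 : (φ D.θ) ^ p = φ (algebraMap F M D.u) := by rw [← map_pow, D.theta_pow]
        have e3 : ‖φ (algebraMap F M D.u)‖ = 1 := by
          have e4 : φ (algebraMap F M D.u) ≠ 0 := by simp
          have e5 : (φ (algebraMap F M D.u)) * (starRingEnd ℂ) (φ (algebraMap F M D.u)) = 1 := by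
            have : (starRingEnd ℂ) (φ (algebraMap F M D.u)) = (φ (algebraMap F M D.u))⁻¹ := by
              rw [← map_inv₀ φ, ← map_inv₀ (algebraMap F M)]; exact e1.symm
            rw [this, mul_inv_cancel₀ e4]
          have e6 := congrArg norm e5
          rw [norm_mul, RCLike.norm_conj, norm_one] at e6
          nlinarith [norm_nonneg (φ (algebraMap F M D.u))]
        have e7 : ‖φ (D.θ : M)‖ = 1 := by
          rw [← e2, norm_pow] at e3
          exact (pow_eq_one_iff_of_nonneg (norm_nonneg _) hpF.out.ne_zero).1 e3
        rw [Complex.inv_def, Complex.normSq_eq_norm_sq, e7]; simp)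
    intro x
    exact DFunLike.congr_fun this x

/-- the half-system -/
abbrev HS (p : ℕ) [Fact p.Prime] := {d : (ZMod p)ˣ // (d : ZMod p).val ≤ (p - 1) / 2}

theorem HS_neg (hp5 : 5 ≤ p) (d : (ZMod p)ˣ) : ((d : ZMod p).val ≤ (p - 1) / 2) ↔ ¬ (((-d : (ZMod p)ˣ) : ZMod p).val ≤ (p - 1) / 2) := by
  have : NeZero (d : ZMod p) := ⟨d.ne_zero⟩
  have h1 : (((-d : (ZMod p)ˣ) : ZMod p).val) = p - (d : ZMod p).val := by rw [Units.val_neg, ZMod.val_neg_of_ne_zero]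
  have h2 := ZMod.val_lt (d : ZMod p)
  have h3 : (d : ZMod p).val ≠ 0 := by rw [Ne, ZMod.val_eq_zero]; exact d.ne_zero
  have h4 : p % 2 = 1 := Nat.odd_iff.1 (hpF.out.odd_of_ne_two (by omega))
  rw [h1]; omega

theorem HS_card (hp5 : 5 ≤ p) : 2 * Fintype.card (HS p) = p - 1 := by
  classical
  have e : HS p ≃ {d : (ZMod p)ˣ // ¬ ((d : ZMod p).val ≤ (p - 1) / 2)} :=
    (Equiv.neg _).subtypeEquiv (fun d => by rw [HS_neg hp5 d]; rfl)
  have h1 := Fintype.card_congr e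
  have h2 := Fintype.card_subtype_compl (fun d : (ZMod p)ˣ => (d : ZMod p).val ≤ (p - 1) / 2)
  have h3 := ZMod.card_units p
  have h4 := Fintype.card_subtype_le (fun d : (ZMod p)ˣ => (d : ZMod p).val ≤ (p - 1) / 2)
  rw [h3] at h2 h4
  change Fintype.card (HS p) = _ at h1
  change _ = _ - Fintype.card (HS p) at h2
  change Fintype.card (HS p) ≤ _ at h4
  omega

theorem unit_of_v (f : Fˣ) (hf : f ∈ EE F N) (h : ∀ d, C.v d f = 0) : f ∈ (unitsHom F).range := by
  rw [← mem_EE_one_iff, mem_EE_iff one_ne_zero]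
  intro v _
  by_cases hv : (N : 𝓞 F) ∈ v.asIdeal
  · obtain ⟨d, rfl⟩ := C.eq_nn v hv
    rw [C.ord_eq d f (Units.mk0 (N : F) N_ne) rfl, h d, zero_mul]
  · exact (mem_EE_iff hNF.out.ne_zero).1 hf v hv

end Cy

end

section

open NumberField IsDedekindDomain

/-- a subgroup of small index in a space of functions is killed by a functional -/
theorem exists_functional {p : ℕ} [hpF : Fact p.Prime] {R : Type} [Fintype R] [DecidableEq R] {A : Type*} [AddCommGroup A] (Φ : A →+ (R → ZMod p))
    (h : ¬ Function.Surjective Φ) : ∃ c : R → ZMod p, c ≠ 0 ∧ ∀ a, ∑ r, c r * Φ a r = 0 := by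
  let W : Submodule (ZMod p) (R → ZMod p) := AddSubgroup.toZModSubmodule p Φ.range
  have hW : W < ⊤ := by
    rw [lt_top_iff_ne_top]
    intro hc
    apply h
    intro x
    have : x ∈ W := by rw [hc]; trivial
    exact this
  obtain ⟨f, hf0, hf⟩ := Submodule.exists_le_ker_of_lt_top W hW
  refine ⟨fun r => f (Pi.single r 1), ?_, ?_⟩
  · intro hc
    apply hf0
    ext r
    simpa using congrFun hc r
  · intro a
    have h1 : f (Φ a) = 0 := hf (show Φ a ∈ W from ⟨a, rfl⟩)
    rw [LinearMap.pi_apply_eq_sum_univ f (Φ a)] at h1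
    rw [← h1]
    apply Finset.sum_congr rfl
    intro r _
    rw [smul_eq_mul, mul_comm]
    have e : (Pi.single r 1 : R → ZMod p) = fun j => if r = j then 1 else 0 := by
      ext j
      simp [Pi.single_apply, eq_comm]
    change Φ a r * f (Pi.single r 1) = _
    rw [e]

namespace Cy
variable {p N : ℕ} [hpF : Fact p.Prime] [hNF : Fact N.Prime] {F : Type} [Field F] [NumberField F] (C : Cy p N F)

theorem gt_iii (hh : ¬ p ∣ classNumber F) (u : Fˣ) (hu : u ∈ EE F N) (hPR : C.PR u) (hc : C.sgu (-1) u = u⁻¹)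
    (Cf : (ZMod p)ˣ → ZMod p) (a : ZMod p) (hC : ∀ d, (C.v d u : ZMod p) = Cf d ∧ C.s d u = a * Cf d) (hne : ∃ d, Cf d ≠ 0) :
    ∃ d' : (ZMod p)ˣ → ZMod p, (∃ x, d' x ≠ 0) ∧ (∀ x, d' (-x) = d' x) ∧ (∀ x, Cf x = 0 → d' x = 0) ∧
      ∀ y ∈ EE F N, C.sgu (-1) y = y → ∑ x, d' x * (a * (C.v x y : ZMod p) - C.s x y) = 0 := by
  classical
  have hp5 := C.hp5
  have hdvd : ∀ d, Cf d = 0 ↔ (p : ℤ) ∣ C.v d u := by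
    intro d; rw [← (hC d).1, ZMod.intCast_zmod_eq_zero_iff_dvd]
  have hCneg : ∀ d, Cf (-d) = - Cf d := by
    intro d
    have h1 := C.v_sg d (-1) u
    rw [hc, v_inv, mul_neg_one] at h1
    rw [← (hC (-d)).1, ← h1, ← (hC d).1]; push_cast; rfl
  obtain ⟨M, _, _, _, D, rfl, hζ⟩ := exists_KD hpF.out hp5 C.hζ u (by
    intro b hb
    obtain ⟨d, hd⟩ := hne
    have hb0 : b ≠ 0 := by
      rintro rfl
      rw [zero_pow hpF.out.ne_zero] at hb
      exact u.ne_zero hb.symm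
    have : u = (Units.mk0 b hb0) ^ p := by ext; exact hb.symm
    apply hd
    rw [hdvd, this, v_pow]
    exact dvd_mul_right _ _)
  obtain ⟨τ, hτσ, hτ2, hτc, hCM⟩ := C.exists_tau D hζ hc
  -- primes
  have hQd : ∀ d : (ZMod p)ˣ, ∃ Q : Fin p → HeightOneSpectrum (𝓞 M), (Cf d = 0 → Function.Injective Q) ∧
      ∀ i, (Q i).asIdeal.LiesOver (C.nn d).asIdeal := by
    intro d
    by_cases h : Cf d = 0
    · obtain ⟨Q, h1, h2⟩ := C.split_primes D d ((hdvd d).1 h) (by rw [(hC d).2, h, mul_zero])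
      exact ⟨Q, fun _ => h1, h2⟩
    · obtain ⟨Q, hQ⟩ := exists_over (M := M) (C.nn d)
      exact ⟨fun _ => Q, fun h' => absurd h' h, fun _ => hQ⟩
  choose Qd hQ1 hQ2 using hQd
  have hp0 : 0 < p := by omega
  let i0 : Fin p := ⟨0, hp0⟩
  let T := Σ d : HS p, {i : Fin p // Cf d.1 ≠ 0 → i = i0}
  let R := {d : HS p // Cf d.1 ≠ 0}
  set ρ := Fintype.card R with hρ
  have hcardH := HS_card (p := p) hp5
  have hρle : ρ ≤ Fintype.card (HS p) := Fintype.card_subtype_le _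
  have hρ1 : 1 ≤ ρ := by
    rw [hρ, Nat.one_le_iff_ne_zero, ← Nat.pos_iff_ne_zero, Fintype.card_pos_iff]
    obtain ⟨d, hd⟩ := hne
    by_cases h : (d : ZMod p).val ≤ (p - 1) / 2
    · exact ⟨⟨⟨d, h⟩, hd⟩⟩
    · rw [HS_neg hp5, not_not] at h
      exact ⟨⟨⟨-d, h⟩, by change Cf (-d) ≠ 0; rw [hCneg, neg_ne_zero]; exact hd⟩⟩
  have hcardT : Fintype.card T + p * ρ = ρ + p * Fintype.card (HS p) := by
    have h1 : Fintype.card T = ∑ d : HS p, if Cf d.1 ≠ 0 then 1 else p := by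
      rw [Fintype.card_sigma]
      apply Finset.sum_congr rfl
      intro d _
      split_ifs with h
      · rw [Fintype.card_eq_one_iff]
        exact ⟨⟨i0, fun _ => rfl⟩, fun x => Subtype.ext (x.2 h)⟩
      · have : Fintype.card {i : Fin p // Cf d.1 ≠ 0 → i = i0} = Fintype.card (Fin p) :=
          Fintype.card_congr (Equiv.subtypeUnivEquiv (fun i h' => absurd h' h))
        rw [this, Fintype.card_fin]
    rw [h1, Finset.sum_ite, Finset.sum_const, Finset.sum_const]
    have h2 : (Finset.univ.filter (fun d : HS p => Cf d.1 ≠ 0)).card = ρ := (Fintype.card_subtype _).symm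
    have h3 := Finset.card_filter_add_card_filter_not (s := (Finset.univ : Finset (HS p))) (fun d : HS p => Cf d.1 ≠ 0)
    rw [h2, Finset.card_univ] at h3
    rw [h2, ← h3]
    simp only [smul_eq_mul]
    ring
  have hrF := C.rankF
  have hrM := C.rankM D
  obtain ⟨k, hk⟩ : ∃ k, p = 2 * k + 1 := by
    obtain ⟨k, hk⟩ := hpF.out.odd_of_ne_two (show p ≠ 2 by omega); exact ⟨k, hk⟩
  have hbound := D.gt_bound hh τ (C.sg (-1)).toRingEquiv hτσ hτ2 hτc (m := Units.torsionOrder M)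
    (Units.torsionOrder_pos M).ne' (cm_pow τ hCM) (s := N) hNF.out.ne_zero
    (C.urat_all D hζ hPR hu) (I := HS p) (fun d => C.vH d.1)
    (by
      intro f hf hv
      refine C.unit_of_v f hf.1 ?_
      intro d
      by_cases h : (d : ZMod p).val ≤ (p - 1) / 2
      · exact hv ⟨d, h⟩
      · rw [HS_neg hp5, not_not] at h
        have h1 := hv ⟨-d, h⟩
        have h2 : C.sgu (-1) f = f := hf.2
        rw [← h2, v_sg, mul_neg_one]; exact h1)
    (T := T) (fun t => Qd t.1.1 t.2.1)
    (by
      intro t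
      have := (hQ2 t.1.1 t.2.1)
      rw [liesOver_natCast_mem_iff this]
      exact C.N_mem_nn _)
    (by
      intro t t' htt
      have l1 := (hQ2 t.1.1 t.2.1)
      have l2 := (hQ2 t'.1.1 t'.2.1)
      constructor
      · intro hQQ
        have hdd : t.1.1 = t'.1.1 := by
          apply C.nn_inj
          apply HeightOneSpectrum.ext
          rw [l1.over, l2.over]
          exact congrArg (fun Q : HeightOneSpectrum (𝓞 M) => Q.asIdeal.under (𝓞 F)) hQQ
        obtain ⟨⟨d, hd⟩, i, hi⟩ := t
        obtain ⟨⟨d', hd'⟩, i', hi'⟩ := t'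
        simp only at hdd
        subst hdd
        apply htt
        have : i = i' := by
          by_cases h : Cf d = 0
          · exact hQ1 d h hQQ
          · rw [hi h, hi' h]
        subst this
        rfl
      · have hne : ¬ ∀ x, C.ph t'.1.1 x = 0 → C.ph (-t.1.1) x = 0 := by
          intro hx
          have := C.ph_inj hx
          have h1 := t'.1.2
          rw [this] at h1
          exact (HS_neg hp5 t.1.1).1 t.1.2 h1
        push Not at hne
        obtain ⟨x, hx1, hx2⟩ := hne
        refine ⟨algebraMap (𝓞 F) (𝓞 M) x, (liesOver_mem_iff l2 x).2 hx1, ?_⟩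
        have e : RingOfIntegers.mapRingHom (τ : M →+* M) (algebraMap (𝓞 F) (𝓞 M) x) = algebraMap (𝓞 F) (𝓞 M) (C.sgO (-1) x) := by
          apply RingOfIntegers.ext
          exact hτc x
        rw [e, liesOver_mem_iff l1, mem_nn, ph_sgO, mul_neg_one]
        exact hx2)
    (p - 1 - ρ)
    (by
      have e1 : Fintype.card (HS p) = k := by omega
      rw [e1] at hcardT hρle ⊢
      obtain ⟨j, hj⟩ : ∃ j, k = ρ + j := ⟨k - ρ, by omega⟩
      have e2 : p - 1 - ρ = k + j := by omega
      have e3 : p - 1 = 2 * k := by omega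
      rw [e3] at hrF hrM
      have e8 : (p - 1) * (p - 1 - ρ) = 2 * k * (k + j) := by rw [e2, e3]
      rw [e8]
      have e4 : Units.rank M + 1 = k * p := by nlinarith
      have e5 : Fintype.card T = ρ + p * j := by
        rw [hj] at hcardT; nlinarith
      have e6 : Units.rank F + 1 = k := by omega
      rw [e5]
      have e7 : 2 * k * (k + j) + k + k ≤ k * p + ρ + p * j := by
        rw [hk, hj]; nlinarith
      omega)
  obtain ⟨hb1, hb0⟩ := hbound
  set U := KD.XX F (C.sg (-1)).toRingEquiv N with hU
  -- the map
  let Φ : Additive U →+ (R → ZMod p) :=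
    { toFun := fun y r => a * (C.v r.1.1 (y.toMul : Fˣ) : ZMod p) - C.s r.1.1 (y.toMul : Fˣ)
      map_zero' := by ext r; simp [v_one, s_one]
      map_add' := fun x y => by
        ext r
        simp only [toMul_add, Subgroup.coe_mul, v_mul, s_mul, Pi.add_apply]
        push_cast; ring }
  have hns : ¬ Function.Surjective Φ := by
    intro hsurj
    have h1 : ((D.NX τ N).subgroupOf U) ≤ (AddMonoidHom.toMultiplicativeRight Φ).ker := by
      intro y hy
      rw [MonoidHom.mem_ker]
      obtain ⟨w, -, hw⟩ := Subgroup.mem_subgroupOf.1 hy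
      change Multiplicative.ofAdd (Φ (Additive.ofMul y)) = 1
      rw [ofAdd_eq_one]
      ext r
      change a * (C.v r.1.1 (y : Fˣ) : ZMod p) - C.s r.1.1 (y : Fˣ) = 0
      have h2 := C.symbol_norm D r.1.1 (fun h => r.2 ((hdvd _).2 h)) w
      rw [hw, (hC r.1.1).1, (hC r.1.1).2] at h2
      have h3 : Cf r.1.1 * (a * (C.v r.1.1 (y : Fˣ) : ZMod p) - C.s r.1.1 (y : Fˣ)) = 0 := by linear_combination h2
      exact (mul_eq_zero.1 h3).resolve_left r.2
    have h2 : (AddMonoidHom.toMultiplicativeRight Φ).ker.index = p ^ ρ := by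
      rw [Subgroup.index_ker, MonoidHom.range_eq_top.2 (show Function.Surjective (AddMonoidHom.toMultiplicativeRight Φ) from hsurj)]
      rw [Subgroup.card_top]
      change Nat.card (R → ZMod p) = _
      rw [Nat.card_fun, Nat.card_zmod, Nat.card_eq_fintype_card]
    have h3 : (AddMonoidHom.toMultiplicativeRight Φ).ker.index ≤ (D.NX τ N).relIndex U :=
      Nat.le_of_dvd (Nat.pos_of_ne_zero hb0) (Subgroup.index_dvd_of_le h1)
    rw [h2] at h3
    have h4 : p ^ ρ * p ^ (p - 1 - ρ) ≤ p ^ (Units.rank F + Fintype.card (HS p)) := (Nat.mul_le_mul_right _ h3).trans hb1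
    rw [← pow_add] at h4
    have h5 := (Nat.pow_le_pow_iff_right (show 1 < p by omega)).1 h4
    omega
  obtain ⟨c, hc0, hc1⟩ := exists_functional Φ hns
  let d0 : (ZMod p)ˣ → ZMod p := fun x => if h : ∃ h : (x : ZMod p).val ≤ (p - 1) / 2, Cf x ≠ 0 then c ⟨⟨x, h.choose⟩, h.choose_spec⟩ else 0
  have hd0R : ∀ r : R, d0 r.1.1 = c r := by
    intro r
    simp only [d0]
    rw [dif_pos ⟨r.1.2, r.2⟩]
  have hd0n : ∀ x : (ZMod p)ˣ, (¬ ∃ h : (x : ZMod p).val ≤ (p - 1) / 2, Cf x ≠ 0) → d0 x = 0 := by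
    intro x hx; exact dif_neg hx
  have hsum : ∀ w : (ZMod p)ˣ → ZMod p, ∑ x, d0 x * w x = ∑ r : R, c r * w r.1.1 := by
    intro w
    symm
    refine Finset.sum_of_injOn (fun r : R => r.1.1) (fun r _ r' _ h => Subtype.ext (Subtype.ext h)) (by simp) ?_ ?_
    · intro x _ hx
      rw [hd0n, zero_mul]
      rintro ⟨h1, h2⟩
      exact hx ⟨⟨⟨x, h1⟩, h2⟩, by simp, rfl⟩
    · intro r _
      rw [hd0R]
  refine ⟨fun x => d0 x + d0 (-x), ?_, ?_, ?_, ?_⟩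
  · obtain ⟨r, hr⟩ := Function.ne_iff.1 hc0
    refine ⟨r.1.1, ?_⟩
    change d0 r.1.1 + d0 (-r.1.1) ≠ 0
    rw [hd0R, hd0n (-r.1.1), add_zero]
    · exact hr
    · rintro ⟨h1, -⟩
      exact (HS_neg hp5 r.1.1).1 r.1.2 h1
  · intro x; simp only [neg_neg]; ring
  · intro x hx
    change d0 x + d0 (-x) = 0
    rw [hd0n x, hd0n (-x), add_zero]
    · rintro ⟨-, h⟩; rw [hCneg, hx, neg_zero] at h; exact h rfl
    · rintro ⟨-, h⟩; exact h hx
  · intro y hy hcy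
    let w : (ZMod p)ˣ → ZMod p := fun x => a * (C.v x y : ZMod p) - C.s x y
    have hw : ∀ x, w (-x) = w x := by
      intro x
      simp only [w]
      have e1 := C.v_sg x (-1) y
      have e2 := C.s_sg x (-1) y
      rw [hcy, mul_neg_one] at e1 e2
      rw [e1, e2]
    have h0 : ∑ x, d0 x * w x = 0 := by
      rw [hsum]
      exact hc1 (Additive.ofMul (⟨y, hy, hcy⟩ : U))
    have h1 : ∑ x, d0 (-x) * w x = 0 := by
      rw [← h0, ← Equiv.sum_comp (Equiv.neg _) (fun x => d0 x * w x)]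
      apply Finset.sum_congr rfl
      intro x _
      rw [Equiv.neg_apply, hw]
    calc _ = ∑ x, d0 x * w x + ∑ x, d0 (-x) * w x := by
          rw [← Finset.sum_add_distrib]; apply Finset.sum_congr rfl; intro x _; simp only [w]; ring
      _ = 0 := by rw [h0, h1, add_zero]

end Cy

end

section

open Finset NumberField IsDedekindDomain

namespace Cy
variable {p N : ℕ} [hpF : Fact p.Prime] [hNF : Fact N.Prime] {F : Type} [Field F] [NumberField F] (C : Cy p N F)

theorem two_ne' (C : Cy p N F) : (2 : ZMod p) ≠ 0 := by
  intro h0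
  have : ((2:ℕ) : ZMod p) = 0 := by exact_mod_cast h0
  rw [ZMod.natCast_eq_zero_iff] at this
  have := Nat.le_of_dvd (by norm_num) this
  have := C.hp5; omega

theorem plus_mk (y : Fˣ) (hy : y ∈ EE F N) (j : ℕ) (hj : Even j) : ∃ y' ∈ EE F N, C.sgu (-1) y' = y' ∧
    hat j (fun d => C.s d y') = 2 * hat j (fun d => C.s d y) ∧
    hat j (fun d => (C.v d y' : ZMod p)) = 2 * hat j (fun d => (C.v d y : ZMod p)) := by
  refine ⟨y * C.sgu (-1) y, mul_mem hy (C.sgu_mem _ _ _ hy), ?_, ?_, ?_⟩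
  · rw [map_mul, sgu_sgu, neg_mul_neg, one_mul, sgu_one, mul_comm]
  · simp_rw [s_mul, s_sg]
    rw [hat_add, hat_shift j (fun d => C.s d y) (-1), Units.val_neg, Units.val_one, hj.neg_one_pow]; ring
  · simp_rw [v_mul, v_sg]; push_cast
    rw [hat_add, hat_shift j (fun d => (C.v d y : ZMod p)) (-1), Units.val_neg, Units.val_one, hj.neg_one_pow]; ring

theorem exists_gamma (hh : ¬ p ∣ classNumber F) (j : ℕ) : ∃ y ∈ EE F N, hat j (fun d => (C.v d y : ZMod p)) ≠ 0 := by
  classical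
  obtain ⟨γ, h1, h2⟩ := exists_gen (C.nn 1)
  let n : Fˣ := Units.mk0 (N : F) N_ne
  refine ⟨γ, ?_, ?_⟩
  · rw [mem_EE_iff hNF.out.ne_zero]
    intro v hv
    apply h2
    rintro rfl
    exact hv (C.N_mem_nn 1)
  · have h3 : ∀ d, d ≠ 1 → C.v d γ = 0 := by
      intro d hd
      exact C.v_zero_of_ord d γ (h2 _ (fun h => hd (C.nn_inj h)))
    have h4 : ¬ (p : ℤ) ∣ C.v 1 γ := by
      intro h
      have := C.ord_eq 1 γ n rfl
      rw [h1] at this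
      apply hh
      have h5 : (p : ℤ) ∣ (classNumber F : ℤ) := by rw [this]; exact h.mul_right _
      exact_mod_cast h5
    rw [hat, sum_eq_single 1]
    · simp only [inv_one, Units.val_one, one_pow, one_mul]
      rwa [Ne, ZMod.intCast_zmod_eq_zero_iff_dvd]
    · intro d _ hd
      rw [h3 d hd, Int.cast_zero, mul_zero]
    · simp

/-- the key property -/
def PP (a : ZMod p) (j : ℕ) : Prop := ∀ y ∈ EE F N, C.sgu (-1) y = y →
  hat j (fun d => C.s d y) = a * hat j (fun d => (C.v d y : ZMod p))

theorem PP_Lf (a : ZMod p) (j : ℕ) (hj : Even j) (h2 : 2 ≤ j) (hjp : j < p - 1) (h : C.PP a j) : hat j (fun d => C.Lf d) = 0 := by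
  by_contra hc
  obtain ⟨y, hy, hy2⟩ := C.hat_cyc j (by omega) hjp hc
  obtain ⟨y', h3, h4, h5, h6⟩ := C.plus_mk y (units_le_EE N hNF.out.ne_zero hy) j hj
  have h7 := h y' h3 h4
  have h8 : hat j (fun d => (C.v d y : ZMod p)) = 0 := by
    unfold hat
    exact sum_eq_zero fun d _ => by beta_reduce; rw [C.v_unit _ y hy, Int.cast_zero, mul_zero]
  rw [h5, h6, h8, mul_zero, mul_zero] at h7
  exact hy2 ((mul_eq_zero.1 h7).resolve_left C.two_ne')

theorem PP_unique (hh : ¬ p ∣ classNumber F) (a b : ZMod p) (j : ℕ) (hj : Even j) (h : C.PP a j) (h' : C.PP b j) : a = b := by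
  obtain ⟨y, hy, hy2⟩ := C.exists_gamma hh j
  obtain ⟨y', h3, h4, h5, h6⟩ := C.plus_mk y hy j hj
  have h7 := (h y' h3 h4).symm.trans (h' y' h3 h4)
  refine mul_right_cancel₀ ?_ h7
  rw [h6]
  exact mul_ne_zero C.two_ne' hy2

theorem pow_p_sub (x : (ZMod p)ˣ) (j : ℕ) (hj : j ≤ p - 1) : (x : ZMod p) ^ (p - j) = x * ((x⁻¹ : (ZMod p)ˣ) : ZMod p) ^ j := by
  have hp := hpF.out.one_le
  rw [← mul_left_inj' (pow_ne_zero j x.ne_zero), mul_assoc, ← mul_pow, Units.inv_mul, one_pow, mul_one, ← pow_add, show p - j + j = p - 1 + 1 by omega, pow_succ,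
    ZMod.pow_card_sub_one_eq_one x.ne_zero, one_mul]

theorem even_case (hh : ¬ p ∣ classNumber F) (hG : ∀ k, Odd k → 3 ≤ k → k ≤ p - 2 → hat k (fun d => C.G d) ≠ 0)
    (j0 : ℕ) (hj0 : Even j0) (hj2 : 2 ≤ j0) (hjp : j0 ≤ p - 3) : ∃ y ∈ EE F N, hat j0 (fun d => C.s d y) ≠ 0 := by
  classical
  by_contra hcon
  push Not at hcon
  have hp5 := C.hp5
  have hodd : Odd p := hpF.out.odd_of_ne_two (by omega)
  obtain ⟨g, hg⟩ := exists_gpow (p := p)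
  let E := (range (p - 1)).filter (fun j => Even j ∧ 2 ≤ j ∧ hat j (fun d => C.Lf d) = 0)
  have hE : ∀ j ∈ E, ∃ (u : Fˣ) (a : ZMod p), u ∈ EE F N ∧ C.PR u ∧ C.sgu (-1) u = u⁻¹ ∧ a ≠ 0 ∧
      ∀ d : (ZMod p)ˣ, (C.v d u : ZMod p) = d ^ (p - j) ∧ C.s d u = a * d ^ (p - j) := by
    intro j hj
    obtain ⟨h1, h2, h3, h4⟩ := Finset.mem_filter.1 hj
    have h1 := mem_range.1 h1
    have hpj : j ≠ p - 2 := by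
      rintro rfl
      rw [Nat.even_iff] at h2; rw [Nat.odd_iff] at hodd; omega
    have ho : Odd (p - j) := by rw [Nat.even_iff] at h2; rw [Nat.odd_iff] at hodd ⊢; omega
    obtain ⟨u, e1, e2, e3, a, e4, e5⟩ := C.exists_u hh (p - j) ho (by omega) (by omega)
      (by rw [C.hat_Lf (p - j) j (by omega) (by omega)]; exact h4) (hG _ ho (by omega) (by omega))
    exact ⟨u, a, e1, e2, e3, e4, e5⟩
  choose! u a hu1 hu2 hu3 ha0 hu4 using hE
  let B : ZMod p → Finset ℕ := fun x => E.filter (fun j => C.PP x j)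
  let K : ZMod p → Finset ℕ := fun x => E.filter (fun j => a j = x)
  have hBmem : ∀ x j, Even j → 2 ≤ j → j < p - 1 → C.PP x j → j ∈ B x := by
    intro x j h1 h2 h3 h4
    simp only [B, E, Finset.mem_filter, mem_range]
    exact ⟨⟨h3, h1, h2, C.PP_Lf x j h1 h2 h3 h4⟩, h4⟩
  have hj0B : j0 ∈ B 0 := hBmem 0 j0 hj0 hj2 (by omega) (by
    intro y hy _; rw [hcon y hy, zero_mul])
  have hKsum : ∑ x ∈ univ.erase 0, (K x).card = E.card := by
    symm
    apply Finset.card_eq_sum_card_fiberwise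
    intro j hj
    simp only [coe_erase, coe_univ]
    exact ⟨trivial, ha0 j hj⟩
  have hBsum : ∑ x : ZMod p, (B x).card ≤ E.card := by
    rw [← Finset.card_biUnion]
    · apply card_le_card
      intro j hj
      obtain ⟨x, -, hx⟩ := Finset.mem_biUnion.1 hj
      exact (Finset.mem_filter.1 hx).1
    · intro x _ y _ hxy
      change Disjoint (B x) (B y)
      rw [Finset.disjoint_left]
      intro j h1 h2
      have h1 := Finset.mem_filter.1 h1
      have h2 := Finset.mem_filter.1 h2
      exact hxy (C.PP_unique hh x y j (Finset.mem_filter.1 h1.1).2.1 h1.2 h2.2)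
  obtain ⟨v, hv0, hlt⟩ : ∃ v ∈ univ.erase (0 : ZMod p), (B v).card < (K v).card := by
    apply Finset.exists_lt_of_sum_lt
    rw [hKsum]
    refine lt_of_lt_of_le ?_ hBsum
    rw [← Finset.sum_erase_add univ _ (Finset.mem_univ (0 : ZMod p))]
    have : 0 < (B 0).card := Finset.card_pos.2 ⟨j0, hj0B⟩
    omega
  have hv0 : v ≠ 0 := (Finset.mem_erase.1 hv0).1
  -- choose the coefficients
  obtain ⟨cc, ⟨j1, hj1, hcc1⟩, hcc2⟩ : ∃ cc : ℕ → ZMod p, (∃ j ∈ K v, cc j ≠ 0) ∧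
      ∀ i < (B v).card, ∑ j ∈ K v, cc j * ((g ^ i : (ZMod p)ˣ) : ZMod p) ^ j = 0 := by
    let L : ((K v) → ZMod p) →ₗ[ZMod p] (Fin (B v).card → ZMod p) :=
      LinearMap.pi (fun i => ∑ j : K v, (((g ^ (i : ℕ) : (ZMod p)ˣ) : ZMod p) ^ (j : ℕ)) • LinearMap.proj j)
    have hker : LinearMap.ker L ≠ ⊥ := by
      apply LinearMap.ker_ne_bot_of_finrank_lt
      simpa using hlt
    obtain ⟨c, hc1, hc2⟩ := Submodule.exists_mem_ne_zero_of_ne_bot hker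
    obtain ⟨j, hj⟩ := Function.ne_iff.1 hc2
    refine ⟨fun j => if h : j ∈ K v then c ⟨j, h⟩ else 0, ⟨j, j.2, ?_⟩, ?_⟩
    · simpa using hj
    · intro i hi
      have h1 := congrFun (LinearMap.mem_ker.1 hc1) ⟨i, hi⟩
      simp only [L, LinearMap.pi_apply, LinearMap.sum_apply, LinearMap.smul_apply, LinearMap.proj_apply, smul_eq_mul, Pi.zero_apply] at h1
      refine Eq.trans ?_ h1
      rw [← Finset.sum_coe_sort (K v)]
      apply sum_congr rfl
      intro j _
      simp only [dif_pos j.2]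
      exact mul_comm _ _
  have hKE : ∀ j ∈ K v, j ∈ E ∧ a j = v := fun j hj => Finset.mem_filter.1 hj
  have hEp : ∀ j ∈ E, j < p - 1 := fun j hj => mem_range.1 (Finset.mem_filter.1 hj).1
  let Cf : (ZMod p)ˣ → ZMod p := fun d => ∑ j ∈ K v, cc j * (d : ZMod p) ^ (p - j)
  have hCf : ∀ d, Cf d⁻¹ = ((d⁻¹ : (ZMod p)ˣ) : ZMod p) * ∑ j ∈ K v, cc j * (d : ZMod p) ^ j := by
    intro d
    simp only [Cf]
    rw [mul_sum]
    apply sum_congr rfl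
    intro j hj
    rw [pow_p_sub _ _ (hEp j (hKE j hj).1).le, inv_inv]; ring
  let w : Fˣ := ∏ j ∈ K v, (u j) ^ (cc j).val
  obtain ⟨d', ⟨x0, hx0⟩, hd1, hd2, hd3⟩ := C.gt_iii hh w
    (Subgroup.prod_mem _ fun j hj => Subgroup.pow_mem _ (hu1 j (hKE j hj).1) _)
    (C.PR_prod _ _ fun j hj => C.PR_pow (hu2 j (hKE j hj).1) _)
    (by
      simp only [w]
      rw [map_prod, ← Finset.prod_inv_distrib]
      apply prod_congr rfl
      intro j hj
      rw [map_pow, hu3 j (hKE j hj).1, inv_pow])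
    Cf v
    (by
      intro d
      simp only [w, Cf]
      rw [v_prod, s_prod, mul_sum]
      push_cast
      constructor
      · apply sum_congr rfl
        intro j hj
        rw [v_pow]; push_cast
        rw [(hu4 j (hKE j hj).1 d).1, ZMod.natCast_zmod_val]
      · apply sum_congr rfl
        intro j hj
        rw [s_pow, (hu4 j (hKE j hj).1 d).2, ZMod.natCast_zmod_val, (hKE j hj).2]; ring)
    (by
      by_contra! hz
      apply hcc1
      refine vander g hg (K v) (fun j hj => hEp j (hKE j hj).1) cc ?_ j1 hj1
      intro i _
      have := hCf (g ^ i)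
      rw [hz] at this
      exact (mul_eq_zero.1 this.symm).resolve_left (Units.ne_zero _))
  let f : (ZMod p)ˣ → ZMod p := fun x => d' x⁻¹
  have hf0 : ∀ i < (B v).card, f (g ^ i) = 0 := by
    intro i hi
    apply hd2
    rw [hCf, hcc2 i hi, mul_zero]
  have hfe : ∀ x, f (-x) = f x := by
    intro x; simp only [f]; rw [inv_neg, hd1]
  have hkey : ∀ j, ∀ y ∈ EE F N, C.sgu (-1) y = y → hat j f * (v * hat j (fun d => (C.v d y : ZMod p)) - hat j (fun d => C.s d y)) = 0 := by
    intro j y hy hcy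
    have e1 : hat j f = ∑ x, d' x * (x : ZMod p) ^ j := by
      rw [hat, ← Equiv.sum_comp (Equiv.inv _) (fun x => d' x * (x : ZMod p) ^ j)]
      apply sum_congr rfl
      intro x _
      simp only [Equiv.inv_apply, f]; ring
    rw [← hat_mul, ← hat_sub, e1, sum_mul]
    have e2 : ∀ x : (ZMod p)ˣ, d' x * (x : ZMod p) ^ j * hat j (fun d => v * (C.v d y : ZMod p) - C.s d y) =
        ∑ b : (ZMod p)ˣ, ((b⁻¹ : (ZMod p)ˣ) : ZMod p) ^ j * (d' x * (v * (C.v x (C.sgu b y) : ZMod p) - C.s x (C.sgu b y))) := by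
      intro x
      rw [mul_assoc, ← hat_conv j (fun d => v * (C.v d y : ZMod p) - C.s d y) x, mul_sum]
      apply sum_congr rfl
      intro b _
      rw [v_sg, s_sg]; ring
    simp_rw [e2]
    rw [sum_comm]
    apply sum_eq_zero
    intro b _
    rw [← mul_sum, hd3 (C.sgu b y) (C.sgu_mem _ _ _ hy) (by rw [sgu_comm, hcy]), mul_zero]
  have hsupp : ∀ j ∈ range (p - 1), j ∉ B v → hat j f = 0 := by
    intro j hj hjB
    have hj := mem_range.1 hj
    by_contra hne
    have hPP : C.PP v j := by
      intro y hy hcy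
      have := (mul_eq_zero.1 (hkey j y hy hcy)).resolve_left hne
      linear_combination -this
    by_cases hje : Even j
    · by_cases hj2 : 2 ≤ j
      · exact hjB (hBmem v j hje hj2 hj hPP)
      · have : j = 0 := by rw [Nat.even_iff] at hje; omega
        subst this
        let n : Fˣ := Units.mk0 (N : F) N_ne
        have h1 := hPP n (by
          rw [mem_EE_iff hNF.out.ne_zero]
          intro q hq
          refine (ord_eq_zero_iff_notMem q n ((N : ℕ) : 𝓞 F) ?_).2 hq
          simp [n]) (by ext; rw [sgu_coe]; simp [n])
        simp_rw [(C.vs_N _ n rfl).1, (C.vs_N _ n rfl).2] at h1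
        simp only [hat, pow_zero, Int.cast_one, mul_one, mul_zero, sum_const_zero, sum_const, card_univ, ZMod.card_units, nsmul_eq_mul,
          Nat.cast_sub hpF.out.one_le, Nat.cast_one, CharP.cast_eq_zero, zero_sub, mul_neg, zero_eq_neg] at h1
        exact hv0 (by simpa using h1)
    · exact hne (hat_even_odd (by omega) f hfe j (Nat.not_even_iff_odd.1 hje))
  have hBE : B v ⊆ range (p - 1) := fun j hj => mem_range.2 (hEp j (Finset.mem_filter.1 hj).1)
  have hfB : ∀ d, f d = - ∑ j ∈ B v, hat j f * (d : ZMod p) ^ j := by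
    intro d
    rw [hat_inv f d]
    congr 1
    symm
    apply sum_subset hBE
    intro j h1 h2
    rw [hsupp j h1 h2, zero_mul]
  have hz := vander g hg (B v) (fun j hj => mem_range.1 (hBE hj)) (fun j => hat j f) (by
    intro i hi
    have := hfB (g ^ i)
    rw [hf0 i hi] at this
    exact neg_eq_zero.1 this.symm)
  apply hx0
  have := hfB x0⁻¹
  simp only [f, inv_inv] at this
  rw [this, neg_eq_zero]
  apply sum_eq_zero
  intro j hj
  exact mul_eq_zero_of_left (hz j hj) _

end Cy

end

section

open Finset

theorem line_lemma {p : ℕ} [hpF : Fact p.Prime] {Q : Type*} [AddCommGroup Q] [Module (ZMod p) Q] (σ δ : Module.End (ZMod p) Q)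
    (g : (ZMod p)ˣ) (hg : orderOf g = p - 1) (m : ℕ) (hm : (m : ZMod p) = g) (hδ : δ * σ = σ ^ m * δ)
    (hN : ∑ i ∈ range p, σ ^ i = 0) (hfix : ∀ x y, σ x = x → σ y = y → x = 0 ∨ ∃ a : ZMod p, y = a • x)
    (V : Submodule (ZMod p) Q) (hV : ∀ v ∈ V, δ v = v) : ∀ v ∈ V, ∀ w ∈ V, v = 0 ∨ ∃ a : ZMod p, w = a • v := by
  set n : Module.End (ZMod p) Q := σ - 1 with hn
  have hcn : Commute σ n := by rw [hn]; exact (Commute.refl σ).sub_right (Commute.one_right σ)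
  have hnil : n ^ (p - 1) = 0 := by
    have h1 : (Polynomial.X - 1 : Polynomial (ZMod p)) ^ (p - 1) = ∑ i ∈ range p, Polynomial.X ^ i := by
      have h0 : (Polynomial.X - 1 : Polynomial (ZMod p)) ≠ 0 := by
        rw [← Polynomial.C_1]; exact Polynomial.X_sub_C_ne_zero 1
      apply mul_right_cancel₀ h0
      rw [geom_sum_mul, ← pow_succ, Nat.sub_add_cancel hpF.out.one_le, sub_pow_char, one_pow]
    have h2 := congrArg (Polynomial.aeval σ) h1
    simp only [map_pow, map_sub, Polynomial.aeval_X, map_one, map_sum] at h2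
    rw [hn, h2, hN]
  have hfixn : ∀ x, n x = 0 → σ x = x := by
    intro x hx
    rw [hn, LinearMap.sub_apply, Module.End.one_apply, sub_eq_zero] at hx
    exact hx
  -- conjugation
  have hc : ∀ i, δ * n ^ i = (σ ^ m - 1) ^ i * δ := by
    intro i
    induction i with
    | zero => simp
    | succ i ih =>
      have : δ * n = (σ ^ m - 1) * δ := by rw [hn, mul_sub, hδ, sub_mul, mul_one, one_mul]
      rw [pow_succ, ← mul_assoc, ih, mul_assoc, this, ← mul_assoc, ← pow_succ]
  have hS : ∃ R : Polynomial (ZMod p), (Polynomial.X ^ m - 1 : Polynomial (ZMod p)) = (Polynomial.X - 1) * (Polynomial.C (m : ZMod p) + (Polynomial.X - 1) * R) := by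
    have h1 : (Polynomial.X - 1 : Polynomial (ZMod p)) ∣ (∑ i ∈ range m, Polynomial.X ^ i) - Polynomial.C (m : ZMod p) := by
      rw [← Polynomial.C_1, Polynomial.dvd_iff_isRoot, Polynomial.IsRoot.def]
      simp [Polynomial.eval_finset_sum]
    obtain ⟨R, hR⟩ := h1
    refine ⟨R, ?_⟩
    rw [← hR, add_sub_cancel, mul_geom_sum]
  have hSi : ∀ i : ℕ, ∃ R : Polynomial (ZMod p), (Polynomial.X ^ m - 1 : Polynomial (ZMod p)) ^ i = Polynomial.C ((m : ZMod p) ^ i) * (Polynomial.X - 1) ^ i + R * (Polynomial.X - 1) ^ (i + 1) := by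
    obtain ⟨R, hR⟩ := hS
    intro i
    induction i with
    | zero => exact ⟨0, by simp⟩
    | succ i ih =>
      obtain ⟨R', hR'⟩ := ih
      refine ⟨Polynomial.C ((m : ZMod p) ^ i) * R + R' * Polynomial.C (m : ZMod p) + R' * (Polynomial.X - 1) * R, ?_⟩
      rw [pow_succ, hR', hR]
      simp only [map_pow]
      ring
  have hact : ∀ v ∈ V, ∀ i, (n ^ (i + 1)) v = 0 → δ ((n ^ i) v) = (g : ZMod p) ^ i • (n ^ i) v := by
    intro v hv i hi
    have h1 := congrArg (fun e : Module.End (ZMod p) Q => e v) (hc i)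
    simp only [Module.End.mul_apply, hV v hv] at h1
    rw [h1]
    obtain ⟨R, hR⟩ := hSi i
    have h2 := congrArg (Polynomial.aeval σ) hR
    simp only [map_pow, map_sub, map_add, map_mul, Polynomial.aeval_X, map_one, Polynomial.aeval_C, ← hn] at h2
    rw [h2, LinearMap.add_apply, Module.End.mul_apply, Module.End.mul_apply, hi, map_zero, add_zero, hm, ← map_pow, Module.algebraMap_end_apply]
  have hexp : ∀ v : Q, v ≠ 0 → ∃ i < p - 1, (n ^ i) v ≠ 0 ∧ (n ^ (i + 1)) v = 0 := by
    intro v hv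
    classical
    have hex : ∃ i, (n ^ i) v = 0 := ⟨p - 1, by rw [hnil]; rfl⟩
    have h0 : Nat.find hex ≠ 0 := by
      intro h
      have := Nat.find_spec hex
      rw [h] at this
      exact hv this
    have hle : Nat.find hex ≤ p - 1 := Nat.find_min' hex (by rw [hnil]; rfl)
    refine ⟨Nat.find hex - 1, by omega, Nat.find_min hex (by omega), ?_⟩
    rw [show Nat.find hex - 1 + 1 = Nat.find hex by omega]
    exact Nat.find_spec hex
  have hsame : ∀ v ∈ V, ∀ w ∈ V, ∀ i < p - 1, ∀ j < p - 1, (n ^ i) v ≠ 0 → (n ^ (i + 1)) v = 0 → (n ^ j) w ≠ 0 → (n ^ (j + 1)) w = 0 →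
      i = j ∧ ∃ a : ZMod p, (n ^ j) w = a • (n ^ i) v := by
    intro v hv w hw i hi j hj h1 h2 h3 h4
    obtain ⟨a, ha⟩ := (hfix ((n ^ i) v) ((n ^ j) w) (hfixn _ (by rw [← Module.End.mul_apply, ← pow_succ', h2]))
      (hfixn _ (by rw [← Module.End.mul_apply, ← pow_succ', h4]))).resolve_left h1
    refine ⟨?_, a, ha⟩
    have e1 := hact w hw j h4
    rw [ha, map_smul, hact v hv i h2, smul_comm a, ← sub_eq_zero, ← sub_smul, ← ha] at e1
    have e2 := (smul_eq_zero.1 e1).resolve_right h3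
    have e3 : g ^ i = g ^ j := by
      ext; push_cast; exact sub_eq_zero.1 e2
    exact pow_injOn_Iio_orderOf (by rw [hg]; exact hi) (by rw [hg]; exact hj) e3
  intro v hv w hw
  by_cases hv0 : v = 0
  · exact Or.inl hv0
  right
  by_cases hw0 : w = 0
  · exact ⟨0, by rw [hw0, zero_smul]⟩
  obtain ⟨i, hi, a1, a2⟩ := hexp v hv0
  obtain ⟨j, hj, b1, b2⟩ := hexp w hw0
  obtain ⟨hij, a, ha⟩ := hsame v hv w hw i hi j hj a1 a2 b1 b2
  subst hij
  refine ⟨a, ?_⟩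
  by_contra hne
  have hne' : w - a • v ≠ 0 := fun h => hne (sub_eq_zero.1 h)
  have hmem : w - a • v ∈ V := V.sub_mem hw (V.smul_mem a hv)
  obtain ⟨k, hk, c1, c2⟩ := hexp _ hne'
  obtain ⟨hik, -⟩ := hsame v hv _ hmem i hi k hk a1 a2 c1 c2
  subst hik
  apply c1
  rw [map_sub, map_smul, ha, sub_self]

/-- small index lemma -/
theorem small_index {G : Type*} [CommGroup G] {p : ℕ} (hp : p.Prime) (H A : Subgroup G) (hHA : H ≤ A) (h0 : H.relIndex A ≠ 0) (h : H.relIndex A ≤ p)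
    (t1 t2 : G) (h1 : t1 ∈ A) (h2 : t2 ∈ A) (hp1 : t1 ^ p ∈ H) : t1 ∈ H ∨ ∃ a : ℤ, t2 * t1 ^ a ∈ H := by
  by_cases hc : t1 ∈ H
  · exact Or.inl hc
  right
  let q : A →* A ⧸ (H.subgroupOf A) := QuotientGroup.mk' _
  have hcard : Nat.card (A ⧸ (H.subgroupOf A)) = H.relIndex A := rfl
  have : Finite (A ⧸ (H.subgroupOf A)) := Nat.finite_of_card_ne_zero (by rw [hcard]; exact h0)
  have hmem : ∀ a : A, q a = 1 ↔ (a : G) ∈ H := by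
    intro a
    rw [show q a = QuotientGroup.mk a from rfl, QuotientGroup.eq_one_iff, Subgroup.mem_subgroupOf]
  have ho : orderOf (q ⟨t1, h1⟩) = p := by
    have := hp.eq_one_or_self_of_dvd _ (orderOf_dvd_of_pow_eq_one (x := q ⟨t1, h1⟩) (n := p) (by rw [← map_pow, hmem]; exact hp1))
    refine this.resolve_left ?_
    rw [orderOf_eq_one_iff, hmem]
    exact hc
  have htop : Subgroup.zpowers (q ⟨t1, h1⟩) = ⊤ := by
    apply Subgroup.eq_top_of_le_card
    rw [Nat.card_zpowers, ho, hcard]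
    exact h
  have hm : q ⟨t2, h2⟩ ∈ Subgroup.zpowers (q ⟨t1, h1⟩) := by rw [htop]; trivial
  obtain ⟨a, ha⟩ := Subgroup.mem_zpowers_iff.1 hm
  refine ⟨-a, ?_⟩
  have : q (⟨t2, h2⟩ * ⟨t1, h1⟩ ^ (-a)) = 1 := by
    rw [map_mul, map_zpow, ← ha, ← zpow_add, add_neg_cancel, zpow_zero]
  rw [hmem] at this
  exact this

end

section

open Finset NumberField IsDedekindDomain

namespace Cy
variable {p N : ℕ} [hpF : Fact p.Prime] [hNF : Fact N.Prime] {F : Type} [Field F] [NumberField F] (C : Cy p N F)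

/-- the elements of `EE F N` with vanishing symbols -/
def kerS : Subgroup Fˣ where
  carrier := {y | y ∈ EE F N ∧ ∀ d, C.s d y = 0}
  one_mem' := ⟨one_mem _, fun d => C.s_one d⟩
  mul_mem' := fun {x y} hx hy => ⟨mul_mem hx.1 hy.1, fun d => by rw [s_mul, hx.2, hy.2, add_zero]⟩
  inv_mem' := fun {x} hx => ⟨inv_mem hx.1, fun d => by rw [s_inv, hx.2, neg_zero]⟩

theorem mem_kerS {y : Fˣ} : y ∈ C.kerS ↔ y ∈ EE F N ∧ ∀ d, C.s d y = 0 := Iff.rfl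

theorem kerS_le : C.kerS ≤ EE F N := fun _ h => h.1

theorem kerS_index (B : Finset ℕ) (hB : ∀ j ∈ B, j < p - 1) (h : ∀ j ∈ B, ∃ y ∈ EE F N, hat j (fun d => C.s d y) ≠ 0) :
    p ^ B.card ≤ C.kerS.relIndex (EE F N) := by
  classical
  let Φ : Additive (EE F N) →+ ((ZMod p)ˣ → ZMod p) :=
    { toFun := fun y d => C.s d (y.toMul : Fˣ)
      map_zero' := by ext d; simp [s_one]
      map_add' := fun x y => by
        ext d
        simp only [toMul_add, Subgroup.coe_mul, s_mul, Pi.add_apply] }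
  let Ψ := AddMonoidHom.toMultiplicativeRight Φ
  have h1 : C.kerS.subgroupOf (EE F N) = Ψ.ker := by
    ext y
    rw [MonoidHom.mem_ker, Subgroup.mem_subgroupOf, mem_kerS]
    change _ ↔ Multiplicative.ofAdd (Φ (Additive.ofMul y)) = 1
    rw [ofAdd_eq_one]
    constructor
    · intro hy; ext d; exact hy.2 d
    · intro hy; exact ⟨y.2, fun d => congrFun hy d⟩
  have h2 : C.kerS.relIndex (EE F N) = Nat.card Ψ.range := by
    rw [← Subgroup.index_ker, ← h1]; rfl
  let W : Submodule (ZMod p) ((ZMod p)ˣ → ZMod p) := AddSubgroup.toZModSubmodule p Φ.range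
  have h3 : Nat.card Ψ.range = Nat.card W := rfl
  have h4 : Nat.card W = p ^ Module.finrank (ZMod p) W := by
    rw [Module.natCard_eq_pow_finrank (K := ZMod p), Nat.card_zmod]
  rw [h2, h3, h4]
  apply Nat.pow_le_pow_right hpF.out.pos
  have hW : ∀ j ∈ B, (fun d : (ZMod p)ˣ => (d : ZMod p) ^ j) ∈ W := by
    intro j hj
    obtain ⟨y, hy, hy2⟩ := h j hj
    have e : (fun d : (ZMod p)ˣ => (d : ZMod p) ^ j) = (hat j (fun d => C.s d y))⁻¹ • (fun d => C.s d (C.TT j y)) := by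
      ext d
      rw [Pi.smul_apply, s_TT, smul_eq_mul]
      field_simp
    rw [e]
    apply W.smul_mem
    exact ⟨Additive.ofMul ⟨C.TT j y, C.TT_mem j N y hy⟩, rfl⟩
  obtain ⟨g, hg⟩ := exists_gpow (p := p)
  have hli : LinearIndependent (ZMod p) (fun j : B => (⟨_, hW j j.2⟩ : W)) := by
    rw [Fintype.linearIndependent_iff]
    intro c hc j
    have := vander g hg B hB (fun j => if h : j ∈ B then c ⟨j, h⟩ else 0) (by
      intro i _
      have e := congrArg (fun w : W => w.1 (g ^ i)) hc
      simp only [Submodule.coe_sum, Submodule.coe_smul, Finset.sum_apply, Pi.smul_apply, smul_eq_mul, Submodule.coe_zero, Pi.zero_apply] at e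
      refine Eq.trans ?_ e
      rw [← Finset.sum_coe_sort B]
      apply sum_congr rfl
      intro j _
      simp only [dif_pos j.2]) j j.2
    simpa using this
  have := hli.fintype_card_le_finrank
  simpa using this

theorem exists_hat (hh : ¬ p ∣ classNumber F) (hG : ∀ k, Odd k → 3 ≤ k → k ≤ p - 2 → hat k (fun d => C.G d) ≠ 0)
    (j : ℕ) (h2 : 2 ≤ j) (hj : j ≤ p - 2) : ∃ y ∈ EE F N, hat j (fun d => C.s d y) ≠ 0 := by
  have hp5 := C.hp5
  rcases Nat.even_or_odd j with he | ho
  · refine C.even_case hh hG j he h2 ?_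
    have hodd : Odd p := hpF.out.odd_of_ne_two (by omega)
    rw [Nat.even_iff] at he; rw [Nat.odd_iff] at hodd; omega
  · have h3 : 3 ≤ j := by rw [Nat.odd_iff] at ho; omega
    obtain ⟨b, hb, hb2⟩ := exists_b ho h3 hj
    have hb' : ((1 : (ZMod p)ˣ) : ZMod p) + b ≠ 0 := by simpa using hb
    refine ⟨_, C.Ju_mem _ _ (Units.ne_zero 1) (Units.ne_zero b) hb', ?_⟩
    rw [C.hat_s_J j 1 b hb', Units.val_one]
    exact mul_ne_zero hb2 (hG j ho h3 hj)

theorem kerS_index1 (hh : ¬ p ∣ classNumber F) (hG : ∀ k, Odd k → 3 ≤ k → k ≤ p - 2 → hat k (fun d => C.G d) ≠ 0) :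
    p ^ (p - 3) ≤ C.kerS.relIndex (EE F N) := by
  have hp5 := C.hp5
  have := C.kerS_index (Icc 2 (p - 2)) (fun j hj => by have := mem_Icc.1 hj; omega)
    (fun j hj => C.exists_hat hh hG j (mem_Icc.1 hj).1 (mem_Icc.1 hj).2)
  rwa [Nat.card_Icc, show p - 2 + 1 - 2 = p - 3 by omega] at this

theorem kerS_index2 (hh : ¬ p ∣ classNumber F) (hG : ∀ k, Odd k → 3 ≤ k → k ≤ p - 2 → hat k (fun d => C.G d) ≠ 0)
    (hz : C.ind C.z ≠ 0) : p ^ (p - 2) ≤ C.kerS.relIndex (EE F N) := by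
  have hp5 := C.hp5
  have := C.kerS_index (Icc 1 (p - 2)) (fun j hj => by have := mem_Icc.1 hj; omega)
    (fun j hj => by
      obtain ⟨h1, h2⟩ := mem_Icc.1 hj
      rcases h1.eq_or_lt with rfl | h1
      · refine ⟨C.zu, ?_, ?_⟩
        · apply mem_EE_of_pow hpF.out.ne_zero hNF.out.ne_zero
          have : C.zu ^ p = 1 := by ext; exact C.hζ.pow_eq_one
          rw [this]; exact one_mem _
        · simp_rw [(C.vs_zeta _).2]
          have e : hat 1 (fun d : (ZMod p)ˣ => (d : ZMod p) * C.ind C.z) = ∑ d : (ZMod p)ˣ, C.ind C.z := by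
            unfold hat
            apply sum_congr rfl
            intro d _
            rw [pow_one, ← mul_assoc, Units.inv_mul, one_mul]
          rw [e, sum_const, card_univ, ZMod.card_units, nsmul_eq_mul, Nat.cast_sub hpF.out.one_le, CharP.cast_eq_zero, Nat.cast_one, zero_sub]
          simpa using hz
      · exact C.exists_hat hh hG j h1 h2)
  rwa [Nat.card_Icc, show p - 2 + 1 - 1 = p - 2 by omega] at this

theorem PR_or (n : Fˣ) (hn : (n : F) = N) : C.PR n ∨ C.ind C.z ≠ 0 := by
  by_cases h : p ∣ C.m0
  · left
    obtain ⟨k, hk⟩ := h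
    refine ⟨((N : ℕ) : 𝓞 F), 1, ?_, ?_, ?_⟩
    · intro h; exact C.pO_prime.not_unit (isUnit_of_dvd_one h)
    · have e : ((N : ℕ) : 𝓞 F) - 1 = (p : 𝓞 F) * (p : 𝓞 F) * k := by
        rw [C.hN, hk]; push_cast; ring
      rw [e]
      apply Dvd.dvd.mul_right
      have h1 : C.pO ^ (p - 1) ∣ (p : 𝓞 F) := C.pO_assoc.dvd
      have h2 : C.pO ∣ (p : 𝓞 F) := C.pO_dvd_p
      have := mul_dvd_mul h1 h2
      rwa [← pow_succ, Nat.sub_add_cancel hpF.out.one_le] at this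
    · rw [hn]; simp
  · right
    intro h0
    have h1 := C.ind_spec (x := C.z) (C.hz.ne_zero hpF.out.ne_zero)
    rw [h0, ZMod.val_zero, pow_zero] at h1
    exact h (C.hz.dvd_of_pow_eq_one _ h1.symm)

end Cy

end

section

open NumberField IsDedekindDomain

/-- trivial classes -/
def TR (M : Type*) [Field M] (p s : ℕ) : Subgroup Mˣ where
  carrier := {x | ∃ e ∈ EE M s, ∃ y : Mˣ, x = e * y ^ p}
  one_mem' := ⟨1, one_mem _, 1, by simp⟩
  mul_mem' := by
    rintro _ _ ⟨e, he, y, rfl⟩ ⟨e', he', y', rfl⟩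
    exact ⟨e * e', mul_mem he he', y * y', by rw [mul_pow, mul_mul_mul_comm]⟩
  inv_mem' := by
    rintro _ ⟨e, he, y, rfl⟩
    exact ⟨e⁻¹, inv_mem he, y⁻¹, by rw [mul_inv, inv_pow]⟩

theorem mem_TR {M : Type*} [Field M] {p s : ℕ} {x : Mˣ} : x ∈ TR M p s ↔ ∃ e ∈ EE M s, ∃ y : Mˣ, x = e * y ^ p := Iff.rfl

theorem EE_le_TR {M : Type*} [Field M] {p s : ℕ} : EE M s ≤ TR M p s := fun x hx => ⟨x, hx, 1, by simp⟩

theorem pow_mem_TR {M : Type*} [Field M] {p s : ℕ} (y : Mˣ) : y ^ p ∈ TR M p s := ⟨1, one_mem _, y, by simp⟩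

namespace KD
variable {p : ℕ} {F M : Type} [Field F] [Field M] [NumberField F] [NumberField M] [Algebra F M]

theorem s_mem_EE (D : KD p F M) {s : ℕ} {x : Mˣ} (hx : x ∈ EE M s) : D.s x ∈ EE M s := ua_mem_EE _ hx

theorem s_iter_mem_EE (D : KD p F M) {s : ℕ} {x : Mˣ} (hx : x ∈ EE M s) (i : ℕ) : D.s^[i] x ∈ EE M s := by
  induction i with
  | zero => exact hx
  | succ n ih => rw [Function.iterate_succ_apply']; exact D.s_mem_EE ih

theorem s_iter_div (D : KD p F M) {s : ℕ} {x : Mˣ} (hx : D.s x / x ∈ EE M s) (i : ℕ) : D.s^[i] x / x ∈ EE M s := by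
  induction i with
  | zero => simp [one_mem]
  | succ n ih =>
    have : D.s^[n+1] x / x = (D.s^[n] (D.s x / x)) * (D.s^[n] x / x) := by
      rw [iterate_map_div, Function.iterate_succ_apply, div_mul_div_cancel]
    rw [this]
    exact mul_mem (D.s_iter_mem_EE hx n) ih

theorem Nm_div (D : KD p F M) {s : ℕ} {x : Mˣ} (hx : D.s x / x ∈ EE M s) : um F M (D.Nm x) / x ^ p ∈ EE M s := by
  have : um F M (D.Nm x) / x ^ p = ∏ i ∈ Finset.range p, D.s^[i] x / x := by
    rw [Finset.prod_div_distrib, D.prod_s]; simp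
  rw [this]
  exact Subgroup.prod_mem _ fun i _ => D.s_iter_div hx i

theorem ker_main (D : KD p F M) (hh : ¬ p ∣ classNumber F) {s : ℕ} (hs : s ≠ 0)
    (hUR : ∀ q : HeightOneSpectrum (𝓞 F), (s : 𝓞 F) ∉ q.asIdeal → URat p F M q)
    (x ε w η : Mˣ) (hx : x ∈ Sel M p s) (hε : ε ∈ EE M s) (hη : η ∈ EE M s) (h : D.s x / x = ε * w ^ p) (hN : D.Nm w = D.Nm η) :
    x ∈ TR M p s := by
  have hp := D.hp
  obtain ⟨y, hy⟩ := D.hilbert90 (w / η) (by rw [map_div, hN, div_self'])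
  set x' := x / y ^ p with hx'
  have hx'S : x' ∈ Sel M p s := Subgroup.div_mem _ hx (pow_mem_Sel y)
  have hd : D.s x' / x' ∈ EE M s := by
    have : D.s x' / x' = ε * η ^ p := by
      rw [hx', map_div, map_pow, div_div_div_comm, h, ← div_pow, ← hy, div_pow, mul_div_assoc, div_div_cancel]
    rw [this]
    exact mul_mem hε (pow_mem hη _)
  have hE := D.Nm_div hd
  set f := D.Nm x' with hf
  obtain ⟨a, e, he, hfe⟩ := exists_pow_class (n := p ^ 2) (pow_ne_zero 2 hp.ne_zero) hs f (by
    intro q hq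
    apply D.dvd_ord_of_URat (hUR q hq)
    intro Q hQ
    have hQs : (s : 𝓞 M) ∉ Q.asIdeal := by
      rwa [liesOver_natCast_mem_iff hQ]
    have h1 : ord Q (um F M f) = p * ord Q x' := by
      have := (mem_EE_iff hs).1 hE Q hQs
      rw [ord_div, ord_pow] at this
      linarith
    rw [h1, pow_two]
    push_cast
    exact mul_dvd_mul_left _ (hx'S Q hQs))
  set h0 := classNumber F
  have hx2 : x' ^ h0 / um F M a ^ p ∈ EE M s := by
    apply mem_EE_of_pow hp.ne_zero hs
    have e1 : (x' ^ h0 / um F M a ^ p) ^ p = um F M e / (um F M f / x' ^ p) ^ h0 := by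
      have := congrArg (um F M) hfe
      rw [map_pow, map_mul, map_pow] at this
      rw [div_pow (um F M f), this, div_pow, ← pow_mul, ← pow_mul, ← pow_mul, mul_comm h0 p, pow_two, div_div_eq_mul_div,
        mul_comm ((um F M) a ^ (p * p)), div_mul_eq_div_div, mul_div_right_comm, div_self', one_mul]
    rw [e1]
    exact Subgroup.div_mem _ (um_mem_EE_iff.2 he) (pow_mem hE _)
  have hx3 : x' ^ h0 ∈ TR M p s := ⟨_, hx2, um F M a, by rw [div_mul_cancel]⟩
  have hx4 : x' ∈ TR M p s := coprime_pow_mem _ ((Nat.Prime.coprime_iff_not_dvd hp).2 hh) (pow_mem_TR x') hx3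
  have : x = x' * y ^ p := by rw [hx', div_mul_cancel]
  rw [this]
  exact mul_mem hx4 (pow_mem_TR y)

/-- norms of S-units -/
noncomputable def NE (D : KD p F M) (s : ℕ) : Subgroup Fˣ := (EE M s).map D.Nm

theorem XX_refl (s : ℕ) : XX M (RingEquiv.refl M) s = EE M s := by
  ext x
  constructor
  · exact fun h => h.1
  · exact fun h => ⟨h, by ext; rfl⟩

theorem NE_bound (D : KD p F M) (hh : ¬ p ∣ classNumber F) {s : ℕ} (hs : s ≠ 0)
    (hUR : ∀ q : HeightOneSpectrum (𝓞 F), (s : 𝓞 F) ∉ q.asIdeal → URat p F M q) {I : Type} [Fintype I] (v : I → Additive Fˣ →+ ℤ)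
    (hv : ∀ f ∈ EE F s, (∀ i, v i (Additive.ofMul f) = 0) → f ∈ (unitsHom F).range)
    (q : I → HeightOneSpectrum (𝓞 F)) (hq : Function.Injective q) (hqs : ∀ i, (s : 𝓞 F) ∈ (q i).asIdeal)
    (hrF : 2 * (Units.rank F + 1) = p - 1) (hrM : 2 * (Units.rank M + 1) = (p - 1) * p) :
    (D.NE s).relIndex (EE F s) ≤ p ^ (Fintype.card I - 1) ∧ (D.NE s).relIndex (EE F s) ≠ 0 := by
  classical
  have hp5 := D.hp5
  have hex : ∀ i, ∃ Q : HeightOneSpectrum (𝓞 M), Q.asIdeal.LiesOver (q i).asIdeal := fun i => exists_over (q i)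
  choose Q hQ using hex
  obtain ⟨k, hk⟩ : ∃ k, p = 2 * k + 1 := by
    obtain ⟨k, hk⟩ := D.hp.odd_of_ne_two (show p ≠ 2 by omega); exact ⟨k, hk⟩
  have e3 : p - 1 = 2 * k := by omega
  obtain ⟨h1, h2⟩ := D.gt_bound hh (RingEquiv.refl M) (RingEquiv.refl F) (fun _ => rfl) (fun _ => rfl) (fun _ => rfl) (m := 1) one_ne_zero
    (fun x _ => by congr 1) hs hUR (I := I) v (by rw [XX_refl]; exact hv) (T := I) Q
    (fun i => by rw [liesOver_natCast_mem_iff (hQ i)]; exact hqs i)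
    (fun t t' htt => by
      have hne : Q t ≠ Q t' := by
        intro h
        apply htt
        apply hq
        apply HeightOneSpectrum.ext
        rw [(hQ t).over, (hQ t').over]
        exact congrArg (fun Q : HeightOneSpectrum (𝓞 M) => Q.asIdeal.under (𝓞 F)) h
      refine ⟨hne, ?_⟩
      by_contra! hc
      have hle : (Q t').asIdeal ≤ (Q t).asIdeal := by
        intro z hz
        have := hc z hz
        have e : RingOfIntegers.mapRingHom ((RingEquiv.refl M : M ≃+* M) : M →+* M) z = z := by
          apply RingOfIntegers.ext; rfl
        rwa [e] at this
      exact hne (HeightOneSpectrum.ext ((Q t').isMaximal.eq_of_le (Q t).isPrime.ne_top hle).symm))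
    k (by
      rw [e3] at hrF hrM ⊢
      have : Units.rank M + 1 = k * p := by nlinarith
      rw [hk] at this
      nlinarith)
  have hNE : D.NX (RingEquiv.refl M) s = D.NE s := by rw [NX, XX_refl, NE]
  rw [hNE, XX_refl] at h1 h2
  refine ⟨?_, h2⟩
  have e5 : Units.rank F + Fintype.card I = (Fintype.card I - 1) + k ∨ Fintype.card I = 0 := by omega
  rcases e5 with e5 | e5
  · rw [e5, pow_add] at h1
    exact Nat.le_of_mul_le_mul_right h1 (pow_pos D.hp.pos _)
  · rw [e5, Nat.add_zero] at h1
    have : p ^ Units.rank F < p ^ k := Nat.pow_lt_pow_right (by omega) (by omega)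
    have h3 := Nat.le_mul_of_pos_left (p ^ k) (Nat.pos_of_ne_zero h2)
    omega

end KD

end

section

open NumberField IsDedekindDomain

theorem ord_span {K : Type*} [Field K] [NumberField K] (v : HeightOneSpectrum (𝓞 K)) (x : Kˣ) (a : 𝓞 K) (h : (x : K) = algebraMap (𝓞 K) K a)
    (hv : v.asIdeal = Ideal.span {a}) : ord v x = 1 := by
  have ha : a ≠ 0 := by
    rintro rfl
    rw [map_zero] at h
    exact x.ne_zero h
  rw [ord, h, v.valuation_of_algebraMap, v.intValuation_singleton ha hv, WithZero.log_exp, neg_neg]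

namespace Cy
variable {p N : ℕ} [hpF : Fact p.Prime] [hNF : Fact N.Prime] {F M : Type} [Field F] [NumberField F] [Field M] [NumberField M] [Algebra F M] (C : Cy p N F)

/-- the uniformizer -/
noncomputable def pu : Fˣ := Units.mk0 (C.pO : F) (by
  rw [Ne, RingOfIntegers.coe_eq_zero_iff]; exact C.pO_prime.ne_zero)

theorem ord_lam_pu : ord C.lam C.pu = 1 := ord_span _ _ C.pO rfl rfl

theorem ord_pu (q : HeightOneSpectrum (𝓞 F)) (hq : (p : 𝓞 F) ∉ q.asIdeal) : ord q C.pu = 0 := by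
  rw [ord_eq_zero_iff_notMem q C.pu C.pO rfl]
  intro h
  apply hq
  obtain ⟨c, hc⟩ := C.pO_dvd_p
  rw [hc]; exact Ideal.mul_mem_right _ _ h

theorem Nm_mem_EE (D : KD p F M) {s : ℕ} {x : Mˣ} (hx : x ∈ EE M s) : D.Nm x ∈ EE F s := by
  rw [← um_mem_EE_iff (M := M), ← D.prod_s]
  exact Subgroup.prod_mem _ fun i _ => D.s_iter_mem_EE hx i

theorem s_Nm (D : KD p F M) (hu : (D.u : F) = N) (d : (ZMod p)ˣ) (w : Mˣ) : C.s d (D.Nm w) = 0 := by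
  obtain ⟨h1, h2⟩ := C.vs_N d D.u hu
  have := C.symbol_norm D d (by
    rw [h1]; intro h
    have := Int.eq_one_of_dvd_one (by positivity) h
    have := C.hp5; omega) w
  rw [h1, h2] at this
  simpa using this.symm

theorem fix_w (D : KD p F M) (hu : (D.u : F) = N) (x : Mˣ) (hf : D.s x / x ∈ TR M p N) :
    ∃ ε ∈ EE M N, ∃ w : Mˣ, D.s x / x = ε * w ^ p ∧ D.Nm w ∈ C.kerS ∧ (D.Nm w) ^ p ∈ D.NE N := by
  obtain ⟨ε, hε, w, h⟩ := hf
  have h1 : D.Nm ε * D.Nm w ^ p = 1 := by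
    rw [← map_pow, ← map_mul, ← h, map_div, D.Nm_s, div_self']
  have h2 : D.Nm w ^ p = D.Nm ε⁻¹ := by rw [map_inv, eq_inv_iff_mul_eq_one, mul_comm]; exact h1
  refine ⟨ε, hε, w, h, ⟨?_, fun d => C.s_Nm D hu d w⟩, ε⁻¹, inv_mem hε, h2.symm⟩
  apply mem_EE_of_pow hpF.out.ne_zero hNF.out.ne_zero
  rw [h2]
  exact Nm_mem_EE D (inv_mem hε)

theorem line_ur (D : KD p F M) (hu : (D.u : F) = N) (hh : ¬ p ∣ classNumber F)
    (hker : p ^ (p - 3) ≤ C.kerS.relIndex (EE F N))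
    (hUR : ∀ q : HeightOneSpectrum (𝓞 F), (N : 𝓞 F) ∉ q.asIdeal → KD.URat p F M q)
    (x1 x2 : Mˣ) (S1 : x1 ∈ Sel M p N) (S2 : x2 ∈ Sel M p N) (f1 : D.s x1 / x1 ∈ TR M p N) (f2 : D.s x2 / x2 ∈ TR M p N) :
    x1 ∈ TR M p N ∨ ∃ a : ℤ, x2 * x1 ^ a ∈ TR M p N := by
  have hp5 := C.hp5
  obtain ⟨e1, he1, w1, hw1, t1, tp1⟩ := C.fix_w D hu x1 f1
  obtain ⟨e2, he2, w2, hw2, t2, tp2⟩ := C.fix_w D hu x2 f2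
  have hle : D.NE N ≤ C.kerS := by
    rintro _ ⟨η, hη, rfl⟩
    exact ⟨Nm_mem_EE D hη, fun d => C.s_Nm D hu d η⟩
  obtain ⟨b1, b2⟩ := D.NE_bound hh hNF.out.ne_zero hUR (I := (ZMod p)ˣ) (fun d => C.vH d)
    (fun f hf hv => C.unit_of_v f hf hv) C.nn (fun _ _ h => C.nn_inj h) (fun d => C.N_mem_nn d) C.rankF (C.rankM D)
  rw [ZMod.card_units] at b1
  have hmul := Subgroup.relIndex_mul_relIndex _ _ _ hle C.kerS_le
  have hi0 : (D.NE N).relIndex C.kerS ≠ 0 := fun h => b2 (by rw [← hmul, h, zero_mul])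
  have hi : (D.NE N).relIndex C.kerS ≤ p := by
    have h1 : (D.NE N).relIndex C.kerS * p ^ (p - 3) ≤ p * p ^ (p - 3) := by
      refine (Nat.mul_le_mul_left _ hker).trans ?_
      rw [hmul, ← pow_succ', show p - 3 + 1 = p - 1 - 1 by omega]
      exact b1
    exact Nat.le_of_mul_le_mul_right h1 (pow_pos hpF.out.pos _)
  rcases small_index hpF.out _ _ hle hi0 hi _ _ t1 t2 tp1 with ⟨η, hη, h⟩ | ⟨a, η, hη, h⟩
  · left
    exact D.ker_main hh hNF.out.ne_zero hUR x1 e1 w1 η S1 he1 hη hw1 h.symm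
  · right
    refine ⟨a, D.ker_main hh hNF.out.ne_zero hUR (x2 * x1 ^ a) (e2 * e1 ^ a) (w2 * w1 ^ a) η (mul_mem S2 (zpow_mem S1 a))
      (mul_mem he2 (zpow_mem he1 a)) hη ?_ ?_⟩
    · rw [map_mul, map_zpow, mul_div_mul_comm, ← div_zpow, hw1, hw2, mul_zpow, mul_pow, mul_mul_mul_comm]
      congr 2
      rw [← zpow_natCast, ← zpow_natCast, zpow_comm]
    · rw [map_mul, map_zpow]; exact h.symm

section ram
variable (D : KD p F M) (Q0 : HeightOneSpectrum (𝓞 M)) (hQ0 : Q0.asIdeal.LiesOver C.lam.asIdeal)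
  (he : C.lam.asIdeal.ramificationIdx' Q0.asIdeal = p) (hun : ∀ Q' : HeightOneSpectrum (𝓞 M), Q'.asIdeal.LiesOver C.lam.asIdeal → Q' = Q0)

theorem eq_Q0 (hun : ∀ Q' : HeightOneSpectrum (𝓞 M), Q'.asIdeal.LiesOver C.lam.asIdeal → Q' = Q0)
    (Q : HeightOneSpectrum (𝓞 M)) (hQ : (p : 𝓞 M) ∈ Q.asIdeal) : Q = Q0 := by
  obtain ⟨q, hq⟩ := exists_under (K := F) Q
  apply hun
  rw [liesOver_natCast_mem_iff hq] at hQ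
  rwa [C.eq_lam q hQ] at hq

theorem ord_Q0_um (hQ0 : Q0.asIdeal.LiesOver C.lam.asIdeal) (he : C.lam.asIdeal.ramificationIdx' Q0.asIdeal = p) (f : Fˣ) :
    ord Q0 (um F M f) = p * ord C.lam f := by
  rw [ord_liesOver C.lam Q0, he]

theorem p_mem_Q0 (hQ0 : Q0.asIdeal.LiesOver C.lam.asIdeal) : (p : 𝓞 M) ∈ Q0.asIdeal := by
  rw [liesOver_natCast_mem_iff hQ0]; exact C.p_mem_lam

theorem ord_Q0_s (hQ0 : Q0.asIdeal.LiesOver C.lam.asIdeal)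
    (hun : ∀ Q' : HeightOneSpectrum (𝓞 M), Q'.asIdeal.LiesOver C.lam.asIdeal → Q' = Q0) (x : Mˣ) : ord Q0 (D.s x) = ord Q0 x := by
  obtain ⟨q, h1, h2⟩ := exists_ord_equiv (D.σ : M ≃+* M) Q0
  have : q = Q0 := C.eq_Q0 Q0 hun q ((natCast_mem_equiv _ h2 p).2 (C.p_mem_Q0 Q0 hQ0))
  rw [this] at h1
  exact h1 x

theorem ord_lam_Nm (hQ0 : Q0.asIdeal.LiesOver C.lam.asIdeal) (he : C.lam.asIdeal.ramificationIdx' Q0.asIdeal = p)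
    (hun : ∀ Q' : HeightOneSpectrum (𝓞 M), Q'.asIdeal.LiesOver C.lam.asIdeal → Q' = Q0) (x : Mˣ) : ord C.lam (D.Nm x) = ord Q0 x := by
  have h1 := C.ord_Q0_um Q0 hQ0 he (D.Nm x)
  have h2 : ∀ i, ord Q0 (D.s^[i] x) = ord Q0 x := by
    intro i
    induction i with
    | zero => rfl
    | succ n ih => rw [Function.iterate_succ_apply', C.ord_Q0_s D Q0 hQ0 hun, ih]
  rw [← D.prod_s, ord_prod, Finset.sum_congr rfl (fun i _ => h2 i), Finset.sum_const, Finset.card_range, nsmul_eq_mul] at h1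
  have : (p : ℤ) ≠ 0 := by exact_mod_cast hpF.out.ne_zero
  exact (mul_left_cancel₀ this h1).symm

theorem adjust (hQ0 : Q0.asIdeal.LiesOver C.lam.asIdeal) (he : C.lam.asIdeal.ramificationIdx' Q0.asIdeal = p)
    (hun : ∀ Q' : HeightOneSpectrum (𝓞 M), Q'.asIdeal.LiesOver C.lam.asIdeal → Q' = Q0)
    (e : Mˣ) (hE : e ∈ EE M (p * N)) (m : ℤ) (hm : ord Q0 e = p * m) : e * (um F M C.pu) ^ (-m) ∈ EE M N := by
  rw [mem_EE_iff hNF.out.ne_zero]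
  intro Q hQ
  by_cases hp : (p : 𝓞 M) ∈ Q.asIdeal
  · rw [C.eq_Q0 Q0 hun Q hp, ord_mul, ord_zpow, hm, C.ord_Q0_um Q0 hQ0 he, ord_lam_pu]; ring
  · have h1 : ord Q e = 0 := by
      refine (mem_EE_iff (mul_ne_zero hpF.out.ne_zero hNF.out.ne_zero)).1 hE Q ?_
      push_cast
      intro h
      exact (Q.isPrime.mem_or_mem h).elim hp hQ
    obtain ⟨q, hq⟩ := exists_under (K := F) Q
    rw [liesOver_natCast_mem_iff hq] at hp
    rw [ord_mul, ord_zpow, h1, ord_liesOver q Q, C.ord_pu q hp]; simp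

theorem TR_adjust (hQ0 : Q0.asIdeal.LiesOver C.lam.asIdeal) (he : C.lam.asIdeal.ramificationIdx' Q0.asIdeal = p)
    (hun : ∀ Q' : HeightOneSpectrum (𝓞 M), Q'.asIdeal.LiesOver C.lam.asIdeal → Q' = Q0) (hNQ : (N : 𝓞 M) ∉ Q0.asIdeal)
    (x : Mˣ) (hx : x ∈ TR M p (p * N)) (hS : x ∈ Sel M p N) : ∃ m : ℤ, x * (um F M C.pu) ^ m ∈ TR M p N := by
  obtain ⟨e, hE, y, rfl⟩ := hx
  have h1 := hS Q0 hNQ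
  rw [ord_mul, ord_pow, dvd_add_left (dvd_mul_right _ _)] at h1
  obtain ⟨m, hm⟩ := h1
  refine ⟨-m, ?_⟩
  rw [mul_right_comm]
  exact mul_mem (EE_le_TR (C.adjust Q0 hQ0 he hun e hE m hm)) (pow_mem_TR y)

end ram

end Cy

end

section

open NumberField IsDedekindDomain

namespace Cy
variable {p N : ℕ} [hpF : Fact p.Prime] [hNF : Fact N.Prime] {F M : Type} [Field F] [NumberField F] [Field M] [NumberField M] [Algebra F M] (C : Cy p N F)

theorem N_notMem_of_p {L : Type*} [Field L] [NumberField L] (C : Cy p N F) (Q : HeightOneSpectrum (𝓞 L)) (hQ : (p : 𝓞 L) ∈ Q.asIdeal) : (N : 𝓞 L) ∉ Q.asIdeal := by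
  intro h
  rw [C.hN] at h
  apply Q.isPrime.ne_top
  rw [Ideal.eq_top_iff_one]
  push_cast at h
  rwa [Ideal.add_mem_iff_right _ (Ideal.mul_mem_left _ _ hQ)] at h

theorem hUR_pN (D : KD p F M) (hζ : D.ζ = C.ζ) (hm : D.u ∈ EE F N) (q : HeightOneSpectrum (𝓞 F)) (hq : ((p * N : ℕ) : 𝓞 F) ∉ q.asIdeal) :
    KD.URat p F M q := by
  push_cast at hq
  have h1 : (p : 𝓞 F) ∉ q.asIdeal := fun h => hq (Ideal.mul_mem_right _ _ h)
  have h2 : (N : 𝓞 F) ∉ q.asIdeal := fun h => hq (Ideal.mul_mem_left _ _ h)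
  exact C.urat_a D hζ q h1 ((mem_EE_iff hNF.out.ne_zero).1 hm q h2)

theorem pN_ne : p * N ≠ 0 := mul_ne_zero hpF.out.ne_zero hNF.out.ne_zero

theorem NE_pN (D : KD p F M) (hζ : D.ζ = C.ζ) (hm : D.u ∈ EE F N) (hh : ¬ p ∣ classNumber F) :
    (D.NE (p * N)).relIndex (EE F (p * N)) ≤ p ^ (p - 1) ∧ (D.NE (p * N)).relIndex (EE F (p * N)) ≠ 0 := by
  have hp5 := C.hp5
  have h := D.NE_bound hh pN_ne (C.hUR_pN D hζ hm) (I := Option (ZMod p)ˣ) (fun o => o.elim (ordHom C.lam) C.vH)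
    (fun f hf hv => by
      refine C.unit_of_v f ?_ (fun d => hv (some d))
      rw [mem_EE_iff hNF.out.ne_zero]
      intro v hvN
      by_cases hvp : (p : 𝓞 F) ∈ v.asIdeal
      · rw [C.eq_lam v hvp]; exact hv none
      · refine (mem_EE_iff pN_ne).1 hf v ?_
        push_cast
        intro h
        exact (v.isPrime.mem_or_mem h).elim hvp hvN)
    (fun o => o.elim C.lam C.nn)
    (by
      have hne : ∀ d, C.nn d ≠ C.lam := fun d h => C.N_notMem_of_p C.lam C.p_mem_lam (h ▸ C.N_mem_nn d)
      rintro (_ | a) (_ | b) h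
      · rfl
      · exact absurd h.symm (hne b)
      · exact absurd h (hne a)
      · exact congrArg some (C.nn_inj h))
    (by
      rintro (_ | a)
      · push_cast; exact Ideal.mul_mem_right _ _ C.p_mem_lam
      · push_cast; exact Ideal.mul_mem_left _ _ (C.N_mem_nn a))
    C.rankF (C.rankM D)
  rw [Fintype.card_option, ZMod.card_units] at h
  rwa [show p - 1 + 1 - 1 = p - 1 by omega] at h

/-- elements of `EE F (pN)` with `lam`-order divisible by `p` -/
noncomputable def Up : Subgroup Fˣ where
  carrier := {f | f ∈ EE F (p * N) ∧ (p : ℤ) ∣ ord C.lam f}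
  one_mem' := ⟨one_mem _, by rw [ord_one]; exact dvd_zero _⟩
  mul_mem' := fun {x y} hx hy => ⟨mul_mem hx.1 hy.1, by rw [ord_mul]; exact dvd_add hx.2 hy.2⟩
  inv_mem' := fun {x} hx => ⟨inv_mem hx.1, by rw [ord_inv]; exact (dvd_neg).2 hx.2⟩

theorem pu_mem : C.pu ∈ EE F (p * N) := by
  rw [mem_EE_iff pN_ne]
  intro v hv
  apply C.ord_pu
  intro h
  apply hv
  push_cast; exact Ideal.mul_mem_right _ _ h

theorem Up_index : C.Up.relIndex (EE F (p * N)) = p := by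
  let Φ : Additive (EE F (p * N)) →+ ZMod p :=
    { toFun := fun y => (ord C.lam (y.toMul : Fˣ) : ZMod p)
      map_zero' := by simp [ord_one]
      map_add' := fun x y => by
        simp only [toMul_add, Subgroup.coe_mul, ord_mul, Int.cast_add] }
  let Ψ := AddMonoidHom.toMultiplicativeRight Φ
  have h1 : C.Up.subgroupOf (EE F (p * N)) = Ψ.ker := by
    ext y
    rw [MonoidHom.mem_ker, Subgroup.mem_subgroupOf]
    change _ ↔ Multiplicative.ofAdd (Φ (Additive.ofMul y)) = 1
    rw [ofAdd_eq_one]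
    change (_ ∧ _) ↔ ((ord C.lam (y : Fˣ) : ℤ) : ZMod p) = 0
    rw [ZMod.intCast_zmod_eq_zero_iff_dvd]
    exact and_iff_right y.2
  have h2 : C.Up.relIndex (EE F (p * N)) = Nat.card Ψ.range := by
    rw [← Subgroup.index_ker, ← h1]; rfl
  have h3 : Ψ.range = ⊤ := by
    rw [MonoidHom.range_eq_top]
    intro z
    obtain ⟨k, hk⟩ := ZMod.intCast_surjective (Multiplicative.toAdd z)
    refine ⟨(⟨C.pu, C.pu_mem⟩ : EE F (p * N)) ^ k, ?_⟩
    change Multiplicative.ofAdd (((ord C.lam (C.pu ^ k) : ℤ) : ZMod p)) = z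
    rw [ord_zpow, ord_lam_pu, mul_one, hk]; rfl
  rw [h2, h3, Subgroup.card_top]
  change Nat.card (ZMod p) = p
  exact Nat.card_zmod p

theorem Sel_mono {L : Type*} [Field L] [NumberField L] {p s t : ℕ} (h : s ∣ t) : Sel L p s ≤ Sel L p t := by
  intro x hx v hv
  refine hx v fun hs => hv ?_
  obtain ⟨c, rfl⟩ := h
  push_cast; exact Ideal.mul_mem_right _ _ hs

theorem EE_le_Up : EE F N ≤ C.Up := by
  intro f hf
  refine ⟨EE_mono (dvd_mul_left _ _) hf, ?_⟩
  rw [(mem_EE_iff hNF.out.ne_zero).1 hf C.lam (C.N_notMem_of_p C.lam C.p_mem_lam)]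
  exact dvd_zero _

theorem line_nr (D : KD p F M) (hζ : D.ζ = C.ζ) (hu : (D.u : F) = N) (hm : D.u ∈ EE F N) (hh : ¬ p ∣ classNumber F)
    (hker : p ^ (p - 2) ≤ C.kerS.relIndex (EE F N))
    (Q0 : HeightOneSpectrum (𝓞 M)) (hQ0 : Q0.asIdeal.LiesOver C.lam.asIdeal)
    (he : C.lam.asIdeal.ramificationIdx' Q0.asIdeal = p) (hun : ∀ Q' : HeightOneSpectrum (𝓞 M), Q'.asIdeal.LiesOver C.lam.asIdeal → Q' = Q0)
    (x1 x2 : Mˣ) (S1 : x1 ∈ Sel M p N) (S2 : x2 ∈ Sel M p N) (f1 : D.s x1 / x1 ∈ TR M p N) (f2 : D.s x2 / x2 ∈ TR M p N) :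
    x1 ∈ TR M p N ∨ ∃ a : ℤ, x2 * x1 ^ a ∈ TR M p N := by
  have hp5 := C.hp5
  have hNQ : (N : 𝓞 M) ∉ Q0.asIdeal := C.N_notMem_of_p Q0 (C.p_mem_Q0 Q0 hQ0)
  have hEm : ∀ {L : Type} [Field L] [NumberField L], EE L N ≤ EE L (p * N) := fun {L} _ _ => EE_mono (dvd_mul_left _ _)
  obtain ⟨e1, he1, w1, hw1, t1, tp1⟩ := C.fix_w D hu x1 f1
  obtain ⟨e2, he2, w2, hw2, t2, tp2⟩ := C.fix_w D hu x2 f2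
  set H := D.NE (p * N) ⊓ EE F N with hH
  have hle : H ≤ C.kerS := by
    rintro _ ⟨⟨η, hη, rfl⟩, h2⟩
    exact ⟨h2, fun d => C.s_Nm D hu d η⟩
  obtain ⟨b1, b2⟩ := C.NE_pN D hζ hm hh
  have hHi : H.relIndex (EE F N) = (D.NE (p * N)).relIndex (EE F N) := Subgroup.inf_relIndex_right _ _
  have hmul := Subgroup.relIndex_mul_relIndex _ _ _ hle C.kerS_le
  -- kernel elements
  have key : ∀ x ε w η : Mˣ, x ∈ Sel M p N → ε ∈ EE M N → η ∈ EE M (p * N) → D.s x / x = ε * w ^ p → D.Nm w = D.Nm η →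
      ∃ m : ℤ, x * (um F M C.pu) ^ m ∈ TR M p N := by
    intro x ε w η hx hε hη h1 h2
    exact C.TR_adjust Q0 hQ0 he hun hNQ x (D.ker_main hh pN_ne (C.hUR_pN D hζ hm) x ε w η (Sel_mono (dvd_mul_left _ _) hx) (hEm hε) hη h1 h2) hx
  by_cases hpu : um F M C.pu ∈ TR M p N
  · have hb : H.relIndex (EE F N) ≤ p ^ (p - 1) := by
      rw [hHi]; exact (Subgroup.relIndex_le_of_le_right hEm b2).trans b1
    have hb0 : H.relIndex (EE F N) ≠ 0 := by
      rw [hHi]; exact fun h => b2 (Subgroup.relIndex_eq_zero_of_le_right hEm h)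
    have hi0 : H.relIndex C.kerS ≠ 0 := fun h => hb0 (by rw [← hmul, h, zero_mul])
    have hi : H.relIndex C.kerS ≤ p := by
      have h1 : H.relIndex C.kerS * p ^ (p - 2) ≤ p * p ^ (p - 2) := by
        refine (Nat.mul_le_mul_left _ hker).trans ?_
        rw [hmul, ← pow_succ', show p - 2 + 1 = p - 1 by omega]
        exact hb
      exact Nat.le_of_mul_le_mul_right h1 (pow_pos hpF.out.pos _)
    have fin : ∀ x, (∃ m : ℤ, x * (um F M C.pu) ^ m ∈ TR M p N) → x ∈ TR M p N := by
      rintro x ⟨m, hx⟩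
      exact ((TR M p N).mul_mem_cancel_right (zpow_mem hpu m)).1 hx
    have tp1' : D.Nm w1 ^ p ∈ H := by
      refine ⟨?_, pow_mem t1.1 p⟩
      obtain ⟨η, hη, h⟩ := tp1
      exact ⟨η, hEm hη, h⟩
    rcases small_index hpF.out _ _ hle hi0 hi _ _ t1 t2 tp1' with ⟨⟨η, hη, h⟩, _⟩ | ⟨a, ⟨η, hη, h⟩, _⟩
    · left
      exact fin _ (key x1 e1 w1 η S1 he1 hη hw1 h.symm)
    · right
      refine ⟨a, fin _ (key (x2 * x1 ^ a) (e2 * e1 ^ a) (w2 * w1 ^ a) η (mul_mem S2 (zpow_mem S1 a))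
        (mul_mem he2 (zpow_mem he1 a)) hη ?_ ?_)⟩
      · rw [map_mul, map_zpow, mul_div_mul_comm, ← div_zpow, hw1, hw2, mul_zpow, mul_pow, mul_mul_mul_comm]
        congr 2
        rw [← zpow_natCast, ← zpow_natCast, zpow_comm]
      · rw [map_mul, map_zpow]; exact h.symm
  · have hdv : ∀ η ∈ EE M (p * N), (p : ℤ) ∣ ord Q0 η := by
      intro η hη
      by_contra hnd
      apply hpu
      have h1 := C.adjust Q0 hQ0 he hun (η ^ p) (pow_mem hη p) (ord Q0 η) (by rw [ord_pow])
      have h2 : (um F M C.pu) ^ (-(ord Q0 η)) ∈ TR M p N :=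
        ((TR M p N).mul_mem_cancel_left (pow_mem_TR η)).1 (EE_le_TR h1)
      have h3 : (um F M C.pu) ^ (ord Q0 η) ∈ TR M p N := by rw [zpow_neg] at h2; exact inv_mem_iff.1 h2
      have h4 : (um F M C.pu) ^ (ord Q0 η).natAbs ∈ TR M p N := by
        rcases Int.natAbs_eq (ord Q0 η) with h | h <;> rw [h] at h3
        · rwa [zpow_natCast] at h3
        · rw [zpow_neg, zpow_natCast] at h3; exact inv_mem_iff.1 h3
      refine coprime_pow_mem _ ?_ h4 (pow_mem_TR (um F M C.pu))
      rw [Nat.coprime_comm, hpF.out.coprime_iff_not_dvd]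
      rwa [← Int.natCast_dvd]
    have hNU : D.NE (p * N) ≤ C.Up := by
      rintro _ ⟨η, hη, rfl⟩
      refine ⟨Nm_mem_EE D hη, ?_⟩
      rw [C.ord_lam_Nm D Q0 hQ0 he hun]
      exact hdv η hη
    have hmul2 := Subgroup.relIndex_mul_relIndex _ _ _ hNU (fun f hf => hf.1 : C.Up ≤ EE F (p * N))
    rw [C.Up_index] at hmul2
    have c0 : (D.NE (p * N)).relIndex C.Up ≠ 0 := fun h => b2 (by rw [← hmul2, h, zero_mul])
    have c1 : (D.NE (p * N)).relIndex C.Up ≤ p ^ (p - 2) := by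
      have : (D.NE (p * N)).relIndex C.Up * p ≤ p ^ (p - 2) * p := by
        rw [hmul2, ← pow_succ, show p - 2 + 1 = p - 1 by omega]; exact b1
      exact Nat.le_of_mul_le_mul_right this hpF.out.pos
    have hb : H.relIndex (EE F N) ≤ p ^ (p - 2) := by
      rw [hHi]; exact (Subgroup.relIndex_le_of_le_right C.EE_le_Up c0).trans c1
    have hb0 : H.relIndex (EE F N) ≠ 0 := by
      rw [hHi]; exact fun h => c0 (Subgroup.relIndex_eq_zero_of_le_right C.EE_le_Up h)
    have hi0 : H.relIndex C.kerS ≠ 0 := fun h => hb0 (by rw [← hmul, h, zero_mul])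
    have hi : H.relIndex C.kerS ≤ 1 := by
      have h1 : H.relIndex C.kerS * p ^ (p - 2) ≤ 1 * p ^ (p - 2) := by
        refine (Nat.mul_le_mul_left _ hker).trans ?_
        rw [hmul, one_mul]
        exact hb
      exact Nat.le_of_mul_le_mul_right h1 (pow_pos hpF.out.pos _)
    have hKH : C.kerS ≤ H := Subgroup.relIndex_eq_one.1 (by omega)
    obtain ⟨⟨η1, hη1, h1⟩, _⟩ := hKH t1
    obtain ⟨⟨η2, hη2, h2⟩, _⟩ := hKH t2
    obtain ⟨m1, k1⟩ := key x1 e1 w1 η1 S1 he1 hη1 hw1 h1.symm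
    obtain ⟨m2, k2⟩ := key x2 e2 w2 η2 S2 he2 hη2 hw2 h2.symm
    have hpp : ∀ c : ℤ, (p : ℤ) ∣ c → (um F M C.pu) ^ c ∈ TR M p N := by
      rintro _ ⟨c, rfl⟩
      rw [mul_comm, zpow_mul, zpow_natCast]; exact pow_mem_TR _
    by_cases hd : (p : ℤ) ∣ m1
    · left
      exact ((TR M p N).mul_mem_cancel_right (hpp _ hd)).1 k1
    · right
      have hcop : IsCoprime m1 (p : ℤ) := ((Nat.prime_iff_prime_int.1 hpF.out).coprime_iff_not_dvd.2 hd).symm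
      obtain ⟨a, b, hab⟩ := hcop
      refine ⟨-(a * m2), ?_⟩
      have h3 := mul_mem k2 (zpow_mem k1 (-(a * m2)))
      rw [mul_zpow, mul_mul_mul_comm, ← zpow_mul, ← zpow_add] at h3
      refine ((TR M p N).mul_mem_cancel_right (hpp _ ?_)).1 h3
      refine ⟨b * m2, ?_⟩
      linear_combination (-m2) * hab

theorem fixed_line (D : KD p F M) (hζ : D.ζ = C.ζ) (hu : (D.u : F) = N) (hm : D.u ∈ EE F N) (hh : ¬ p ∣ classNumber F)
    (hG : ∀ k, Odd k → 3 ≤ k → k ≤ p - 2 → hat k (fun d => C.G d) ≠ 0)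
    (x1 x2 : Mˣ) (S1 : x1 ∈ Sel M p N) (S2 : x2 ∈ Sel M p N) (f1 : D.s x1 / x1 ∈ TR M p N) (f2 : D.s x2 / x2 ∈ TR M p N) :
    x1 ∈ TR M p N ∨ ∃ a : ℤ, x2 * x1 ^ a ∈ TR M p N := by
  have hgal := D.galois
  have hfd := D.finDim
  rcases C.PR_or D.u hu with hPR | hz
  · exact C.line_ur D hu hh (C.kerS_index1 hh hG) (C.urat_all D hζ hPR hm) x1 x2 S1 S2 f1 f2
  · rcases ram_dichotomy hpF.out D.hdeg C.lam with h | ⟨Q0, hQ0, he, hun, _⟩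
    · refine C.line_ur D hu hh (C.kerS_index1 hh hG) ?_ x1 x2 S1 S2 f1 f2
      intro q hq
      by_cases hqp : (p : 𝓞 F) ∈ q.asIdeal
      · rw [C.eq_lam q hqp]; exact h
      · exact C.urat_a D hζ q hqp ((mem_EE_iff hNF.out.ne_zero).1 hm q hq)
    · exact C.line_nr D hζ hu hm hh (C.kerS_index2 hh hG hz) Q0 hQ0 he (fun Q' h => hun Q' h) x1 x2 S1 S2 f1 f2

/-- norms of Selmer elements are trivial -/
theorem Nm_TR (D : KD p F M) (hζ : D.ζ = C.ζ) (hm : D.u ∈ EE F N) (hh : ¬ p ∣ classNumber F)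
    (x : Mˣ) (S : x ∈ Sel M p N) : um F M (D.Nm x) ∈ TR M p N := by
  have hgal := D.galois
  have hfd := D.finDim
  have hS : ∀ i, D.s^[i] x ∈ Sel M p N := by
    intro i
    induction i with
    | zero => exact S
    | succ n ih => rw [Function.iterate_succ_apply']; exact Sel_map_equiv _ ih
  have hU : ∀ q : HeightOneSpectrum (𝓞 F), (N : 𝓞 F) ∉ q.asIdeal → KD.URat p F M q → (p : ℤ) ∣ ord q (D.Nm x) := by
    intro q hq h
    have := D.dvd_ord_of_URat h (D.Nm x) 1 (by
      intro Q hQ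
      have hNQ : (N : 𝓞 M) ∉ Q.asIdeal := by rwa [liesOver_natCast_mem_iff hQ]
      rw [← D.prod_s, ord_prod, pow_one]
      exact Finset.dvd_sum fun i _ => hS i Q hNQ)
    simpa using this
  have hF : D.Nm x ∈ Sel F p N := by
    intro q hq
    by_cases hqp : (p : 𝓞 F) ∈ q.asIdeal
    · rcases ram_dichotomy hpF.out D.hdeg C.lam with h | ⟨Q0, hQ0, he, hun, _⟩
      · exact hU q hq (by rw [C.eq_lam q hqp]; exact h)
      · rw [C.eq_lam q hqp, C.ord_lam_Nm D Q0 hQ0 he (fun Q' h => hun Q' h)]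
        exact S Q0 (C.N_notMem_of_p Q0 (C.p_mem_Q0 Q0 hQ0))
    · exact hU q hq (C.urat_a D hζ q hqp ((mem_EE_iff hNF.out.ne_zero).1 hm q hq))
  obtain ⟨a, e, he, h⟩ := exists_pow_class hpF.out.ne_zero hNF.out.ne_zero (D.Nm x) hF
  refine coprime_pow_mem _ (a := classNumber F) (b := p) ?_ ?_ (pow_mem_TR _)
  · rw [Nat.coprime_comm, hpF.out.coprime_iff_not_dvd]; exact hh
  · rw [← map_pow, h, map_mul, map_pow]
    exact mul_mem (pow_mem_TR _) (EE_le_TR ((um_mem_EE_iff).2 he))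

end Cy

end

section

open NumberField IsDedekindDomain

theorem line_group_aux {p : ℕ} [hpF : Fact p.Prime] {G : Type*} [CommGroup G] (S T : Subgroup G) (s d : G →* G)
    (sS : ∀ x ∈ S, s x ∈ S) (dS : ∀ x ∈ S, d x ∈ S)
    (g : (ZMod p)ˣ) (hg : orderOf g = p - 1) (m : ℕ) (hm : (m : ZMod p) = g) (hd : ∀ x, d (s x) = s^[m] (d x))
    (hN : ∀ x ∈ S, ∏ i ∈ Finset.range p, s^[i] x ∈ T)
    (hfix : ∀ x1 ∈ S, ∀ x2 ∈ S, s x1 / x1 ∈ T → s x2 / x2 ∈ T → x1 ∈ T ∨ ∃ a : ℤ, x2 * x1 ^ a ∈ T)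
    (x1 x2 : G) (S1 : x1 ∈ S) (S2 : x2 ∈ S) (d1 : d x1 = x1) (d2 : d x2 = x2)
    {Q : Type*} [AddCommGroup Q] [Module (ZMod p) Q] (π : Additive S →+ Q) (hπ : Function.Surjective π)
    (hπT : ∀ x : S, π (Additive.ofMul x) = 0 ↔ (x : G) ∈ T) (σ δ : Q →+ Q)
    (hσ : ∀ x : S, σ (π (Additive.ofMul x)) = π (Additive.ofMul ⟨s x, sS x x.2⟩))
    (hδ : ∀ x : S, δ (π (Additive.ofMul x)) = π (Additive.ofMul ⟨d x, dS x x.2⟩)) : x1 ∈ T ∨ ∃ a : ℤ, x2 * x1 ^ a ∈ T := by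
  let mkS : ∀ x ∈ S, Q := fun x hx => π (Additive.ofMul (⟨x, hx⟩ : S))
  have mk0 : ∀ x hx, mkS x hx = 0 ↔ x ∈ T := fun x hx => hπT ⟨x, hx⟩
  have ex : ∀ q : Q, ∃ x hx, q = mkS x hx := by
    intro q
    obtain ⟨y, hy⟩ := hπ q
    exact ⟨y.toMul, y.toMul.2, hy.symm⟩
  let σ' : Module.End (ZMod p) Q := σ.toZModLinearMap p
  let δ' : Module.End (ZMod p) Q := δ.toZModLinearMap p
  have σmk : ∀ x hx, σ' (mkS x hx) = mkS (s x) (sS x hx) := fun x hx => hσ ⟨x, hx⟩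
  have δmk : ∀ x hx, δ' (mkS x hx) = mkS (d x) (dS x hx) := fun x hx => hδ ⟨x, hx⟩
  have siS : ∀ i, ∀ x ∈ S, s^[i] x ∈ S := by
    intro i x hx
    induction i with
    | zero => exact hx
    | succ n ih => rw [Function.iterate_succ_apply']; exact sS _ ih
  have σi : ∀ i x hx, (σ' ^ i) (mkS x hx) = mkS (s^[i] x) (siS i x hx) := by
    intro i x hx
    induction i with
    | zero => rfl
    | succ n ih =>
      rw [pow_succ', Module.End.mul_apply, ih, σmk]
      congr 1
      simp only [Function.iterate_succ_apply']
  have mkadd : ∀ x hx y hy, mkS x hx + mkS y hy = mkS (x * y) (mul_mem hx hy) := fun x hx y hy => (π.map_add (Additive.ofMul (⟨x, hx⟩ : S)) (Additive.ofMul (⟨y, hy⟩ : S))).symm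
  have mksub : ∀ x hx y hy, mkS x hx - mkS y hy = mkS (x / y) (div_mem hx hy) := fun x hx y hy => (π.map_sub (Additive.ofMul (⟨x, hx⟩ : S)) (Additive.ofMul (⟨y, hy⟩ : S))).symm
  have mkz : ∀ x hx (a : ℤ), a • mkS x hx = mkS (x ^ a) (zpow_mem hx a) := fun x hx a => (map_zsmul π a (Additive.ofMul (⟨x, hx⟩ : S))).symm
  have mksum : ∀ (B : Finset ℕ) (f : ℕ → G) (hf : ∀ i, f i ∈ S), ∑ i ∈ B, mkS (f i) (hf i) = mkS (∏ i ∈ B, f i) (Subgroup.prod_mem _ fun i _ => hf i) := by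
    intro B f hf
    classical
    induction B using Finset.induction_on with
    | empty => rw [Finset.sum_empty, eq_comm, mk0, Finset.prod_empty]; exact one_mem T
    | insert a B ha ih =>
      rw [Finset.sum_insert ha, ih, mkadd]
      simp only [Finset.prod_insert ha]
  have zsm : ∀ (a : ZMod p) (q : Q), ∃ b : ℤ, a • q = b • q := by
    intro a q
    obtain ⟨b, rfl⟩ := ZMod.intCast_surjective a
    exact ⟨b, Int.cast_smul_eq_zsmul _ _ _⟩
  have main := line_lemma σ' δ' g hg m hm (by
      ext q
      obtain ⟨x, hx, rfl⟩ := ex q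
      rw [Module.End.mul_apply, Module.End.mul_apply, σmk, δmk, δmk, σi]
      simp only [hd x]) (by
      ext q
      obtain ⟨x, hx, rfl⟩ := ex q
      rw [LinearMap.sum_apply]
      simp_rw [σi]
      rw [mksum _ (fun i => s^[i] x) (fun i => siS i x hx), LinearMap.zero_apply, mk0]
      exact hN x hx) (by
      intro q1 q2 h1 h2
      obtain ⟨x, hx, rfl⟩ := ex q1
      obtain ⟨y, hy, rfl⟩ := ex q2
      rw [σmk, ← sub_eq_zero, mksub, mk0] at h1 h2
      rcases hfix x hx y hy h1 h2 with h | ⟨a, h⟩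
      · left; rwa [mk0]
      · right
        rw [← mk0 _ (mul_mem hy (zpow_mem hx a)), ← mkadd _ hy _ (zpow_mem hx a), ← mkz, add_eq_zero_iff_eq_neg, ← neg_smul] at h
        exact ⟨((-a : ℤ) : ZMod p), by rw [Int.cast_smul_eq_zsmul]; exact h⟩)
    (LinearMap.ker (δ' - 1)) (by
      intro v hv
      rw [LinearMap.mem_ker, LinearMap.sub_apply, sub_eq_zero] at hv
      exact hv)
    (mkS x1 S1) (by
      rw [LinearMap.mem_ker, LinearMap.sub_apply, sub_eq_zero, δmk]
      simp only [d1]; rfl)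
    (mkS x2 S2) (by
      rw [LinearMap.mem_ker, LinearMap.sub_apply, sub_eq_zero, δmk]
      simp only [d2]; rfl)
  rcases main with h | ⟨a, h⟩
  · left; rwa [mk0] at h
  · right
    obtain ⟨b, hb⟩ := zsm a (mkS x1 S1)
    rw [hb, ← sub_eq_zero, sub_eq_add_neg, ← neg_smul, mkz, mkadd, mk0] at h
    exact ⟨-b, h⟩

theorem line_group {p : ℕ} [hpF : Fact p.Prime] {G : Type*} [CommGroup G] (S T : Subgroup G) (hpow : ∀ x, x ^ p ∈ T) (s d : G →* G)
    (sS : ∀ x ∈ S, s x ∈ S) (sT : ∀ x ∈ T, s x ∈ T) (dS : ∀ x ∈ S, d x ∈ S) (dT : ∀ x ∈ T, d x ∈ T)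
    (g : (ZMod p)ˣ) (hg : orderOf g = p - 1) (m : ℕ) (hm : (m : ZMod p) = g) (hd : ∀ x, d (s x) = s^[m] (d x))
    (hN : ∀ x ∈ S, ∏ i ∈ Finset.range p, s^[i] x ∈ T)
    (hfix : ∀ x1 ∈ S, ∀ x2 ∈ S, s x1 / x1 ∈ T → s x2 / x2 ∈ T → x1 ∈ T ∨ ∃ a : ℤ, x2 * x1 ^ a ∈ T)
    (x1 x2 : G) (S1 : x1 ∈ S) (S2 : x2 ∈ S) (d1 : d x1 = x1) (d2 : d x2 = x2) : x1 ∈ T ∨ ∃ a : ℤ, x2 * x1 ^ a ∈ T := by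
  let s' : S →* S := (s.comp S.subtype).codRestrict S (fun x => sS x x.2)
  let d' : S →* S := (d.comp S.subtype).codRestrict S (fun x => dS x x.2)
  let sq : S ⧸ T.subgroupOf S →* S ⧸ T.subgroupOf S := QuotientGroup.map _ _ s' (fun x hx => sT x hx)
  let dq : S ⧸ T.subgroupOf S →* S ⧸ T.subgroupOf S := QuotientGroup.map _ _ d' (fun x hx => dT x hx)
  letI : Module (ZMod p) (Additive (S ⧸ T.subgroupOf S)) := AddCommGroup.zmodModule (n := p) (by
    intro x
    obtain ⟨y, hy⟩ := QuotientGroup.mk_surjective x.toMul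
    have h : (QuotientGroup.mk (y ^ p) : S ⧸ T.subgroupOf S) = 1 := by
      rw [QuotientGroup.eq_one_iff]; exact hpow y
    change x.toMul ^ p = 1
    rw [← hy]; exact h)
  exact line_group_aux S T s d sS dS g hg m hm hd hN hfix x1 x2 S1 S2 d1 d2 (MonoidHom.toAdditive (QuotientGroup.mk' (T.subgroupOf S)))
    (QuotientGroup.mk'_surjective (T.subgroupOf S)) (fun x => by
      change (QuotientGroup.mk x : S ⧸ T.subgroupOf S) = 1 ↔ _
      rw [QuotientGroup.eq_one_iff]; rfl) (MonoidHom.toAdditive sq) (MonoidHom.toAdditive dq) (fun x => rfl) (fun x => rfl)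

namespace Cy
variable {p N : ℕ} [hpF : Fact p.Prime] [hNF : Fact N.Prime] {F M : Type} [Field F] [NumberField F] [Field M] [NumberField M] [Algebra F M] (C : Cy p N F)

theorem ua_mem_TR (e : M ≃+* M) {x : Mˣ} {s : ℕ} (hx : x ∈ TR M p s) : ua e x ∈ TR M p s := by
  obtain ⟨ε, hε, y, rfl⟩ := hx
  rw [map_mul, map_pow]
  exact mul_mem (EE_le_TR (ua_mem_EE _ hε)) (pow_mem_TR _)

theorem Sel_line (D : KD p F M) (hζ : D.ζ = C.ζ) (hu : (D.u : F) = N) (hm : D.u ∈ EE F N) (hh : ¬ p ∣ classNumber F)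
    (hG : ∀ k, Odd k → 3 ≤ k → k ≤ p - 2 → hat k (fun d => C.G d) ≠ 0) :
    ∃ e : M ≃+* M, e D.θ = D.θ ∧ ∀ x1 x2 : Mˣ, x1 ∈ Sel M p N → x2 ∈ Sel M p N → ua e x1 = x1 → ua e x2 = x2 →
      (x1 ∈ TR M p N ∨ ∃ a : ℤ, x2 * x1 ^ a ∈ TR M p N) := by
  obtain ⟨g, hg⟩ := exists_gpow (p := p)
  obtain ⟨e, he, heθ⟩ := D.exists_aut (C.sg g : F ≃+* F) D.θ (by
    have h1 : (D.θ : M) ^ p = algebraMap F M D.u := by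
      have := congrArg (fun x : Mˣ => (x : M)) D.hu; simpa using this
    rw [h1, hu]
    simp)
  refine ⟨e, heθ, fun x1 x2 S1 S2 e1 e2 => ?_⟩
  set m := (g : ZMod p).val with hmdef
  have hcomm : ∀ x : M, e (D.σ x) = (D.σ ^ m) (e x) := by
    have := D.hom_ext ((e : M →+* M).comp (D.σ : M →+* M)) (((D.σ ^ m : M ≃ₐ[F] M) : M →+* M).comp (e : M →+* M)) (by
      intro f
      simp only [RingHom.comp_apply]
      change e (D.σ (algebraMap F M f)) = (D.σ ^ m) (e (algebraMap F M f))
      rw [AlgEquiv.commutes, he]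
      exact ((D.σ ^ m).commutes _).symm) (by
      change e (D.σ D.θ) = (D.σ ^ m) (e D.θ)
      rw [D.hσ, map_mul, he, heθ, D.sigma_pow_theta, hζ]
      congr 2
      exact C.sg_zeta g)
    intro x
    exact RingHom.congr_fun this x
  refine line_group (Sel M p N) (TR M p N) pow_mem_TR D.s (ua e) (fun x hx => Sel_map_equiv _ hx) (fun x hx => ua_mem_TR _ hx)
    (fun x hx => Sel_map_equiv _ hx) (fun x hx => ua_mem_TR _ hx) g hg m (ZMod.natCast_zmod_val _) ?_ ?_
    (fun x1 h1 x2 h2 f1 f2 => C.fixed_line D hζ hu hm hh hG x1 x2 h1 h2 f1 f2) x1 x2 S1 S2 e1 e2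
  · intro x
    ext
    rw [D.s_iter]
    exact hcomm x
  · intro x hx
    rw [D.prod_s]
    exact C.Nm_TR D hζ hm hh x hx

end Cy

end

section

open NumberField IsDedekindDomain

section
variable {K : Type*} [Field K] [NumberField K]

theorem dvd_ord_of_pow {p : ℕ} (I : Ideal (𝓞 K)) (x : 𝓞 K) (X : Kˣ) (hX : (X : K) = algebraMap (𝓞 K) K x) (h : I ^ p = Ideal.span {x})
    (v : HeightOneSpectrum (𝓞 K)) : (p : ℤ) ∣ ord v X := by
  classical
  have hx : x ≠ 0 := by
    rintro rfl
    rw [map_zero] at hX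
    exact X.ne_zero hX
  by_cases hp : p = 0
  · subst hp
    have h0 : ord v X = 0 := by
      rw [ord_eq_zero_iff_notMem v X x hX]
      intro hm
      rw [pow_zero] at h
      apply v.isPrime.ne_top
      rw [eq_top_iff, ← Ideal.one_eq_top, h]
      exact (Ideal.span_singleton_le_iff_mem _).2 hm
    rw [h0]; exact dvd_zero _
  have hI : I ≠ 0 := by
    rintro rfl
    rw [zero_pow hp] at h
    exact hx (by simpa using h.symm)
  rw [ord, hX, v.valuation_of_algebraMap, v.intValuation_if_neg hx, WithZero.log_exp, neg_neg, ← h, Associates.mk_pow,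
    Associates.count_pow (Associates.mk_ne_zero.2 hI) v.associates_irreducible]
  push_cast
  exact dvd_mul_right _ _

theorem isPrincipal_of_pow {p : ℕ} (hp : p ≠ 0) (I : Ideal (𝓞 K)) (x : 𝓞 K) (X : Kˣ) (hX : (X : K) = algebraMap (𝓞 K) K x) (h : I ^ p = Ideal.span {x})
    (u Y : Kˣ) (hu : u ∈ (unitsHom K).range) (hXY : X = u * Y ^ p) : I.IsPrincipal := by
  have hY : IsIntegral ℤ (Y : K) := by
    rw [isIntegral_iff_ord]
    intro v
    have h1 : 0 ≤ ord v X := ord_integral v X x hX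
    rw [hXY, ord_mul, mem_units_iff.1 hu v, zero_add, ord_pow] at h1
    have : (0 : ℤ) < p := by positivity
    exact nonneg_of_mul_nonneg_right h1 this
  obtain ⟨w, rfl⟩ := hu
  let y : 𝓞 K := ⟨Y, hY⟩
  have hxy : x = w * y ^ p := by
    apply RingOfIntegers.ext
    change algebraMap (𝓞 K) K x = _
    rw [← hX, hXY]
    simp [y]; rfl
  have h2 : I ^ p = (Ideal.span {y}) ^ p := by
    rw [h, hxy, Ideal.span_singleton_pow, Ideal.span_singleton_mul_left_unit w.isUnit]
  have h3 : I = Ideal.span {y} := pow_left_injective hp h2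
  rw [h3]
  exact ⟨y, rfl⟩

theorem norm_mem_EE {M : Type*} [Field M] [NumberField M] [Algebra K M] {s : ℕ} (x : Mˣ) (hx : x ∈ EE M s) :
    Units.map (Algebra.norm K : M →* K) x ∈ EE K s := by
  obtain ⟨n, h1, h2⟩ := hx
  have key : ∀ z : Mˣ, IsIntegral ℤ ((s : M) ^ n * (z : M)) →
      IsIntegral ℤ ((s : K) ^ (n * Module.finrank K M) * ((Units.map (Algebra.norm K : M →* K) z : Kˣ) : K)) := by
    intro z hz
    have h := Algebra.isIntegral_norm K hz
    have e : Algebra.norm K ((s : M) ^ n * (z : M)) = (s : K) ^ (n * Module.finrank K M) * ((Units.map (Algebra.norm K : M →* K) z : Kˣ) : K) := by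
      rw [map_mul, map_pow, ← map_natCast (algebraMap K M), Algebra.norm_algebraMap, ← pow_mul, mul_comm n]
      rfl
    rwa [e] at h
  refine ⟨n * Module.finrank K M, key x h1, ?_⟩
  rw [← map_inv]
  exact key x⁻¹ h2

variable {p N : ℕ} [hpF : Fact p.Prime] [hNF : Fact N.Prime]

theorem alpha_prime (α : Kˣ) (hα : (α : K) ^ p = (N : K)) (hdeg : Module.finrank ℚ K = p) :
    ∃ v0 : HeightOneSpectrum (𝓞 K), ord v0 α = 1 ∧ ∀ v : HeightOneSpectrum (𝓞 K), (N : 𝓞 K) ∈ v.asIdeal → v = v0 := by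
  have hintg : IsIntegral ℤ (α : K) := by
    apply IsIntegral.of_pow hpF.out.pos
    rw [hα]; exact mod_cast (isIntegral_algebraMap : IsIntegral ℤ (algebraMap ℤ K (N : ℤ)))
  let a : 𝓞 K := ⟨α, hintg⟩
  have hap : a ^ p = (N : 𝓞 K) := by
    apply RingOfIntegers.ext
    have e : ((a ^ p : 𝓞 K) : K) = (α : K) ^ p := map_pow (algebraMap (𝓞 K) K) a p
    rw [e, hα]; exact (map_natCast (algebraMap (𝓞 K) K) N).symm
  have hn : Ideal.absNorm (Ideal.span {a}) = N := by
    have h1 : Ideal.absNorm (Ideal.span {a}) ^ p = N ^ p := by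
      rw [← map_pow, Ideal.span_singleton_pow, hap, Ideal.absNorm_span_natCast, RingOfIntegers.rank, hdeg]
    exact Nat.pow_left_injective hpF.out.ne_zero h1
  have hpr : (Ideal.span {a}).IsPrime := Ideal.isPrime_of_irreducible_absNorm (by rw [hn]; exact hNF.out)
  have ha0 : a ≠ 0 := by
    intro h
    apply α.ne_zero
    exact congrArg (fun z : 𝓞 K => (z : K)) h
  let v0 : HeightOneSpectrum (𝓞 K) := ⟨Ideal.span {a}, hpr, by simpa using ha0⟩
  refine ⟨v0, ord_span v0 α a rfl rfl, fun v hv => ?_⟩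
  rw [← hap] at hv
  have h1 := v.isPrime.mem_of_pow_mem p hv
  have h2 : v0.asIdeal ≤ v.asIdeal := (Ideal.span_singleton_le_iff_mem _).2 h1
  exact (HeightOneSpectrum.ext (v0.isMaximal.eq_of_le v.isPrime.ne_top h2)).symm

/-- descent of triviality to `K` -/
theorem TR_descent {M : Type*} [Field M] [NumberField M] [Algebra K M] (α : Kˣ) (hα : (α : K) ^ p = (N : K)) (hdeg : Module.finrank ℚ K = p)
    (hKM : Module.finrank K M = p - 1) (X : Kˣ) (hX : ∀ v : HeightOneSpectrum (𝓞 K), (p : ℤ) ∣ ord v X) (h : um K M X ∈ TR M p N) :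
    ∃ u ∈ (unitsHom K).range, ∃ Y : Kˣ, X = u * Y ^ p := by
  have hT : X ∈ TR K p N := by
    refine coprime_pow_mem _ (a := p - 1) (b := p) ?_ ?_ (pow_mem_TR X)
    · have := (Nat.coprime_self_sub_right hpF.out.one_le).2 (Nat.coprime_one_right p)
      exact this.symm
    · obtain ⟨e, he, y, hy⟩ := h
      refine ⟨_, norm_mem_EE e he, Units.map (Algebra.norm K : M →* K) y, ?_⟩
      rw [← map_pow, ← map_mul, ← hy]
      ext
      rw [Units.val_pow_eq_pow_val, ← hKM]
      exact (Algebra.norm_algebraMap (X : K)).symm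
  obtain ⟨e, he, y, rfl⟩ := hT
  obtain ⟨v0, h1, h2⟩ := alpha_prime α hα hdeg
  have h3 := hX v0
  rw [ord_mul, ord_pow, dvd_add_left (dvd_mul_right _ _)] at h3
  obtain ⟨m, hm⟩ := h3
  refine ⟨e / (α ^ m) ^ p, ?_, α ^ m * y, ?_⟩
  · rw [mem_units_iff]
    intro v
    rw [ord_div, ord_pow, ord_zpow]
    by_cases hv : (N : 𝓞 K) ∈ v.asIdeal
    · rw [h2 v hv, hm, h1]; ring
    · have ha : ord v α = 0 := by
        have : ord v (α ^ p) = 0 := by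
          rw [ord_eq_zero_iff_notMem v _ (N : 𝓞 K)]
          · exact hv
          · rw [Units.val_pow_eq_pow_val, hα]; simp
        rw [ord_pow] at this
        have hp0 : (p : ℤ) ≠ 0 := by exact_mod_cast hpF.out.ne_zero
        exact (mul_eq_zero.1 this).resolve_left hp0
      rw [(mem_EE_iff hNF.out.ne_zero).1 he v hv, ha]; simp
  · rw [mul_pow, ← mul_assoc, div_mul_cancel]

end

end

section

open NumberField IsDedekindDomain
open scoped TensorProduct

theorem tensor_rank_le_one {p : ℕ} [hpF : Fact p.Prime] {A : Type*} [CommGroup A] [Finite A]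
    (h : ∀ c1 c2 : A, c1 ^ p = 1 → c2 ^ p = 1 → c1 = 1 ∨ ∃ a : ℤ, c2 * c1 ^ a = 1) :
    Module.finrank (ZMod p) (ZMod p ⊗[ℤ] Additive A) ≤ 1 := by
  let f : A →* A := powMonoidHom p
  have hker : Nat.card f.ker ≤ p := by
    by_cases ht : ∃ c1 : A, c1 ^ p = 1 ∧ c1 ≠ 1
    · obtain ⟨c1, h1, h2⟩ := ht
      have hle : f.ker ≤ Subgroup.zpowers c1 := by
        intro c hc
        rcases h c1 c h1 hc with h3 | ⟨a, ha⟩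
        · exact absurd h3 h2
        · rw [mul_eq_one_iff_eq_inv, ← zpow_neg] at ha
          exact ⟨-a, ha.symm⟩
      have := Subgroup.card_le_of_le hle
      rw [Nat.card_zpowers] at this
      exact this.trans (Nat.le_of_dvd hpF.out.pos (orderOf_dvd_of_pow_eq_one h1))
    · push Not at ht
      have : f.ker = ⊥ := by
        rw [eq_bot_iff]
        intro c hc
        exact ht c hc
      rw [this, Subgroup.card_bot]
      exact hpF.out.one_le
  have hidx : f.range.index = Nat.card f.ker := by
    have e1 := Subgroup.index_mul_card f.range
    have e2 := Subgroup.index_mul_card f.ker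
    rw [Subgroup.index_ker] at e2
    rw [← e2, mul_comm] at e1
    exact Nat.eq_of_mul_eq_mul_left Nat.card_pos e1
  let φ : Additive A →+ ZMod p ⊗[ℤ] Additive A := (TensorProduct.mk ℤ (ZMod p) (Additive A) 1).toAddMonoidHom
  have hφ : ∀ a, φ a = (1 : ZMod p) ⊗ₜ[ℤ] a := fun a => rfl
  have hsurj : Function.Surjective φ := by
    intro t
    induction t using TensorProduct.induction_on with
    | zero => exact ⟨0, map_zero _⟩
    | tmul z a =>
      obtain ⟨b, rfl⟩ := ZMod.intCast_surjective z
      refine ⟨b • a, ?_⟩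
      rw [hφ, ← TensorProduct.smul_tmul]
      congr 1
      simp
    | add x y hx hy =>
      obtain ⟨a, rfl⟩ := hx
      obtain ⟨b, rfl⟩ := hy
      exact ⟨a + b, map_add _ _ _⟩
  have hfin : Finite (ZMod p ⊗[ℤ] Additive A) := Finite.of_surjective φ hsurj
  let ψ : A ⧸ f.range → ZMod p ⊗[ℤ] Additive A := Quotient.lift (fun a : A => φ (Additive.ofMul a)) (by
    intro a b hab
    have hab' : a⁻¹ * b ∈ f.range := QuotientGroup.leftRel_apply.1 hab
    obtain ⟨c, hc⟩ := hab'
    have e : Additive.ofMul b = Additive.ofMul a + p • Additive.ofMul c := by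
      rw [← ofMul_pow, ← ofMul_mul]
      congr 1
      rw [eq_comm, ← eq_inv_mul_iff_mul_eq]; exact hc
    have e2 : φ (p • Additive.ofMul c) = 0 := by
      rw [map_nsmul, ← Nat.cast_smul_eq_nsmul (ZMod p), CharP.cast_eq_zero, zero_smul]
    change φ (Additive.ofMul a) = φ (Additive.ofMul b)
    rw [e, map_add, e2, add_zero])
  have hψ : Function.Surjective ψ := by
    intro t
    obtain ⟨a, rfl⟩ := hsurj t
    exact ⟨QuotientGroup.mk a.toMul, rfl⟩
  have hc : Nat.card (ZMod p ⊗[ℤ] Additive A) ≤ p := by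
    have := Nat.card_le_card_of_surjective ψ hψ
    refine this.trans ?_
    change f.range.index ≤ p
    rw [hidx]; exact hker
  rw [Module.natCard_eq_pow_finrank (K := ZMod p), Nat.card_zmod] at hc
  by_contra hlt
  have h2 : p ^ 2 ≤ p ^ 1 := (Nat.pow_le_pow_right hpF.out.pos (by omega)).trans (hc.trans (pow_one p).ge)
  have := (Nat.pow_le_pow_iff_right hpF.out.one_lt).1 h2
  omega

theorem exists_emb {p N : ℕ} [hpF : Fact p.Prime] {K M : Type*} [Field K] [NumberField K] [Field M] [NumberField M]
    (hb : ∀ b : ℚ, b ^ p ≠ (N : ℚ)) (α : K) (hα : α ^ p = (N : K)) (hdeg : Module.finrank ℚ K = p) (θ : M) (hθ : θ ^ p = (N : M)) :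
    ∃ e : K →+* M, ∀ δ : M →+* M, δ θ = θ → ∀ x, δ (e x) = e x := by
  let P : Polynomial ℚ := Polynomial.X ^ p - Polynomial.C (N : ℚ)
  have hirr : Irreducible P := X_pow_sub_C_irreducible_of_prime hpF.out hb
  have : Fact (Irreducible P) := ⟨hirr⟩
  have hne : P ≠ 0 := hirr.ne_zero
  let φ : AdjoinRoot P →+* K := AdjoinRoot.lift (algebraMap ℚ K) α (by simp [P, hα])
  let ψ : AdjoinRoot P →+* M := AdjoinRoot.lift (algebraMap ℚ M) θ (by simp [P, hθ])
  let φa : AdjoinRoot P →ₗ[ℚ] K := φ.toRatAlgHom.toLinearMap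
  have hfin : Module.finrank ℚ (AdjoinRoot P) = Module.finrank ℚ K := by
    rw [hdeg, (AdjoinRoot.powerBasis hne).finrank, AdjoinRoot.powerBasis_dim]
    exact Polynomial.natDegree_X_pow_sub_C
  have hfd : FiniteDimensional ℚ (AdjoinRoot P) := (AdjoinRoot.powerBasis hne).finite
  have hsurj : Function.Surjective φ :=
    (LinearMap.injective_iff_surjective_of_finrank_eq_finrank (f := φa) hfin).1 φ.injective
  let E : AdjoinRoot P ≃+* K := RingEquiv.ofBijective φ ⟨φ.injective, hsurj⟩
  refine ⟨ψ.comp (E.symm : K →+* AdjoinRoot P), fun δ hδ x => ?_⟩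
  have h : δ.comp ψ = ψ := by
    apply AdjoinRoot.ringHom_ext
    · exact Subsingleton.elim _ _
    · simp [ψ, hδ]
  exact RingHom.congr_fun h (E.symm x)

end

section

open NumberField IsDedekindDomain
open scoped TensorProduct

theorem class_line {p N : ℕ} [hpF : Fact p.Prime] [hNF : Fact N.Prime] {K M : Type*} [Field K] [NumberField K] [Field M] [NumberField M] [Algebra K M]
    (α : K) (hα : α ^ p = (N : K)) (hdeg : Module.finrank ℚ K = p) (hKM : Module.finrank K M = p - 1)
    (hline : ∀ X1 X2 : Kˣ, X1 ∈ Sel K p N → X2 ∈ Sel K p N → um K M X1 ∈ TR M p N ∨ ∃ a : ℤ, um K M (X2 * X1 ^ a) ∈ TR M p N)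
    (c1 c2 : ClassGroup (𝓞 K)) (h1 : c1 ^ p = 1) (h2 : c2 ^ p = 1) : c1 = 1 ∨ ∃ a : ℤ, c2 * c1 ^ a = 1 := by
  have hα0 : α ≠ 0 := by
    rintro rfl
    rw [zero_pow hpF.out.ne_zero] at hα
    exact hNF.out.ne_zero (by exact_mod_cast hα.symm)
  have rep : ∀ c : ClassGroup (𝓞 K), c ^ p = 1 → ∃ (I : nonZeroDivisors (Ideal (𝓞 K))) (x : 𝓞 K) (X : Kˣ),
      c = ClassGroup.mk0 I ∧ (X : K) = algebraMap (𝓞 K) K x ∧ (I : Ideal (𝓞 K)) ^ p = Ideal.span {x} := by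
    intro c hc
    obtain ⟨I, rfl⟩ := ClassGroup.mk0_surjective c
    rw [← map_pow, ClassGroup.mk0_eq_one_iff] at hc
    obtain ⟨x, hx⟩ := hc
    have hx0 : x ≠ 0 := by
      rintro rfl
      have h0 : ((I ^ p : nonZeroDivisors (Ideal (𝓞 K))) : Ideal (𝓞 K)) = 0 := by rw [hx]; simp
      exact nonZeroDivisors.coe_ne_zero _ h0
    have hxK : algebraMap (𝓞 K) K x ≠ 0 := by simpa using hx0
    exact ⟨I, x, Units.mk0 _ hxK, rfl, rfl, hx⟩
  have fin : ∀ (I : nonZeroDivisors (Ideal (𝓞 K))) (x : 𝓞 K) (X : Kˣ), (X : K) = algebraMap (𝓞 K) K x →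
      (I : Ideal (𝓞 K)) ^ p = Ideal.span {x} → um K M X ∈ TR M p N → ClassGroup.mk0 I = 1 := by
    intro I x X hX hI hT
    obtain ⟨u, hu, Y, hY⟩ := TR_descent (Units.mk0 α hα0) hα hdeg hKM X (dvd_ord_of_pow (I : Ideal (𝓞 K)) x X hX hI) hT
    rw [ClassGroup.mk0_eq_one_iff]
    exact isPrincipal_of_pow hpF.out.ne_zero _ x X hX hI u Y hu hY
  obtain ⟨I1, x1, X1, rfl, e1, i1⟩ := rep c1 h1
  obtain ⟨I2, x2, X2, rfl, e2, i2⟩ := rep c2 h2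
  rcases hline X1 X2 (fun v _ => dvd_ord_of_pow _ x1 X1 e1 i1 v) (fun v _ => dvd_ord_of_pow _ x2 X2 e2 i2 v) with h | ⟨a, h⟩
  · left; exact fin I1 x1 X1 e1 i1 h
  · right
    have hp0 : (p : ℤ) ≠ 0 := by exact_mod_cast hpF.out.ne_zero
    obtain ⟨n, hn⟩ := Int.eq_ofNat_of_zero_le (Int.emod_nonneg a hp0)
    refine ⟨(n : ℤ), ?_⟩
    rw [zpow_natCast, ← map_pow, ← map_mul]
    refine fin (I2 * I1 ^ n) (x2 * x1 ^ n) (X2 * X1 ^ n) ?_ ?_ ?_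
    · rw [Units.val_mul, Units.val_pow_eq_pow_val, e1, e2, map_mul, map_pow]
    · push_cast
      rw [mul_pow, i2, ← pow_mul, mul_comm n, pow_mul, i1, Ideal.span_singleton_pow, Ideal.span_singleton_mul_span_singleton]
    · have ea : a = n + p * (a / p) := by
        have := Int.emod_add_mul_ediv a p
        rw [hn] at this; exact this.symm
      rw [ea, zpow_add, zpow_mul, zpow_natCast, zpow_natCast, ← mul_assoc, map_mul] at h
      refine ((TR M p N).mul_mem_cancel_right ?_).1 h
      rw [map_zpow, map_pow]
      exact zpow_mem (pow_mem_TR _) _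

theorem main_bound {p N : ℕ} [hpF : Fact p.Prime] [hNF : Fact N.Prime] (hp5 : 5 ≤ p) (hmod : N % p = 1) (F : Type) [Field F] [NumberField F]
    [hc : IsCyclotomicExtension {p} ℚ F] (hh : ¬ p ∣ classNumber F)
    (hM : ∀ i, Odd i → 1 ≤ i → i ≤ p - 4 → ¬ ∃ y : ZMod N, y ^ p = ∏ l ∈ Finset.Icc 1 (N - 1), ∏ a ∈ Finset.Icc 1 (l - 1), (l : ZMod N) ^ (a ^ i))
    (K : Type*) [Field K] [NumberField K] (α : K) (hα : α ^ p = (N : K)) (hdeg : Module.finrank ℚ K = p) :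
    Module.finrank (ZMod p) (ZMod p ⊗[ℤ] Additive (ClassGroup (𝓞 K))) ≤ 1 := by
  obtain ⟨C⟩ := exists_Cy (N := N) hp5 hmod F
  have hG : ∀ k, Odd k → 3 ≤ k → k ≤ p - 2 → hat k (fun d => C.G d) ≠ 0 := by
    intro k hk h3 hk2
    refine C.hat_G_ne hk h3 hk2 (hM (p - 1 - k) ?_ (by omega) (by omega))
    have hpo : Odd p := hpF.out.odd_of_ne_two (by omega)
    grind
  let u : Fˣ := Units.mk0 (N : F) Cy.N_ne
  have hFp : ∀ b : F, b ^ p ≠ (u : F) := by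
    intro b hb
    have hb0 : b ≠ 0 := by
      rintro rfl
      rw [zero_pow hpF.out.ne_zero] at hb
      exact u.ne_zero hb.symm
    have e : u = (Units.mk0 b hb0) ^ p := by ext; exact hb.symm
    have h1 := (C.vs_N 1 u rfl).1
    rw [e, C.v_pow] at h1
    have := Int.eq_one_of_dvd_one (by positivity) ⟨_, h1.symm⟩
    omega
  have hQp : ∀ b : ℚ, b ^ p ≠ (N : ℚ) := by
    intro b hb
    apply hFp (algebraMap ℚ F b)
    rw [← map_pow, hb, map_natCast]; rfl
  obtain ⟨M, _, _, _, D, hDu, hζ⟩ := exists_KD hpF.out hp5 C.hζ u hFp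
  have hu : (D.u : F) = N := by rw [hDu]; rfl
  have hm : D.u ∈ EE F N := by
    rw [mem_EE_iff hNF.out.ne_zero]
    intro v hv
    rw [ord_eq_zero_iff_notMem v D.u (N : 𝓞 F) (by rw [hu]; simp)]
    exact hv
  obtain ⟨e, heθ, hline⟩ := C.Sel_line D hζ hu hm hh hG
  have hθ : (D.θ : M) ^ p = (N : M) := by
    have := congrArg (fun x : Mˣ => (x : M)) D.hu
    simp only [Units.val_pow_eq_pow_val] at this
    rw [this]
    change algebraMap F M D.u = _
    rw [hu, map_natCast]
  obtain ⟨j, hj⟩ := exists_emb hQp α hα hdeg (D.θ : M) hθ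
  let alg : Algebra K M := j.toAlgebra
  have hKM : Module.finrank K M = p - 1 := by
    have hfd := D.finDim
    have t1 := Module.finrank_mul_finrank ℚ K M
    have t2 := Module.finrank_mul_finrank ℚ F M
    rw [D.hdeg, IsCyclotomicExtension.finrank F (Cy.irr_cyc (p := p)), Nat.totient_prime hpF.out] at t2
    rw [hdeg, ← t2, mul_comm] at t1
    exact Nat.eq_of_mul_eq_mul_right hpF.out.pos t1
  apply tensor_rank_le_one
  intro c1 c2 h1 h2
  refine class_line (M := M) α hα hdeg hKM ?_ c1 c2 h1 h2
  intro X1 X2 S1 S2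
  have hfix : ∀ X : Kˣ, ua e (um K M X) = um K M X := by
    intro X
    ext
    exact hj (e : M →+* M) heθ X
  rcases hline (um K M X1) (um K M X2) (Sel_map S1) (Sel_map S2) (hfix _) (hfix _) with h | ⟨a, h⟩
  · exact Or.inl h
  · right
    refine ⟨a, ?_⟩
    rw [map_mul, map_zpow]; exact h

end

/-- If `p ≥ 5` is regular, `N ≡ 1 (mod p)` is prime, and `r_K ≥ 2`, then some `M_i`
with `i` odd, `1 ≤ i ≤ p - 4`, is a `p`-th power in `𝔽_N^×`. -/
theorem statement1 (p N : ℕ) (hp : p.Prime) (hp5 : 5 ≤ p)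
    (hreg : RegularPrime ⟨p, hp.pos⟩)
    (hN : N.Prime) (hNmod : N % p = 1)
    (K : Type*) [Field K] [NumberField K]
    (α : K) (hα : α ^ p = (N : K)) (hKdeg : Module.finrank ℚ K = p)
    (hrank : 2 ≤ classRank p K) :
    ∃ i : ℕ, Odd i ∧ 1 ≤ i ∧ i ≤ p - 4 ∧ IsPthPow p (Mnum N i) := by
  have := Fact.mk hp
  have := Fact.mk hN
  have : NeZero (p : ℚ) := ⟨Nat.cast_ne_zero.2 hp.ne_zero⟩
  have : IsCyclotomicExtension {p} ℚ (CyclotomicField p ℚ) := CyclotomicField.isCyclotomicExtension p ℚ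
  by_contra hcon
  have hb := main_bound (p := p) (N := N) hp5 hNmod (CyclotomicField p ℚ)
    (by
      intro h
      apply hreg
      have e : Nat.card (ClassGroup (NumberField.RingOfIntegers (CyclotomicField p ℚ)))
          = NumberField.classNumber (CyclotomicField p ℚ) := by
        rw [NumberField.classNumber, Nat.card_eq_fintype_card]
      rw [← e] at h
      exact h)
    (fun i h1 h2 h3 h4 => hcon ⟨i, h1, h2, h3, h4⟩) K α hα hKdeg
  have hb' : classRank p K ≤ 1 := hb
  omega
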